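/- There exist absolute constants c, c' > 0 with the following property. Let n ≥ 2, let μ be an isotropic log-concave probability measure on ℝⁿ, let 2n ≤ m ≤ exp(√n), and let x₁,…,x_m, y₁,…,y_m be mutually independent random vectors each distributed according to μ. Set B_m = absconv{e₁,…,e_n, x₁/√n,…,x_m/√n} and A_m = absconv{e₁,…,e_n, y₁/√n,…,y_m/√n}, where {e₁,…,e_n} is the standard orthonormal basis of ℝⁿ. Then, with probability at least 1 − 2·exp(−c'·√n) − 2^{1−n²}, one has d_BM(X_{A_m}, X_{B_m}) ≥ c·n/ln(1+m/n). -/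

import Mathlib

open MeasureTheory Set
open scoped ENNReal RealInnerProductSpace Pointwise BigOperators

noncomputable section

abbrev Euc (n : ℕ) := EuclideanSpace ℝ (Fin n)

/-- The absolute convex hull of a set. -/
def absConv (n : ℕ) (A : Set (Euc n)) : Set (Euc n) := convexHull ℝ (A ∪ -A)

/-- A log-concave function on `ℝⁿ`. -/
def IsLogConcaveFn (n : ℕ) (f : Euc n → ℝ) : Prop :=
  ∀ x y : Euc n, ∀ a b : ℝ, 0 ≤ a → 0 ≤ b → a + b = 1 →
    f x ^ a * f y ^ b ≤ f (a • x + b • y)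

/-- `f` is a log-concave density of `μ` with barycenter `0`, total mass `1`
and identity covariance. -/
def IsIsotropicDensity (n : ℕ) (μ : Measure (Euc n)) (f : Euc n → ℝ) : Prop :=
  (∀ x, 0 ≤ f x) ∧ IsLogConcaveFn n f ∧
  μ = volume.withDensity (fun x => ENNReal.ofReal (f x)) ∧
  IsProbabilityMeasure μ ∧ (∫ x, x ∂μ) = 0 ∧
  ∀ y z : Euc n, (∫ x, ⟪x, y⟫ * ⟪x, z⟫ ∂μ) = ⟪y, z⟫

/-- An isotropic log-concave probability measure on `ℝⁿ`. -/
def IsIsotropicLogConcave (n : ℕ) (μ : Measure (Euc n)) : Prop :=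
  ∃ f, IsIsotropicDensity n μ f

/-- A centrally symmetric convex body. -/
def IsSymmConvexBody (n : ℕ) (K : Set (Euc n)) : Prop :=
  Convex ℝ K ∧ K = -K ∧ IsCompact K ∧ (0 : Euc n) ∈ interior K

/-- A convex body (not necessarily symmetric). -/
def IsConvexBody (n : ℕ) (K : Set (Euc n)) : Prop :=
  Convex ℝ K ∧ IsCompact K ∧ (interior K).Nonempty

/-- The operator norm of `T : X_K → X_L`, where `X_K` and `X_L` carry the gauges of `K`, `L`. -/
def bodyOpNorm (n : ℕ) (K L : Set (Euc n)) (T : Euc n →ₗ[ℝ] Euc n) : ℝ :=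
  sSup ((fun x => gauge L (T x)) '' K)

/-- The Banach–Mazur distance between the normed spaces with unit balls `K` and `L`. -/
def distBM (n : ℕ) (K L : Set (Euc n)) : ℝ :=
  sInf {d : ℝ | ∃ T : Euc n ≃ₗ[ℝ] Euc n,
    d = bodyOpNorm n K L T.toLinearMap * bodyOpNorm n L K T.symm.toLinearMap}

/-- The `ℓ₂ⁿ → ℓ₂ⁿ` operator norm of a linear map. -/
def eucOpNorm (n : ℕ) (T : Euc n →ₗ[ℝ] Euc n) : ℝ :=
  ‖LinearMap.toContinuousLinearMap T‖

/-- The standard orthonormal basis vectors of `ℝⁿ`, as a set. -/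
def stdBasisSet (n : ℕ) : Set (Euc n) :=
  Set.range fun i : Fin n => (EuclideanSpace.single i (1 : ℝ) : Euc n)

/-- The basis-enriched random polytope `absconv{e₁,…,eₙ, x₁/√n,…,x_m/√n}`. -/
def enrichedBody (n m : ℕ) (x : Fin m → Euc n) : Set (Euc n) :=
  absConv n (stdBasisSet n ∪ Set.range fun j => (Real.sqrt n)⁻¹ • x j)

/-- `s_k(T) ≥ 1`, via the Courant–Fischer characterization of singular values. -/
def SingValGe (n : ℕ) (T : Euc n →ₗ[ℝ] Euc n) (k : ℕ) : Prop :=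
  ∃ F : Submodule ℝ (Euc n), k ≤ Module.finrank ℝ F ∧ ∀ x ∈ F, ‖x‖ ≤ ‖T x‖

/-- A `(k,β)`-mixing operator. -/
def IsMixing (n : ℕ) (T : Euc n →ₗ[ℝ] Euc n) (k : ℕ) (β : ℝ) : Prop :=
  ∃ E : Submodule ℝ (Euc n), k ≤ Module.finrank ℝ E ∧
    ∀ x ∈ E, β * ‖x‖ ≤ ‖Submodule.orthogonalProjectionOnto Eᗮ (T x)‖

/-- The basis constant of the normed space with unit ball `K`. -/
def basisConstant (n : ℕ) (K : Set (Euc n)) : ℝ :=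
  sInf {c : ℝ | 0 < c ∧ ∃ b : Module.Basis (Fin n) ℝ (Euc n),
    ∀ k : ℕ, k ≤ n → ∀ lam : Fin n → ℝ,
      gauge K (∑ i ∈ Finset.univ.filter (fun i : Fin n => (i : ℕ) < k), lam i • b i) ≤
        c * gauge K (∑ i, lam i • b i)}

/-- The polar body. -/
def polarBody (n : ℕ) (B : Set (Euc n)) : Set (Euc n) :=
  {y | ∀ x ∈ B, ⟪x, y⟫ ≤ 1}

/-- The 1-summing norm of the identity `I : X_B* → ℓ₂ⁿ`. -/
def piOneId (n : ℕ) (B : Set (Euc n)) : ℝ :=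
  sInf {α : ℝ | 0 < α ∧ ∀ N : ℕ, ∀ z : Fin N → Euc n,
    ∑ j, ‖z j‖ ≤ α * sSup ((fun y => ∑ j, |⟪y, z j⟫|) '' B)}

/-- The normed space with unit ball `L` admits a `1`-unconditional basis. -/
def HasOneUncondBasis (n : ℕ) (L : Set (Euc n)) : Prop :=
  ∃ b : Module.Basis (Fin n) ℝ (Euc n), ∀ lam : Fin n → ℝ,
    gauge L (∑ i, lam i • b i) = gauge L (∑ i, |lam i| • b i)

set_option maxHeartbeats 400000
set_option linter.all false
notation "psv" => by positivity
notation "fpp" => by fun_prop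
notation "lnr" => by linarith
notation "nnm" => by norm_num
notation "smp" => by simp
open ENNReal (ofReal top_div ofReal_toReal one_lt_top toReal_mono ofReal_le_ofReal rpow_natCast rpow_mul inv_ne_top ofReal_mul ofReal_pow ofReal_le_one toReal_ofReal ofReal_one measurable_ofReal toReal_mul ofReal_add ofReal_le_ofReal_iff ofReal_pos toReal_add toReal_natCast toReal_nonneg ofReal_sum_of_nonneg ofReal_natCast ofReal_ne_top)
open Module (finrank Basis)
open Filter (Eventually Tendsto atTop univ_mem)
open Real (exp exp_add exp_nat_mul exp_le_exp norm_eq_abs exp_pos norm_of_nonneg add_one_le_exp one_le_exp sin cos abs_sin_le_one exp_zero abs_cos_le_one hasDerivAt_cos cos_nonneg_of_mem_Icc pi_pos sqrt_pos sq_sqrt sqrt_mul sqrt_nonneg sqrt_sq sqrt_le_one exp_neg sqrt_le_iff sqrt_le_sqrt log_le_log log_exp log_mul continuous_exp log_le_iff_le_exp exp_le_one_iff pow_div_factorial_le_exp exp_one_lt_d9 enorm_eq_ofReal_abs rpow_le_rpow rpow_nonneg sqrt_eq_rpow)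
open Metric (closedBall isClosed_closedBall ball_mem_nhds infDist_le_dist_of_mem infDist_nonneg measure_ball_pos)
open MeasureTheory.Measure (restrict_univ isProbabilityMeasure_map map_prod_map map_map map_apply addHaar_closedBall)
open Finset (induction_on sum_insert sum_mul sum_le_sum sum_nonneg sum_add_distrib sum_congr mul_sum sum_sub_distrib abs_sum_le_sum_abs sum_mul_sum sum_comm smul_sum sum_ite_eq sum_eq_single card_univ sum_const mem_filter sum_le_sum_of_subset_of_nonneg sum_ite_eq' prod_const)

def LCc {E : Type*} [MeasurableSpace E] [AddCommGroup E] [Module ℝ E] (μ : Measure E)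
    (c : E → E → ℝ≥0∞) : Prop :=
  ∀ f g h : E → ℝ≥0∞, Measurable f → Measurable g → Measurable h →
    (∀ x y, f x * g y ≤ h ((1 / 2 : ℝ) • (x + y)) ^ 2 * c x y) →
    (∫⁻ x, f x ∂μ) * (∫⁻ x, g x ∂μ) ≤ (∫⁻ x, h x ∂μ) ^ 2

lemma ennreal_amgm (u v : ℝ≥0∞) : u * v ≤ ((u + v) / 2) ^ 2 := by
  rcases eq_or_ne u ⊤ with rfl | hu
  · simp [top_div]
  rcases eq_or_ne v ⊤ with rfl | hv
  · simp [top_div]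
  lift u to NNReal using hu
  lift v to NNReal using hv
  have h2 : ((u : ℝ≥0∞) + v) / 2 = (((u + v) / 2 : NNReal) : ℝ≥0∞) := by
    rw [ENNReal.coe_div nnm]; simp
  rw [h2]
  norm_cast
  rw [← NNReal.coe_le_coe]; push_cast
  nlinarith [sq_nonneg ((u : ℝ) - v)]

lemma bm_compact {K L C : Set ℝ} (hK : IsCompact K) (hL : IsCompact L) (hK0 : K.Nonempty)
    (hL0 : L.Nonempty) (h : ∀ x ∈ K, ∀ y ∈ L, x + y ∈ C) : volume K + volume L ≤ volume C := by
  obtain ⟨a, ha, ha'⟩ := hK.exists_isGreatest hK0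
  obtain ⟨b, hb, hb'⟩ := hL.exists_isLeast hL0
  have h1 : volume ((fun x => x + b) '' K) = volume K := by simp
  have h2 : volume ((fun x => a + x) '' L) = volume L := by simp
  have hm2 : MeasurableSet ((fun x => a + x) '' L) := (hL.image fpp).measurableSet
  have hint : volume (((fun x => x + b) '' K) ∩ ((fun x => a + x) '' L)) = 0 := by
    refine measure_mono_null (t := {a + b}) ?_ smp
    rintro _ ⟨⟨x, hx, rfl⟩, ⟨y, hy, hxy⟩⟩
    have := ha' hx; have := hb' hy
    simp only at hxy ⊢
    simp only [mem_singleton_iff]; linarith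
  rw [← h1, ← h2, ← measure_union_add_inter _ hm2, hint, add_zero]
  refine measure_mono (union_subset ?_ ?_)
  · rintro _ ⟨x, hx, rfl⟩; exact h x hx b hb
  · rintro _ ⟨x, hx, rfl⟩; exact h a ha x hx

lemma bm_one {A B C : Set ℝ} (hA : MeasurableSet A) (hB : MeasurableSet B) (hA0 : A.Nonempty)
    (hB0 : B.Nonempty) (h : ∀ x ∈ A, ∀ y ∈ B, x + y ∈ C) : volume A + volume B ≤ volume C := by
  obtain ⟨a, ha⟩ := hA0
  obtain ⟨b, hb⟩ := hB0
  rw [hA.measure_eq_iSup_isCompact, hB.measure_eq_iSup_isCompact]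
  simp only [iSup_and']
  refine ENNReal.biSup_add_biSup_le' ⟨∅, by simp⟩ ⟨∅, by simp⟩ ?_
  rintro K ⟨hKA, hK⟩ L ⟨hLB, hL⟩
  refine (add_le_add (measure_mono (subset_insert a K)) (measure_mono (subset_insert b L))).trans ?_
  refine bm_compact (hK.insert a) (hL.insert b) ⟨a, by simp⟩ ⟨b, by simp⟩ ?_
  exact fun x hx y hy => h x (insert_subset ha hKA hx) y (insert_subset hb hLB hy)

lemma bm_mid {A B C : Set ℝ} (hA : MeasurableSet A) (hB : MeasurableSet B) (hA0 : A.Nonempty)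
    (hB0 : B.Nonempty) (h : ∀ x ∈ A, ∀ y ∈ B, (1 / 2 : ℝ) • (x + y) ∈ C) :
    volume A + volume B ≤ 2 * volume C := by
  have := bm_one (C := (fun x : ℝ => (1 / 2 : ℝ) * x) ⁻¹' C) hA hB hA0 hB0 (fun x hx y hy => h x hx y hy)
  rw [Real.volume_preimage_mul_left nnm] at this
  simpa using this

lemma lint_layer {f : ℝ → ℝ≥0∞} (hf : Measurable f) (h1 : ∀ x, f x ≤ 1) :
    ∫⁻ x, f x = ∫⁻ s in Ioo (0 : ℝ) 1, volume {x | ofReal s < f x} := by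
  have e : ∀ x, f x = ofReal (f x).toReal := fun x =>
    (ofReal_toReal ((h1 x).trans_lt one_lt_top).ne).symm
  have h2 := lintegral_eq_lintegral_meas_lt (μ := (volume : Measure ℝ)) (f := fun x => (f x).toReal)
    (Eventually.of_forall fun x => by positivity) fpp
  rw [lintegral_congr e, h2]
  have : ∀ s ∈ Ioi (0 : ℝ), volume {x | s < (f x).toReal} =
      (Ioo (0 : ℝ) 1).indicator (fun s => volume {x | ofReal s < f x}) s := by
    intro s hs
    by_cases hs1 : s < 1
    · rw [indicator_of_mem (show s ∈ Ioo (0 : ℝ) 1 from ⟨hs, hs1⟩)]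
      congr 1; ext x
      simp only [mem_ofPred_eq]
      rw [ENNReal.ofReal_lt_iff_lt_toReal hs.le ((h1 x).trans_lt one_lt_top).ne]
    · rw [indicator_of_notMem (fun h => hs1 h.2)]
      convert measure_empty (μ := (volume : Measure ℝ))
      ext x; simp only [mem_ofPred_eq, mem_empty_iff_false, iff_false, not_lt]
      have := toReal_mono smp (h1 x)
      simp at this; linarith
  rw [setLIntegral_congr_fun measurableSet_Ioi this, lintegral_indicator measurableSet_Ioo,
    Measure.restrict_restrict measurableSet_Ioo]
  congr 2
  ext s; simp; exact fun h _ => h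

lemma pl_norm {f g h : ℝ → ℝ≥0∞} (hf : Measurable f) (hg : Measurable g) (hh : Measurable h)
    (hf1 : ∀ x, f x ≤ 1) (hg1 : ∀ x, g x ≤ 1) (hfs : ∀ a < 1, ∃ x, a < f x) (hgs : ∀ a < 1, ∃ x, a < g x)
    (H : ∀ x y, f x * g y ≤ h ((1 / 2 : ℝ) • (x + y)) ^ 2) :
    (∫⁻ x, f x) * (∫⁻ x, g x) ≤ (∫⁻ x, h x) ^ 2 := by
  refine (ennreal_amgm _ _).trans ?_
  gcongr
  refine ENNReal.div_le_of_le_mul' ?_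
  calc _ = ∫⁻ s in Ioo (0 : ℝ) 1, (volume {x | ofReal s < f x} +
          volume {x | ofReal s < g x}) := by
        rw [lint_layer hf hf1, lint_layer hg hg1, lintegral_add_left']
        refine (Antitone.measurable ?_).aemeasurable
        exact fun s t hst => measure_mono fun x hx => (ofReal_le_ofReal hst).trans_lt hx
    _ ≤ ∫⁻ s in Ioo (0 : ℝ) 1, 2 * volume {x | ofReal s < min (h x) 1} := by
        refine setLIntegral_mono' measurableSet_Ioo fun s hs => ?_
        have hs1 : ofReal s < 1 := by simpa using hs.2
        refine bm_mid (measurableSet_lt measurable_const hf) (measurableSet_lt measurable_const hg)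
          (hfs _ hs1) (hgs _ hs1) ?_
        intro x hx y hy
        simp only [mem_ofPred_eq, lt_min_iff] at hx hy ⊢
        refine ⟨?_, hs1⟩
        by_contra hcon
        push Not at hcon
        have h1 : h ((1 / 2 : ℝ) • (x + y)) ^ 2 ≤ ofReal s ^ 2 := by gcongr
        have h2 : ofReal s * ofReal s < f x * g y := ENNReal.mul_lt_mul hx hy
        exact absurd ((H x y).trans h1) (by rw [sq]; exact not_le.2 h2)
    _ = 2 * ∫⁻ x, min (h x) 1 := by
        rw [lint_layer (hh.min measurable_const) (fun x => min_le_right _ _), lintegral_const_mul']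
        simp
    _ ≤ _ := by gcongr; exact min_le_left _ _

lemma pl_bdd {f g h : ℝ → ℝ≥0∞} (hf : Measurable f) (hg : Measurable g) (hh : Measurable h)
    (N : ℝ≥0∞) (hN : N ≠ ⊤) (hf1 : ∀ x, f x ≤ N) (hg1 : ∀ x, g x ≤ N)
    (H : ∀ x y, f x * g y ≤ h ((1 / 2 : ℝ) • (x + y)) ^ 2) :
    (∫⁻ x, f x) * (∫⁻ x, g x) ≤ (∫⁻ x, h x) ^ 2 := by
  set F := ⨆ x, f x with hF
  set G := ⨆ x, g x with hG
  rcases eq_or_ne F 0 with hF0 | hF0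
  · have : ∀ x, f x = 0 := by simpa [F] using hF0
    simp [this]
  rcases eq_or_ne G 0 with hG0 | hG0
  · have : ∀ x, g x = 0 := by simpa [G] using hG0
    simp [this]
  have hFt : F ≠ ⊤ := ((iSup_le hf1).trans_lt hN.lt_top).ne
  have hGt : G ≠ ⊤ := ((iSup_le hg1).trans_lt hN.lt_top).ne
  have key : ∀ (φ : ℝ → ℝ≥0∞) (_ : (⨆ x, φ x) ≠ 0) (_ : (⨆ x, φ x) ≠ ⊤),
      (∀ x, (⨆ x, φ x)⁻¹ * φ x ≤ 1) ∧ ∀ a < 1, ∃ x, a < (⨆ x, φ x)⁻¹ * φ x := by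
    intro φ h0 ht
    refine ⟨fun x => ?_, fun a ha => ?_⟩
    · rw [mul_comm, ← div_eq_mul_inv]; exact ENNReal.div_le_of_le_mul (by simpa using le_iSup φ x)
    · have : a < ⨆ x, (⨆ x, φ x)⁻¹ * φ x := by
        rw [← ENNReal.mul_iSup, ENNReal.inv_mul_cancel h0 ht]; exact ha
      exact lt_iSup_iff.1 this
  set r : ℝ≥0∞ := (F * G) ^ (-(1 / 2) : ℝ) with hr
  have hr2 : r ^ 2 = F⁻¹ * G⁻¹ := by
    rw [hr, ← rpow_natCast, ← rpow_mul]
    norm_num [ENNReal.rpow_neg_one]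
    rw [ENNReal.mul_inv (Or.inl hF0) (Or.inl hFt)]
  have := pl_norm (f := fun x => F⁻¹ * f x) (g := fun x => G⁻¹ * g x) (h := fun x => r * h x)
    fpp fpp fpp (key f hF0 hFt).1 (key g hG0 hGt).1 (key f hF0 hFt).2
    (key g hG0 hGt).2 (fun x y => by
      rw [mul_pow, hr2, mul_mul_mul_comm]; gcongr; exact H x y)
  rw [lintegral_const_mul _ hf, lintegral_const_mul _ hg, lintegral_const_mul _ hh, mul_pow, hr2,
    mul_mul_mul_comm] at this
  have h0 : F⁻¹ * G⁻¹ ≠ 0 := mul_ne_zero (ENNReal.inv_ne_zero.2 hFt) (ENNReal.inv_ne_zero.2 hGt)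
  have ht : F⁻¹ * G⁻¹ ≠ ⊤ := ENNReal.mul_ne_top (inv_ne_top.2 hF0) (inv_ne_top.2 hG0)
  exact (ENNReal.mul_le_mul_iff_right h0 ht).1 this

lemma LCc_real : LCc (volume : Measure ℝ) (fun _ _ => 1) := by
  intro f g h hf hg hh H
  have hlim : ∀ φ : ℝ → ℝ≥0∞, Measurable φ →
      Tendsto (fun n : ℕ => ∫⁻ x, min (φ x) n) atTop (nhds (∫⁻ x, φ x)) := by
    intro φ hφ
    refine lintegral_tendsto_of_tendsto_of_monotone (fun n => by fun_prop) ?_ ?_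
    · exact .of_forall fun x i j hij => min_le_min le_rfl (by exact_mod_cast hij)
    · refine .of_forall fun x => ?_
      have : Tendsto (fun n : ℕ => min (φ x) (n : ℝ≥0∞)) atTop (nhds (min (φ x) ⊤)) :=
        tendsto_const_nhds.min ENNReal.tendsto_nat_nhds_top
      simpa using this
  rcases eq_or_ne (∫⁻ x, f x) 0 with h0 | h0
  · simp [h0]
  rcases eq_or_ne (∫⁻ x, g x) 0 with h0' | h0'
  · simp [h0']
  refine le_of_tendsto (ENNReal.Tendsto.mul (hlim f hf) (Or.inl h0) (hlim g hg) (Or.inl h0')) ?_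
  refine .of_forall fun n => ?_
  refine pl_bdd fpp fpp hh n smp (fun x => min_le_right _ _)
    (fun x => min_le_right _ _) fun x y => ?_
  refine le_trans ?_ ((H x y).trans smp)
  gcongr <;> exact min_le_left _ _

section gen
variable {E F : Type*} [MeasurableSpace E] [AddCommGroup E] [Module ℝ E]
  [MeasurableSpace F] [AddCommGroup F] [Module ℝ F]

lemma LCc.ae {μ : Measure E} {c : E → E → ℝ≥0∞} (hμ : LCc μ c) {f g h : E → ℝ≥0∞}
    (hh : AEMeasurable h μ) (H : ∀ x y, f x * g y ≤ h ((1 / 2 : ℝ) • (x + y)) ^ 2 * c x y) :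
    (∫⁻ x, f x ∂μ) * (∫⁻ x, g x ∂μ) ≤ (∫⁻ x, h x ∂μ) ^ 2 := by
  obtain ⟨f', hf', hff, e1⟩ := exists_measurable_le_lintegral_eq μ f
  obtain ⟨g', hg', hgg, e2⟩ := exists_measurable_le_lintegral_eq μ g
  set N := toMeasurable μ {x | h x ≠ hh.mk h x}
  have hN : μ N = 0 := by rw [measure_toMeasurable]; exact hh.ae_eq_mk
  set h' : E → ℝ≥0∞ := fun x => N.indicator (fun _ => ⊤) x + hh.mk h x
  have e3 : ∫⁻ x, h' x ∂μ = ∫⁻ x, h x ∂μ := by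
    refine lintegral_congr_ae ?_
    filter_upwards [hh.ae_eq_mk, measure_eq_zero_iff_ae_notMem.1 hN] with x hx hx2
    simp [h', hx2, hx]
  rw [e1, e2, ← e3]
  refine hμ f' g' h' hf' hg' ((measurable_const.indicator (measurableSet_toMeasurable _ _)).add
    hh.measurable_mk) fun x y => ?_
  refine (mul_le_mul' (hff x) (hgg y)).trans ((H x y).trans ?_)
  gcongr
  by_cases hx : (1 / 2 : ℝ) • (x + y) ∈ N
  · simp only [h', indicator_of_mem hx, top_add]; exact le_top
  · have : h ((1 / 2 : ℝ) • (x + y)) = hh.mk h ((1 / 2 : ℝ) • (x + y)) := by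
      by_contra hc; exact hx (subset_toMeasurable _ _ hc)
    rw [this]; exact le_add_self

lemma LCc.prod {μ : Measure E} {ν : Measure F} [SFinite μ] [SFinite ν] {c : E → E → ℝ≥0∞}
    {d : F → F → ℝ≥0∞} (hμ : LCc μ c) (hν : LCc ν d) :
    LCc (μ.prod ν) (fun p q => c p.1 q.1 * d p.2 q.2) := by
  intro f g h hf hg hh H
  rw [lintegral_prod _ hf.aemeasurable, lintegral_prod _ hg.aemeasurable,
    lintegral_prod _ hh.aemeasurable]
  refine hμ _ _ _ hf.lintegral_prod_right' hg.lintegral_prod_right' hh.lintegral_prod_right' ?_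
  intro x y
  have hs : (c x y ^ (1 / 2 : ℝ)) ^ 2 = c x y := by
    rw [← rpow_natCast, ← rpow_mul]; norm_num
  have := hν (fun z => f (x, z)) (fun z => g (y, z))
    (fun z => c x y ^ (1 / 2 : ℝ) * h ((1 / 2 : ℝ) • (x + y), z)) fpp fpp
    fpp (fun z w => by
      refine (H (x, z) (y, w)).trans (le_of_eq ?_)
      rw [mul_pow, hs]
      simp only [Prod.mk_add_mk, Prod.smul_mk]; ring)
  rw [lintegral_const_mul _ fpp, mul_pow, hs] at this
  rw [mul_comm (_ ^ 2)]; exact this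

lemma LCc.map {μ : Measure E} {c : E → E → ℝ≥0∞} {c' : F → F → ℝ≥0∞} (hμ : LCc μ c)
    (P : E →ₗ[ℝ] F) (hP : Measurable P) (h : ∀ x y, c' (P x) (P y) ≤ c x y) : LCc (μ.map P) c' := by
  intro f g k hf hg hk H
  rw [lintegral_map hf hP, lintegral_map hg hP, lintegral_map hk hP]
  refine hμ _ _ _ (hf.comp hP) (hg.comp hP) (hk.comp hP) fun x y => ?_
  refine (H _ _).trans ?_
  rw [← map_add, ← map_smul]
  gcongr
  exact h x y

lemma LCc.density {μ : Measure E} {c c' d : E → E → ℝ≥0∞} (hμ : LCc μ c) {p : E → ℝ≥0∞}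
    (hp : AEMeasurable p μ) (hd : ∀ x y, p x * p y ≤ p ((1 / 2 : ℝ) • (x + y)) ^ 2 * d x y)
    (h : ∀ x y, c' x y * d x y ≤ c x y) : LCc (μ.withDensity p) c' := by
  intro f g k hf hg hk H
  rw [lintegral_withDensity_eq_lintegral_mul₀ hp hf.aemeasurable,
    lintegral_withDensity_eq_lintegral_mul₀ hp hg.aemeasurable,
    lintegral_withDensity_eq_lintegral_mul₀ hp hk.aemeasurable]
  refine hμ.ae (hp.mul hk.aemeasurable) fun x y => ?_
  simp only [Pi.mul_apply]
  calc p x * f x * (p y * g y) = (p x * p y) * (f x * g y) := by ring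
    _ ≤ (p ((1 / 2 : ℝ) • (x + y)) ^ 2 * d x y) * (k ((1 / 2 : ℝ) • (x + y)) ^ 2 * c' x y) :=
        mul_le_mul' (hd x y) (H x y)
    _ = (p ((1 / 2 : ℝ) • (x + y)) * k ((1 / 2 : ℝ) • (x + y))) ^ 2 * (c' x y * d x y) := by ring
    _ ≤ _ := by gcongr; exact h x y

lemma LCc.mono {μ : Measure E} {c c' : E → E → ℝ≥0∞} (hμ : LCc μ c) (h : ∀ x y, c' x y ≤ c x y) :
    LCc μ c' := fun f g k hf hg hk H => hμ f g k hf hg hk fun x y => (H x y).trans (by gcongr; exact h x y)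

lemma LCc.smul {μ : Measure E} {c : E → E → ℝ≥0∞} (hμ : LCc μ c) (a : ℝ≥0∞) : LCc (a • μ) c := by
  rw [← withDensity_const]
  exact hμ.density (d := fun _ _ => 1) aemeasurable_const (fun x y => by simp [sq]) (fun x y => by simp)

lemma LCc.restrict {μ : Measure E} {c : E → E → ℝ≥0∞} (hμ : LCc μ c) {S : Set E}
    (hS : MeasurableSet S) (hc : Convex ℝ S) : LCc (μ.restrict S) c := by
  rw [← withDensity_indicator_one hS]
  refine hμ.density (d := fun _ _ => 1) (measurable_one.indicator hS).aemeasurable (fun x y => ?_)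
    (fun x y => by simp)
  by_cases hx : x ∈ S
  · by_cases hy : y ∈ S
    · have : (1 / 2 : ℝ) • (x + y) ∈ S := by
        rw [smul_add]; exact hc hx hy nnm nnm nnm
      rw [indicator_of_mem this, indicator_of_mem hx, indicator_of_mem hy]; simp
    · simp [hy]
  · simp [hx]
end gen

lemma LCc_pi (n : ℕ) : LCc (volume : Measure (Fin n → ℝ)) (fun _ _ => 1) := by
  induction n with
  | zero =>
    intro f g h hf hg hh H
    have h1 : ∀ φ : (Fin 0 → ℝ) → ℝ≥0∞, ∫⁻ x, φ x = φ 0 := fun φ => by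
      rw [volume_pi, Measure.pi_of_empty _ 0, lintegral_dirac]
    rw [h1, h1, h1]
    simpa using H 0 0
  | succ n ih =>
    have e := (volume_preserving_piFinSuccAbove (fun _ : Fin (n+1) => ℝ) 0).symm
    have h2 := LCc_real.prod ih
    let P : (ℝ × (Fin n → ℝ)) →ₗ[ℝ] (Fin (n+1) → ℝ) :=
      { toFun := fun p => Fin.cons p.1 p.2
        map_add' := fun p q => by ext i; refine Fin.cases ?_ (fun j => ?_) i <;> simp
        map_smul' := fun a q => by ext i; refine Fin.cases ?_ (fun j => ?_) i <;> simp }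
    have hP : ⇑(MeasurableEquiv.piFinSuccAbove (fun _ : Fin (n+1) => ℝ) 0).symm = P := by
      ext p i; simp [P]
    rw [← e.map_eq, hP]
    rw [hP] at e
    exact h2.map P e.measurable (fun x y => by simp)

section inner
variable {E F : Type*} [NormedAddCommGroup E] [InnerProductSpace ℝ E] [FiniteDimensional ℝ E]
  [MeasurableSpace E] [BorelSpace E] [NormedAddCommGroup F] [InnerProductSpace ℝ F]
  [FiniteDimensional ℝ F] [MeasurableSpace F] [BorelSpace F]

lemma LCc_volume : LCc (volume : Measure E) (fun _ _ => 1) := by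
  set b := stdOrthonormalBasis ℝ E
  have e := b.measurePreserving_repr_symm.comp
    ((EuclideanSpace.volume_preserving_symm_measurableEquiv_toLp (Fin (finrank ℝ E))).symm)
  let P : (Fin (finrank ℝ E) → ℝ) →ₗ[ℝ] E :=
    (b.repr.symm.toLinearEquiv.toLinearMap).comp (WithLp.linearEquiv 2 ℝ _).symm.toLinearMap
  rw [← e.map_eq]
  exact (LCc_pi _).map P e.measurable (fun x y => by simp)

def ULC (t : ℝ) (μ : Measure E) : Prop :=
  LCc μ (fun x y => ofReal (exp (t * ‖x - y‖ ^ 2 / 4)))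

lemma ULC_volume : ULC 0 (volume : Measure E) := by
  simpa [ULC] using LCc_volume (E := E)

lemma ULC.smul {t : ℝ} {μ : Measure E} (h : ULC t μ) (a : ℝ≥0∞) : ULC t (a • μ) := LCc.smul h a

lemma ULC.restrict {t : ℝ} {μ : Measure E} (h : ULC t μ) {S : Set E}
    (hS : MeasurableSet S) (hc : Convex ℝ S) : ULC t (μ.restrict S) := LCc.restrict h hS hc

lemma ULC.mono {t s : ℝ} {μ : Measure E} (h : ULC t μ) (hs : s ≤ t) : ULC s μ := by
  refine LCc.mono h fun x y => ?_
  gcongr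

lemma ULC.gauss {t : ℝ} {μ : Measure E} (h : ULC t μ) (s : ℝ) (θ : E) :
    ULC (t + s) (μ.withDensity fun x => ofReal (exp (⟪θ, x⟫ - s * ‖x‖ ^ 2 / 2))) := by
  refine LCc.density h (d := fun x y => ofReal (exp (-s * ‖x - y‖ ^ 2 / 4)))
    fpp (fun x y => ?_) (fun x y => ?_)
  · rw [← ofReal_mul psv, ← ofReal_pow psv,
      ← ofReal_mul psv, ← exp_add, ← exp_nat_mul, ← exp_add]
    refine le_of_eq ?_
    congr 2
    rw [inner_smul_right, inner_add_right, norm_smul, mul_pow]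
    have := parallelogram_law_with_norm ℝ x y
    norm_num
    linear_combination (s/4) * this
  · rw [← ofReal_mul psv, ← exp_add]
    refine le_of_eq ?_
    congr 2; ring

lemma ULC.lc {t : ℝ} {μ : Measure E} (h : ULC t μ) {p : E → ℝ≥0∞} (hp : AEMeasurable p μ)
    (hd : ∀ x y, p x * p y ≤ p ((1 / 2 : ℝ) • (x + y)) ^ 2) : ULC t (μ.withDensity p) :=
  LCc.density h (d := fun _ _ => 1) hp (fun x y => by simpa using hd x y) (fun x y => by simp)

lemma ULC.map_prod {a b t : ℝ} {μ : Measure E} {ν : Measure F} [SFinite μ] [SFinite ν] {G : Type*}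
    [NormedAddCommGroup G] [InnerProductSpace ℝ G] [MeasurableSpace G]
    (hμ : ULC a μ) (hν : ULC b ν) (P : E × F →ₗ[ℝ] G) (hP : Measurable P)
    (h : ∀ x y, t * ‖P (x, y)‖ ^ 2 ≤ a * ‖x‖ ^ 2 + b * ‖y‖ ^ 2) :
    LCc ((μ.prod ν).map P) (fun x y => ofReal (exp (t * ‖x - y‖ ^ 2 / 4))) := by
  refine LCc.map (LCc.prod hμ hν) P hP fun x y => ?_
  rw [← ofReal_mul psv, ← exp_add]
  gcongr
  have := h (x - y).1 (x - y).2
  rw [← map_sub]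
  rw [Prod.mk.eta] at this
  simp only [Prod.fst_sub, Prod.snd_sub] at this
  linarith

lemma ULC.map {a t : ℝ} {μ : Measure E} (hμ : ULC a μ) (P : E →ₗ[ℝ] F)
    (h : ∀ x, t * ‖P x‖ ^ 2 ≤ a * ‖x‖ ^ 2) : ULC t (μ.map P) := by
  refine LCc.map hμ P (LinearMap.continuous_of_finiteDimensional P).measurable fun x y => ?_
  refine ofReal_le_ofReal (exp_le_exp.2 ?_)
  rw [← map_sub]; linarith [h (x - y)]
end inner

section m3
variable {E F : Type*} [NormedAddCommGroup E] [InnerProductSpace ℝ E] [FiniteDimensional ℝ E]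
  [MeasurableSpace E] [BorelSpace E] [NormedAddCommGroup F] [InnerProductSpace ℝ F]
  [FiniteDimensional ℝ F] [MeasurableSpace F] [BorelSpace F]

lemma maurey {t : ℝ} (ht : 0 ≤ t) {ν : Measure E} [IsProbabilityMeasure ν] (hν : ULC t ν) {S : Set E}
    (hS : MeasurableSet S) {ψ : E → ℝ} (hψ : Measurable ψ) (h : ∀ x ∈ S, ∀ y, ψ y ≤ ‖x - y‖ ^ 2) :
    ν S * ∫⁻ y, ofReal (exp (t * ψ y / 4)) ∂ν ≤ 1 := by
  have := hν (S.indicator 1) (fun y => ofReal (exp (t * ψ y / 4))) 1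
    (measurable_one.indicator hS) fpp measurable_one (fun x y => by
      by_cases hx : x ∈ S
      · simp only [indicator_of_mem hx, Pi.one_apply, one_mul, one_pow]
        gcongr; exact h x hx y
      · simp [hx])
  rw [lintegral_indicator_one hS] at this
  simpa using this

lemma exp_lower {s : ℝ} (hs : |s| ≤ 1) : 1 + s + s ^ 2 / 2 - |s| ^ 3 ≤ exp s := by
  have := Real.exp_bound hs (n := 3) nnm
  have h1 := (abs_le.1 this).1
  have : 0 ≤ |s| ^ 3 := by positivity
  norm_num [Finset.sum_range_succ, Nat.factorial] at h1
  linarith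

lemma poinc_arith {ε M K q q2 I1 I2 : ℝ} (hε : 0 < ε) (hε1 : ε ≤ 1) (hM : 0 ≤ M) (hK : 0 ≤ K)
    (hq : 0 ≤ q) (hq2 : q ≤ q2) (h1 : 1 - ε ^ 2 * q + ε ^ 2 / 2 * M - ε ^ 3 * K ≤ I1)
    (h2 : 1 + ε ^ 2 / 2 * M - ε ^ 3 * K ≤ I2) (h : I1 * I2 ≤ 1) :
    M - q ≤ ε * (2 * K + (M + K) * (M + K + q2)) := by
  by_contra hcon
  push Not at hcon
  have e2 : 0 < ε ^ 2 := by positivity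
  obtain ⟨P, hP⟩ : ∃ P, P = (M + K) * (M + K + q2) := ⟨_, rfl⟩
  have hP0 : 0 ≤ P := hP ▸ mul_nonneg lnr lnr
  rw [← hP] at hcon
  obtain ⟨β, hβ⟩ : ∃ β, β = M / 2 - ε * K := ⟨_, rfl⟩
  have hεK : ε * K ≤ K := by nlinarith
  have hεK0 : 0 ≤ ε * K := by positivity
  have hεP0 : 0 ≤ ε * P := by positivity
  have hβ0 : 0 < β := by nlinarith
  have hβ1 : β ≤ M + K := by linarith
  have h1' : 1 + ε ^ 2 * (β - q) ≤ I1 := by rw [hβ]; linarith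
  have h2' : 1 + ε ^ 2 * β ≤ I2 := by rw [hβ]; linarith
  have hsum : ε * P < (β - q) + β := by rw [hβ]; linarith
  have hprod : -((β - q) * β) ≤ P := by
    rw [hP]
    have : q - β ≤ M + K + q2 := by linarith
    have h3 : (q - β) * β ≤ (M + K + q2) * β := by gcongr
    have h4 : (M + K + q2) * β ≤ (M + K + q2) * (M + K) := mul_le_mul_of_nonneg_left hβ1 lnr
    linarith
  have hε2 : ε ^ 2 * P ≤ ε * P := by gcongr; nlinarith
  have pos : 0 < (β - q) + β + ε ^ 2 * ((β - q) * β) := by nlinarith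
  have hI2 : 0 < 1 + ε ^ 2 * β := by positivity
  have hp2 : 1 < (1 + ε ^ 2 * (β - q)) * (1 + ε ^ 2 * β) := by nlinarith
  have hI1 : 0 < 1 + ε ^ 2 * (β - q) := (pos_iff_pos_of_mul_pos lnr).2 hI2
  have : (1 + ε ^ 2 * (β - q)) * (1 + ε ^ 2 * β) ≤ I1 * I2 := mul_le_mul h1' h2' hI2.le lnr
  linarith

lemma poincare_aux {t B C : ℝ} (ht : 0 < t) (hB : 0 ≤ B) (hC : 0 ≤ C) {ν : Measure E}
    [IsProbabilityMeasure ν]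
    (hν : ULC t ν) {S : Set E} (hS : MeasurableSet S) (hS1 : ∀ᵐ x ∂ν, x ∈ S) {φ : E → ℝ} {g : E → E}
    (hφ : Measurable φ) (hg : Measurable g) (hφB : ∀ x ∈ S, |φ x| ≤ B) (hgB : ∀ x ∈ S, ‖g x‖ ≤ B)
    (h : ∀ x ∈ S, ∀ y ∈ S, φ x - φ y ≤ ⟪g x, x - y⟫ + C * ‖x - y‖ ^ 2) (hm : ∫ x, φ x ∂ν = 0) :
    ∫ x, φ x ^ 2 ∂ν ≤ 1 / t * ∫ x, ‖g x‖ ^ 2 ∂ν := by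
  set M := ∫ x, φ x ^ 2 ∂ν with hM
  set Q := ∫ x, ‖g x‖ ^ 2 ∂ν with hQ
  have iφ : Integrable φ ν := ⟨hφ.aestronglyMeasurable,
    HasFiniteIntegral.of_bounded (C := B) (hS1.mono fun x hx => hφB x hx)⟩
  have iφ2 : Integrable (fun x => φ x ^ 2) ν := ⟨by fun_prop,
    HasFiniteIntegral.of_bounded (C := B ^ 2) (hS1.mono fun x hx => by
      rw [norm_eq_abs, abs_pow]; exact pow_le_pow_left₀ (abs_nonneg _) (hφB x hx) 2)⟩
  have ig : Integrable (fun x => ‖g x‖ ^ 2) ν := ⟨by fun_prop,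
    HasFiniteIntegral.of_bounded (C := B ^ 2) (hS1.mono fun x hx => by
      rw [norm_eq_abs, abs_pow, abs_norm]
      exact pow_le_pow_left₀ (norm_nonneg _) (hgB x hx) 2)⟩
  have hM0 : 0 ≤ M := integral_nonneg fun x => by positivity
  have hQ0 : 0 ≤ Q := integral_nonneg fun x => by positivity
  set L := B + 2 * B ^ 2 / t with hL
  have hL0 : 0 ≤ L := by positivity
  set K := L ^ 2 + L ^ 3 with hK
  have hK0 : 0 ≤ K := by positivity
  have key : ∀ ε : ℝ, 0 < ε → ε ≤ 1 → ε * L ≤ 1 → 8 * ε * C ≤ t →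
      M - Q / (t - 4 * ε * C) ≤ ε * (2 * K + (M + K) * (M + K + 2 * Q / t)) := by
    intro ε hε hε1 hεL hεC
    set a := t - 4 * ε * C with ha
    have ha2 : t / 2 ≤ a := by linarith
    have ha0 : 0 < a := by linarith
    have hqL : ∀ x ∈ S, ‖g x‖ ^ 2 / a ≤ 2 * B ^ 2 / t := fun x hx => by
      have h1 : ‖g x‖ ^ 2 ≤ B ^ 2 := pow_le_pow_left₀ (norm_nonneg _) (hgB x hx) 2
      rw [div_le_div_iff₀ ha0 ht]; nlinarith [sq_nonneg B]
    have pl := hν (S.indicator fun x => ofReal (exp (ε * φ x - ε ^ 2 * (‖g x‖ ^ 2 / a))))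
      (S.indicator fun x => ofReal (exp (- ε * φ x))) 1
      (Measurable.indicator fpp hS) (Measurable.indicator fpp hS) measurable_one
      (fun x y => by
        by_cases hx : x ∈ S
        · by_cases hy : y ∈ S
          · simp only [indicator_of_mem hx, indicator_of_mem hy, Pi.one_apply, one_pow, one_mul]
            rw [← ofReal_mul psv, ← exp_add]
            gcongr
            have h1 := h x hx y hy
            have h2 := real_inner_le_norm (g x) (x - y)
            have h3 : ε * ‖g x‖ * ‖x - y‖ ≤ ε ^ 2 * (‖g x‖ ^ 2 / a) + a * ‖x - y‖ ^ 2 / 4 := by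
              have : 0 ≤ (2 * ε * ‖g x‖ - a * ‖x - y‖) ^ 2 / (4 * a) := by positivity
              have e : (2 * ε * ‖g x‖ - a * ‖x - y‖) ^ 2 / (4 * a) =
                ε ^ 2 * (‖g x‖ ^ 2 / a) + a * ‖x - y‖ ^ 2 / 4 - ε * ‖g x‖ * ‖x - y‖ := by
                field_simp; ring
              linarith
            have h4 : ε * (φ x - φ y) ≤ ε * (‖g x‖ * ‖x - y‖ + C * ‖x - y‖ ^ 2) := by gcongr; linarith
            clear h hφB hgB
            calc _ = ε * (φ x - φ y) - ε ^ 2 * (‖g x‖ ^ 2 / a) := by ring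
              _ ≤ _ := by rw [ha] at h3 ⊢; linarith
          · simp [hy]
        · simp [hx])
    have conv : ∀ ψ : E → ℝ, Measurable ψ → (∀ x ∈ S, |ψ x| ≤ ε * L) →
        ∫⁻ x, S.indicator (fun x => ofReal (exp (ψ x))) x ∂ν =
          ofReal (∫ x, exp (ψ x) ∂ν) ∧
        ∀ u : E → ℝ, Integrable u ν → (∀ x ∈ S, u x ≤ exp (ψ x)) → ∫ x, u x ∂ν ≤ ∫ x, exp (ψ x) ∂ν := by
      intro ψ hψ hb
      have hi : Integrable (fun x => exp (ψ x)) ν := ⟨by fun_prop,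
        HasFiniteIntegral.of_bounded (C := exp 1) (hS1.mono fun x hx => by
          rw [norm_eq_abs, Real.abs_exp]
          exact exp_le_exp.2 ((le_abs_self _).trans ((hb x hx).trans hεL)))⟩
      refine ⟨?_, fun u hu hle => integral_mono_ae hu hi (hS1.mono fun x hx => hle x hx)⟩
      rw [ofReal_integral_eq_lintegral_ofReal hi (.of_forall fun x => by positivity)]
      exact lintegral_congr_ae (hS1.mono fun x hx => by simp [hx])
    have b1 : ∀ x ∈ S, |ε * φ x - ε ^ 2 * (‖g x‖ ^ 2 / a)| ≤ ε * L := fun x hx => by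
      have h0 : 0 ≤ ‖g x‖ ^ 2 / a := by positivity
      have h1 := hφB x hx
      have h2 : |ε * φ x| ≤ ε * B := by rw [abs_mul, abs_of_pos hε]; gcongr
      have h3 : ε ^ 2 * (‖g x‖ ^ 2 / a) ≤ ε * (2 * B ^ 2 / t) := by
        have : ε ^ 2 ≤ ε := by nlinarith
        exact mul_le_mul this (hqL x hx) h0 hε.le
      have h4 : 0 ≤ ε ^ 2 * (‖g x‖ ^ 2 / a) := by positivity
      calc _ ≤ |ε * φ x| + |ε ^ 2 * (‖g x‖ ^ 2 / a)| := abs_sub _ _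
        _ ≤ _ := by rw [abs_of_nonneg h4, hL, mul_add]; linarith
    have b2 : ∀ x ∈ S, |-ε * φ x| ≤ ε * L := fun x hx => by
      rw [abs_mul, abs_neg, abs_of_pos hε]
      have h1 := hφB x hx
      have : 0 ≤ 2 * B ^ 2 / t := by positivity
      gcongr; linarith
    obtain ⟨c1, d1⟩ := conv _ fpp b1
    obtain ⟨c2, d2⟩ := conv _ fpp b2
    rw [c1, c2, ← ofReal_mul (integral_nonneg fun x => by positivity)] at pl
    simp only [Pi.one_apply, lintegral_const, measure_univ, mul_one, one_pow] at pl
    rw [ofReal_le_one] at pl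
    have e1 := d1 (fun x => 1 + ε * φ x - ε ^ 2 / a * ‖g x‖ ^ 2 + ε ^ 2 / 2 * φ x ^ 2 - ε ^ 3 * K)
      fpp (fun x hx => by
        have hb := b1 x hx
        refine le_trans ?_ (exp_lower (hb.trans hεL))
        have h3 : |ε * φ x - ε ^ 2 * (‖g x‖ ^ 2 / a)| ^ 3 ≤ (ε * L) ^ 3 := by gcongr
        have h4 : φ x * (‖g x‖ ^ 2 / a) ≤ L ^ 2 := by
          have h0 : 0 ≤ ‖g x‖ ^ 2 / a := by positivity
          have hp : 0 ≤ 2 * B ^ 2 / t := by positivity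
          rw [sq L]
          refine mul_le_mul ?_ ?_ h0 hL0
          · have := (le_abs_self _).trans (hφB x hx); rw [hL]; linarith
          · have := hqL x hx; rw [hL]; linarith
        have h5 : 0 ≤ (ε ^ 2 * (‖g x‖ ^ 2 / a)) ^ 2 := by positivity
        have h6 : ε ^ 3 * (φ x * (‖g x‖ ^ 2 / a)) ≤ ε ^ 3 * L ^ 2 := by gcongr
        have e : ε ^ 2 / a * ‖g x‖ ^ 2 = ε ^ 2 * (‖g x‖ ^ 2 / a) := by ring
        rw [e, hK]
        calc _ = 1 + (ε * φ x - ε ^ 2 * (‖g x‖ ^ 2 / a)) + (ε * φ x) ^ 2 / 2 - ε ^ 3 * L ^ 2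
              - (ε * L) ^ 3 := by ring
          _ ≤ 1 + (ε * φ x - ε ^ 2 * (‖g x‖ ^ 2 / a)) + (ε * φ x - ε ^ 2 * (‖g x‖ ^ 2 / a)) ^ 2 / 2
              - (ε * L) ^ 3 := by linarith
          _ ≤ _ := by linarith)
    have e2 := d2 (fun x => 1 - ε * φ x + ε ^ 2 / 2 * φ x ^ 2 - ε ^ 3 * K)
      fpp (fun x hx => by
        have hb := b2 x hx
        refine le_trans ?_ (exp_lower (hb.trans hεL))
        have h3 : |-ε * φ x| ^ 3 ≤ (ε * L) ^ 3 := by gcongr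
        have : 0 ≤ ε ^ 3 * L ^ 2 := by positivity
        rw [hK]; linarith)
    rw [integral_sub fpp fpp, integral_add fpp fpp,
      integral_sub fpp fpp, integral_add fpp fpp] at e1
    rw [integral_sub fpp fpp, integral_add fpp fpp,
      integral_sub fpp fpp] at e2
    simp only [integral_const, integral_const_mul, hm, ← hM, ← hQ, probReal_univ, smul_eq_mul,
      one_mul, mul_zero, add_zero, sub_zero] at e1 e2
    have hQa : Q / a ≤ 2 * Q / t := by
      rw [div_le_div_iff₀ ha0 ht]; clear e1 e2 pl; nlinarith
    refine poinc_arith hε hε1 hM0 hK0 psv hQa ?_ ?_ pl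
    · refine le_trans (le_of_eq ?_) e1; ring
    · refine le_trans (le_of_eq ?_) e2; ring
  have lim : Tendsto (fun ε : ℝ => M - Q / (t - 4 * ε * C)) (nhdsWithin 0 (Ioi 0))
      (nhds (M - Q / (t - 4 * 0 * C))) := by
    refine (ContinuousAt.tendsto ?_).mono_left nhdsWithin_le_nhds
    have : t - 4 * 0 * C ≠ 0 := by simp; linarith
    fun_prop (disch := simpa)
  have lim2 : Tendsto (fun ε : ℝ => ε * (2 * K + (M + K) * (M + K + 2 * Q / t)))
      (nhdsWithin 0 (Ioi 0)) (nhds (0 * (2 * K + (M + K) * (M + K + 2 * Q / t)))) :=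
    (ContinuousAt.tendsto fpp).mono_left nhdsWithin_le_nhds
  have ev : ∀ c : ℝ, 0 ≤ c → ∀ d > 0, ∀ᶠ ε in nhdsWithin (0 : ℝ) (Ioi 0), ε * c ≤ d := by
    intro c hc d hd
    have : Tendsto (fun ε : ℝ => ε * c) (nhdsWithin 0 (Ioi 0)) (nhds (0 * c)) :=
      (ContinuousAt.tendsto fpp).mono_left nhdsWithin_le_nhds
    exact (this.eventually (gt_mem_nhds (by simpa using hd))).mono fun _ h => h.le
  have := le_of_tendsto_of_tendsto lim lim2 (by
    filter_upwards [ev 1 nnm 1 nnm, ev L hL0 1 nnm,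
      ev (8 * C) psv t ht, self_mem_nhdsWithin] with ε h1 h2 h3 h4
    exact key ε h4 lnr h2 lnr)
  simp at this
  rw [one_div, inv_mul_eq_div]; linarith

lemma poincare {t B C : ℝ} (ht : 0 < t) (hB : 0 ≤ B) (hC : 0 ≤ C) {ν : Measure E}
    [IsProbabilityMeasure ν]
    (hν : ULC t ν) {S : Set E} (hS : MeasurableSet S) (hS1 : ∀ᵐ x ∂ν, x ∈ S) {φ : E → ℝ} {g : E → E}
    (hφ : Measurable φ) (hg : Measurable g) (hφB : ∀ x ∈ S, |φ x| ≤ B) (hgB : ∀ x ∈ S, ‖g x‖ ≤ B)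
    (h : ∀ x ∈ S, ∀ y ∈ S, φ x - φ y ≤ ⟪g x, x - y⟫ + C * ‖x - y‖ ^ 2) :
    ∫ x, (φ x - ∫ y, φ y ∂ν) ^ 2 ∂ν ≤ 1 / t * ∫ x, ‖g x‖ ^ 2 ∂ν := by
  have iφ : Integrable φ ν := ⟨hφ.aestronglyMeasurable,
    HasFiniteIntegral.of_bounded (C := B) (hS1.mono fun x hx => hφB x hx)⟩
  set m := ∫ y, φ y ∂ν
  refine poincare_aux (B := B + |m|) ht psv hC hν hS hS1 fpp hg (fun x hx => ?_)
    (fun x hx => (hgB x hx).trans (by linarith [abs_nonneg m])) (fun x hx y hy => ?_) ?_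
  · exact (abs_sub _ _).trans (by linarith [hφB x hx])
  · simpa using h x hx y hy
  · rw [integral_sub iφ fpp]; simp [m]

lemma varlin {t R : ℝ} (ht : 0 < t) (hR : 0 ≤ R) {ν : Measure E} [IsProbabilityMeasure ν]
    (hν : ULC t ν) (hS1 : ∀ᵐ x ∂ν, ‖x‖ ≤ R) (v : E) :
    ∫ x, (⟪v, x⟫ - ∫ y, ⟪v, y⟫ ∂ν) ^ 2 ∂ν ≤ 1 / t * ‖v‖ ^ 2 := by
  have := poincare (B := ‖v‖ * (R + 1)) (C := 0) ht psv le_rfl hν (S := closedBall 0 R)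
    isClosed_closedBall.measurableSet (by simpa using hS1) (φ := fun x => ⟪v, x⟫) (g := fun _ => v)
    fpp fpp (fun x hx => ?_) (fun x hx => ?_) (fun x hx y hy => by
      simp [inner_sub_right])
  · simpa using this
  · refine (abs_real_inner_le_norm v x).trans ?_
    gcongr; have : ‖x‖ ≤ R := by simpa using hx
    linarith
  · nlinarith [norm_nonneg v, mul_nonneg (norm_nonneg v) hR]

lemma borell_step {ν : Measure E} (hν : ULC 0 ν) [IsProbabilityMeasure ν] {N : E → ℝ} (hN : Measurable N)
    (hsub : ∀ x y, N y ≤ 2 * N ((1 / 2 : ℝ) • (x + y)) + N x) (u s : ℝ) :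
    ν {x | N x ≤ u} * ν {x | (2 * s + 1) * u < N x} ≤ ν {x | s * u < N x} ^ 2 := by
  have m1 : MeasurableSet {x | N x ≤ u} := measurableSet_le hN measurable_const
  have m2 : MeasurableSet {x | (2 * s + 1) * u < N x} := measurableSet_lt measurable_const hN
  have m3 : MeasurableSet {x | s * u < N x} := measurableSet_lt measurable_const hN
  rw [← lintegral_indicator_one m1, ← lintegral_indicator_one m2, ← lintegral_indicator_one m3]
  refine hν _ _ _ (measurable_one.indicator m1) (measurable_one.indicator m2)
    (measurable_one.indicator m3) fun x y => ?_
  by_cases hx : N x ≤ u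
  · by_cases hy : (2 * s + 1) * u < N y
    · have : s * u < N ((1 / 2 : ℝ) • (x + y)) := by have := hsub x y; linarith
      rw [indicator_of_mem (show x ∈ {x | N x ≤ u} from hx),
        indicator_of_mem (show y ∈ {x | (2 * s + 1) * u < N x} from hy),
        indicator_of_mem (show _ ∈ {x | s * u < N x} from this)]
      simp
    · rw [indicator_of_notMem (show y ∉ {x | (2 * s + 1) * u < N x} from hy)]; simp
  · rw [indicator_of_notMem (show x ∉ {x | N x ≤ u} from hx)]; simp
end m3

section
variable {E : Type*} [NormedAddCommGroup E] [InnerProductSpace ℝ E] [FiniteDimensional ℝ E]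
  [MeasurableSpace E] [BorelSpace E] {b δ t β ε s lam R q C τ c a r l : ℝ} {F f g u p : E → ℝ} {k N n : ℕ} {ν m μ : Measure E} {y : E}

section g0

lemma int_gauss (hb : 0 < b) : Integrable (fun x : E => exp (-b * ‖x‖ ^ 2)) := by
  have := (GaussianFourier.integrable_cexp_neg_mul_sq_norm_add (b := (b : ℂ)) (by simpa) 0 (0 : E)).norm
  refine this.congr (ae_of_all _ fun x => ?_)
  simp [Complex.norm_exp, ← Complex.ofReal_pow]

variable (E) in
def gZ : ℝ := ∫ x : E, exp (-(1/2) * ‖x‖ ^ 2)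
lemma gZ_pos : 0 < gZ E := by
  rw [gZ, integral_pos_iff_support_of_nonneg (fun x => (exp_pos _).le) (int_gauss nnm)]
  have : Function.support (fun x : E => exp (-(1/2) * ‖x‖ ^ 2)) = univ := by
    ext x; simp [Real.exp_ne_zero]
  rw [this]; exact isOpen_univ.measure_pos _ univ_nonempty
def gd (x : E) : ℝ := (gZ E)⁻¹ * exp (-(1/2) * ‖x‖ ^ 2)
lemma gd_pos (x : E) : 0 < gd x := mul_pos (inv_pos.2 gZ_pos) (exp_pos _)
@[fun_prop] lemma gd_meas : Measurable (gd : E → ℝ) := by unfold gd; fun_prop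
variable (E) in
def gam : Measure E := volume.withDensity fun x => ofReal (gd x)

lemma gam_integral (F : E → ℝ) : ∫ x, F x ∂(gam E) = ∫ x, gd x * F x := by
  rw [gam, integral_withDensity_eq_integral_toReal_smul fpp smp]
  simp [toReal_ofReal (gd_pos _).le]
lemma gam_integrable : Integrable F (gam E) ↔ Integrable (fun x => gd x * F x) := by
  rw [gam, integrable_withDensity_iff_integrable_smul' fpp smp]
  simp [toReal_ofReal (gd_pos _).le]
instance gam_prob : IsProbabilityMeasure (gam E) := by
  constructor
  rw [gam, withDensity_apply _ MeasurableSet.univ, restrict_univ,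
    ← ofReal_integral_eq_lintegral_ofReal (f := gd) ((int_gauss nnm).const_mul _)
    (ae_of_all _ fun x => (gd_pos x).le)]
  simp only [gd, integral_const_mul]
  rw [← gZ, inv_mul_cancel₀ gZ_pos.ne', ofReal_one]
lemma gam_ULC : ULC 1 (gam E) := by
  have := ((ULC_volume (E := E)).gauss 1 0).smul (ofReal (gZ E)⁻¹)
  rw [zero_add] at this
  suffices e : gam E = ofReal (gZ E)⁻¹ • (volume : Measure E).withDensity
      (fun x => ofReal (exp (⟪(0:E), x⟫ - 1 * ‖x‖ ^ 2 / 2))) by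
    rw [e]; exact this
  rw [gam, ← withDensity_smul _ fpp]
  congr 1; ext x
  simp only [gd, Pi.smul_apply, smul_eq_mul]
  rw [← ofReal_mul (inv_pos.2 gZ_pos).le]; congr 3; simp; ring

lemma gam_exp (a : ℝ) : Integrable (fun x : E => exp (a * ‖x‖)) (gam E) := by
  rw [gam_integrable]
  refine ((int_gauss (E := E) (b := 1/4) nnm).const_mul ((gZ E)⁻¹ * exp (a^2))).mono'
    fpp (ae_of_all _ fun x => ?_)
  rw [norm_of_nonneg (mul_nonneg (gd_pos x).le (exp_pos _).le), gd, mul_assoc, mul_assoc,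
    ← exp_add, ← exp_add]
  have := inv_pos.2 (gZ_pos (E := E))
  refine mul_le_mul_of_nonneg_left (exp_le_exp.2 ?_) this.le
  nlinarith [sq_nonneg (a - ‖x‖/2)]

lemma gam_growth (hF : AEStronglyMeasurable F (gam E)) (C a : ℝ)
    (h : ∀ x, |F x| ≤ C * exp (a * ‖x‖)) : Integrable F (gam E) :=
  ((gam_exp a).const_mul C).mono' hF (ae_of_all _ h)

lemma gd_shift (x v : E) : gd (x - v) = gd x * exp (⟪v, x⟫ - ‖v‖ ^ 2 / 2) := by
  rw [gd, gd, mul_assoc, ← exp_add, norm_sub_sq_real, real_inner_comm]; congr 2; ring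

lemma gam_CM (F : E → ℝ) (v : E) :
    ∫ x, F (x + v) ∂(gam E) = ∫ x, F x * exp (⟪v, x⟫ - ‖v‖ ^ 2 / 2) ∂(gam E) := by
  rw [gam_integral, gam_integral, ← integral_sub_right_eq_self _ v]
  simp only [sub_add_cancel, gd_shift]
  congr 1; ext x; ring
lemma gam_CML (F : E → ℝ≥0∞) (hF : Measurable F) (v : E) :
    ∫⁻ x, F (x + v) ∂(gam E) = ∫⁻ x, F x * ofReal (exp (⟪v, x⟫ - ‖v‖ ^ 2 / 2)) ∂(gam E) := by
  rw [gam, lintegral_withDensity_eq_lintegral_mul _ fpp fpp,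
    lintegral_withDensity_eq_lintegral_mul _ fpp fpp,
    ← lintegral_sub_right_eq_self _ v]
  simp only [sub_add_cancel, gd_shift, Pi.mul_apply]
  congr 1; ext x; rw [ofReal_mul (gd_pos x).le]; ring

lemma fderiv_gd (x v : E) : HasFDerivAt gd (-(gd x) • (innerSL ℝ x)) x := by
  have h := (((hasStrictFDerivAt_norm_sq x).hasFDerivAt.const_mul (-(1/2))).exp.const_mul (gZ E)⁻¹)
  refine h.congr_fderiv ?_
  ext v; simp [gd]; ring

lemma gam_ibp (hF : Differentiable ℝ F) (v : E) (C a : ℝ)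
    (h : ∀ x, |F x| ≤ C * exp (a * ‖x‖)) (h' : ∀ x, |fderiv ℝ F x v| ≤ C * exp (a * ‖x‖)) :
    ∫ x, ⟪x, v⟫ * F x ∂(gam E) = ∫ x, fderiv ℝ F x v ∂(gam E) := by
  have hFm : Measurable F := hF.continuous.measurable
  have hm : Measurable fun x => fderiv ℝ F x v := measurable_fderiv_apply_const ℝ F v
  have i1 : Integrable (fun x => ⟪x, v⟫ * F x) (gam E) := by
    refine gam_growth fpp (‖v‖ * C) (a + 1) fun x => ?_
    rw [abs_mul, add_mul, one_mul, exp_add]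
    have h1 := abs_real_inner_le_norm x v
    have h2 : ‖x‖ ≤ exp ‖x‖ := by linarith [add_one_le_exp ‖x‖]
    calc _ ≤ (exp ‖x‖ * ‖v‖) * (C * exp (a * ‖x‖)) :=
          mul_le_mul (h1.trans (by gcongr)) (h x) (abs_nonneg _) psv
      _ = _ := by ring
  have i2 := gam_growth hm.aestronglyMeasurable C a h'
  have i3 := gam_growth hFm.aestronglyMeasurable C a h
  rw [gam_integrable] at i1 i2 i3
  have e : ∀ x, fderiv ℝ gd x v * F x = - (gd x * (⟪x, v⟫ * F x)) := fun x => by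
    rw [(fderiv_gd x v).fderiv]; simp; ring
  have := integral_mul_fderiv_eq_neg_fderiv_mul_of_integrable (μ := volume) (f := gd) (g := F) (v := v)
    (by simp only [e]; exact i1.neg) i2 i3 (fun x _ => (fderiv_gd x v).differentiableAt) (fun x _ => hF x)
  rw [gam_integral, gam_integral, this]
  simp only [e, integral_neg, neg_neg]

lemma norm_le_exp (a : ℝ) : a ≤ exp a := by linarith [add_one_le_exp a]

lemma gam_int_inner (v : E) : Integrable (fun x => ⟪x, v⟫) (gam E) :=
  gam_growth fpp ‖v‖ 1 fun x => (abs_real_inner_le_norm x v).trans (by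
    rw [mul_comm, one_mul]; gcongr; exact norm_le_exp _)
lemma gam_inner2 (v w : E) : ∫ x, ⟪x, v⟫ * ⟪x, w⟫ ∂(gam E) = ⟪v, w⟫ := by
  have hd : ∀ x, fderiv ℝ (fun x : E => ⟪x, w⟫) x v = ⟪v, w⟫ := fun x => by
    have : HasFDerivAt (fun x : E => ⟪x, w⟫) ((innerSL ℝ).flip w) x := ((innerSL ℝ).flip w).hasFDerivAt
    rw [this.fderiv]; rfl
  rw [gam_ibp (F := fun x => ⟪x, w⟫) (fun x => ((innerSL ℝ).flip w).differentiableAt) v (‖w‖ + |⟪v, w⟫|) 1]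
  · simp [hd]
  · intro x
    have := abs_real_inner_le_norm x w
    rw [one_mul]
    have h1 := norm_le_exp ‖x‖
    have : ‖x‖ * ‖w‖ ≤ exp ‖x‖ * ‖w‖ := by gcongr
    nlinarith [abs_nonneg ⟪v, w⟫, exp_pos ‖x‖, mul_nonneg (abs_nonneg ⟪v, w⟫) (exp_pos ‖x‖).le]
  · intro x; rw [hd, one_mul]
    have h1 : 1 ≤ exp ‖x‖ := one_le_exp (norm_nonneg _)
    nlinarith [abs_nonneg ⟪v, w⟫, mul_nonneg (norm_nonneg w) (exp_pos ‖x‖).le]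
lemma gam_inner (v : E) : ∫ x, ⟪x, v⟫ ∂(gam E) = 0 := by
  have := gam_ibp (F := fun _ : E => (1 : ℝ)) fpp v 1 0 smp smp
  simpa using this
end g0

section g1

def DD (v : E) (f : E → ℝ) : E → ℝ := fun x => fderiv ℝ f x v
def Db : ℕ → (E → ℝ) → Prop
  | 0, f => Continuous f ∧ ∃ C, ∀ x, |f x| ≤ C
  | k + 1, f => Differentiable ℝ f ∧ (∃ C, ∀ x, |f x| ≤ C) ∧ ∀ v, Db k (DD v f)
def Nice (f : E → ℝ) : Prop := ∀ k, Db k f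

lemma Db.bdd (h : Db k f) : ∃ C, ∀ x, |f x| ≤ C := by
  cases k <;> simp only [Db] at h; exacts [h.2, h.2.1]
lemma Db.cont (h : Db k f) : Continuous f := by
  cases k <;> simp only [Db] at h; exacts [h.1, h.1.continuous]
lemma Db.pred : ∀ {f : E → ℝ}, Db (k + 1) f → Db k f := by
  induction k with
  | zero => intro f h; exact ⟨h.1.continuous, h.2.1⟩
  | succ k ih => intro f h; exact ⟨h.1, h.2.1, fun v => ih (h.2.2 v)⟩
lemma Nice.bdd (h : Nice f) : ∃ C, 0 ≤ C ∧ ∀ x, |f x| ≤ C := by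
  obtain ⟨C, hC⟩ := (h 0).bdd
  exact ⟨C, (abs_nonneg _).trans (hC 0), hC⟩
@[fun_prop] lemma Nice.cont {f : E → ℝ} (h : Nice f) : Continuous f := (h 0).cont
@[fun_prop] lemma Nice.diff {f : E → ℝ} (h : Nice f) : Differentiable ℝ f := (h 1).1
lemma Nice.D (h : Nice f) (v : E) : Nice (DD v f) := fun k => (h (k + 1)).2.2 v
lemma Nice.coind (P : (E → ℝ) → Prop) (hP : ∀ f, P f → Differentiable ℝ f ∧ (∃ C, ∀ x, |f x| ≤ C) ∧
    ∀ v, P (DD v f)) (hf : P f) : Nice f := by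
  intro k
  induction k generalizing f with
  | zero => exact ⟨(hP f hf).1.continuous, (hP f hf).2.1⟩
  | succ k ih => exact ⟨(hP f hf).1, (hP f hf).2.1, fun v => ih ((hP f hf).2.2 v)⟩
lemma nice_const (c : ℝ) : Nice (fun _ : E => c) :=
  Nice.coind (fun f => ∃ c, f = fun _ => c) (by
    rintro f ⟨c, rfl⟩
    exact ⟨by fun_prop, ⟨|c|, by simp⟩, fun v => ⟨0, by ext x; simp [DD]⟩⟩) ⟨c, rfl⟩
lemma DD_add (hf : Differentiable ℝ f) (hg : Differentiable ℝ g) (v : E) :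
    DD v (fun x => f x + g x) = fun x => DD v f x + DD v g x := by
  ext x; simp only [DD]; rw [fderiv_fun_add (hf x) (hg x)]; rfl
lemma DD_mul (hf : Differentiable ℝ f) (hg : Differentiable ℝ g) (v : E) :
    DD v (fun x => f x * g x) = fun x => f x * DD v g x + DD v f x * g x := by
  ext x; simp only [DD]; rw [fderiv_fun_mul (hf x) (hg x)]; simp; ring
lemma Db.add : ∀ {f g : E → ℝ}, Db k f → Db k g → Db k (fun x => f x + g x) := by
  have hb : ∀ {f g : E → ℝ}, (∃ C, ∀ x, |f x| ≤ C) → (∃ C, ∀ x, |g x| ≤ C) →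
      ∃ C, ∀ x, |f x + g x| ≤ C := by
    rintro f g ⟨C, hC⟩ ⟨D, hD⟩
    exact ⟨C + D, fun x => (abs_add_le _ _).trans (add_le_add (hC x) (hD x))⟩
  induction k with
  | zero => intro f g hf hg; exact ⟨hf.1.add hg.1, hb hf.2 hg.2⟩
  | succ k ih =>
    intro f g hf hg
    refine ⟨hf.1.add hg.1, hb hf.2.1 hg.2.1, fun v => ?_⟩
    rw [DD_add hf.1 hg.1]; exact ih (hf.2.2 v) (hg.2.2 v)
lemma Db.mul : ∀ {f g : E → ℝ}, Db k f → Db k g → Db k (fun x => f x * g x) := by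
  have hb : ∀ {f g : E → ℝ}, (∃ C, ∀ x, |f x| ≤ C) → (∃ C, ∀ x, |g x| ≤ C) →
      ∃ C, ∀ x, |f x * g x| ≤ C := by
    rintro f g ⟨C, hC⟩ ⟨D, hD⟩
    exact ⟨C * D, fun x => (abs_mul _ _).le.trans
      (mul_le_mul (hC x) (hD x) (abs_nonneg _) ((abs_nonneg _).trans (hC x)))⟩
  induction k with
  | zero => intro f g hf hg; exact ⟨hf.1.mul hg.1, hb hf.2 hg.2⟩
  | succ k ih =>
    intro f g hf hg
    refine ⟨hf.1.mul hg.1, hb hf.2.1 hg.2.1, fun v => ?_⟩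
    rw [DD_mul hf.1 hg.1]
    exact (ih hf.pred (hg.2.2 v)).add (ih (hf.2.2 v) hg.pred)
lemma Nice.add (hf : Nice f) (hg : Nice g) : Nice (fun x => f x + g x) :=
  fun k => (hf k).add (hg k)
lemma Nice.mul (hf : Nice f) (hg : Nice g) : Nice (fun x => f x * g x) :=
  fun k => (hf k).mul (hg k)
lemma Nice.sub (hf : Nice f) (hg : Nice g) : Nice (fun x => f x - g x) := by
  simpa [sub_eq_add_neg] using hf.add ((nice_const (-1)).mul hg)
lemma Nice.sum {ι : Type*} (s : Finset ι) {f : ι → E → ℝ} (hf : ∀ i, Nice (f i)) :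
    Nice (fun x => ∑ i ∈ s, f i x) := by
  classical
  induction s using induction_on with
  | empty => simpa using nice_const 0
  | insert a s ha ih => simp only [sum_insert ha]; exact (hf a).add ih
lemma Nice.meas (h : Nice f) : Measurable f := h.cont.measurable
lemma Nice.integrable (h : Nice f) (ρ : Measure E) [IsFiniteMeasure ρ] : Integrable f ρ := by
  obtain ⟨C, -, hC⟩ := h.bdd
  exact .of_bound h.meas.aestronglyMeasurable C (ae_of_all _ hC)

variable (E) in
abbrev ob := stdOrthonormalBasis ℝ E
lemma norm_le_ob (L : E →L[ℝ] ℝ) : ‖L‖ ≤ ∑ i, |L (ob E i)| := by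
  refine L.opNorm_le_bound psv fun x => ?_
  conv_lhs => rw [← (ob E).sum_repr' x, map_sum]
  rw [sum_mul]
  refine (norm_sum_le _ _).trans (sum_le_sum fun i _ => ?_)
  rw [map_smul, smul_eq_mul, norm_mul, mul_comm, norm_eq_abs, norm_eq_abs]
  gcongr
  exact (abs_real_inner_le_norm _ _).trans smp
lemma fd_eq (L : E →L[ℝ] ℝ) (v : E) : L v = ∑ i, ⟪v, ob E i⟫ * L (ob E i) := by
  conv_lhs => rw [← (ob E).sum_repr' v, map_sum]
  simp [real_inner_comm]
lemma Nice.lip (h : Nice f) : ∃ C, 0 ≤ C ∧ ∀ x, ‖fderiv ℝ f x‖ ≤ C := by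
  choose C hC0 hC using fun i => (h.D (ob E i)).bdd
  exact ⟨∑ i, C i, sum_nonneg fun i _ => hC0 i,
    fun x => (norm_le_ob _).trans (sum_le_sum fun i _ => hC i x)⟩
lemma Nice.lip' (h : Nice f) :
    ∃ C, 0 ≤ C ∧ ∀ x y, ‖fderiv ℝ f x - fderiv ℝ f y‖ ≤ C * ‖x - y‖ := by
  choose C hC0 hC using fun i => (h.D (ob E i)).lip
  refine ⟨∑ i, C i, sum_nonneg fun i _ => hC0 i,
    fun x y => (norm_le_ob _).trans ?_⟩
  rw [sum_mul]
  exact sum_le_sum fun i _ => Convex.norm_image_sub_le_of_norm_fderiv_le (𝕜 := ℝ)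
    (fun z _ => (h.D _).diff z) (fun z _ => hC i z) convex_univ (mem_univ y) (mem_univ x)
lemma Nice.taylor (h : Nice f) :
    ∃ C, 0 ≤ C ∧ ∀ x y, |f y - f x - fderiv ℝ f x (y - x)| ≤ C * ‖y - x‖ ^ 2 := by
  obtain ⟨C, hC0, hC⟩ := h.lip'
  refine ⟨C, hC0, fun x y => ?_⟩
  have := Convex.norm_image_sub_le_of_norm_fderiv_le' (𝕜 := ℝ) (f := f) (φ := fderiv ℝ f x)
    (s := closedBall x ‖y - x‖) (C := C * ‖y - x‖) (fun z _ => h.diff z) (fun z hz => (hC z x).trans (by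
      gcongr; simpa [dist_eq_norm] using hz)) (convex_closedBall _ _)
    (Metric.mem_closedBall_self (norm_nonneg _)) (show y ∈ _ by simp [dist_eq_norm])
  rw [norm_eq_abs] at this
  linarith
lemma Nice.sin (v : E) (a : ℝ) : Nice (fun x : E => Real.sin (⟪x, v⟫ + a)) := by
  refine Nice.coind (fun f => ∃ c a : ℝ, f = fun x => c * Real.sin (⟪x, v⟫ + a)) ?_ ⟨1, a, by simp⟩
  rintro f ⟨c, a, rfl⟩
  have hd : ∀ x, HasFDerivAt (fun x : E => c * Real.sin (⟪x, v⟫ + a))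
    (c • cos (⟪x, v⟫ + a) • (innerSL ℝ).flip v) x := fun x =>
      ((((innerSL ℝ).flip v).hasFDerivAt.add_const a).sin).const_mul c
  refine ⟨fun x => (hd x).differentiableAt, ⟨|c|, fun x => ?_⟩, fun w => ⟨c * ⟪w, v⟫, a + Real.pi / 2, ?_⟩⟩
  · rw [abs_mul]; exact mul_le_of_le_one_right (abs_nonneg _) (abs_sin_le_one _)
  · ext x
    simp only [DD, (hd x).fderiv, ← add_assoc, Real.sin_add_pi_div_two]
    show c * (cos (⟪x, v⟫ + a) * ⟪w, v⟫) = _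
    ring

section RG
variable {α : Type*} [MeasurableSpace α] {ρ : Measure α} [IsFiniteMeasure ρ]
def RG (ρ : Measure α) (a c : α → ℝ) (ξ : α → E) (g : E → ℝ) : E → ℝ :=
  fun x => ∫ p, a p * g (c p • x + ξ p) ∂ρ
variable {a c : α → ℝ} {ξ : α → E}
lemma RG_D (ha : Measurable a) (hc : Measurable c) (hξ : Measurable ξ) (ha1 : ∀ᵐ p ∂ρ, |a p| ≤ 1)
    (hc1 : ∀ᵐ p ∂ρ, |c p| ≤ 1) (hg : Nice g) :
    Differentiable ℝ (RG ρ a c ξ g) ∧ ∀ v, DD v (RG ρ a c ξ g) = RG ρ (fun p => a p * c p) c ξ (DD v g) := by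
  obtain ⟨C, hC0, hC⟩ := hg.lip
  obtain ⟨B, hB0, hB⟩ := hg.bdd
  have hgm := hg.meas
  have hfm : Measurable (fderiv ℝ g) := measurable_fderiv ℝ g
  have key : ∀ x, HasFDerivAt (RG ρ a c ξ g) (∫ p, (a p * c p) • fderiv ℝ g (c p • x + ξ p) ∂ρ) x := by
    intro x
    refine hasFDerivAt_integral_of_dominated_of_fderiv_le (s := univ)
      (F := fun x p => a p * g (c p • x + ξ p))
      (F' := fun x p => (a p * c p) • fderiv ℝ g (c p • x + ξ p))
      (bound := fun _ => C) univ_mem (Eventually.of_forall fun y => by fun_prop) ?_ ?_ ?_ (integrable_const _) ?_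
    · refine .of_bound (C := B) fpp ?_
      filter_upwards [ha1] with p hp
      rw [norm_mul]; exact (mul_le_mul hp (hB _) (abs_nonneg _) zero_le_one).trans smp
    · exact AEStronglyMeasurable.smul (f := fun p => a p * c p) fpp
        (hfm.comp (by fun_prop : Measurable fun p => c p • x + ξ p)).aestronglyMeasurable
    · filter_upwards [ha1, hc1] with p hp hq y _
      rw [norm_smul, norm_mul]
      refine (mul_le_mul (mul_le_mul hp hq (abs_nonneg _) zero_le_one) (hC _) (norm_nonneg _) smp).trans
        smp
    · refine ae_of_all _ fun p y _ => ?_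
      have h1 : HasFDerivAt (fun y : E => c p • y + ξ p) (c p • ContinuousLinearMap.id ℝ E) y :=
        ((hasFDerivAt_id y).const_smul (c p)).add_const _
      refine (((hg.diff _).hasFDerivAt.comp y h1).const_mul (a p)).congr_fderiv ?_
      ext v; simp; ring
  refine ⟨fun x => (key x).differentiableAt, fun v => ?_⟩
  ext x
  simp only [DD, (key x).fderiv]
  rw [ContinuousLinearMap.integral_apply]
  · simp [RG, DD]
  · refine .of_bound (C := C) (AEStronglyMeasurable.smul (f := fun p => a p * c p) fpp
        (hfm.comp (by fun_prop : Measurable fun p => c p • x + ξ p)).aestronglyMeasurable) ?_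
    filter_upwards [ha1, hc1] with p hp hq
    rw [norm_smul, norm_mul]
    refine (mul_le_mul (mul_le_mul hp hq (abs_nonneg _) zero_le_one) (hC _) (norm_nonneg _) smp).trans
        smp
lemma RG_nice (ha : Measurable a) (hc : Measurable c) (hξ : Measurable ξ) (ha1 : ∀ᵐ p ∂ρ, |a p| ≤ 1)
    (hc1 : ∀ᵐ p ∂ρ, |c p| ≤ 1) (hg : Nice g) : Nice (RG ρ a c ξ g) := by
  refine Nice.coind (fun f => ∃ (a : α → ℝ) (g : E → ℝ), Measurable a ∧ (∀ᵐ p ∂ρ, |a p| ≤ 1) ∧ Nice g ∧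
    f = RG ρ a c ξ g) ?_ ⟨a, g, ha, ha1, hg, rfl⟩
  rintro f ⟨a, g, ha, ha1, hg, rfl⟩
  obtain ⟨h1, h2⟩ := RG_D ha hc hξ ha1 hc1 hg
  obtain ⟨B, hB0, hB⟩ := hg.bdd
  refine ⟨h1, ⟨B * ρ.real univ, fun x => ?_⟩, fun v => ⟨_, DD v g, ha.mul hc, ?_, hg.D v, h2 v⟩⟩
  · rw [← norm_eq_abs]; refine norm_integral_le_of_norm_le_const (μ := ρ) ?_
    filter_upwards [ha1] with p hp
    rw [norm_mul]; exact (mul_le_mul hp (hB _) (abs_nonneg _) zero_le_one).trans smp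
  · filter_upwards [ha1, hc1] with p hp hq
    simp only [Pi.mul_apply, abs_mul]; exact mul_le_one₀ hp (abs_nonneg _) hq
end RG
end g1

section g2

lemma nice_ibp {h : E → ℝ} (hh : Nice h) (x v : E) (s : ℝ) :
    ∫ y, ⟪y, v⟫ * h (x + s • y) ∂(gam E) = s * ∫ y, DD v h (x + s • y) ∂(gam E) := by
  obtain ⟨B, hB0, hB⟩ := hh.bdd
  obtain ⟨B', hB0', hB'⟩ := (hh.D v).bdd
  have hd : ∀ y, HasFDerivAt (fun y => h (x + s • y)) (s • fderiv ℝ h (x + s • y)) y := fun y => by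
    have h1 : HasFDerivAt (fun y : E => x + s • y) (s • ContinuousLinearMap.id ℝ E) y :=
        ((hasFDerivAt_id y).const_smul s).const_add _
    refine ((hh.diff _).hasFDerivAt.comp y h1).congr_fderiv ?_
    ext v; simp
  have hD : ∀ y, fderiv ℝ (fun y => h (x + s • y)) y v = s * DD v h (x + s • y) := fun y => by
    rw [(hd y).fderiv]; rfl
  rw [gam_ibp (F := fun y => h (x + s • y)) (fun y => (hd y).differentiableAt) v (B + |s| * B') 0]
  · simp only [hD, integral_const_mul]
  · intro y; simp only [zero_mul, exp_zero, mul_one]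
    have := hB (x + s • y); have : 0 ≤ |s| * B' := by positivity
    linarith
  · intro y; simp only [zero_mul, exp_zero, mul_one, hD, abs_mul]
    have := mul_le_mul_of_nonneg_left (hB' (x + s • y)) (abs_nonneg s)
    linarith

lemma int_norm_gam : Integrable (fun x : E => ‖x‖) (gam E) :=
  gam_growth fpp 1 1 fun x => by simpa using norm_le_exp ‖x‖

def psi (g : E → ℝ) (x : E) (θ : ℝ) : ℝ := ∫ y, g (cos θ • x + sin θ • y) ∂(gam E)
lemma psi_cont (hg : Nice g) (x : E) : Continuous (psi g x) := by
  obtain ⟨B, hB0, hB⟩ := hg.bdd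
  have := hg.cont
  exact continuous_of_dominated (bound := fun _ => B) (fun θ => by fun_prop)
    (fun θ => ae_of_all _ fun y => hB _) (integrable_const _) (ae_of_all _ fun y => by fun_prop)
lemma psi_deriv (hg : Nice g) (x : E) (θ : ℝ) :
    HasDerivAt (psi g x) (-sin θ * (∑ i, ⟪x, ob E i⟫ * psi (DD (ob E i) g) x θ) +
      cos θ * sin θ * ∑ i, psi (DD (ob E i) (DD (ob E i) g)) x θ) θ := by
  obtain ⟨C, hC0, hC⟩ := hg.lip
  obtain ⟨B, hB0, hB⟩ := hg.bdd
  have hgc := hg.cont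
  have hi : ∀ i, Integrable (fun y => DD (ob E i) g (cos θ • x + sin θ • y)) (gam E) := fun i => by
    obtain ⟨B, hB0, hB⟩ := (hg.D (ob E i)).bdd
    have := (hg.D (ob E i)).meas
    exact .of_bound (this.comp fpp).aestronglyMeasurable B (ae_of_all _ fun y => hB _)
  have hi2 : ∀ i, Integrable (fun y => ⟪y, ob E i⟫ * DD (ob E i) g (cos θ • x + sin θ • y)) (gam E) := fun i => by
    obtain ⟨B, hB0, hB⟩ := (hg.D (ob E i)).bdd
    have := (hg.D (ob E i)).meas
    exact (gam_int_inner (ob E i)).mul_bdd (this.comp fpp).aestronglyMeasurable (ae_of_all _ fun y => hB _)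
  have key := (hasDerivAt_integral_of_dominated_loc_of_deriv_le (μ := gam E) (s := univ) (x₀ := θ)
    (F := fun θ y => g (cos θ • x + sin θ • y))
    (F' := fun θ y => fderiv ℝ g (cos θ • x + sin θ • y) (-sin θ • x + cos θ • y))
    (bound := fun y => C * (‖x‖ + ‖y‖)) univ_mem (Eventually.of_forall fun y => by fun_prop)
    (.of_bound fpp B (ae_of_all _ fun y => hB _)) ?_ (ae_of_all _ fun y θ _ => ?_)
    (((integrable_const _).add int_norm_gam).const_mul _) (ae_of_all _ fun y θ _ => ?_)).2
  · refine key.congr_deriv ?_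
    have e : ∀ y, fderiv ℝ g (cos θ • x + sin θ • y) (-sin θ • x + cos θ • y) =
      (∑ i, (-sin θ * ⟪x, ob E i⟫) * DD (ob E i) g (cos θ • x + sin θ • y)) +
      ∑ i, cos θ * (⟪y, ob E i⟫ * DD (ob E i) g (cos θ • x + sin θ • y)) := fun y => by
      rw [fd_eq, ← sum_add_distrib]
      refine sum_congr rfl fun i _ => ?_
      rw [inner_add_left, inner_smul_left, inner_smul_left, DD]
      simp; ring
    simp only [e]
    rw [integral_add (integrable_finsetSum _ fun i _ => (hi i).const_mul _)
      (integrable_finsetSum _ fun i _ => (hi2 i).const_mul _), integral_finsetSum _ (fun i _ => (hi i).const_mul _),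
      integral_finsetSum _ (fun i _ => (hi2 i).const_mul _)]
    simp only [integral_const_mul, nice_ibp (hg.D _), mul_sum, psi]
    congr 1 <;> exact sum_congr rfl fun i _ => by ring
  · have hfm : Measurable (fderiv ℝ g) := measurable_fderiv ℝ g
    have : Measurable (fun p : (E →L[ℝ] ℝ) × E => p.1 p.2) :=
      (isBoundedBilinearMap_apply (𝕜 := ℝ) (E := E) (F := ℝ)).continuous.measurable
    exact (this.comp (Measurable.prodMk (hfm.comp (by fun_prop : Measurable fun y => cos θ • x + sin θ • y))
      (by fun_prop : Measurable fun y => -sin θ • x + cos θ • y))).aestronglyMeasurable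
  · refine (ContinuousLinearMap.le_opNorm _ _).trans (mul_le_mul (hC _) ?_ (norm_nonneg _) hC0)
    refine (norm_add_le _ _).trans ?_
    rw [norm_smul, norm_smul, norm_neg]
    exact add_le_add (mul_le_of_le_one_left (norm_nonneg _) (abs_sin_le_one _))
      (mul_le_of_le_one_left (norm_nonneg _) (abs_cos_le_one _))
  · exact (hg.diff _).hasFDerivAt.comp_hasDerivAt θ
      (((hasDerivAt_cos θ).smul_const x).add ((Real.hasDerivAt_sin θ).smul_const y))

variable (E) in
abbrev rm : Measure (ℝ × E) := (volume.restrict (Ioc 0 (Real.pi / 2))).prod (gam E)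
def RR (k : ℕ) (g : E → ℝ) : E → ℝ := RG (rm E) (fun p => cos p.1 ^ k * sin p.1)
  (fun p => cos p.1) (fun p => sin p.1 • p.2) g
lemma RR_w (k : ℕ) : ∀ᵐ p ∂(rm E), |cos p.1 ^ k * sin p.1| ≤ 1 := ae_of_all _ fun p => by
  rw [abs_mul, abs_pow]
  exact mul_le_one₀ (pow_le_one₀ (abs_nonneg _) (abs_cos_le_one _)) (abs_nonneg _) (abs_sin_le_one _)
lemma RR_nice (k : ℕ) (hg : Nice g) : Nice (RR k g) :=
  RG_nice fpp fpp fpp (RR_w k) (ae_of_all _ fun p => abs_cos_le_one _) hg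
lemma RR_D (k : ℕ) (hg : Nice g) (v : E) : DD v (RR k g) = RR (k + 1) (DD v g) := by
  rw [RR, (RG_D fpp fpp fpp (RR_w k)
    (ae_of_all _ fun p => abs_cos_le_one _) hg).2 v, RR]
  congr 1; ext p; ring
lemma RR_eq (k : ℕ) (hg : Nice g) (x : E) :
    RR k g x = ∫ θ in (0)..(Real.pi / 2), cos θ ^ k * sin θ * psi g x θ := by
  obtain ⟨B, hB0, hB⟩ := hg.bdd
  have := hg.cont
  rw [RR, RG, integral_prod, intervalIntegral.integral_of_le psv]
  · simp only [integral_const_mul]; rfl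
  · refine .of_bound fpp B ?_
    filter_upwards [RR_w k] with p hp
    rw [norm_mul]; exact (mul_le_mul hp (hB _) (abs_nonneg _) zero_le_one).trans smp

lemma RR_id (k : ℕ) (hg : Nice g) (x : E) :
    (k + 1) * RR k g x + ∑ i, ⟪x, ob E i⟫ * DD (ob E i) (RR k g) x -
      ∑ i, DD (ob E i) (DD (ob E i) (RR k g)) x = g x := by
  have hc := fun {g : E → ℝ} (hg : Nice g) => psi_cont hg x
  have h0 := hc hg
  have h1 := fun i => hc (hg.D (ob E i))
  have h2 := fun i => hc ((hg.D (ob E i)).D (ob E i))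
  have key := intervalIntegral.integral_eq_sub_of_hasDerivAt (a := 0) (b := Real.pi / 2)
    (f := fun θ => - (cos θ ^ (k + 1) * psi g x θ))
    (f' := fun θ => (k + 1) * (cos θ ^ k * sin θ * psi g x θ) +
      (∑ i, ⟪x, ob E i⟫ * (cos θ ^ (k + 1) * sin θ * psi (DD (ob E i) g) x θ)) -
      ∑ i, cos θ ^ (k + 2) * sin θ * psi (DD (ob E i) (DD (ob E i) g)) x θ)
    (fun θ _ => by
      refine ((((hasDerivAt_cos θ).pow (k + 1)).mul (psi_deriv hg x θ)).neg).congr_deriv ?_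
      have e1 : (∑ i, ⟪x, ob E i⟫ * (cos θ ^ (k + 1) * sin θ * psi (DD (ob E i) g) x θ)) =
        cos θ ^ (k + 1) * sin θ * ∑ i, ⟪x, ob E i⟫ * psi (DD (ob E i) g) x θ := by
        rw [mul_sum]; exact sum_congr rfl fun i _ => by ring
      rw [e1, ← mul_sum]
      simp; ring) (Continuous.intervalIntegrable fpp _ _)
  simp only [Real.cos_pi_div_two, Real.cos_zero, psi, Real.sin_zero] at key
  simp only [← psi.eq_1] at key
  rw [intervalIntegral.integral_sub (Continuous.intervalIntegrable fpp _ _)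
    (Continuous.intervalIntegrable fpp _ _), intervalIntegral.integral_add (Continuous.intervalIntegrable fpp _ _)
    (Continuous.intervalIntegrable fpp _ _),
    intervalIntegral.integral_finsetSum (fun i _ => Continuous.intervalIntegrable fpp _ _),
    intervalIntegral.integral_finsetSum (fun i _ => Continuous.intervalIntegrable fpp _ _)] at key
  simp only [intervalIntegral.integral_const_mul] at key
  simp only [RR_D k hg, RR_D (k + 1) (hg.D _), RR_eq k hg, RR_eq (k + 1) (hg.D _), RR_eq _ ((hg.D _).D _)]
  rw [key]; simp

lemma RR_grad (k : ℕ) (hg : Nice g) {B : ℝ} (hB : ∀ x, |g x| ≤ B) (i) (x : E) :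
    |DD (ob E i) (RR k g) x| ≤ B * ∫ θ in (0)..(Real.pi / 2), cos θ ^ (k + 1) := by
  have hB0 : 0 ≤ B := (abs_nonneg _).trans (hB 0)
  rw [RR_D k hg, RR_eq _ (hg.D _), mul_comm, ← intervalIntegral.integral_mul_const, ← norm_eq_abs]
  refine intervalIntegral.norm_integral_le_of_norm_le psv (ae_of_all _ fun θ hθ => ?_)
    (Continuous.intervalIntegrable fpp _ _)
  have hcos : 0 ≤ cos θ := cos_nonneg_of_mem_Icc ⟨by linarith [hθ.1, pi_pos], hθ.2⟩
  rw [mul_assoc, psi, ← nice_ibp hg, norm_mul, norm_of_nonneg psv]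
  refine mul_le_mul_of_nonneg_left ?_ psv
  have hi : Integrable (fun y => ⟪y, ob E i⟫ * ⟪y, ob E i⟫) (gam E) := by
    by_contra h
    have := gam_inner2 (ob E i) (ob E i)
    rw [integral_undef h] at this; simp at this
  calc _ ≤ ∫ y, B * ((1 + ⟪y, ob E i⟫ * ⟪y, ob E i⟫) / 2) ∂(gam E) := by
        refine norm_integral_le_of_norm_le ((((integrable_const 1).add hi).div_const 2).const_mul B)
          (ae_of_all _ fun y => ?_)
        rw [norm_mul, mul_comm]
        refine mul_le_mul (hB _) ?_ (norm_nonneg _) hB0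
        rw [norm_eq_abs]
        have := sq_abs ⟪y, ob E i⟫
        nlinarith [sq_nonneg (|⟪y, ob E i⟫| - 1)]
    _ = B := by
        rw [integral_const_mul, integral_div, integral_add (integrable_const 1) hi, gam_inner2]
        simp
lemma cos_int_small (hδ : 0 < δ) : ∃ k : ℕ, ∫ θ in (0)..(Real.pi / 2), cos θ ^ (k + 1) < δ := by
  have : Tendsto (fun k : ℕ => ∫ θ in (0)..(Real.pi / 2), cos θ ^ (k + 1)) atTop
      (nhds (∫ θ in (0)..(Real.pi / 2), (0 : ℝ))) := by
    refine intervalIntegral.tendsto_integral_filter_of_dominated_convergence (fun _ => 1)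
      (Eventually.of_forall fun k => by fun_prop) (Eventually.of_forall fun k => ae_of_all _ fun θ _ => ?_)
      (Continuous.intervalIntegrable fpp _ _) (ae_of_all _ fun θ hθ => ?_)
    · rw [norm_pow]; exact pow_le_one₀ (norm_nonneg _) (abs_cos_le_one _)
    · rw [uIoc_of_le psv] at hθ
      refine (tendsto_pow_atTop_nhds_zero_of_lt_one
        (cos_nonneg_of_mem_Icc ⟨by linarith [hθ.1, pi_pos], hθ.2⟩) ?_).comp (Filter.tendsto_add_atTop_nat 1)
      have := Real.cos_lt_cos_of_nonneg_of_le_pi_div_two le_rfl hθ.2 hθ.1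
      simpa using this
  simp only [intervalIntegral.integral_zero] at this
  exact (this.eventually_lt_const hδ).exists
end g2

section g3

lemma Nice.symm2 (hu : Nice u) (v w : E) : DD v (DD w u) = DD w (DD v u) := by
  have hd : Differentiable ℝ (fderiv ℝ u) := by
    have e : fderiv ℝ u = fun x => ∑ i, DD (ob E i) u x • innerSL ℝ (ob E i) := by
      ext x v
      rw [fd_eq]; simp [DD, real_inner_comm, mul_comm]
    rw [e]
    exact Differentiable.fun_sum fun i _ => (hu.D _).diff.smul_const _
  ext x
  have hs := second_derivative_symmetric (𝕜 := ℝ) (fun y => (hu.diff y).hasFDerivAt) (hd x).hasFDerivAt v w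
  have key : ∀ a b : E, DD a (DD b u) x = fderiv ℝ (fderiv ℝ u) x a b := fun a b => by
    have := ((ContinuousLinearMap.apply ℝ ℝ b).hasFDerivAt.comp x (hd x).hasFDerivAt)
    change fderiv ℝ (fun y => fderiv ℝ u y b) x a = _
    rw [show (fun y => fderiv ℝ u y b) = (ContinuousLinearMap.apply ℝ ℝ b) ∘ fderiv ℝ u from rfl, this.fderiv]
    rfl
  rw [key, key, hs]

def Lg (F : E → ℝ) : Prop := Continuous F ∧ ∃ C, 0 ≤ C ∧ ∀ x, |F x| ≤ C * (1 + ‖x‖)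
lemma Nice.lg (h : Nice f) : Lg f := by
  obtain ⟨C, h0, hC⟩ := h.bdd
  refine ⟨h.cont, C, h0, fun x => (hC x).trans ?_⟩
  nlinarith [mul_nonneg h0 (norm_nonneg x)]
lemma Lg.add (hf : Lg f) (hg : Lg g) : Lg (fun x => f x + g x) := by
  obtain ⟨h1, C, h0, hC⟩ := hf
  obtain ⟨h2, D, h0', hD⟩ := hg
  exact ⟨h1.add h2, C + D, add_nonneg h0 h0', fun x => (abs_add_le _ _).trans (by linarith [hC x, hD x])⟩
lemma Lg.mulN (hf : Lg f) (hg : Nice g) : Lg (fun x => f x * g x) := by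
  obtain ⟨h1, C, h0, hC⟩ := hf
  obtain ⟨D, h0', hD⟩ := hg.bdd
  refine ⟨h1.mul hg.cont, C * D, mul_nonneg h0 h0', fun x => ?_⟩
  rw [abs_mul]
  calc _ ≤ (C * (1 + ‖x‖)) * D := mul_le_mul (hC x) (hD x) (abs_nonneg _) psv
    _ = _ := by ring
lemma Lg.sub (hf : Lg f) (hg : Lg g) : Lg (fun x => f x - g x) := by
  simpa [sub_eq_add_neg] using hf.add (hg.mulN (nice_const (-1)))
lemma Lg.sum {ι : Type*} (s : Finset ι) {f : ι → E → ℝ} (hf : ∀ i, Lg (f i)) :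
    Lg (fun x => ∑ i ∈ s, f i x) := by
  classical
  induction s using induction_on with
  | empty => simpa using (nice_const (0:ℝ)).lg
  | insert a s ha ih => simp only [sum_insert ha]; exact (hf a).add ih
lemma Lg_inner (v : E) : Lg (fun x => ⟪x, v⟫) := by
  refine ⟨by fun_prop, ‖v‖, norm_nonneg _, fun x => (abs_real_inner_le_norm x v).trans ?_⟩
  nlinarith [norm_nonneg v]
lemma Lg.int [IsProbabilityMeasure ν] (h2 : Integrable (fun x => ‖x‖ ^ 2) ν)
    (hf : Lg f) (hg : Lg g) : Integrable (fun x => f x * g x) ν := by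
  obtain ⟨h1, C, h0, hC⟩ := hf
  obtain ⟨h3, D, h0', hD⟩ := hg
  refine (((integrable_const (1:ℝ)).add h2).const_mul (2 * C * D)).mono' fpp (ae_of_all _ fun x => ?_)
  rw [norm_mul]
  calc _ ≤ (C * (1 + ‖x‖)) * (D * (1 + ‖x‖)) := mul_le_mul (hC x) (hD x) (abs_nonneg _) psv
    _ = (C * D) * (1 + ‖x‖) ^ 2 := by ring
    _ ≤ (C * D) * (2 * (1 + ‖x‖ ^ 2)) := by
        refine mul_le_mul_of_nonneg_left ?_ psv
        nlinarith [sq_nonneg (1 - ‖x‖)]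
    _ = _ := by simp; ring
lemma Lg.int1 [IsProbabilityMeasure ν] (h2 : Integrable (fun x => ‖x‖ ^ 2) ν)
    (hf : Lg f) : Integrable f ν := by
  simpa using hf.int h2 (nice_const 1).lg

abbrev Ix (E : Type*) [NormedAddCommGroup E] [InnerProductSpace ℝ E] [FiniteDimensional ℝ E] :=
  Fin (finrank ℝ E)
def gr (u : E → ℝ) (x : E) : ℝ := ∑ i, DD (ob E i) u x ^ 2
structure LD (ν : Measure E) (η : Ix E → E → ℝ) (t : ℝ) : Prop where
  pr : IsProbabilityMeasure ν
  nice : ∀ i, Nice (η i)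
  m2 : Integrable (fun x => ‖x‖ ^ 2) ν
  t0 : 0 < t
  ibp : ∀ i (F : E → ℝ), Differentiable ℝ F → Lg F → Lg (DD (ob E i) F) →
    ∫ x, (⟪x, ob E i⟫ - η i x) * F x ∂ν = ∫ x, DD (ob E i) F x ∂ν
  hess : ∀ x (a : Ix E → ℝ), ∑ i, ∑ j, DD (ob E i) (η j) x * (a i * a j) ≤ (1 - t) * ∑ i, a i ^ 2
  poin : ∀ f, Nice f → t * ∫ x, (f x - ∫ y, f y ∂ν) ^ 2 ∂ν ≤ ∫ x, gr f x ∂ν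

lemma Nice.gr (hu : Nice u) : Nice (gr u) := by
  unfold _root_.gr; simp only [sq]
  exact Nice.sum _ fun i => (hu.D _).mul (hu.D _)

def NN (η : Ix E → E → ℝ) (u : E → ℝ) (x : E) : ℝ :=
  ∑ i, ((⟪x, ob E i⟫ - η i x) * DD (ob E i) u x - DD (ob E i) (DD (ob E i) u) x)

variable {η : Ix E → E → ℝ}
lemma NN_lg (H : LD ν η t) (hu : Nice u) : Lg (NN η u) :=
  Lg.sum _ fun i => (((Lg_inner _).sub (H.nice i).lg).mulN (hu.D _)).sub ((hu.D _).D _).lg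

lemma diff_inner (v : E) : Differentiable ℝ (fun x : E => ⟪x, v⟫) :=
  fun x => ((innerSL ℝ).flip v).differentiableAt
lemma DD_inner (v w : E) : DD w (fun x : E => ⟪x, v⟫) = fun _ => ⟪w, v⟫ := by
  ext x
  have : HasFDerivAt (fun x : E => ⟪x, v⟫) ((innerSL ℝ).flip v) x := ((innerSL ℝ).flip v).hasFDerivAt
  rw [DD, this.fderiv]; rfl
lemma DD_sub (hf : Differentiable ℝ f) (hg : Differentiable ℝ g) (v : E) :
    DD v (fun x => f x - g x) = fun x => DD v f x - DD v g x := by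
  ext x; simp only [DD]; rw [fderiv_fun_sub (hf x) (hg x)]; rfl
lemma DD_sum {ι : Type*} (s : Finset ι) {f : ι → E → ℝ} (hf : ∀ i, Differentiable ℝ (f i)) (v : E) :
    DD v (fun x => ∑ i ∈ s, f i x) = fun x => ∑ i ∈ s, DD v (f i) x := by
  ext x; simp only [DD]; rw [fderiv_fun_sum fun i _ => hf i x]; simp

lemma NN_diff (H : LD ν η t) (hu : Nice u) : Differentiable ℝ (NN η u) := by
  refine Differentiable.fun_sum fun i _ => ?_
  exact (((diff_inner _).sub (H.nice i).diff).mul (hu.D _).diff).sub ((hu.D _).D _).diff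
lemma DD_NN (H : LD ν η t) (hu : Nice u) (j) (x : E) :
    DD (ob E j) (NN η u) x = NN η (DD (ob E j) u) x + DD (ob E j) u x
      - ∑ i, DD (ob E j) (η i) x * DD (ob E i) u x := by
  have hd : ∀ i, Differentiable ℝ (fun x : E => ⟪x, ob E i⟫ - η i x) := fun i => (diff_inner (ob E i)).sub (H.nice i).diff
  have h1 := fun i => (hu.D (ob E i)).diff
  have h2 := fun i => ((hu.D (ob E i)).D (ob E i)).diff
  have h3 : ∀ i, Differentiable ℝ (fun x : E => (⟪x, ob E i⟫ - η i x) * DD (ob E i) u x) := fun i => (hd i).mul (h1 i)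
  unfold NN
  rw [DD_sum Finset.univ (fun i => (h3 i).fun_sub (h2 i))]
  have e : ∀ i, DD (ob E j) (fun x => (⟪x, ob E i⟫ - η i x) * DD (ob E i) u x - DD (ob E i) (DD (ob E i) u) x) x =
     ((⟪x, ob E i⟫ - η i x) * DD (ob E i) (DD (ob E j) u) x - DD (ob E i) (DD (ob E i) (DD (ob E j) u)) x)
     + ⟪ob E j, ob E i⟫ * DD (ob E i) u x - DD (ob E j) (η i) x * DD (ob E i) u x := fun i => by
    rw [DD_sub (h3 i) (h2 i), DD_mul (hd i) (h1 i), DD_sub (diff_inner _) (H.nice i).diff, DD_inner]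
    simp only []
    rw [(hu.D (ob E i)).symm2 (ob E j), hu.symm2 (ob E j) (ob E i)]; ring
  simp only [e]
  rw [sum_sub_distrib, sum_add_distrib]
  congr 2
  simp [orthonormal_iff_ite.1 (ob E).orthonormal]

lemma ibp2 (H : LD ν η t) {W : E → ℝ} (hu : Nice u) (hW : Differentiable ℝ W) (hl : Lg W)
    (hD : ∀ i, Lg (DD (ob E i) W)) :
    ∫ x, NN η u x * W x ∂ν = ∑ i, ∫ x, DD (ob E i) u x * DD (ob E i) W x ∂ν := by
  have := H.pr
  simp only [NN, sum_mul]
  have i1 := fun i => ((((Lg_inner (ob E i)).sub (H.nice i).lg).mulN (hu.D (ob E i))).int H.m2 hl)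
  have i2 := fun i => ((hu.D (ob E i)).D (ob E i)).lg.int H.m2 hl
  have i3 := fun i => (hu.D (ob E i)).lg.int H.m2 (hD i)
  rw [integral_finsetSum _ fun i _ => by simp only [sub_mul _ _ (W _)]; exact (i1 i).sub (i2 i)]
  refine sum_congr rfl fun i _ => ?_
  simp only [sub_mul _ _ (W _)]
  rw [integral_sub (i1 i) (i2 i)]
  have hh : DD (ob E i) (fun x => DD (ob E i) u x * W x) = _ := DD_mul (hu.D (ob E i)).diff hW _
  have := H.ibp i (fun x => DD (ob E i) u x * W x) ((hu.D _).diff.mul hW)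
    (by simpa [mul_comm] using hl.mulN (hu.D (ob E i)))
    (by rw [hh]
        exact Lg.add (by simpa [mul_comm] using (hD i).mulN (hu.D (ob E i)))
          (by simpa [mul_comm] using hl.mulN ((hu.D (ob E i)).D (ob E i))))
  rw [hh, integral_add (i3 i) (i2 i)] at this
  simp only [mul_assoc] at this ⊢
  rw [this]; ring

lemma bochner (H : LD ν η t) (hu : Nice u) :
    ∑ i, ∫ x, gr (DD (ob E i) u) x ∂ν + t * ∫ x, gr u x ∂ν ≤ ∫ x, NN η u x ^ 2 ∂ν := by
  have := H.pr
  have hn : ∀ i j, Nice (fun x => DD (ob E i) (η j) x * DD (ob E j) u x) := fun i j => ((H.nice j).D _).mul (hu.D _)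
  have hn' := fun i => Nice.sum Finset.univ (hn i)
  have hnn := fun i => NN_lg H (hu.D (ob E i))
  have hD : ∀ i, DD (ob E i) (NN η u) = fun x => NN η (DD (ob E i) u) x + DD (ob E i) u x
      - ∑ j, DD (ob E i) (η j) x * DD (ob E j) u x := fun i => funext (DD_NN H hu i)
  have e1 : ∫ x, NN η u x ^ 2 ∂ν = ∑ i, ∫ x, DD (ob E i) u x * DD (ob E i) (NN η u) x ∂ν := by
    simp only [sq]
    exact ibp2 H hu (NN_diff H hu) (NN_lg H hu) fun i => by
      rw [hD]; exact ((hnn i).add (hu.D _).lg).sub (hn' i).lg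
  have i1 := fun i => (hnn i).int H.m2 (hu.D (ob E i)).lg
  have i2 := fun i => ((hu.D (ob E i)).mul (hu.D (ob E i))).integrable ν
  have i3 := fun i => ((hu.D (ob E i)).mul (hn' i)).integrable ν
  have e2 : ∀ i, ∫ x, DD (ob E i) u x * DD (ob E i) (NN η u) x ∂ν = ∫ x, gr (DD (ob E i) u) x ∂ν +
      ∫ x, DD (ob E i) u x * DD (ob E i) u x ∂ν - ∫ x, DD (ob E i) u x * ∑ j, DD (ob E i) (η j) x * DD (ob E j) u x ∂ν := by
    intro i
    have h1 := ibp2 H (hu.D (ob E i)) (hu.D (ob E i)).diff (hu.D (ob E i)).lg (fun j => ((hu.D (ob E i)).D (ob E j)).lg)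
    rw [← integral_finsetSum _ fun j _ =>
      (((hu.D (ob E i)).D (ob E j)).mul ((hu.D (ob E i)).D (ob E j))).integrable ν] at h1
    have h2 : gr (DD (ob E i) u) = fun x => ∑ j, DD (ob E j) (DD (ob E i) u) x * DD (ob E j) (DD (ob E i) u) x := by
      ext x; simp [gr, sq]
    have hs : Integrable (fun x => NN η (DD (ob E i) u) x * DD (ob E i) u x + DD (ob E i) u x * DD (ob E i) u x) ν := (i1 i).add (i2 i)
    rw [h2, ← h1, ← integral_add (i1 i) (i2 i), ← integral_sub hs (i3 i), hD]
    congr 1; ext x; ring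
  have e3 : ∑ i, ∫ x, DD (ob E i) u x * DD (ob E i) u x ∂ν = ∫ x, gr u x ∂ν := by
    rw [← integral_finsetSum _ fun i _ => i2 i]; simp [gr, sq]
  have e4 : ∑ i, ∫ x, DD (ob E i) u x * ∑ j, DD (ob E i) (η j) x * DD (ob E j) u x ∂ν ≤ (1 - t) * ∫ x, gr u x ∂ν := by
    rw [← integral_finsetSum _ fun i _ => i3 i, ← integral_const_mul]
    refine integral_mono (integrable_finsetSum _ fun i _ => i3 i) ((hu.gr.integrable ν).const_mul _) fun x => ?_
    refine le_trans (le_of_eq ?_) (H.hess x fun i => DD (ob E i) u x)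
    refine sum_congr rfl fun i _ => ?_
    rw [mul_sum]; exact sum_congr rfl fun j _ => by ring
  rw [e1, sum_congr rfl fun i _ => e2 i, sum_sub_distrib, sum_add_distrib, e3]
  linarith
end g3

section g4
variable {η : Ix E → E → ℝ}

lemma NN_add {w : E → ℝ} (hu : Nice u) (hw : Nice w) (x : E) :
    NN η (fun x => u x + w x) x = NN η u x + NN η w x := by
  simp only [NN, ← sum_add_distrib]
  refine sum_congr rfl fun i _ => ?_
  rw [DD_add hu.diff hw.diff, DD_add (hu.D _).diff (hw.D _).diff]; ring
lemma NN_RR (k : ℕ) (hg : Nice g) (x : E) :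
    NN η (RR k g) x + (k + 1) * RR k g x = g x - ∑ i, η i x * DD (ob E i) (RR k g) x := by
  rw [← RR_id k hg x]
  simp only [NN, sub_mul, sum_sub_distrib]; ring

lemma NN_zero (x : E) : NN η (fun _ => 0) x = 0 := by
  have h : ∀ v : E, DD v (fun _ => (0:ℝ)) = fun _ => 0 := fun v => by ext x; simp [DD]
  simp [NN, h]
lemma resolv (H : LD ν η t) : ∃ z : ℝ, 0 < z ∧ ∀ f : E → ℝ, Nice f → ∀ β : ℝ, 0 < β →
    ∃ u e : E → ℝ, Nice u ∧ Nice e ∧ (∀ x, NN η u x + z * u x = f x - e x) ∧ ∀ x, |e x| ≤ β := by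
  choose C hC0 hC using fun i => (H.nice i).bdd
  have hS : 0 ≤ ∑ i, C i := sum_nonneg fun i _ => hC0 i
  obtain ⟨k, hk⟩ := cos_int_small (δ := 1 / (2 * (∑ i, C i + 1))) psv
  set δ := ∫ θ in (0)..(Real.pi / 2), cos θ ^ (k + 1)
  refine ⟨k + 1, by positivity, fun f hf β hβ => ?_⟩
  obtain ⟨B, hB0, hB⟩ := hf.bdd
  have key : ∀ J : ℕ, ∃ u g : E → ℝ, Nice u ∧ Nice g ∧ (∀ x, NN η u x + (k + 1) * u x = f x - g x) ∧
      ∀ x, |g x| ≤ B * (1 / 2) ^ J := by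
    intro J
    induction J with
    | zero => exact ⟨fun _ => 0, f, nice_const 0, hf, fun x => by simp [NN_zero], by simpa using hB⟩
    | succ J ih =>
      obtain ⟨u, g, hu, hg, h1, h2⟩ := ih
      refine ⟨fun x => u x + RR k g x, fun x => ∑ i, η i x * DD (ob E i) (RR k g) x, hu.add (RR_nice k hg),
        Nice.sum _ fun i => (H.nice i).mul ((RR_nice k hg).D _), fun x => ?_, fun x => ?_⟩
      · rw [NN_add hu (RR_nice k hg)]
        linarith [h1 x, NN_RR (η := η) k hg x]
      · have hp : 0 ≤ B * (1 / 2) ^ J := by positivity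
        have hδ : (∑ i, C i) * δ ≤ 1 / 2 := by
          rw [lt_div_iff₀ psv] at hk
          by_cases h : 0 ≤ δ
          · nlinarith
          · nlinarith
        calc _ ≤ ∑ i, |η i x * DD (ob E i) (RR k g) x| := abs_sum_le_sum_abs _ _
          _ ≤ ∑ i, C i * (B * (1 / 2) ^ J * δ) := sum_le_sum fun i _ => by
              rw [abs_mul]; exact mul_le_mul (hC i x) (RR_grad k hg h2 i x) (abs_nonneg _) (hC0 i)
          _ = ((∑ i, C i) * δ) * (B * (1 / 2) ^ J) := by rw [← sum_mul]; ring
          _ ≤ 1 / 2 * (B * (1 / 2) ^ J) := mul_le_mul_of_nonneg_right hδ hp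
          _ = _ := by ring
  obtain ⟨J, hJ⟩ := exists_pow_lt_of_lt_one (show 0 < β / (B + 1) by positivity) (show (1 / 2 : ℝ) < 1 by norm_num)
  obtain ⟨u, g, hu, hg, h1, h2⟩ := key J
  refine ⟨u, g, hu, hg, h1, fun x => (h2 x).trans ?_⟩
  rw [lt_div_iff₀ psv] at hJ
  nlinarith [show (0:ℝ) < (1 / 2) ^ J by positivity]

lemma NN_int0 (H : LD ν η t) (hu : Nice u) : ∫ x, NN η u x ∂ν = 0 := by
  have := ibp2 H hu (W := fun _ => 1) fpp (nice_const 1).lg (fun i => ((nice_const 1).D _).lg)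
  simpa [DD] using this
lemma NN_intu (H : LD ν η t) (hu : Nice u) : ∫ x, NN η u x * u x ∂ν = ∫ x, gr u x ∂ν := by
  have := H.pr
  rw [ibp2 H hu hu.diff hu.lg (fun i => (hu.D _).lg)]
  rw [← integral_finsetSum _ fun i _ => ((hu.D _).mul (hu.D _)).integrable ν]; simp [gr, sq]

lemma var_eq [IsProbabilityMeasure ν] (hf : Integrable f ν) (h2 : Integrable (fun x => f x ^ 2) ν) :
    ∫ x, (f x - ∫ y, f y ∂ν) ^ 2 ∂ν = ∫ x, f x ^ 2 ∂ν - (∫ y, f y ∂ν) ^ 2 := by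
  set m := ∫ y, f y ∂ν
  have : ∀ x, (f x - m) ^ 2 = f x ^ 2 - (2 * m) * f x + m ^ 2 := fun x => by ring
  simp only [this]
  have h3 : Integrable (fun x => f x ^ 2 - (2 * m) * f x) ν := h2.sub (hf.const_mul _)
  rw [integral_add h3 (integrable_const _), integral_sub h2 (hf.const_mul _), integral_const_mul]
  simp; ring

lemma Nice.sqi (hf : Nice f) (ν : Measure E) [IsFiniteMeasure ν] : Integrable (fun x => f x ^ 2) ν := by
  simpa [sq] using (hf.mul hf).integrable ν

lemma step_ar {z U m F : ℝ} (hz : 0 < z) (ht : 0 < t) (hm : m ^ 2 ≤ (β / z) ^ 2)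
    (h : (z + t) ^ 2 * U - 2 * t * (z + t) * m ^ 2 ≤ (1 + t / (2 * z)) * F + (1 + 2 * z / t) * β ^ 2) :
    (1 + t / (2 * z)) * (z ^ 2 * U) + (1 + 2 * z / t) * β ^ 2 ≤
     ((z + t / 2) / (z + t)) ^ 2 * F + ((1 + t / (2 * z)) * z ^ 2 / (z + t) ^ 2 * ((1 + 2 * z / t) + 2 * t * (z + t) / z ^ 2)
      + (1 + 2 * z / t)) * β ^ 2 := by
  have h1 : (z + t) ^ 2 * U ≤ (1 + t / (2 * z)) * F + ((1 + 2 * z / t) + 2 * t * (z + t) / z ^ 2) * β ^ 2 := by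
    have : 2 * t * (z + t) * m ^ 2 ≤ 2 * t * (z + t) * (β / z) ^ 2 := mul_le_mul_of_nonneg_left hm psv
    have e : 2 * t * (z + t) * (β / z) ^ 2 = 2 * t * (z + t) / z ^ 2 * β ^ 2 := by field_simp
    linarith
  have h2 := mul_le_mul_of_nonneg_left h1 (show 0 ≤ (1 + t / (2 * z)) * z ^ 2 / (z + t) ^ 2 by positivity)
  have e1 : (1 + t / (2 * z)) * z ^ 2 / (z + t) ^ 2 * ((z + t) ^ 2 * U) = (1 + t / (2 * z)) * (z ^ 2 * U) := by
    field_simp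
  have e2 : ((z + t / 2) / (z + t)) ^ 2 = (1 + t / (2 * z)) * z ^ 2 / (z + t) ^ 2 * (1 + t / (2 * z)) := by field_simp
  rw [e1] at h2; rw [e2]; linarith

lemma int_sq_add [IsProbabilityMeasure ν] {e : E → ℝ} (hf : Nice f) (he : Nice e) {θ : ℝ} (hθ : 0 < θ) (h : ∀ x, |e x| ≤ β) :
    ∫ x, (f x + e x) ^ 2 ∂ν ≤ (1 + θ) * ∫ x, f x ^ 2 ∂ν + (1 + 1 / θ) * β ^ 2 := by
  rw [← integral_const_mul]
  have : (1 + 1 / θ) * β ^ 2 = ∫ x, (1 + 1 / θ) * β ^ 2 ∂ν := by simp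
  rw [this, ← integral_add ((hf.sqi ν).const_mul _) (integrable_const _)]
  refine integral_mono ((hf.add he).sqi ν) (((hf.sqi ν).const_mul _).add (integrable_const _)) fun x => ?_
  have h1 : e x ^ 2 ≤ β ^ 2 := sq_le_sq' (by linarith [(abs_le.1 (h x)).1]) (abs_le.1 (h x)).2
  have h2 := mul_le_mul_of_nonneg_left h1 (show 0 ≤ 1 + 1 / θ by positivity)
  have h3 : 2 * (f x * e x) ≤ θ * f x ^ 2 + 1 / θ * e x ^ 2 := by
    have : 0 ≤ (θ * f x - e x) ^ 2 / θ := by positivity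
    have e : (θ * f x - e x) ^ 2 / θ = θ * f x ^ 2 + 1 / θ * e x ^ 2 - 2 * (f x * e x) := by field_simp; ring
    linarith
  simp only []
  nlinarith

lemma step (H : LD ν η t) : ∃ ρ C : ℝ, 0 ≤ ρ ∧ ρ < 1 ∧ 0 ≤ C ∧ ∀ f : E → ℝ, Nice f → ∫ x, f x ∂ν = 0 → ∀ β : ℝ, 0 < β →
    ∃ u r : E → ℝ, Nice u ∧ Nice r ∧ (∀ x, NN η u x = f x - r x) ∧
      ∫ x, r x ^ 2 ∂ν ≤ ρ * ∫ x, f x ^ 2 ∂ν + C * β ^ 2 := by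
  have := H.pr
  have ht := H.t0
  obtain ⟨z, hz, hr⟩ := resolv H
  refine ⟨((z + t / 2) / (z + t)) ^ 2, (1 + t / (2 * z)) * z ^ 2 / (z + t) ^ 2 * ((1 + 2 * z / t) + 2 * t * (z + t) / z ^ 2)
      + (1 + 2 * z / t), by positivity, ?_, by positivity, fun f hf hf0 β hβ => ?_⟩
  · rw [sq_lt_one_iff₀ psv, div_lt_one psv]; linarith
  obtain ⟨u, e, hu, he, h1, h2⟩ := hr f hf β hβ
  have hzu := (nice_const (E := E) z).mul hu
  refine ⟨u, fun x => z * u x + e x, hu, hzu.add he, fun x => by linarith [h1 x], ?_⟩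
  have hθ : 0 < t / (2 * z) := by positivity
  have e0 : 1 / (t / (2 * z)) = 2 * z / t := by field_simp
  have a1 := int_sq_add (ν := ν) hzu he hθ h2
  have a2 := int_sq_add (ν := ν) hf ((nice_const (E := E) (-1)).mul he) hθ (β := β) (by simpa using h2)
  rw [e0] at a1 a2
  have e1 : ∫ x, (z * u x) ^ 2 ∂ν = z ^ 2 * ∫ x, u x ^ 2 ∂ν := by
    simp only [mul_pow]; rw [integral_const_mul]
  rw [e1] at a1
  refine a1.trans (step_ar (m := ∫ x, u x ∂ν) hz ht ?_ ?_)
  · have i1 : ∫ x, (NN η u x + z * u x) ∂ν = z * ∫ x, u x ∂ν := by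
      rw [integral_add ((NN_lg H hu).int1 H.m2) (hzu.integrable ν), NN_int0 H hu, integral_const_mul, zero_add]
    have i2 : ∫ x, (NN η u x + z * u x) ∂ν = - ∫ x, e x ∂ν := by
      simp only [h1]; rw [integral_sub (hf.integrable ν) (he.integrable ν), hf0, zero_sub]
    have i3 : |∫ x, e x ∂ν| ≤ β := by
      have := norm_integral_le_of_norm_le_const (μ := ν) (f := e) (C := β) (ae_of_all _ h2)
      simpa using this
    have : |∫ x, u x ∂ν| ≤ β / z := by
      have h3 : |z * ∫ x, u x ∂ν| ≤ β := by rw [← i1, i2, abs_neg]; exact i3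
      rw [abs_mul, abs_of_pos hz] at h3
      rw [le_div_iff₀ hz]; linarith
    exact sq_le_sq' (by linarith [(abs_le.1 this).1]) (abs_le.1 this).2
  · refine le_trans ?_ a2
    have p := H.poin u hu
    rw [var_eq (hu.integrable ν) (hu.sqi ν)] at p
    have e3 : ∀ x, f x + -1 * e x = NN η u x + z * u x := fun x => by linarith [h1 x]
    simp only [e3]
    have iN : Integrable (fun x => NN η u x * u x) ν := (NN_lg H hu).int H.m2 hu.lg
    have iN2 : Integrable (fun x => (NN η u x + z * u x) ^ 2) ν := by
      simp only [h1]; exact (hf.sub he).sqi ν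
    have : ∫ x, (2 * (z + t)) * (NN η u x * u x) + (z ^ 2 - t ^ 2) * u x ^ 2 ∂ν ≤ ∫ x, (NN η u x + z * u x) ^ 2 ∂ν :=
      integral_mono ((iN.const_mul _).add ((hu.sqi ν).const_mul _)) iN2 fun x => by
        simp only []; nlinarith [sq_nonneg (NN η u x - t * u x)]
    rw [integral_add (iN.const_mul _) ((hu.sqi ν).const_mul _), integral_const_mul, integral_const_mul, NN_intu H hu] at this
    refine le_trans ?_ this
    nlinarith

lemma dense (H : LD ν η t) (hf : Nice f) (hf0 : ∫ x, f x ∂ν = 0) (hε : 0 < ε) :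
    ∃ u r : E → ℝ, Nice u ∧ Nice r ∧ (∀ x, NN η u x = f x - r x) ∧ ∫ x, r x ^ 2 ∂ν ≤ ε := by
  have := H.pr
  obtain ⟨ρ, C, hρ, hρ1, hC, hs⟩ := step H
  set F := ∫ x, f x ^ 2 ∂ν
  have hF : 0 ≤ F := integral_nonneg fun x => by positivity
  have hβ : 0 < √((1 - ρ) * (ε / 2) / (C + 1)) := sqrt_pos.2 (div_pos (mul_pos lnr lnr) lnr)
  have hβ2 : C * √((1 - ρ) * (ε / 2) / (C + 1)) ^ 2 ≤ (1 - ρ) * (ε / 2) := by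
    rw [sq_sqrt (sqrt_pos.1 hβ).le, mul_div_assoc', div_le_iff₀ lnr]
    nlinarith [mul_pos (show 0 < 1 - ρ by linarith) hε]
  have key : ∀ J : ℕ, ∃ u r : E → ℝ, Nice u ∧ Nice r ∧ (∀ x, NN η u x = f x - r x) ∧ ∫ x, r x ^ 2 ∂ν ≤ ρ ^ J * F + ε / 2 := by
    intro J
    induction J with
    | zero => exact ⟨fun _ => 0, f, nice_const 0, hf, fun x => by simp [NN_zero], by simp [F]; linarith⟩
    | succ J ih =>
      obtain ⟨u, r, hu, hr, h1, h2⟩ := ih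
      have hr0 : ∫ x, r x ∂ν = 0 := by
        have := NN_int0 H hu
        simp only [h1] at this
        rw [integral_sub (hf.integrable ν) (hr.integrable ν)] at this; linarith
      obtain ⟨w, r', hw, hr', h3, h4⟩ := hs r hr hr0 _ hβ
      refine ⟨fun x => u x + w x, r', hu.add hw, hr', fun x => by rw [NN_add hu hw, h1, h3]; ring, ?_⟩
      have := mul_le_mul_of_nonneg_left h2 hρ
      rw [pow_succ]; nlinarith
  obtain ⟨J, hJ⟩ := exists_pow_lt_of_lt_one (show 0 < ε / 2 / (F + 1) by positivity) hρ1
  obtain ⟨u, r, hu, hr, h1, h2⟩ := key J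
  refine ⟨u, r, hu, hr, h1, h2.trans ?_⟩
  rw [lt_div_iff₀ psv] at hJ
  nlinarith [pow_nonneg hρ J]

lemma K_to_P (H : LD ν η t) (hs : 0 < s) (hK : ∀ u : E → ℝ, Nice u → s * ∫ x, gr u x ∂ν ≤ ∫ x, NN η u x ^ 2 ∂ν)
    (hf : Nice f) : s * ∫ x, (f x - ∫ y, f y ∂ν) ^ 2 ∂ν ≤ ∫ x, gr f x ∂ν := by
  have := H.pr
  set m := ∫ y, f y ∂ν
  have hf0 : Nice (fun x => f x - m) := hf.sub (nice_const m)
  have hm : ∫ x, (f x - m) ∂ν = 0 := by rw [integral_sub (hf.integrable ν) (integrable_const _)]; simp [m]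
  refine le_of_forall_pos_le_add fun ε hε => ?_
  obtain ⟨u, r, hu, hr, h1, h2⟩ := dense H hf0 hm (ε := ε / s) psv
  have hD : ∀ i, DD (ob E i) (fun x => f x - m) = DD (ob E i) f := fun i => by
    rw [DD_sub hf.diff fpp]; ext x; simp [DD]
  have e1 := ibp2 H hu hf0.diff hf0.lg (fun i => (hf0.D _).lg)
  simp only [hD] at e1
  rw [← integral_finsetSum _ fun i _ => ((hu.D _).mul (hf.D _)).integrable ν] at e1
  have a1 : ∫ x, ∑ i, DD (ob E i) u x * DD (ob E i) f x ∂ν ≤ ∫ x, (1 / (2 * s)) * gr f x + s / 2 * gr u x ∂ν := by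
    refine integral_mono ((Nice.sum _ fun i => (hu.D _).mul (hf.D _)).integrable ν)
      (((hf.gr.integrable ν).const_mul _).add ((hu.gr.integrable ν).const_mul _)) fun x => ?_
    simp only [gr, mul_sum, ← sum_add_distrib]
    refine sum_le_sum fun i _ => ?_
    set a := DD (ob E i) u x
    set b := DD (ob E i) f x
    have : 0 ≤ (b - s * a) ^ 2 / (2 * s) := by positivity
    have e : (b - s * a) ^ 2 / (2 * s) = 1 / (2 * s) * b ^ 2 + s / 2 * a ^ 2 - a * b := by field_simp; ring
    linarith
  rw [integral_add ((hf.gr.integrable ν).const_mul _) ((hu.gr.integrable ν).const_mul _), integral_const_mul,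
    integral_const_mul, ← e1] at a1
  have hN : NN η u = fun x => f x - m - r x := funext h1
  have nN : Nice (NN η u) := by rw [hN]; exact hf0.sub hr
  have a2 : ∫ x, (f x - m) ^ 2 ∂ν = 2 * ∫ x, NN η u x * (f x - m) ∂ν - ∫ x, NN η u x ^ 2 ∂ν + ∫ x, r x ^ 2 ∂ν := by
    have h3 : Integrable (fun x => 2 * (NN η u x * (f x - m)) - NN η u x ^ 2) ν :=
      (((nN.mul hf0).integrable ν).const_mul 2).sub (nN.sqi ν)
    rw [← integral_const_mul, ← integral_sub (((nN.mul hf0).integrable ν).const_mul 2) (nN.sqi ν),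
      ← integral_add h3 (hr.sqi ν)]
    congr 1; ext x; rw [hN]; ring
  have a3 := hK u hu
  have a4 : ∫ x, (f x - m) ^ 2 ∂ν ≤ 1 / s * ∫ x, gr f x ∂ν + ε / s := by
    have : 2 * (1 / (2 * s) * ∫ x, gr f x ∂ν) = 1 / s * ∫ x, gr f x ∂ν := by field_simp
    linarith
  calc _ ≤ s * (1 / s * ∫ x, gr f x ∂ν + ε / s) := mul_le_mul_of_nonneg_left a4 hs.le
    _ = _ := by field_simp

lemma P_to_K (H : LD ν η t) (hs : 0 < s) (hl : 0 < lam)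
    (hv : ∀ v : E, ∃ m : ℝ, ∫ x, (⟪x, v⟫ - m) ^ 2 ∂ν ≤ lam * ‖v‖ ^ 2)
    (hP : ∀ f : E → ℝ, Nice f → s * ∫ x, (f x - ∫ y, f y ∂ν) ^ 2 ∂ν ≤ ∫ x, gr f x ∂ν)
    (hu : Nice u) : (s + t) / (1 + s * lam) * ∫ x, gr u x ∂ν ≤ ∫ x, NN η u x ^ 2 ∂ν := by
  have := H.pr
  set b : Ix E → ℝ := fun i => ∫ x, DD (ob E i) u x ∂ν
  set N2 := ∫ x, NN η u x ^ 2 ∂ν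
  have h1 : s * (∫ x, gr u x ∂ν - ∑ i, b i ^ 2) ≤ ∑ i, ∫ x, gr (DD (ob E i) u) x ∂ν := by
    simp only [gr]
    rw [integral_finsetSum _ fun i _ => (hu.D (ob E i)).sqi ν, ← sum_sub_distrib, mul_sum]
    refine sum_le_sum fun i _ => ?_
    have := hP _ (hu.D (ob E i))
    rwa [var_eq ((hu.D _).integrable ν) ((hu.D _).sqi ν)] at this
  have h2 : ∑ i, b i ^ 2 ≤ lam * N2 := by
    obtain ⟨m, hm⟩ := hv (∑ i, b i • ob E i)
    set v := ∑ i, b i • ob E i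
    have hin : ∀ i, ⟪ob E i, v⟫ = b i := fun i => (ob E).orthonormal.inner_right_fintype b i
    have hvn : ‖v‖ ^ 2 = ∑ i, b i ^ 2 := by
      rw [← real_inner_self_eq_norm_sq]; simp only [v]; rw [(ob E).orthonormal.inner_sum]
      simp [sq]
    have hlw : Lg (fun x : E => ⟪x, v⟫ - m) := (Lg_inner v).sub (nice_const m).lg
    have hD : ∀ i, DD (ob E i) (fun x : E => ⟪x, v⟫ - m) = fun _ => b i := fun i => by
      rw [DD_sub (diff_inner v) fpp, DD_inner, hin]; ext x; simp [DD]
    have e1 := ibp2 H hu (W := fun x => ⟪x, v⟫ - m) ((diff_inner v).sub_const m) hlw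
      (fun i => by rw [hD]; exact (nice_const (b i)).lg)
    simp only [hD, integral_mul_const] at e1
    have e2 : ∑ i, (∫ x, DD (ob E i) u x ∂ν) * b i = ∑ i, b i ^ 2 := sum_congr rfl fun i _ => by simp [b, sq]
    rw [e2] at e1
    have i1 : Integrable (fun x => NN η u x ^ 2) ν := by simpa [sq] using (NN_lg H hu).int H.m2 (NN_lg H hu)
    have i2 : Integrable (fun x => (⟪x, v⟫ - m) ^ 2) ν := by simpa [sq] using hlw.int H.m2 hlw
    have : ∫ x, NN η u x * (⟪x, v⟫ - m) ∂ν ≤ ∫ x, lam / 2 * NN η u x ^ 2 + 1 / (2 * lam) * (⟪x, v⟫ - m) ^ 2 ∂ν := by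
      refine integral_mono ((NN_lg H hu).int H.m2 hlw) ((i1.const_mul _).add (i2.const_mul _)) fun x => ?_
      have h3 : 0 ≤ (lam * NN η u x - (⟪x, v⟫ - m)) ^ 2 / (2 * lam) := by positivity
      have e : (lam * NN η u x - (⟪x, v⟫ - m)) ^ 2 / (2 * lam) = lam / 2 * NN η u x ^ 2 + 1 / (2 * lam) * (⟪x, v⟫ - m) ^ 2
          - NN η u x * (⟪x, v⟫ - m) := by field_simp; ring
      simp only []; linarith
    rw [integral_add (i1.const_mul _) (i2.const_mul _), integral_const_mul, integral_const_mul, e1] at this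
    have h4 : 1 / (2 * lam) * ∫ x, (⟪x, v⟫ - m) ^ 2 ∂ν ≤ 1 / 2 * ∑ i, b i ^ 2 := by
      rw [← hvn]
      calc _ ≤ 1 / (2 * lam) * (lam * ‖v‖ ^ 2) := mul_le_mul_of_nonneg_left hm psv
        _ = _ := by field_simp
    linarith
  have h3 := bochner H hu
  rw [div_mul_eq_mul_div, div_le_iff₀ psv]
  nlinarith

theorem lich (H : LD ν η t) (hl : 0 < lam)
    (hv : ∀ v : E, ∃ m : ℝ, ∫ x, (⟪x, v⟫ - m) ^ 2 ∂ν ≤ lam * ‖v‖ ^ 2) (hf : Nice f) :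
    ∫ x, (f x - ∫ y, f y ∂ν) ^ 2 ∂ν ≤ √(lam / t) * ∫ x, gr f x ∂ν := by
  have ht := H.t0
  set V : (E → ℝ) → ℝ := fun f => ∫ x, (f x - ∫ y, f y ∂ν) ^ 2 ∂ν
  set s0 := √(t / lam)
  have hs0 : 0 < s0 := sqrt_pos.2 psv
  have hV : ∀ f, 0 ≤ V f := fun f => integral_nonneg fun x => by positivity
  have hsq : s0 ^ 2 * lam = t := by rw [sq_sqrt psv]; field_simp
  have key : ∀ f : E → ℝ, Nice f → s0 * V f ≤ ∫ x, gr f x ∂ν := by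
    by_cases hts : s0 ≤ t
    · exact fun f hf => (mul_le_mul_of_nonneg_right hts (hV f)).trans (H.poin f hf)
    set S : Set ℝ := {s | s ∈ Icc t s0 ∧ ∀ f : E → ℝ, Nice f → s * V f ≤ ∫ x, gr f x ∂ν}
    have hcl : IsCompact S := by
      have : S = Icc t s0 ∩ ⋂ f : E → ℝ, ⋂ _ : Nice f, {s | s * V f ≤ ∫ x, gr f x ∂ν} := by
        ext s; simp [S]
      rw [this]
      exact isCompact_Icc.inter_right (isClosed_iInter fun f => isClosed_iInter fun _ =>
        isClosed_le fpp fpp)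
    have hmem := hcl.sSup_mem ⟨t, ⟨le_rfl, (not_le.1 hts).le⟩, H.poin⟩
    set s := sSup S
    have hsp : 0 < s := ht.trans_le hmem.1.1
    by_cases hlt : s < s0
    · exfalso
      have h1 := fun f hf => K_to_P H (s := (s + t) / (1 + s * lam)) psv (fun u hu => P_to_K H hsp hl hv hmem.2 hu) (f := f) hf
      have h2 : s < (s + t) / (1 + s * lam) := by
        rw [lt_div_iff₀ psv]
        nlinarith [mul_pos (mul_pos hsp (sub_pos.2 hlt)) hl, mul_pos (mul_pos hs0 (sub_pos.2 hlt)) hl]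
      have h3 : min ((s + t) / (1 + s * lam)) s0 ∈ S := by
        refine ⟨⟨le_min (hmem.1.1.trans h2.le) (not_le.1 hts).le, min_le_right _ _⟩, fun f hf => ?_⟩
        exact (mul_le_mul_of_nonneg_right (min_le_left _ _) (hV f)).trans (h1 f hf)
      exact absurd (le_csSup hcl.bddAbove h3) (not_le.2 (lt_min h2 hlt))
    · rw [← le_antisymm hmem.1.2 (not_lt.1 hlt)]; exact hmem.2
  have h1 : √(lam / t) * s0 = 1 := by
    rw [← sqrt_mul psv]; field_simp; simp
  calc V f = √(lam / t) * (s0 * V f) := by rw [← mul_assoc, h1, one_mul]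
    _ ≤ _ := mul_le_mul_of_nonneg_left (key f hf) (sqrt_nonneg _)
end g4

section t0

structure Bd (m : Measure E) (R : ℝ) : Prop where
  pr : IsProbabilityMeasure m
  r0 : 0 ≤ R
  ae : ∀ᵐ y ∂m, ‖y‖ ≤ R
def Bf (R : ℝ) (p : E → ℝ) : Prop := Measurable p ∧ ∃ C, 0 ≤ C ∧ ∀ y, ‖y‖ ≤ R → |p y| ≤ C
lemma Bf.mul {q : E → ℝ} (hp : Bf R p) (hq : Bf R q) : Bf R (fun y => p y * q y) := by
  obtain ⟨h1, C, hC, h2⟩ := hp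
  obtain ⟨h3, D, hD, h4⟩ := hq
  exact ⟨h1.mul h3, C * D, by positivity, fun y hy => by
    rw [abs_mul]; exact mul_le_mul (h2 y hy) (h4 y hy) (abs_nonneg _) hC⟩
lemma Bf.add {q : E → ℝ} (hp : Bf R p) (hq : Bf R q) : Bf R (fun y => p y + q y) := by
  obtain ⟨h1, C, hC, h2⟩ := hp
  obtain ⟨h3, D, hD, h4⟩ := hq
  exact ⟨h1.add h3, C + D, by positivity, fun y hy => (abs_add_le _ _).trans (add_le_add (h2 y hy) (h4 y hy))⟩
lemma Bf_const (R c : ℝ) : Bf R (fun _ : E => c) := ⟨measurable_const, |c|, abs_nonneg _, fun _ _ => le_rfl⟩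
lemma Bf.sub {q : E → ℝ} (hp : Bf R p) (hq : Bf R q) : Bf R (fun y => p y - q y) := by
  simpa [sub_eq_add_neg] using hp.add ((Bf_const R (-1)).mul hq)
lemma Bf_inner (R : ℝ) (v : E) : Bf R (fun y => ⟪y, v⟫) :=
  ⟨by fun_prop, |R| * ‖v‖, by positivity, fun y hy => (abs_real_inner_le_norm _ _).trans
    (mul_le_mul_of_nonneg_right (hy.trans (le_abs_self R)) (norm_nonneg v))⟩
lemma Bf_cont (hp : Continuous p) : Bf R p := by
  obtain ⟨C, hC⟩ := (isCompact_closedBall (0 : E) R).exists_bound_of_continuousOn hp.continuousOn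
  exact ⟨hp.measurable, |C|, abs_nonneg _, fun y hy => (hC y (by simpa using hy)).trans (le_abs_self C)⟩
lemma Bd.int (h : Bd m R) (hp : Bf R p) : Integrable p m := by
  have := h.pr
  obtain ⟨h1, C, hC, h2⟩ := hp
  exact .of_bound h1.aestronglyMeasurable C (h.ae.mono fun y hy => h2 y hy)
lemma Bd.le (h : Bd m R)
    (hC : ∀ y, ‖y‖ ≤ R → |p y| ≤ C) : |∫ y, p y ∂m| ≤ C := by
  have := h.pr
  have := norm_integral_le_of_norm_le_const (μ := m) (f := p) (C := C) (h.ae.mono fun y hy => hC y hy)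
  simpa using this

def tw (s : ℝ) (θ y : E) : ℝ := exp (⟪θ, y⟫ - s * ‖y‖ ^ 2 / 2)
@[fun_prop] lemma tw_cont (s : ℝ) : Continuous (fun p : E × E => tw s p.1 p.2) := by unfold tw; fun_prop
lemma tw_cont1 (s : ℝ) (θ : E) : Continuous (fun y : E => tw s θ y) := by unfold tw; fun_prop
lemma tw_pos (s : ℝ) (θ y : E) : 0 < tw s θ y := exp_pos _
def tl (m : Measure E) (s : ℝ) (θ : E) : Measure E := m.tilted (fun y => ⟪θ, y⟫ - s * ‖y‖ ^ 2 / 2)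
def tZ (m : Measure E) (s : ℝ) (θ : E) : ℝ := ∫ y, tw s θ y ∂m
lemma tw_le {θ : E} (hy : ‖y‖ ≤ R) : tw s θ y ≤ exp (|s| * R ^ 2 / 2) * exp (R * ‖θ‖) := by
  rw [tw, ← exp_add]
  refine exp_le_exp.2 ?_
  have h1 := real_inner_le_norm θ y
  have h2 : -(s * ‖y‖ ^ 2) ≤ |s| * R ^ 2 :=
    (neg_le_abs _).trans (by rw [abs_mul, abs_of_nonneg (sq_nonneg ‖y‖)]; gcongr)
  have h3 : ‖θ‖ * ‖y‖ ≤ ‖θ‖ * R := by gcongr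
  linarith
lemma Bd.tw (h : Bd m R) (s : ℝ) (θ : E) : Integrable (fun y => tw s θ y) m := h.int (Bf_cont (tw_cont1 s θ))
lemma Bd.tZ_pos (h : Bd m R) (s : ℝ) (θ : E) : 0 < tZ m s θ := by
  have := h.pr
  exact integral_exp_pos (h.tw s θ)
lemma Bd.tl (h : Bd m R) (s : ℝ) (θ : E) : Bd (tl m s θ) R := by
  have := h.pr
  exact ⟨isProbabilityMeasure_tilted (h.tw s θ), h.r0, (tilted_absolutelyContinuous m _).ae_le h.ae⟩
lemma tl_int (p : E → ℝ) (s : ℝ) (θ : E) : ∫ y, p y ∂(tl m s θ) = (∫ y, p y * tw s θ y ∂m) / tZ m s θ := by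
  rw [_root_.tl, integral_tilted, ← integral_div]
  congr 1; ext y; rw [smul_eq_mul]; simp only [_root_.tw, tZ]; ring
lemma Bd.ulc (h : Bd m R) (hu : ULC τ m) (s : ℝ) (θ : E) : ULC (τ + s) (_root_.tl m s θ) := by
  have e : _root_.tl m s θ = ofReal (tZ m s θ)⁻¹ •
      m.withDensity fun x => ofReal (exp (⟪θ, x⟫ - s * ‖x‖ ^ 2 / 2)) := by
    rw [← withDensity_smul _ fpp]
    unfold _root_.tl Measure.tilted
    congr 1; ext y
    rw [Pi.smul_apply, smul_eq_mul, ← ofReal_mul (by have := h.tZ_pos s θ; positivity), div_eq_inv_mul]; rfl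
  rw [e]; exact (hu.gauss s θ).smul _
lemma tl_tl (h : Bd m R) (s s' : ℝ) (θ θ' : E) : _root_.tl (_root_.tl m s θ) s' θ' = _root_.tl m (s + s') (θ + θ') := by
  unfold _root_.tl
  rw [tilted_tilted (h.tw s θ)]
  congr 1; ext y; simp only [Pi.add_apply, inner_add_left]; ring
lemma tZ_tl (h : Bd m R) (s s' : ℝ) (θ θ' : E) : tZ m s θ * tZ (_root_.tl m s θ) s' θ' = tZ m (s + s') (θ + θ') := by
  rw [tZ.eq_1 (_root_.tl m s θ), tl_int, mul_div_cancel₀ _ (h.tZ_pos s θ).ne', tZ]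
  congr 1; ext y; simp only [_root_.tw]; rw [← exp_add]; congr 1; simp only [inner_add_left]; ring

def nm (m : Measure E) (s : ℝ) (p : E → ℝ) (θ : E) : ℝ := ∫ y, p y * tw s θ y ∂m
lemma nm_le (h : Bd m R) (hp : Bf R p) (s : ℝ) : ∃ C, 0 ≤ C ∧ ∀ θ, |nm m s p θ| ≤ C * exp (R * ‖θ‖) := by
  obtain ⟨h1, C, hC, h2⟩ := hp
  refine ⟨C * exp (|s| * R ^ 2 / 2), by positivity, fun θ => h.le fun y hy => ?_⟩
  rw [abs_mul, abs_of_pos (tw_pos _ _ _), mul_assoc]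
  exact mul_le_mul (h2 y hy) (tw_le hy) (tw_pos _ _ _).le hC
lemma nm_fd (h : Bd m R) (hp : Bf R p) (s : ℝ) (θ : E) :
    HasFDerivAt (nm m s p) (∫ y, (p y * tw s θ y) • innerSL ℝ y ∂m) θ ∧
    Integrable (fun y => (p y * tw s θ y) • innerSL ℝ y) m := by
  have := h.pr
  obtain ⟨C, hC, hpC⟩ := hp.2
  have hm := hp.1
  have mm : ∀ θ, AEStronglyMeasurable (fun y => (p y * tw s θ y) • innerSL ℝ y) m := fun θ =>
    ((hm.mul (tw_cont1 s θ).measurable).aestronglyMeasurable).smul (innerSL ℝ (E := E)).continuous.aestronglyMeasurable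
  have bd : ∀ θ' y : E, ‖y‖ ≤ R → ‖(p y * tw s θ' y) • innerSL ℝ y‖ ≤
      C * (exp (|s| * R ^ 2 / 2) * exp (R * ‖θ'‖)) * R := fun θ' y hy => by
    rw [norm_smul, innerSL_apply_norm, norm_mul, norm_of_nonneg (tw_pos _ _ _).le]
    exact mul_le_mul (mul_le_mul (hpC y hy) (tw_le hy) (tw_pos _ _ _).le hC) hy (norm_nonneg _) psv
  refine ⟨hasFDerivAt_integral_of_dominated_of_fderiv_le (s := Metric.ball θ 1) (F' := fun θ y => (p y * tw s θ y) • innerSL ℝ y)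
    (bound := fun _ => C * (exp (|s| * R ^ 2 / 2) * exp (R * (‖θ‖ + 1))) * R)
    (ball_mem_nhds θ one_pos) (Eventually.of_forall fun θ' => ?_) ?_ (mm θ)
    (h.ae.mono fun y hy θ' hθ' => (bd θ' y hy).trans ?_) (integrable_const _) (ae_of_all _ fun y θ' _ => ?_), ?_⟩
  · exact (hm.mul (tw_cont1 s θ').measurable).aestronglyMeasurable
  · exact h.int (hp.mul (Bf_cont (tw_cont1 s θ)))
  · have : ‖θ'‖ ≤ ‖θ‖ + 1 := by
      have := norm_sub_norm_le θ' θ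
      rw [Metric.mem_ball, dist_eq_norm] at hθ'; linarith
    have := h.r0
    gcongr
  · have h1 : HasFDerivAt (fun θ : E => ⟪θ, y⟫ - s * ‖y‖ ^ 2 / 2) (innerSL ℝ y) θ' := by
      have : HasFDerivAt (fun x : E => ⟪x, y⟫) (innerSL ℝ y) θ' := by
        have := (innerSL ℝ y).hasFDerivAt (x := θ')
        simpa [real_inner_comm] using this
      exact this.sub_const _
    have := (h1.exp).const_mul (p y)
    rw [smul_smul] at this; exact this
  · exact .of_bound (mm θ) _ (h.ae.mono fun y hy => bd θ y hy)
lemma nm_diff (h : Bd m R) (hp : Bf R p) (s : ℝ) : Differentiable ℝ (nm m s p) :=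
  fun θ => (nm_fd h hp s θ).1.differentiableAt
lemma nm_DD (h : Bd m R) (hp : Bf R p) (s : ℝ) (v : E) :
    DD v (nm m s p) = nm m s (fun y => p y * ⟪y, v⟫) := by
  ext θ
  rw [DD, (nm_fd h hp s θ).1.fderiv, ContinuousLinearMap.integral_apply (nm_fd h hp s θ).2, nm]
  congr 1; ext y; simp; ring
lemma tZ_nm : tZ m s = nm m s (fun _ => 1) := by ext θ; simp [tZ, nm]

def TT (m : Measure E) (s : ℝ) (p : E → ℝ) (θ : E) : ℝ := ∫ y, p y ∂(tl m s θ)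
lemma TT_eq (p : E → ℝ) : TT m s p = fun θ => nm m s p θ / nm m s (fun _ => 1) θ := by
  ext θ; rw [TT, tl_int, tZ_nm]; rfl
lemma TT_diff (h : Bd m R) (hp : Bf R p) (s : ℝ) : Differentiable ℝ (TT m s p) := by
  rw [TT_eq]; simp only [div_eq_mul_inv]
  exact (nm_diff h hp s).mul <| (nm_diff h (Bf_const R 1) s).inv fun θ => by rw [← tZ_nm]; exact (h.tZ_pos s θ).ne'
lemma TT_DD (h : Bd m R) (hp : Bf R p) (s : ℝ) (v : E) :
    DD v (TT m s p) = fun θ => TT m s (fun y => p y * ⟪y, v⟫) θ - TT m s p θ * TT m s (fun y => ⟪y, v⟫) θ := by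
  have hz : ∀ θ, nm m s (fun _ => 1) θ ≠ 0 := fun θ => by rw [← tZ_nm]; exact (h.tZ_pos s θ).ne'
  have e : nm m s p = fun θ => TT m s p θ * nm m s (fun _ => 1) θ := by
    ext θ; rw [TT_eq]; field_simp [hz θ]
  have h1 := congrArg (DD v) e
  rw [DD_mul (TT_diff h hp s) (nm_diff h (Bf_const R 1) s), nm_DD h hp, nm_DD h (Bf_const R 1)] at h1
  ext θ
  have h2 := congrFun h1 θ
  simp only [one_mul] at h2
  rw [TT_eq (fun y => p y * ⟪y, v⟫), TT_eq (fun y : E => ⟪y, v⟫)]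
  simp only []
  rw [h2]; field_simp [hz θ]; ring
lemma TT_nice (h : Bd m R) (hp : Bf R p) (s : ℝ) : Nice (TT m s p) := by
  have hb : ∀ {p : E → ℝ}, Bf R p → ∃ C, ∀ θ, |TT m s p θ| ≤ C := fun hp => by
    obtain ⟨-, C, -, hC⟩ := hp
    exact ⟨C, fun θ => (h.tl s θ).le hC⟩
  intro k
  induction k generalizing p with
  | zero => exact ⟨(TT_diff h hp s).continuous, hb hp⟩
  | succ k ih =>
    refine ⟨TT_diff h hp s, hb hp, fun v => ?_⟩
    rw [TT_DD h hp]
    have := (ih (hp.mul (Bf_inner R v))).add (((nice_const (-1) k).mul (ih hp)).mul (ih (Bf_inner R v)))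
    simpa [sub_eq_add_neg] using this
end t0

section g5

def Eg (f : E → ℝ) : Prop := ∃ C a, 0 ≤ C ∧ 0 ≤ a ∧ ∀ x, |f x| ≤ C * exp (a * ‖x‖)
lemma Eg.mul (hf : Eg f) (hg : Eg g) : Eg (fun x => f x * g x) := by
  obtain ⟨C, a, hC, ha, h1⟩ := hf
  obtain ⟨D, b, hD, hb, h2⟩ := hg
  refine ⟨C * D, a + b, by positivity, by positivity, fun x => ?_⟩
  rw [abs_mul, add_mul, exp_add]
  calc _ ≤ (C * exp (a * ‖x‖)) * (D * exp (b * ‖x‖)) := mul_le_mul (h1 x) (h2 x) (abs_nonneg _) psv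
    _ = _ := by ring
lemma Eg.add (hf : Eg f) (hg : Eg g) : Eg (fun x => f x + g x) := by
  obtain ⟨C, a, hC, ha, h1⟩ := hf
  obtain ⟨D, b, hD, hb, h2⟩ := hg
  refine ⟨C + D, a + b, by positivity, by positivity, fun x => (abs_add_le _ _).trans ?_⟩
  rw [add_mul]
  refine add_le_add ((h1 x).trans ?_) ((h2 x).trans ?_) <;> gcongr <;> linarith
lemma Lg.eg (hf : Lg f) : Eg f := by
  obtain ⟨-, C, hC, h⟩ := hf
  refine ⟨C, 1, hC, zero_le_one, fun x => (h x).trans ?_⟩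
  gcongr; linarith [add_one_le_exp (1 * ‖x‖)]
lemma nm_eg (h : Bd m R) (hp : Bf R p) (s : ℝ) : Eg (nm m s p) := by
  obtain ⟨C, hC, h1⟩ := nm_le h hp s
  exact ⟨C, R, hC, h.r0, h1⟩
lemma Eg.int (hf : Eg f) (hm : AEStronglyMeasurable f (gam E)) : Integrable f (gam E) := by
  obtain ⟨C, a, -, -, h⟩ := hf
  exact gam_growth hm C a h
lemma gam_ibp' (hF : Differentiable ℝ F) (v : E) (h1 : Eg F) (h2 : Eg (DD v F)) :
    ∫ x, ⟪x, v⟫ * F x ∂(gam E) = ∫ x, DD v F x ∂(gam E) := by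
  obtain ⟨C, a, hC, ha, h1⟩ := h1
  obtain ⟨D, b, hD, hb, h2⟩ := h2
  refine gam_ibp hF v (C + D) (a + b) (fun x => (h1 x).trans ?_) (fun x => (h2 x).trans ?_) <;> gcongr <;> linarith

def sm (m : Measure E) : Measure E := (m.prod (gam E)).map (fun p => p.1 + p.2)
lemma sm_eq (h : Bd m R) : sm m = (gam E).withDensity fun z => ofReal (tZ m 1 z) := by
  have := h.pr
  refine Measure.ext_of_lintegral _ fun f hf => ?_
  have hZ : Measurable fun z => ofReal (tZ m 1 z) := by
    rw [tZ_nm]; exact measurable_ofReal.comp (nm_diff h (Bf_const R 1) 1).continuous.measurable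
  rw [sm, lintegral_map hf fpp, lintegral_prod _ fpp,
    lintegral_withDensity_eq_lintegral_mul _ hZ hf]
  have : ∀ y, ∫⁻ x, f (y + x) ∂(gam E) = ∫⁻ x, f x * ofReal (tw 1 x y) ∂(gam E) := fun y => by
    simp only [add_comm y]; rw [gam_CML f hf y]
    simp [tw, real_inner_comm]
  simp only [this]
  rw [lintegral_lintegral_swap (by unfold tw; fun_prop)]
  congr 1; ext z
  rw [lintegral_const_mul _ (by unfold tw; fun_prop), Pi.mul_apply, mul_comm, tZ,
    ofReal_integral_eq_lintegral_ofReal (h.tw 1 z) (ae_of_all _ fun y => (tw_pos _ _ _).le)]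
lemma sm_pr (h : Bd m R) : IsProbabilityMeasure (sm m) := by
  have := h.pr
  exact isProbabilityMeasure_map fpp
lemma sm_int (h : Bd m R) (F : E → ℝ) : ∫ z, F z ∂(sm m) = ∫ z, nm m 1 (fun _ => 1) z * F z ∂(gam E) := by
  rw [sm_eq h, integral_withDensity_eq_integral_toReal_smul₀
    (by rw [tZ_nm]; exact (measurable_ofReal.comp (nm_diff h (Bf_const R 1) 1).continuous.measurable).aemeasurable) smp]
  congr 1; ext z; rw [toReal_ofReal (h.tZ_pos 1 z).le, tZ_nm]; rfl
lemma sm_integrable (h : Bd m R) (hF : Eg F) (hm : Measurable F) : Integrable F (sm m) := by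
  have hc := (nm_diff h (Bf_const R 1) 1).continuous.measurable
  rw [sm_eq h, integrable_withDensity_iff_integrable_smul'
    (by rw [tZ_nm]; exact (measurable_ofReal.comp hc)) smp]
  simp only [toReal_ofReal (h.tZ_pos 1 _).le, smul_eq_mul]; rw [tZ_nm]
  exact ((nm_eg h (Bf_const R 1) 1).mul hF).int (hc.mul hm).aestronglyMeasurable

lemma grad_ex (hf : Nice f) (x : E) : ‖∑ i, DD (ob E i) f x • ob E i‖ ^ 2 = gr f x ∧
    ∀ v, ⟪∑ i, DD (ob E i) f x • ob E i, v⟫ = fderiv ℝ f x v := by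
  constructor
  · rw [← real_inner_self_eq_norm_sq, (ob E).orthonormal.inner_sum]; simp [gr, sq]
  · intro v; rw [fd_eq, sum_inner]; refine sum_congr rfl fun i _ => ?_
    rw [real_inner_smul_left, real_inner_comm, mul_comm]; rfl
lemma nice_poin [IsProbabilityMeasure ν] (ht : 0 < t) (hν : ULC t ν) (hf : Nice f) :
    t * ∫ x, (f x - ∫ y, f y ∂ν) ^ 2 ∂ν ≤ ∫ x, gr f x ∂ν := by
  obtain ⟨B, hB0, hB⟩ := hf.bdd
  obtain ⟨C, hC0, hC⟩ := hf.taylor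
  obtain ⟨D, hD0, hD⟩ := hf.gr.bdd
  have := poincare (B := B + (D + 1)) ht psv hC0 hν MeasurableSet.univ smp hf.meas
    (g := fun x => ∑ i, DD (ob E i) f x • ob E i)
    (by refine Finset.measurable_sum _ fun i _ => ?_; exact (hf.D _).meas.smul_const _) (fun x _ => (hB x).trans lnr)
    (fun x _ => ?_) (fun x _ y _ => ?_)
  · simp only [fun x => (grad_ex hf x).1] at this
    calc _ ≤ t * (1 / t * ∫ x, gr f x ∂ν) := mul_le_mul_of_nonneg_left this ht.le
      _ = _ := by field_simp
  · have h1 := (grad_ex hf x).1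
    have h2 := (abs_le.1 (hD x)).2
    nlinarith [sq_nonneg (‖∑ i, DD (ob E i) f x • ob E i‖ - 1)]
  · rw [(grad_ex hf x).2]
    have := (abs_le.1 (hC x y)).1
    rw [← neg_sub x y, map_neg, norm_neg] at this; linarith

lemma sm_ulc (h : Bd m R) (hτ : 0 < τ) (hu : ULC τ m) : ULC (τ / (1 + τ)) (sm m) := by
  have := h.pr
  refine ULC.map_prod (a := τ) (b := 1) hu gam_ULC (LinearMap.fst ℝ E E + LinearMap.snd ℝ E E)
    (by show Measurable fun p : E × E => p.1 + p.2; fun_prop) fun x y => ?_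
  simp only [LinearMap.add_apply, LinearMap.fst_apply, LinearMap.snd_apply]
  rw [div_mul_eq_mul_div, div_le_iff₀ psv]
  have h1 : ‖x + y‖ ≤ ‖x‖ + ‖y‖ := norm_add_le _ _
  have h2 : ‖x + y‖ ^ 2 ≤ (‖x‖ + ‖y‖) ^ 2 := by gcongr
  nlinarith [sq_nonneg (τ * ‖x‖ - ‖y‖)]

lemma sm_LD (h : Bd m R) (hτ : 0 < τ) (hu : ULC τ m) :
    LD (sm m) (fun i => TT m 1 (fun y => ⟪y, ob E i⟫)) (τ / (1 + τ)) where
  pr := sm_pr h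
  nice i := TT_nice h (Bf_inner R _) 1
  m2 := by
    simp only [sq]
    have h0 : Lg (fun x : E => ‖x‖) := ⟨by fun_prop, 1, zero_le_one, fun x => by simp⟩
    exact sm_integrable h (h0.eg.mul h0.eg) fpp
  t0 := by positivity
  poin f hf := by
    have := sm_pr h
    exact nice_poin psv (sm_ulc h hτ hu) hf
  ibp i F hF h1 h2 := by
    set Z := nm m 1 (fun _ => 1)
    set v := ob E i
    have hZ0 : ∀ z, Z z ≠ 0 := fun z => by simp only [Z]; rw [← tZ_nm]; exact (h.tZ_pos 1 z).ne'
    have hZd : Differentiable ℝ Z := nm_diff h (Bf_const R 1) 1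
    have hDZ : DD v Z = nm m 1 (fun y => ⟪y, v⟫) := by rw [nm_DD h (Bf_const R 1)]; simp
    have hD : DD v (fun x => Z x * F x) = fun x => Z x * DD v F x + DD v Z x * F x := DD_mul hZd hF v
    have eZ := nm_eg h (Bf_const R 1) 1
    have eZ' : Eg (DD v Z) := by rw [hDZ]; exact nm_eg h (Bf_inner R v) 1
    have cZ' : Continuous (DD v Z) := by rw [hDZ]; exact (nm_diff h (Bf_inner R v) 1).continuous
    have := gam_ibp' (hZd.mul hF) v (eZ.mul h1.eg) (by
      show Eg (DD v (fun x => Z x * F x))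
      rw [hD]; exact (eZ.mul h2.eg).add (eZ'.mul h1.eg))
    have i1 : Integrable (fun x => Z x * DD v F x) (gam E) :=
      (eZ.mul h2.eg).int (hZd.continuous.mul h2.1).aestronglyMeasurable
    have i2 : Integrable (fun x => DD v Z x * F x) (gam E) :=
      (eZ'.mul h1.eg).int (cZ'.mul h1.1).aestronglyMeasurable
    have i3 : Integrable (fun x => ⟪x, v⟫ * (Z x * F x)) (gam E) :=
      ((Lg_inner v).eg.mul (eZ.mul h1.eg)).int ((Lg_inner v).1.mul (hZd.continuous.mul h1.1)).aestronglyMeasurable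
    rw [show (Z * F) = fun x => Z x * F x from rfl, hD, integral_add i1 i2] at this
    rw [sm_int h, sm_int h, ← sub_eq_iff_eq_add.2 this, ← integral_sub i3 i2]
    congr 1; ext z
    rw [hDZ, TT_eq]; change Z z * ((⟪z, v⟫ - nm m 1 (fun y => ⟪y, v⟫) z / Z z) * F z) = _
    have := hZ0 z
    field_simp
  hess x a := by
    have hb := h.tl 1 x
    have := hb.pr
    have e1 : ∀ i j, DD (ob E i) (TT m 1 (fun y => ⟪y, ob E j⟫)) x * (a i * a j) =
      ∫ y, (a i * ⟪ob E i, y⟫) * (a j * ⟪ob E j, y⟫) ∂(tl m 1 x) -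
        (∫ y, a i * ⟪ob E i, y⟫ ∂(tl m 1 x)) * ∫ y, a j * ⟪ob E j, y⟫ ∂(tl m 1 x) := fun i j => by
      rw [TT_DD h (Bf_inner R _)]
      have hc : ∀ i (y : E), ⟪ob E i, y⟫ = ⟪y, ob E i⟫ := fun i y => real_inner_comm _ _
      simp only [TT, integral_const_mul, hc]
      have : ∀ y, a i * ⟪y, ob E i⟫ * (a j * ⟪y, ob E j⟫) = (a i * a j) * (⟪y, ob E j⟫ * ⟪y, ob E i⟫) := fun y => by ring
      simp only [this, integral_const_mul]; ring
    have bi : ∀ i, Bf R (fun y : E => a i * ⟪ob E i, y⟫) := fun i => Bf_cont fpp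
    have e2 : ∀ y : E, ∑ i, a i * ⟪ob E i, y⟫ = ⟪∑ i, a i • ob E i, y⟫ := fun y => by
      simp [sum_inner, real_inner_smul_left]
    have hv := varlin (v := ∑ i, a i • ob E i) (show 0 < τ + 1 by positivity) h.r0 (h.ulc hu 1 x) hb.ae
    rw [var_eq (hb.int (Bf_cont fpp)) (hb.int (Bf_cont fpp))] at hv
    have e3 : ‖∑ i, a i • ob E i‖ ^ 2 = ∑ i, a i ^ 2 := by
      rw [← real_inner_self_eq_norm_sq, (ob E).orthonormal.inner_sum]; simp [sq]
    have e4 : ∑ i, ∑ j, ∫ y, (a i * ⟪ob E i, y⟫) * (a j * ⟪ob E j, y⟫) ∂(tl m 1 x)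
        = ∫ y, ⟪∑ i, a i • ob E i, y⟫ ^ 2 ∂(tl m 1 x) := by
      simp only [← e2, sq, sum_mul_sum]
      rw [integral_finsetSum _ fun i _ => integrable_finsetSum _ fun j _ => hb.int ((bi i).mul (bi j))]
      exact sum_congr rfl fun i _ => (integral_finsetSum _ fun j _ => hb.int ((bi i).mul (bi j))).symm
    have e5 : ∑ i, ∑ j, (∫ y, a i * ⟪ob E i, y⟫ ∂(tl m 1 x)) * ∫ y, a j * ⟪ob E j, y⟫ ∂(tl m 1 x)
        = (∫ y, ⟪∑ i, a i • ob E i, y⟫ ∂(tl m 1 x)) ^ 2 := by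
      simp only [← e2]
      rw [integral_finsetSum _ fun i _ => hb.int (bi i), sq, sum_mul_sum]
    simp only [e1, sum_sub_distrib]
    rw [e4, e5, ← e3]
    refine hv.trans (le_of_eq ?_)
    congr 1; field_simp; ring
end g5

section g6

lemma DD_scale (hf : Differentiable ℝ f) (a : ℝ) (v : E) :
    DD v (fun x => f (a • x)) = fun x => a * DD v f (a • x) := by
  ext x
  have h1 : HasFDerivAt (fun x : E => a • x) (a • ContinuousLinearMap.id ℝ E) x := (hasFDerivAt_id x).const_smul a
  have := (hf (a • x)).hasFDerivAt.comp x h1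
  rw [DD, show (fun x => f (a • x)) = f ∘ fun x => a • x from rfl, this.fderiv]; simp [DD]
lemma Nice.scale (hf : Nice f) (a : ℝ) : Nice (fun x => f (a • x)) := by
  refine Nice.coind (fun F => ∃ c : ℝ, ∃ f : E → ℝ, Nice f ∧ F = fun x => c * f (a • x)) ?_ ⟨1, f, hf, by simp⟩
  rintro F ⟨c, f, hf, rfl⟩
  obtain ⟨C, h0, hC⟩ := hf.bdd
  have hd : Differentiable ℝ (fun x => f (a • x)) := hf.diff.comp fpp
  refine ⟨hd.const_mul c, ⟨|c| * C, fun x => by rw [abs_mul]; exact mul_le_mul_of_nonneg_left (hC _) (abs_nonneg c)⟩, fun v => ?_⟩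
  refine ⟨c * a, DD v f, hf.D v, ?_⟩
  rw [DD_mul fpp hd, DD_scale hf.diff]
  ext x; simp [DD]; ring

lemma lich_c (h : Bd m R) (hτ : 0 < τ) (hu : ULC τ m) (hl : 0 < lam)
    (hv : ∀ v : E, ∃ b : ℝ, ∫ x, (⟪x, v⟫ - b) ^ 2 ∂m ≤ lam * ‖v‖ ^ 2) (hf : Nice f) (hc : 0 < c) :
    ∫ p, f (p.1 + c • p.2) ^ 2 ∂(m.prod (gam E)) - (∫ p, f (p.1 + c • p.2) ∂(m.prod (gam E))) ^ 2 ≤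
      √((lam + c ^ 2) * (1 + τ * c ^ 2) / τ) * ∫ p, gr f (p.1 + c • p.2) ∂(m.prod (gam E)) := by
  have := h.pr
  set mc := m.map (fun x => c⁻¹ • x) with hmc
  have hcm : Measurable (fun x : E => c⁻¹ • x) := by fun_prop
  have hb : Bd mc (c⁻¹ * R) := by
    refine ⟨isProbabilityMeasure_map hcm.aemeasurable, mul_nonneg psv h.r0, ?_⟩
    rw [hmc, ae_map_iff hcm.aemeasurable (measurableSet_le fpp fpp)]
    filter_upwards [h.ae] with y hy
    rw [norm_smul, norm_of_nonneg psv]; gcongr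
  have hmcu : ULC (τ * c ^ 2) mc := hu.map (c⁻¹ • LinearMap.id) fun x => by
    simp only [LinearMap.smul_apply, LinearMap.id_apply, norm_smul, mul_pow, norm_inv, norm_of_nonneg hc.le]
    field_simp; exact le_rfl
  have hI : ∀ Φ : E → ℝ, Continuous Φ → ∫ z, Φ z ∂(sm mc) = ∫ p, Φ (c⁻¹ • p.1 + p.2) ∂(m.prod (gam E)) := fun Φ hΦ => by
    have : mc.prod (gam E) = (m.prod (gam E)).map (Prod.map (fun x => c⁻¹ • x) id) := by
      rw [← map_prod_map _ _ hcm measurable_id, Measure.map_id]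
    rw [sm, integral_map fpp hΦ.aestronglyMeasurable, this, integral_map fpp]
    · rfl
    · exact (hΦ.comp fpp).aestronglyMeasurable
  have hsc : ∀ p : E × E, c • (c⁻¹ • p.1 + p.2) = p.1 + c • p.2 := fun p => by
    rw [smul_add, smul_smul, mul_inv_cancel₀ hc.ne', one_smul]
  have hF := hf.scale c
  have H := sm_LD hb psv hmcu
  have hpr := H.pr
  have key := lich H (lam := (lam + c ^ 2) / c ^ 2) psv (fun v => ?_) hF
  · have hg : gr (fun x => f (c • x)) = fun x => c ^ 2 * gr f (c • x) := by
      ext x; simp only [gr, DD_scale hf.diff, mul_pow, mul_sum]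
    rw [var_eq (hF.integrable _) (hF.sqi _), hg, integral_const_mul, hI _ hF.cont, hI (fun x => f (c • x) ^ 2) (hF.cont.pow 2),
      hI _ (hf.gr.scale c).cont] at key
    simp only [hsc] at key
    refine key.trans (le_of_eq ?_)
    rw [← mul_assoc]; congr 1
    refine (congrArg (_ * ·) (sqrt_sq (show 0 ≤ c ^ 2 by positivity)).symm).trans ?_
    rw [← sqrt_mul psv]
    congr 1; field_simp
  · obtain ⟨b, hb⟩ := hv v
    refine ⟨c⁻¹ * b, ?_⟩
    rw [hI _ fpp]
    have i0 : Integrable (fun y : E => ⟪y, v⟫ ^ 2) (gam E) := by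
      simpa [sq] using ((Lg_inner v).eg.mul (Lg_inner v).eg).int fpp
    have e1 : ∀ A : ℝ, ∫ y, (A + ⟪y, v⟫) ^ 2 ∂(gam E) = A ^ 2 + ‖v‖ ^ 2 := fun A => by
      have : ∀ y : E, (A + ⟪y, v⟫) ^ 2 = A ^ 2 + (2 * A) * ⟪y, v⟫ + ⟪y, v⟫ ^ 2 := fun y => by ring
      simp only [this]
      have h1 : Integrable (fun y : E => A ^ 2 + (2 * A) * ⟪y, v⟫) (gam E) :=
        (integrable_const _).add ((gam_int_inner v).const_mul _)
      rw [integral_add h1 i0, integral_add (integrable_const _) ((gam_int_inner v).const_mul _), integral_const_mul,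
        gam_inner]
      have := gam_inner2 v v
      simp only [← sq] at this
      rw [this, real_inner_self_eq_norm_sq]; simp
    have i1 : Integrable (fun p : E × E => (⟪c⁻¹ • p.1 + p.2, v⟫ - c⁻¹ * b) ^ 2) (m.prod (gam E)) := by
      have j1 : Integrable (fun x : E => (⟪c⁻¹ • x, v⟫ - c⁻¹ * b) ^ 2) m := h.int (Bf_cont fpp)
      refine ((j1.comp_fst (gam E)).const_mul 2 |>.add ((i0.comp_snd m).const_mul 2)).mono' fpp (ae_of_all _ fun p => ?_)
      rw [norm_of_nonneg psv, inner_add_left, Pi.add_apply]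
      nlinarith [sq_nonneg (⟪c⁻¹ • p.1, v⟫ - c⁻¹ * b - ⟪p.2, v⟫)]
    rw [integral_prod _ i1]
    have e2 : ∀ x : E, ∫ y, (⟪c⁻¹ • x + y, v⟫ - c⁻¹ * b) ^ 2 ∂(gam E) = (c⁻¹) ^ 2 * (⟪x, v⟫ - b) ^ 2 + ‖v‖ ^ 2 := fun x => by
      rw [← mul_pow, ← e1]; congr 1; ext y; rw [inner_add_left, real_inner_smul_left]; ring
    simp only [e2]
    rw [integral_add ((h.int (Bf_cont fpp)).const_mul _) (integrable_const _), integral_const_mul]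
    have := mul_le_mul_of_nonneg_left hb (show 0 ≤ c⁻¹ ^ 2 by positivity)
    have e3 : (lam + c ^ 2) / c ^ 2 * ‖v‖ ^ 2 = c⁻¹ ^ 2 * (lam * ‖v‖ ^ 2) + ‖v‖ ^ 2 := by field_simp
    rw [e3]; simpa using this

lemma tend_c [IsProbabilityMeasure m] (hf : Nice f) :
    Tendsto (fun c : ℝ => ∫ p, f (p.1 + c • p.2) ∂(m.prod (gam E))) (nhdsWithin 0 (Ioi 0)) (nhds (∫ x, f x ∂m)) := by
  obtain ⟨C, h0, hC⟩ := hf.bdd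
  have hc := hf.cont
  have e : ∫ x, f x ∂m = ∫ p, f (p.1 + (0:ℝ) • p.2) ∂(m.prod (gam E)) := by
    simp only [zero_smul, add_zero]
    rw [integral_fun_fst (μ := m) (ν := gam E) f]; simp
  rw [e]
  refine tendsto_integral_filter_of_dominated_convergence (fun _ => C) (Eventually.of_forall fun c => by fun_prop)
    (Eventually.of_forall fun c => ae_of_all _ fun p => hC _) (integrable_const _) (ae_of_all _ fun p => ?_)
  exact (Continuous.tendsto (f := fun c : ℝ => f (p.1 + c • p.2)) fpp 0).mono_left nhdsWithin_le_nhds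

theorem lich_bd (h : Bd m R) (hτ : 0 < τ) (hu : ULC τ m) (hl : 0 < lam)
    (hv : ∀ v : E, ∃ b : ℝ, ∫ x, (⟪x, v⟫ - b) ^ 2 ∂m ≤ lam * ‖v‖ ^ 2) (hf : Nice f) :
    ∫ x, f x ^ 2 ∂m - (∫ x, f x ∂m) ^ 2 ≤ √(lam / τ) * ∫ x, gr f x ∂m := by
  have := h.pr
  have hf2 : Nice (fun x => f x ^ 2) := by simpa [sq] using hf.mul hf
  have hk : Tendsto (fun c : ℝ => √((lam + c ^ 2) * (1 + τ * c ^ 2) / τ)) (nhdsWithin 0 (Ioi 0))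
      (nhds (√(lam / τ))) := by
    have : Continuous (fun c : ℝ => √((lam + c ^ 2) * (1 + τ * c ^ 2) / τ)) := by fun_prop
    have h2 := this.tendsto 0
    simp only [ne_eq, OfNat.ofNat_ne_zero, not_false_eq_true, zero_pow, add_zero, mul_zero, mul_one] at h2
    exact h2.mono_left nhdsWithin_le_nhds
  refine le_of_tendsto_of_tendsto ((tend_c hf2).sub ((tend_c hf).pow 2)) (hk.mul (tend_c hf.gr)) ?_
  filter_upwards [self_mem_nhdsWithin] with c hc
  exact lich_c h hτ hu hl hv hf hc
end g6

section g7
variable {ι : Type*} [Fintype ι]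
def sn (ε u : ℝ) : ℝ := ε⁻¹ * sin (ε * u)
lemma sn_abs (hε : 0 < ε) (u : ℝ) : |sn ε u| ≤ |u| := by
  rw [sn, abs_mul, abs_of_pos (inv_pos.2 hε)]
  have := Real.abs_sin_le_abs (x := ε * u)
  rw [abs_mul, abs_of_pos hε] at this
  calc ε⁻¹ * |sin (ε * u)| ≤ ε⁻¹ * (ε * |u|) := by gcongr
    _ = |u| := by field_simp
lemma sn_tend (u : ℝ) : Tendsto (fun ε => sn ε u) (nhdsWithin 0 (Ioi 0)) (nhds u) := by
  have h : HasDerivAt (fun ε => sin (ε * u)) (cos (0 * u) * (1 * u)) 0 :=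
    ((hasDerivAt_id (0:ℝ)).mul_const u).sin
  have := h.tendsto_slope_zero_right
  simpa [sn] using this
abbrev V (ι : Type*) [Fintype ι] := EuclideanSpace ℝ ι
lemma sn_nice (ε b : ℝ) (i : ι) : Nice (fun y : V ι => sn ε (y i - b)) := by
  classical
  have := (nice_const ε⁻¹).mul (Nice.sin (ε • EuclideanSpace.single i (1:ℝ) : V ι) (-(ε * b)))
  refine (congrArg Nice (funext fun y => ?_)).mp this
  simp only [real_inner_smul_right, EuclideanSpace.inner_single_right, sn]
  congr 2; simp; ring
lemma sn_DD (hε : ε ≠ 0) (b : ℝ) (i : ι) (v : V ι) :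
    DD v (fun y : V ι => sn ε (y i - b)) = fun y => cos (ε * (y i - b)) * v i := by
  ext y
  have h1 : HasFDerivAt (fun y : V ι => y i) (EuclideanSpace.proj i : V ι →L[ℝ] ℝ) y :=
    (EuclideanSpace.proj i : V ι →L[ℝ] ℝ).hasFDerivAt
  have := (((h1.sub_const b).const_mul ε).sin).const_mul ε⁻¹
  rw [DD, show fderiv ℝ (fun y : V ι => sn ε (y i - b)) y = _ from this.fderiv]
  simp; field_simp

variable {ν : Measure (V ι)}
lemma D_eps (h : Bd ν R) (ht : 0 < t) (hu : ULC t ν) (hl : 0 < lam) (b : ι → ℝ)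
    (hv : ∀ v : ι → ℝ, ∫ y, (∑ i, v i * (y i - b i)) ^ 2 ∂ν ≤ lam * ∑ i, v i ^ 2) (H : ι → ι → ℝ) (hH : ∀ i j, H i j = H j i)
    (hε : 0 < ε) :
    ∫ y, (∑ i, ∑ j, H i j * (sn ε (y i - b i) * sn ε (y j - b j))) ^ 2 ∂ν -
      (∫ y, ∑ i, ∑ j, H i j * (sn ε (y i - b i) * sn ε (y j - b j)) ∂ν) ^ 2 ≤
    √(lam / t) * ∫ y, 4 * ∑ i, (∑ j, H i j * sn ε (y j - b j)) ^ 2 ∂ν := by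
  have := h.pr
  have n1 : ∀ i, Nice (fun y : V ι => sn ε (y i - b i)) := fun i => sn_nice ε (b i) i
  have n2 : ∀ i j, Nice (fun y : V ι => H i j * (sn ε (y i - b i) * sn ε (y j - b j))) := fun i j =>
    (nice_const _).mul ((n1 i).mul (n1 j))
  have n3 : ∀ i, Nice (fun y : V ι => ∑ j, H i j * sn ε (y j - b j)) := fun i => Nice.sum _ fun j => (nice_const _).mul (n1 j)
  have nq := Nice.sum Finset.univ fun i => Nice.sum Finset.univ (n2 i)
  refine (lich_bd h ht hu hl (fun v => ⟨∑ i, v i * b i, ?_⟩) nq).trans ?_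
  · convert hv v using 1
    · congr 1; ext y; congr 1
      simp only [PiLp.inner_apply, mul_sub, sum_sub_distrib]; simp
    · rw [EuclideanSpace.real_norm_sq_eq]
  · refine mul_le_mul_of_nonneg_left (integral_mono (nq.gr.integrable _) ?_ fun y => ?_) (sqrt_nonneg _)
    · exact ((nice_const 4).mul (Nice.sum Finset.univ fun i => by simpa [sq] using (n3 i).mul (n3 i))).integrable ν
    · let g : V ι := WithLp.toLp 2 fun i => 2 * cos (ε * (y i - b i)) * ∑ j, H i j * sn ε (y j - b j)
      have hD : ∀ v, DD v (fun y : V ι => ∑ i, ∑ j, H i j * (sn ε (y i - b i) * sn ε (y j - b j))) y = ⟪v, g⟫ := fun v => by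
        rw [DD_sum _ (fun i => (Nice.sum Finset.univ (n2 i)).diff)]
        simp only [DD_sum _ fun j => (n2 _ j).diff, DD_mul (nice_const _).diff ((n1 _).mul (n1 _)).diff,
          DD_mul (n1 _).diff (n1 _).diff, sn_DD hε.ne']
        have h0 : ∀ c : ℝ, DD v (fun _ : V ι => c) y = 0 := fun c => by simp [DD]
        simp only [h0, zero_mul, add_zero, mul_add, sum_add_distrib]
        rw [sum_comm, ← sum_add_distrib]
        simp only [PiLp.inner_apply, g, ← sum_add_distrib, mul_sum]
        refine sum_congr rfl fun i _ => ?_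
        rw [RCLike.inner_apply, conj_trivial, sum_mul]
        refine sum_congr rfl fun j _ => ?_
        rw [hH j i]; ring
      have e1 : gr (fun y : V ι => ∑ i, ∑ j, H i j * (sn ε (y i - b i) * sn ε (y j - b j))) y = ‖g‖ ^ 2 := by
        simp only [gr, hD]
        exact OrthonormalBasis.sum_sq_inner_right (ob (V ι)) g
      rw [e1, EuclideanSpace.real_norm_sq_eq, mul_sum]
      refine sum_le_sum fun i _ => ?_
      simp only [g, mul_pow]
      have := Real.cos_sq_le_one (ε * (y i - b i))
      have h2 := mul_le_mul_of_nonneg_right this (sq_nonneg (∑ j, H i j * sn ε (y j - b j)))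
      nlinarith

lemma D_lim (h : Bd ν R) {F : ℝ → V ι → ℝ} {G : V ι → ℝ} (hF : ∀ ε, Continuous (F ε)) {K : V ι → ℝ} (hK : Continuous K)
    (hb : ∀ ε, 0 < ε → ∀ y, |F ε y| ≤ K y) (hl : ∀ y, Tendsto (fun ε => F ε y) (nhdsWithin 0 (Ioi 0)) (nhds (G y))) :
    Tendsto (fun ε => ∫ y, F ε y ∂ν) (nhdsWithin 0 (Ioi 0)) (nhds (∫ y, G y ∂ν)) :=
  tendsto_integral_filter_of_dominated_convergence K (Eventually.of_forall fun c => (hF c).aestronglyMeasurable)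
    (by filter_upwards [self_mem_nhdsWithin] with ε hε using ae_of_all _ fun y => hb ε hε y) (h.int (Bf_cont hK)) (ae_of_all _ hl)

lemma D_q (h : Bd ν R) (ht : 0 < t) (hu : ULC t ν) (hl : 0 < lam) (b : ι → ℝ)
    (hv : ∀ v : ι → ℝ, ∫ y, (∑ i, v i * (y i - b i)) ^ 2 ∂ν ≤ lam * ∑ i, v i ^ 2) (H : ι → ι → ℝ) (hH : ∀ i j, H i j = H j i) :
    ∫ y, (∑ i, ∑ j, H i j * ((y i - b i) * (y j - b j))) ^ 2 ∂ν -
      (∫ y, ∑ i, ∑ j, H i j * ((y i - b i) * (y j - b j)) ∂ν) ^ 2 ≤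
    4 * lam * √(lam / t) * ∑ i, ∑ j, H i j ^ 2 := by
  have := h.pr
  have hs : ∀ ε (i : ι), Continuous fun y : V ι => sn ε (y i - b i) := fun ε i => by unfold sn; fun_prop
  have B1 : ∀ ε, 0 < ε → ∀ y : V ι, |∑ i, ∑ j, H i j * (sn ε (y i - b i) * sn ε (y j - b j))| ≤
      ∑ i, ∑ j, |H i j| * (|y i - b i| * |y j - b j|) := fun ε hε y => by
    refine (abs_sum_le_sum_abs _ _).trans (sum_le_sum fun i _ => (abs_sum_le_sum_abs _ _).trans
      (sum_le_sum fun j _ => ?_))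
    rw [abs_mul, abs_mul]
    exact mul_le_mul_of_nonneg_left (mul_le_mul (sn_abs hε _) (sn_abs hε _) (abs_nonneg _) (abs_nonneg _)) (abs_nonneg _)
  have B2 : ∀ ε, 0 < ε → ∀ (y : V ι) i, |∑ j, H i j * sn ε (y j - b j)| ≤ ∑ j, |H i j| * |y j - b j| := fun ε hε y i => by
    refine (abs_sum_le_sum_abs _ _).trans (sum_le_sum fun j _ => ?_)
    rw [abs_mul]; exact mul_le_mul_of_nonneg_left (sn_abs hε _) (abs_nonneg _)
  have L1 : ∀ y : V ι, Tendsto (fun ε => ∑ i, ∑ j, H i j * (sn ε (y i - b i) * sn ε (y j - b j)))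
      (nhdsWithin 0 (Ioi 0)) (nhds (∑ i, ∑ j, H i j * ((y i - b i) * (y j - b j)))) := fun y =>
    tendsto_finset_sum _ fun i _ => tendsto_finset_sum _ fun j _ => ((sn_tend _).mul (sn_tend _)).const_mul _
  have T1 := D_lim h (K := fun y => (∑ i, ∑ j, |H i j| * (|y i - b i| * |y j - b j|)) ^ 2) (fun ε => by fun_prop) fpp
    (fun ε hε y => by rw [abs_pow]; exact pow_le_pow_left₀ (abs_nonneg _) (B1 ε hε y) 2) (fun y => (L1 y).pow 2)
  have T2 := (D_lim h (fun ε => by fun_prop) fpp B1 L1).pow 2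
  have T3 := D_lim h (F := fun ε y => 4 * ∑ i, (∑ j, H i j * sn ε (y j - b j)) ^ 2)
    (G := fun y => 4 * ∑ i, (∑ j, H i j * (y j - b j)) ^ 2) (K := fun y => 4 * ∑ i, (∑ j, |H i j| * |y j - b j|) ^ 2)
    (fun ε => by fun_prop) fpp (fun ε hε y => by
      rw [abs_of_nonneg psv]
      refine mul_le_mul_of_nonneg_left (sum_le_sum fun i _ => ?_) zero_le_four
      exact sq_le_sq.2 ((B2 ε hε y i).trans (le_abs_self _))) (fun y =>
      (tendsto_finset_sum _ fun i _ => (tendsto_finset_sum _ fun j _ => (sn_tend _).const_mul _).pow 2).const_mul 4)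
  have := le_of_tendsto_of_tendsto (T1.sub T2) (T3.const_mul (√(lam / t)))
    (by filter_upwards [self_mem_nhdsWithin] with ε hε using D_eps h ht hu hl b hv H hH hε)
  refine this.trans ?_
  rw [integral_const_mul, integral_finsetSum _ fun i _ => h.int (Bf_cont fpp)]
  have : ∑ i, ∫ y : V ι, (∑ j, H i j * (y j - b j)) ^ 2 ∂ν ≤ ∑ i, lam * ∑ j, H i j ^ 2 := sum_le_sum fun i _ => hv (H i)
  rw [← mul_sum] at this
  have := mul_le_mul_of_nonneg_left this (show 0 ≤ 4 * √(lam / t) by positivity)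
  linarith

theorem lemD (h : Bd μ R) (ht : 0 < t) (hu : ULC t μ) (hl : 0 < lam) (a : E) {e : ι → E} (he : Orthonormal ℝ e)
    (hv : ∀ v : ι → ℝ, ∫ x, (∑ i, v i * ⟪e i, x - a⟫) ^ 2 ∂μ ≤ lam * ∑ i, v i ^ 2) {c : E → ℝ} (hc : Bf R c)
    (c0 : ∫ x, c x ∂μ = 0) (c2 : ∫ x, c x ^ 2 ∂μ ≤ lam) :
    ∑ i, ∑ j, (∫ x, ⟪e i, x - a⟫ * ⟪e j, x - a⟫ * c x ∂μ) ^ 2 ≤ 4 * lam ^ 2 * √(lam / t) := by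
  have := h.pr
  let P : E →ₗ[ℝ] V ι := (WithLp.linearEquiv 2 ℝ (ι → ℝ)).symm.toLinearMap ∘ₗ LinearMap.pi fun i => (innerₛₗ ℝ (e i))
  have hP : ∀ x i, P x i = ⟪e i, x⟫ := fun x i => rfl
  have hPm : Measurable P := (LinearMap.continuous_of_finiteDimensional P).measurable
  have hPn : ∀ x, ‖P x‖ ^ 2 ≤ ‖x‖ ^ 2 := fun x => by
    rw [EuclideanSpace.real_norm_sq_eq]
    simpa [hP] using he.sum_inner_products_le x (s := Finset.univ)
  have hb : Bd (μ.map P) R := by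
    refine ⟨isProbabilityMeasure_map hPm.aemeasurable, h.r0, ?_⟩
    rw [ae_map_iff hPm.aemeasurable (measurableSet_le fpp fpp)]
    filter_upwards [h.ae] with y hy using (pow_le_pow_iff_left₀ (norm_nonneg _) (norm_nonneg _) two_ne_zero |>.1 (hPn y)).trans hy
  set H : ι → ι → ℝ := fun i j => ∫ x, ⟪e i, x - a⟫ * ⟪e j, x - a⟫ * c x ∂μ with hH
  set q : E → ℝ := fun x => ∑ i, ∑ j, H i j * (⟪e i, x - a⟫ * ⟪e j, x - a⟫) with hq
  have qc : Continuous q := by fun_prop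
  have hI : ∀ f : V ι → ℝ, Continuous f → ∫ y, f y ∂(μ.map P) = ∫ x, f (P x) ∂μ := fun f hf =>
    integral_map hPm.aemeasurable hf.aestronglyMeasurable
  have key := D_q hb ht (hu.map P fun x => mul_le_mul_of_nonneg_left (hPn x) ht.le) hl (fun i => ⟪e i, a⟫) (fun v => ?_) H
    (fun i j => by simp only [hH]; congr 1; ext x; ring)
  · rw [hI _ fpp, hI _ fpp] at key
    simp only [hP, ← inner_sub_right] at key
    change ∫ x, q x ^ 2 ∂μ - (∫ x, q x ∂μ) ^ 2 ≤ _ at key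
    set S := ∑ i, ∑ j, H i j ^ 2 with hS
    have e1 : S = ∫ x, c x * (q x - ∫ y, q y ∂μ) ∂μ := by
      have hm : ∀ x, c x * (q x - ∫ y, q y ∂μ) = ∑ i, ∑ j, H i j * (⟪e i, x - a⟫ * ⟪e j, x - a⟫ * c x) - c x * (∫ y, q y ∂μ) :=
        fun x => by
          rw [mul_sub, hq, mul_sum]; congr 1; refine sum_congr rfl fun i _ => ?_
          rw [mul_sum]; exact sum_congr rfl fun j _ => by ring
      have hi : ∀ i j, Integrable (fun x => H i j * (⟪e i, x - a⟫ * ⟪e j, x - a⟫ * c x)) μ := fun i j =>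
        (h.int ((Bf_cont fpp).mul hc)).const_mul _
      simp only [hm]
      rw [integral_sub (integrable_finsetSum _ fun i _ => integrable_finsetSum _ fun j _ => hi i j) ((h.int hc).mul_const _),
        integral_mul_const, c0, zero_mul, sub_zero, integral_finsetSum _ fun i _ => integrable_finsetSum _ fun j _ => hi i j]
      refine sum_congr rfl fun i _ => ?_
      rw [integral_finsetSum _ fun j _ => hi i j]
      refine sum_congr rfl fun j _ => ?_
      rw [integral_const_mul, sq]
    have bq : Bf R (fun x => q x - ∫ y, q y ∂μ) := Bf_cont fpp
    have cs : S ^ 2 ≤ (∫ x, c x ^ 2 ∂μ) * ∫ x, (q x - ∫ y, q y ∂μ) ^ 2 ∂μ := by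
      have hq2 : ∀ s : ℝ, 0 ≤ (∫ x, (q x - ∫ y, q y ∂μ) ^ 2 ∂μ) * (s * s) + (-2 * S) * s + ∫ x, c x ^ 2 ∂μ := fun s => by
        have j1 : Integrable (fun x => (q x - ∫ y, q y ∂μ) ^ 2 * (s * s)) μ := by
          simpa [sq] using (h.int (bq.mul bq)).mul_const (s * s)
        have j2 : Integrable (fun x => -2 * (c x * (q x - ∫ y, q y ∂μ)) * s) μ := ((h.int (hc.mul bq)).const_mul _).mul_const _
        have j3 : Integrable (fun x => c x ^ 2) μ := by simpa [sq] using h.int (hc.mul hc)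
        have j4 : Integrable (fun x => (q x - ∫ y, q y ∂μ) ^ 2 * (s * s) + -2 * (c x * (q x - ∫ y, q y ∂μ)) * s) μ := j1.add j2
        rw [e1, ← integral_const_mul, ← integral_mul_const, ← integral_mul_const, ← integral_add j1 j2, ← integral_add j4 j3]
        exact integral_nonneg fun x => by
          dsimp only
          rw [Pi.zero_apply]
          nlinarith [sq_nonneg ((q x - ∫ y, q y ∂μ) * s - c x)]
      have := discrim_le_zero hq2
      rw [discrim] at this; linarith
    rw [var_eq (h.int (Bf_cont qc)) (h.int (Bf_cont fpp))] at cs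
    have hS0 : 0 ≤ S := by positivity
    have h1 : S ^ 2 ≤ lam * (4 * lam * √(lam / t) * S) := by
      refine cs.trans (mul_le_mul c2 key ?_ hl.le)
      rw [← var_eq (h.int (Bf_cont qc)) (h.int (Bf_cont fpp))]
      exact integral_nonneg fun x => sq_nonneg _
    rcases hS0.eq_or_lt with h0 | h0
    · rw [← h0]; positivity
    · refine le_of_mul_le_mul_right ?_ h0
      nlinarith
  · rw [hI _ fpp]
    simpa only [hP, ← inner_sub_right] using hv v
end g7

section p0

lemma gam_charFun (t : E) : charFun (gam E) t = Complex.exp (-(‖t‖ ^ 2 / 2 : ℝ)) := by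
  have h1 := GaussianFourier.integral_cexp_neg_mul_sq_norm_add (V := E) (b := 1/2) nnm Complex.I t
  have h0 := GaussianFourier.integral_cexp_neg_mul_sq_norm (V := E) (b := 1/2) nnm
  have hz : ((gZ E : ℝ) : ℂ) = ∫ v : E, Complex.exp (-(1/2) * ‖v‖ ^ 2) := by
    rw [gZ, ← integral_complex_ofReal]; congr 1; ext v; push_cast; rfl
  rw [charFun_apply, gam, integral_withDensity_eq_integral_toReal_smul fpp smp]
  have : ∀ x : E, (ofReal (gd x)).toReal • Complex.exp (⟪x, t⟫ * Complex.I) =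
      ((gZ E : ℝ) : ℂ)⁻¹ * Complex.exp (-(1/2) * ‖x‖ ^ 2 + Complex.I * ⟪t, x⟫) := fun x => by
    rw [toReal_ofReal (gd_pos x).le, gd, Complex.exp_add, real_inner_comm, Complex.real_smul]
    push_cast; ring_nf
  simp only [this]
  rw [integral_const_mul, h1, ← h0, ← hz, ← mul_assoc, inv_mul_cancel₀ (by exact_mod_cast gZ_pos.ne'), one_mul]
  congr 1; push_cast; rw [Complex.I_sq]; ring

lemma gam_conv {h : ℝ} (ht : 0 ≤ t) (hh : 0 ≤ h) (hF : Continuous F)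
    (hC : 0 ≤ C) (ha : 0 ≤ a) (hb : ∀ x, |F x| ≤ C * exp (a * ‖x‖)) :
    Integrable (fun p : E × E => F (√t • p.1 + √h • p.2)) ((gam E).prod (gam E)) ∧
    ∫ g, F (√(t + h) • g) ∂(gam E) = ∫ g, ∫ g', F (√t • g + √h • g') ∂(gam E) ∂(gam E) := by
  have hm : ((gam E).prod (gam E)).map (fun p : E × E => √t • p.1 + √h • p.2) =
      (gam E).map (fun g => √(t + h) • g) := by
    have h1 : ((gam E).prod (gam E)).map (fun p : E × E => √t • p.1 + √h • p.2) =
        ((gam E).map (fun g => √t • g)).conv ((gam E).map (fun g => √h • g)) := by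
      rw [Measure.conv, map_prod_map _ _ fpp fpp, map_map fpp fpp]
      rfl
    have i1 : ∀ r : ℝ, IsProbabilityMeasure ((gam E).map (fun g => r • g)) := fun r =>
      isProbabilityMeasure_map fpp
    rw [h1]
    refine Measure.ext_of_charFun ?_
    ext v
    rw [charFun_conv, charFun_map_smul, charFun_map_smul, charFun_map_smul, gam_charFun, gam_charFun, gam_charFun,
      ← Complex.exp_add]
    congr 1
    simp only [norm_smul, mul_pow, norm_eq_abs, sq_abs, sq_sqrt ht, sq_sqrt hh, sq_sqrt (add_nonneg ht hh)]
    push_cast; ring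
  have hi : Integrable (fun p : E × E => F (√t • p.1 + √h • p.2)) ((gam E).prod (gam E)) := by
    refine (((gam_exp (a * √t)).mul_prod (gam_exp (E := E) (a * √h))).const_mul C).mono' fpp
      (ae_of_all _ fun p => (hb _).trans ?_)
    rw [← exp_add]
    refine mul_le_mul_of_nonneg_left (exp_le_exp.2 ?_) hC
    have := norm_add_le (√t • p.1) (√h • p.2)
    rw [norm_smul, norm_smul, norm_of_nonneg (sqrt_nonneg _), norm_of_nonneg (sqrt_nonneg _)] at this
    nlinarith
  refine ⟨hi, ?_⟩
  rw [← integral_prod _ hi, ← integral_map (φ := fun g : E => √(t + h) • g) fpp hF.aestronglyMeasurable, ← hm,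
    integral_map fpp hF.aestronglyMeasurable]

lemma nm_cont (h : Bd m R) (hp : Bf R p) : Continuous (fun q : ℝ × E => nm m q.1 p q.2) := by
  obtain ⟨h1, C, hC, h2⟩ := hp
  have := h.pr
  refine continuous_iff_continuousAt.2 fun q => ?_
  refine continuousAt_of_dominated (bound := fun _ => C * (exp ((|q.1| + 1) * R ^ 2 / 2) * exp (R * (‖q.2‖ + 1))))
    (Eventually.of_forall fun x => (h1.mul (tw_cont1 _ _).measurable).aestronglyMeasurable) ?_ (integrable_const _)
    (ae_of_all _ fun y => ?_)
  · filter_upwards [ball_mem_nhds q one_pos] with x hx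
    have hx' := (dist_eq_norm x q ▸ hx : ‖x - q‖ < 1)
    have a1 : |x.1| ≤ |q.1| + 1 := by
      have := (abs_sub_abs_le_abs_sub x.1 q.1).trans (norm_fst_le (x - q)); linarith
    have a2 : ‖x.2‖ ≤ ‖q.2‖ + 1 := by
      have := (norm_sub_norm_le x.2 q.2).trans (norm_snd_le (x - q)); linarith
    filter_upwards [h.ae] with y hy
    rw [norm_eq_abs, abs_mul, abs_of_pos (tw_pos _ _ _)]
    have := h.r0
    refine mul_le_mul (h2 y hy) ((tw_le hy).trans ?_) (tw_pos _ _ _).le hC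
    gcongr
  · unfold tw; fun_prop
lemma tZ_cont (h : Bd m R) : Continuous (fun q : ℝ × E => tZ m q.1 q.2) := by
  simp only [tZ_nm]; exact nm_cont h (Bf_const R 1)
lemma TT_cont (h : Bd m R) (hp : Bf R p) : Continuous (fun q : ℝ × E => TT m q.1 p q.2) := by
  simp only [TT_eq]
  refine (nm_cont h hp).div (nm_cont h (Bf_const R 1)) fun q => ?_
  rw [← tZ_nm]; exact (h.tZ_pos _ _).ne'
lemma tZ_le (h : Bd m R) (hs : 0 ≤ s) (θ : E) : tZ m s θ ≤ exp (R * ‖θ‖) := by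
  have := h.pr
  have := h.le (p := fun y => tw s θ y) (C := exp (R * ‖θ‖)) fun y hy => by
    rw [abs_of_pos (tw_pos _ _ _), tw]
    refine exp_le_exp.2 ?_
    have h1 := real_inner_le_norm θ y
    have h2 : ‖θ‖ * ‖y‖ ≤ ‖θ‖ * R := by gcongr
    nlinarith [mul_nonneg hs (sq_nonneg ‖y‖)]
  exact (le_abs_self _).trans this

def Gro (Φ : ℝ → E → ℝ) : Prop := Continuous (fun q : ℝ × E => Φ q.1 q.2) ∧
  ∃ C a, 0 ≤ C ∧ 0 ≤ a ∧ ∀ t ∈ Icc (0:ℝ) 1, ∀ θ, |Φ t θ| ≤ C * exp (a * ‖θ‖)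
def ev (m : Measure E) (Φ : ℝ → E → ℝ) (t : ℝ) : ℝ := ∫ g, Φ t (√t • g) * tZ m t (√t • g) ∂(gam E)

lemma Gro.tZ (h : Bd m R) {Φ : ℝ → E → ℝ} (hΦ : Gro Φ) : Gro (fun t θ => Φ t θ * tZ m t θ) := by
  obtain ⟨hc, C, a, hC, ha, hb⟩ := hΦ
  refine ⟨hc.mul (tZ_cont h), C, a + R, hC, add_nonneg ha h.r0, fun t ht θ => ?_⟩
  rw [abs_mul, abs_of_pos (h.tZ_pos _ _), add_mul, exp_add, ← mul_assoc]
  exact mul_le_mul (hb t ht θ) (tZ_le h ht.1 θ) (h.tZ_pos _ _).le psv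
lemma Gro.bd {Φ : ℝ → E → ℝ} (hΦ : Gro Φ) : ∃ C a, 0 ≤ C ∧ 0 ≤ a ∧ ∀ t ∈ Icc (0:ℝ) 1, ∀ g,
    |Φ t (√t • g)| ≤ C * exp (a * ‖g‖) := by
  obtain ⟨hc, C, a, hC, ha, hb⟩ := hΦ
  refine ⟨C, a, hC, ha, fun t ht g => (hb t ht _).trans ?_⟩
  gcongr
  rw [norm_smul, norm_of_nonneg (sqrt_nonneg _)]
  exact mul_le_of_le_one_left (norm_nonneg _) (sqrt_le_one.2 ht.2)
lemma Gro.int {Φ : ℝ → E → ℝ} (hΦ : Gro Φ) (ht : t ∈ Icc (0:ℝ) 1) :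
    Integrable (fun g => Φ t (√t • g)) (gam E) := by
  obtain ⟨C, a, hC, ha, hb⟩ := hΦ.bd
  exact gam_growth (by have := hΦ.1; exact (this.comp (g := fun q : ℝ × E => Φ q.1 q.2) (f := fun g : E => (t, √t • g)) fpp).aestronglyMeasurable) C a (hb t ht)
lemma ev_cont (h : Bd m R) {Φ : ℝ → E → ℝ} (hΦ : Gro Φ) : ContinuousOn (ev m Φ) (Icc 0 1) := by
  have hG := hΦ.tZ h
  obtain ⟨C, a, hC, ha, hb⟩ := hG.bd
  have hc := hG.1
  refine continuousOn_of_dominated (bound := fun g => C * exp (a * ‖g‖)) (fun t ht => (hG.int ht).aestronglyMeasurable)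
    (fun t ht => ae_of_all _ fun g => hb t ht g) ((gam_exp a).const_mul C) (ae_of_all _ fun g => ?_)
  exact (hc.comp (g := fun q : ℝ × E => Φ q.1 q.2 * _root_.tZ m q.1 q.2) (f := fun t : ℝ => (t, √t • g)) fpp).continuousOn

lemma tw_gam (t : ℝ) (ht : 0 ≤ t) (y : E) : ∫ g, tw t (√t • g) y ∂(gam E) = 1 := by
  have := gam_CM (E := E) (fun _ => 1) (√t • y)
  simp only [one_mul, norm_smul, mul_pow, norm_eq_abs, sq_abs, sq_sqrt ht] at this
  simp only [tw, real_inner_smul_left]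
  rw [← show ∫ _ : E, (1:ℝ) ∂(gam E) = 1 by simp, this]
  congr 1; ext g; rw [real_inner_smul_left, real_inner_comm]
lemma ev_TT (h : Bd m R) (hp : Bf R p) (ht : 0 ≤ t) :
    ev m (fun t θ => TT m t p θ) t = ∫ y, p y ∂m := by
  have := h.pr
  have e : ∀ θ, TT m t p θ * tZ m t θ = ∫ y, p y * tw t θ y ∂m := fun θ => by
    rw [TT, tl_int, div_mul_cancel₀ _ (h.tZ_pos _ _).ne']
  obtain ⟨h1, C, hC, h2⟩ := hp
  simp only [ev, e]
  rw [integral_integral_swap]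
  · congr 1; ext y; rw [integral_const_mul, tw_gam t ht, mul_one]
  · have i1 : Integrable (fun q : E × E => (C * exp (|t| * R ^ 2 / 2)) * exp (R * √t * ‖q.1‖)) ((gam E).prod m) :=
      ((gam_exp (R * √t)).comp_fst m).const_mul _
    refine i1.mono' ?_ ?_
    · have : Continuous fun q : E × E => tw t (√t • q.1) q.2 := by unfold tw; fun_prop
      exact ((h1.comp measurable_snd).mul this.measurable).aestronglyMeasurable
    · have : ∀ᵐ q ∂((gam E).prod m), ‖q.2‖ ≤ R := Measure.quasiMeasurePreserving_snd.ae h.ae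
      filter_upwards [this] with q hq
      simp only [Function.uncurry, norm_eq_abs]
      rw [abs_mul, abs_of_pos (tw_pos _ _ _), mul_assoc, mul_assoc R, ← norm_of_nonneg (sqrt_nonneg t), ← norm_smul,
        norm_of_nonneg (sqrt_nonneg t)]
      exact mul_le_mul (h2 _ hq) (tw_le hq) (tw_pos _ _ _).le hC
lemma ev_one (h : Bd m R) (ht : 0 ≤ t) : ev m (fun _ _ => 1) t = 1 := by
  have := h.pr
  have := ev_TT h (Bf_const R 1) ht
  simp only [integral_const, probReal_univ, smul_eq_mul, mul_one] at this
  refine Eq.trans ?_ this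
  simp only [ev]
  congr 1; ext g
  have := (h.tl t (√t • g)).pr
  simp [TT]

theorem ev_step (h : Bd m R) {Φ Ψ : ℝ → E → ℝ} (hΦ : Gro Φ) (hΨ : Gro Ψ) (ht : 0 ≤ t) (hδ : 0 ≤ δ) (h1 : t + δ ≤ 1)
    (H : ∀ θ, ∫ g, Φ (t + δ) (θ + Real.sqrt δ • g) * tZ (tl m t θ) δ (Real.sqrt δ • g) ∂(gam E) ≤ Φ t θ + δ * Ψ t θ + C) :
    ev m Φ (t + δ) ≤ ev m Φ t + δ * ev m Ψ t + C := by
  have hG := hΦ.tZ h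
  have ht1 : t ∈ Icc (0:ℝ) 1 := ⟨ht, by linarith⟩
  obtain ⟨hc, D, a, hD, ha, hb⟩ := hG
  have e0 := gam_conv ht hδ (F := fun x => Φ (t + δ) x * tZ m (t + δ) x)
    (hc.comp (g := fun q : ℝ × E => Φ q.1 q.2 * tZ m q.1 q.2) (f := fun x : E => (t + δ, x)) fpp) hD ha
    (hb _ ⟨add_nonneg ht hδ, h1⟩)
  have e1 : ev m Φ (t + δ) = ∫ g, (∫ g', Φ (t + δ) (√t • g + Real.sqrt δ • g') *
      tZ (tl m t (√t • g)) δ (Real.sqrt δ • g') ∂(gam E)) * tZ m t (√t • g) ∂(gam E) := by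
    rw [ev, e0.2]
    congr 1; ext g; rw [← integral_mul_const]; congr 1; ext g'
    rw [← tZ_tl h]; ring
  have i1 := (hΦ.tZ h).int ht1
  have i2 := (hΨ.tZ h).int ht1
  have i3 : Integrable (fun g => tZ m t (√t • g)) (gam E) := by
    have : Gro (fun (_ : ℝ) (_ : E) => (1:ℝ)) := ⟨by fun_prop, 1, 0, by simp, by simp, by simp⟩
    simpa using (this.tZ h).int ht1
  have i4 : Integrable (fun g => Φ t (√t • g) * tZ m t (√t • g) + δ * (Ψ t (√t • g) * tZ m t (√t • g))) (gam E) :=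
    i1.add (i2.const_mul δ)
  calc ev m Φ (t + δ) ≤ ∫ g, (Φ t (√t • g) * tZ m t (√t • g) + δ * (Ψ t (√t • g) * tZ m t (√t • g))
        + C * tZ m t (√t • g)) ∂(gam E) := by
        rw [e1]
        refine integral_mono ?_ (i4.add (i3.const_mul C)) fun g => ?_
        · refine e0.1.integral_prod_left.congr (ae_of_all _ fun g => ?_)
          dsimp only
          rw [← integral_mul_const]; congr 1; ext g'; rw [← tZ_tl h]; ring
        · have := mul_le_mul_of_nonneg_right (H (√t • g)) (h.tZ_pos t (√t • g)).le
          dsimp only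
          linarith
    _ = _ := by
        rw [integral_add i4 (i3.const_mul C), integral_add i1 (i2.const_mul δ), integral_const_mul, integral_const_mul]
        have := ev_one h ht
        simp only [ev, one_mul] at this ⊢
        rw [this, mul_one]

lemma cmpr {u w B B' : ℝ → ℝ} {T : ℝ} (hT1 : T ≤ 1) (hu : ContinuousOn u (Icc 0 1))
    (hs : ∀ t δ, 0 ≤ t → 0 ≤ δ → t + δ ≤ 1 → u (t + δ) ≤ u t + δ * w t + C * (δ * Real.sqrt δ))
    (hB : ∀ t ∈ Icc 0 T, HasDerivAt B (B' t) t) (hw : ∀ t ∈ Ico 0 T, w t ≤ B' t) (h0 : u 0 ≤ B 0) :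
    ∀ t ∈ Icc 0 T, u t ≤ B t := by
  refine image_le_of_liminf_slope_right_le_deriv_boundary (hu.mono (Icc_subset_Icc_right hT1)) h0
    (fun t ht => (hB t ht).continuousAt.continuousWithinAt) (fun t ht => (hB t (Ico_subset_Icc_self ht)).hasDerivWithinAt) ?_
  intro x hx r hr
  have hc : Tendsto (fun z : ℝ => w x + C * √(z - x)) (nhdsWithin x (Ioi x)) (nhds (w x)) := by
    have : Continuous (fun z : ℝ => w x + C * √(z - x)) := by fun_prop
    have := this.tendsto x
    simp only [sub_self, Real.sqrt_zero, mul_zero, add_zero] at this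
    exact this.mono_left nhdsWithin_le_nhds
  refine Eventually.frequently ?_
  have hxT : Ioo x T ∈ nhdsWithin x (Ioi x) := Ioo_mem_nhdsGT hx.2
  filter_upwards [hc.eventually (gt_mem_nhds ((hw x hx).trans_lt hr)), hxT] with z hz hzT
  have hd : 0 < z - x := sub_pos.2 hzT.1
  have := hs x (z - x) hx.1 hd.le (by linarith [hzT.2])
  rw [slope_def_field, div_lt_iff₀ hd]
  rw [add_sub_cancel] at this
  nlinarith
end p0

section p1
lemma exp_e1 (u : ℝ) : |exp u - 1| ≤ |u| * exp |u| := by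
  have h1 := add_one_le_exp u
  have h2 := add_one_le_exp (-u)
  have h3 : exp (-u) * exp u = 1 := by rw [← exp_add]; simp
  have h4 : exp u - 1 ≤ u * exp u := by nlinarith [exp_pos u]
  have h6 : 1 ≤ exp |u| := one_le_exp (abs_nonneg u)
  rw [abs_le]
  constructor
  · nlinarith [neg_abs_le u, abs_nonneg u]
  · refine h4.trans ?_
    refine mul_le_mul (le_abs_self u) (exp_le_exp.2 (le_abs_self u)) (exp_pos _).le (abs_nonneg u)
lemma exp_e2 (u : ℝ) : |exp u - 1 - u| ≤ u ^ 2 * exp |u| := by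
  have h1 := add_one_le_exp u
  have h2 := add_one_le_exp (-u)
  have h3 : exp (-u) * exp u = 1 := by rw [← exp_add]; simp
  have h4 : exp u - 1 ≤ u * exp u := by nlinarith [exp_pos u]
  rw [abs_of_nonneg lnr]
  calc exp u - 1 - u ≤ u * (exp u - 1) := by linarith
    _ ≤ |u| * |exp u - 1| := by rw [← abs_mul]; exact le_abs_self _
    _ ≤ |u| * (|u| * exp |u|) := mul_le_mul_of_nonneg_left (exp_e1 u) (abs_nonneg u)
    _ = u ^ 2 * exp |u| := by rw [← mul_assoc, ← sq, sq_abs]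
lemma st_w0 {u : ℝ} (hr : 0 ≤ r) (hr1 : r ≤ 1) (hb : 0 ≤ b) (hu : |u| ≤ r * b) (hl : |u - l| ≤ r ^ 2 * b) :
    |exp u - 1| ≤ r * exp b ^ 2 ∧ |exp u - 1 - l| ≤ 2 * r ^ 2 * exp b ^ 3 ∧
      (exp b)⁻¹ ≤ exp u ∧ exp u ≤ exp b := by
  have hub : |u| ≤ b := hu.trans (mul_le_of_le_one_left hb hr1)
  have he : exp |u| ≤ exp b := exp_le_exp.2 hub
  have hbe : b ≤ exp b := norm_le_exp b
  have h1 : 1 ≤ exp b := one_le_exp hb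
  refine ⟨?_, ?_, ?_, exp_le_exp.2 ((le_abs_self u).trans hub)⟩
  · calc _ ≤ |u| * exp |u| := exp_e1 u
      _ ≤ r * b * exp b := mul_le_mul hu he (exp_pos _).le psv
      _ ≤ r * exp b * exp b := by gcongr
      _ = _ := by ring
  · have e : exp u - 1 - l = (exp u - 1 - u) + (u - l) := by ring
    rw [e]
    calc _ ≤ u ^ 2 * exp |u| + r ^ 2 * b := (abs_add_le _ _).trans (add_le_add (exp_e2 u) hl)
      _ ≤ (r * b) ^ 2 * exp b + r ^ 2 * b := by
        rw [← sq_abs u]; gcongr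
      _ ≤ (r * exp b) ^ 2 * exp b + r ^ 2 * exp b ^ 3 := by
        gcongr; exact hbe.trans (le_self_pow₀ h1 nnm)
      _ = _ := by ring
  · rw [← exp_neg]; exact exp_le_exp.2 (by linarith [neg_abs_le u])

variable {E : Type*} [NormedAddCommGroup E] [InnerProductSpace ℝ E] [FiniteDimensional ℝ E]
  [MeasurableSpace E] [BorelSpace E] {m : Measure E} {K h : ℝ}
lemma st_w (hR : 0 ≤ R) (h0 : 0 ≤ h) (h1 : h ≤ 1) (g : E) {y : E} (hy : ‖y‖ ≤ R) :
    |tw h (√h • g) y - 1| ≤ √h * exp (R * ‖g‖ + R ^ 2) ^ 2 ∧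
    |tw h (√h • g) y - 1 - √h * ⟪g, y⟫| ≤ 2 * √h ^ 2 * exp (R * ‖g‖ + R ^ 2) ^ 3 ∧
    (exp (R * ‖g‖ + R ^ 2))⁻¹ ≤ tw h (√h • g) y ∧ tw h (√h • g) y ≤ exp (R * ‖g‖ + R ^ 2) := by
  have hr1 : √h ≤ 1 := sqrt_le_one.2 h1
  have hr0 := sqrt_nonneg h
  have hs := sq_sqrt h0
  have hy2 : ‖y‖ ^ 2 ≤ R ^ 2 := by gcongr
  have hgy : |⟪g, y⟫| ≤ R * ‖g‖ := (abs_real_inner_le_norm g y).trans (by rw [mul_comm R]; gcongr)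
  have hrr : h ≤ √h := by nlinarith
  rw [tw, real_inner_smul_left]
  refine st_w0 hr0 hr1 psv ?_ ?_
  · refine (abs_sub _ _).trans ?_
    rw [abs_mul, abs_of_nonneg hr0, abs_of_nonneg (show 0 ≤ h * ‖y‖ ^ 2 / 2 by positivity), mul_add]
    have a1 := mul_le_mul_of_nonneg_left hgy hr0
    have a2 : h * ‖y‖ ^ 2 ≤ √h * R ^ 2 := mul_le_mul hrr hy2 psv hr0
    have : 0 ≤ √h * R ^ 2 := by positivity
    linarith
  · rw [sub_sub_cancel_left, abs_neg, abs_of_nonneg psv, hs]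
    have : h * ‖y‖ ^ 2 ≤ h * R ^ 2 := by gcongr
    have : 0 ≤ h * (R * ‖g‖) := by positivity
    have : 0 ≤ h * R ^ 2 := by positivity
    linarith
lemma st_int (hm : Bd m R) {p q : E → ℝ} (hp : Bf R p) (hK : 0 ≤ K) (hpK : ∀ y, ‖y‖ ≤ R → |p y| ≤ K)
    (hq : ∀ y, ‖y‖ ≤ R → |q y| ≤ c) : |∫ y, p y * q y ∂m| ≤ K * c := hm.le fun y hy => by
  rw [abs_mul]; exact mul_le_mul (hpK y hy) (hq y hy) (abs_nonneg _) hK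
lemma st_Z (hm : Bd m R) (h0 : 0 ≤ h) (h1 : h ≤ 1) (g : E) :
    |tZ m h (√h • g) - 1| ≤ √h * exp (R * ‖g‖ + R ^ 2) ^ 2 ∧
    |tZ m h (√h • g) - 1 - √h * ∫ y, ⟪g, y⟫ ∂m| ≤ 2 * √h ^ 2 * exp (R * ‖g‖ + R ^ 2) ^ 3 ∧
    (exp (R * ‖g‖ + R ^ 2))⁻¹ ≤ tZ m h (√h • g) ∧ tZ m h (√h • g) ≤ exp (R * ‖g‖ + R ^ 2) := by
  have := hm.pr
  have iw := hm.tw h (√h • g)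
  have i1 : Integrable (fun y => tw h (√h • g) y - 1) m := iw.sub (integrable_const 1)
  have i2 : Integrable (fun y => √h * ⟪g, y⟫) m := hm.int (Bf_cont fpp)
  have e1 : tZ m h (√h • g) - 1 = ∫ y, (tw h (√h • g) y - 1) ∂m := by
    rw [integral_sub iw (integrable_const 1), tZ]; simp
  refine ⟨?_, ?_, ?_, ?_⟩
  · rw [e1]; exact hm.le fun y hy => (st_w hm.r0 h0 h1 g hy).1
  · rw [e1, ← integral_const_mul, ← integral_sub i1 i2]; exact hm.le fun y hy => (st_w hm.r0 h0 h1 g hy).2.1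
  · have := integral_mono_ae (integrable_const (μ := m) _) iw (hm.ae.mono fun y hy => (st_w hm.r0 h0 h1 g hy).2.2.1)
    simpa [tZ] using this
  · have := integral_mono_ae iw (integrable_const (μ := m) _) (hm.ae.mono fun y hy => (st_w hm.r0 h0 h1 g hy).2.2.2)
    simpa [tZ] using this
lemma st_H (hm : Bd m R) (h0 : 0 ≤ h) (h1 : h ≤ 1) {p : E → ℝ} (hp : Bf R p) (hK : 0 ≤ K)
    (hpK : ∀ y, ‖y‖ ≤ R → |p y| ≤ K) (hp0 : ∫ y, p y ∂m = 0) (g : E) :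
    |TT m h p (√h • g)| ≤ K * √h * exp (R * ‖g‖ + R ^ 2) ^ 3 ∧
    |TT m h p (√h • g) ^ 2 * tZ m h (√h • g) - h * (∫ y, p y * ⟪g, y⟫ ∂m) ^ 2| ≤
      7 * K ^ 2 * (h * √h) * exp (R * ‖g‖ + R ^ 2) ^ 8 := by
  have := hm.pr
  obtain ⟨z1, -, z3, z4⟩ := st_Z hm h0 h1 g
  set r := √h with hr
  set x := exp (R * ‖g‖ + R ^ 2) with hx
  set Z := tZ m h (r • g) with hZ
  set k := ∫ y, p y * ⟪g, y⟫ ∂m with hk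
  have hr0 : 0 ≤ r := sqrt_nonneg h
  have hrh : h = r ^ 2 := (sq_sqrt h0).symm
  have hR := hm.r0
  have x1 : 1 ≤ x := one_le_exp psv
  have Z0 : 0 < Z := lt_of_lt_of_le psv z3
  have Zi : Z⁻¹ ≤ x := inv_le_of_inv_le₀ psv z3
  have bk : |k| ≤ K * x := st_int hm hp hK hpK fun y hy => by
    have : |⟪g, y⟫| ≤ R * ‖g‖ := (abs_real_inner_le_norm g y).trans (by rw [mul_comm R]; gcongr)
    have := norm_le_exp (R * ‖g‖ + R ^ 2)
    have : 0 ≤ R ^ 2 := by positivity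
    linarith
  have ip := hm.int hp
  have iw : Integrable (fun y => p y * tw h (r • g) y) m := hm.int (hp.mul (Bf_cont (tw_cont1 _ _)))
  have i2 : Integrable (fun y => p y * ⟪g, y⟫) m := hm.int (hp.mul (Bf_cont fpp))
  set I := ∫ y, p y * tw h (r • g) y ∂m with hI
  have hH : TT m h p (r • g) = I * Z⁻¹ := by rw [TT, tl_int, div_eq_mul_inv]
  have e1 : I = ∫ y, p y * (tw h (r • g) y - 1) ∂m := by
    simp only [mul_sub, mul_one]; rw [integral_sub iw ip, hp0, sub_zero]
  have e2 : I - r * k = ∫ y, p y * (tw h (r • g) y - 1 - r * ⟪g, y⟫) ∂m := by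
    have : ∀ y, p y * (tw h (r • g) y - 1 - r * ⟪g, y⟫) = p y * (tw h (r • g) y - 1) - r * (p y * ⟪g, y⟫) := fun y => by ring
    simp only [this]
    have i3 : Integrable (fun y => p y * (tw h (r • g) y - 1)) m := hm.int (hp.mul (Bf_cont ((tw_cont1 _ _).sub continuous_const)))
    rw [integral_sub i3 (i2.const_mul _), integral_const_mul, ← e1]
  have b1 : |I| ≤ K * (r * x ^ 2) := by rw [e1]; exact st_int hm hp hK hpK fun y hy => (st_w hm.r0 h0 h1 g hy).1
  have b2 : |I - r * k| ≤ K * (2 * r ^ 2 * x ^ 3) := by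
    rw [e2]; exact st_int hm hp hK hpK fun y hy => (st_w hm.r0 h0 h1 g hy).2.1
  have bI : |I * Z⁻¹| ≤ K * r * x ^ 3 := by
    rw [abs_mul, abs_of_pos (inv_pos.2 Z0)]
    calc _ ≤ K * (r * x ^ 2) * x := mul_le_mul b1 Zi (inv_pos.2 Z0).le psv
      _ = _ := by ring
  rw [hH]
  refine ⟨bI, ?_⟩
  have b3 : |I + r * k| ≤ 2 * K * r * x ^ 2 := by
    refine (abs_add_le _ _).trans ?_
    rw [abs_mul, abs_of_nonneg hr0]
    have a1 : r * |k| ≤ r * (K * x) := by gcongr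
    have a2 : r * (K * x) ≤ r * (K * x ^ 2) := by gcongr; exact le_self_pow₀ x1 nnm
    linarith
  have key : (I * Z⁻¹) ^ 2 * Z - h * k ^ 2 = (I - r * k) * (I + r * k) + I * (I * Z⁻¹) * (1 - Z) := by
    rw [hrh]; field_simp; ring
  rw [key]
  have c1 : |(I - r * k) * (I + r * k)| ≤ 4 * K ^ 2 * (r ^ 2 * r) * x ^ 8 := by
    rw [abs_mul]
    calc _ ≤ K * (2 * r ^ 2 * x ^ 3) * (2 * K * r * x ^ 2) := mul_le_mul b2 b3 (abs_nonneg _) psv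
      _ = 4 * K ^ 2 * (r ^ 2 * r) * x ^ 5 := by ring
      _ ≤ _ := by gcongr <;> first | exact x1 | norm_num
  have c2 : |I * (I * Z⁻¹) * (1 - Z)| ≤ K ^ 2 * (r ^ 2 * r) * x ^ 8 := by
    rw [abs_mul, abs_mul, abs_sub_comm]
    calc _ ≤ K * (r * x ^ 2) * (K * r * x ^ 3) * (r * x ^ 2) :=
          mul_le_mul (mul_le_mul b1 bI (abs_nonneg _) psv) z1 (abs_nonneg _) psv
      _ = K ^ 2 * (r ^ 2 * r) * x ^ 7 := by ring
      _ ≤ _ := by gcongr <;> first | exact x1 | norm_num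
  refine (abs_add_le _ _).trans ((add_le_add c1 c2).trans ?_)
  rw [hrh]
  have : 0 ≤ K ^ 2 * (r ^ 2 * r) * x ^ 8 := by positivity
  linarith

variable (E) in
def JE (R : ℝ) : ℝ := ∫ g : E, exp (R * ‖g‖ + R ^ 2) ^ 13 ∂(gam E)
lemma JE_int (R : ℝ) (k : ℕ) : Integrable (fun g : E => exp (R * ‖g‖ + R ^ 2) ^ k) (gam E) := by
  refine ((gam_exp (k * R)).const_mul (exp (k * R ^ 2))).congr (ae_of_all _ fun g => ?_)
  dsimp only
  rw [← exp_add, ← exp_nat_mul]; congr 1; ring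
lemma JE_le (hR : 0 ≤ R) (hk : k ≤ 13) : ∫ g : E, exp (R * ‖g‖ + R ^ 2) ^ k ∂(gam E) ≤ JE E R :=
  integral_mono (JE_int R k) (JE_int R 13) fun g => pow_le_pow_right₀ (one_le_exp psv) hk
lemma JE_nn : 0 ≤ JE E R := integral_nonneg fun g => by positivity
lemma st_k {ι : Type*} [Fintype ι] (e : OrthonormalBasis ι ℝ E) (hm : Bd m R) {p : E → ℝ} (hp : Bf R p) :
    Integrable (fun g => (∫ y, p y * ⟪g, y⟫ ∂m) ^ 2) (gam E) ∧
    ∫ g, (∫ y, p y * ⟪g, y⟫ ∂m) ^ 2 ∂(gam E) = ∑ i, (∫ y, p y * ⟪e i, y⟫ ∂m) ^ 2 := by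
  have := hm.pr
  set k : E := ∑ i, (∫ y, p y * ⟪e i, y⟫ ∂m) • e i with hk
  have e1 : ∀ g, ∫ y, p y * ⟪g, y⟫ ∂m = ⟪g, k⟫ := fun g => by
    have : ∀ y, p y * ⟪g, y⟫ = ∑ i, ⟪g, e i⟫ * (p y * ⟪e i, y⟫) := fun y => by
      rw [← e.sum_inner_mul_inner g y, mul_sum]; exact sum_congr rfl fun i _ => by ring
    simp only [this]
    rw [integral_finsetSum _ fun i _ => (hm.int (hp.mul (Bf_cont fpp))).const_mul _, hk, inner_sum]
    refine sum_congr rfl fun i _ => ?_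
    rw [integral_const_mul, real_inner_smul_right, mul_comm]
  have e2 : ∀ i, ∫ y, p y * ⟪e i, y⟫ ∂m = ⟪e i, k⟫ := fun i => e1 _
  simp only [e1, e.sum_sq_inner_right]
  have := gam_inner2 k k
  refine ⟨?_, by simpa [sq] using this⟩
  simpa [sq] using ((Lg_inner k).eg.mul (Lg_inner k).eg).int fpp
lemma TT_meas (hm : Bd m R) {p : E → ℝ} (hp : Bf R p) : Continuous fun g : E => TT m h p (√h • g) :=
  (TT_cont hm hp).comp (g := fun q : ℝ × E => TT m q.1 p q.2) (f := fun g : E => (h, √h • g)) fpp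
lemma tZ_meas (hm : Bd m R) : Continuous fun g : E => tZ m h (√h • g) :=
  (tZ_cont hm).comp (g := fun q : ℝ × E => tZ m q.1 q.2) (f := fun g : E => (h, √h • g)) fpp
lemma st_int2 {ι : Type*} [Fintype ι] (e : OrthonormalBasis ι ℝ E) (hm : Bd m R) (h0 : 0 ≤ h) (h1 : h ≤ 1) {p : E → ℝ} (hp : Bf R p)
    (hK : 0 ≤ K) (hpK : ∀ y, ‖y‖ ≤ R → |p y| ≤ K) (hp0 : ∫ y, p y ∂m = 0) :
    Integrable (fun g => TT m h p (√h • g) ^ 2 * tZ m h (√h • g)) (gam E) ∧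
    ∫ g, TT m h p (√h • g) ^ 2 * tZ m h (√h • g) ∂(gam E) ≤
      h * ∑ i, (∫ y, p y * ⟪e i, y⟫ ∂m) ^ 2 + 7 * K ^ 2 * JE E R * (h * √h) := by
  obtain ⟨k1, k2⟩ := st_k e hm hp
  have hb : Integrable (fun g : E => h * (∫ y, p y * ⟪g, y⟫ ∂m) ^ 2 + 7 * K ^ 2 * (h * √h) * exp (R * ‖g‖ + R ^ 2) ^ 8) (gam E) :=
    (k1.const_mul h).add ((JE_int R 8).const_mul _)
  have hp' : ∀ g, TT m h p (√h • g) ^ 2 * tZ m h (√h • g) ≤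
      h * (∫ y, p y * ⟪g, y⟫ ∂m) ^ 2 + 7 * K ^ 2 * (h * √h) * exp (R * ‖g‖ + R ^ 2) ^ 8 := fun g => by
    have := (abs_le.1 (st_H hm h0 h1 hp hK hpK hp0 g).2).2; linarith
  have hi : Integrable (fun g => TT m h p (√h • g) ^ 2 * tZ m h (√h • g)) (gam E) := by
    refine hb.mono' (((TT_meas hm hp).pow 2).mul (tZ_meas hm)).aestronglyMeasurable (ae_of_all _ fun g => ?_)
    rw [norm_of_nonneg (mul_nonneg (sq_nonneg _) (hm.tZ_pos _ _).le)]; exact hp' g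
  refine ⟨hi, (integral_mono hi hb hp').trans ?_⟩
  rw [integral_add (k1.const_mul h) ((JE_int R 8).const_mul _), integral_const_mul, integral_const_mul, k2]
  have := mul_le_mul_of_nonneg_left (JE_le (E := E) hm.r0 (show 8 ≤ 13 by norm_num)) (show 0 ≤ 7 * K ^ 2 * (h * √h) by positivity)
  linarith
lemma st_int4 (hm : Bd m R) (h0 : 0 ≤ h) (h1 : h ≤ 1) {p : E → ℝ} (hp : Bf R p)
    (hK : 0 ≤ K) (hpK : ∀ y, ‖y‖ ≤ R → |p y| ≤ K) (hp0 : ∫ y, p y ∂m = 0) :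
    Integrable (fun g => TT m h p (√h • g) ^ 4 * tZ m h (√h • g)) (gam E) ∧
    ∫ g, TT m h p (√h • g) ^ 4 * tZ m h (√h • g) ∂(gam E) ≤ K ^ 4 * JE E R * (h * √h) := by
  have hb : Integrable (fun g : E => K ^ 4 * (h * √h) * exp (R * ‖g‖ + R ^ 2) ^ 13) (gam E) := (JE_int R 13).const_mul _
  have hp' : ∀ g, TT m h p (√h • g) ^ 4 * tZ m h (√h • g) ≤
      K ^ 4 * (h * √h) * exp (R * ‖g‖ + R ^ 2) ^ 13 := fun g => by
    have b1 := pow_le_pow_left₀ (abs_nonneg _) (st_H hm h0 h1 hp hK hpK hp0 g).1 4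
    rw [← abs_pow, abs_of_nonneg (show 0 ≤ TT m h p (√h • g) ^ 4 by positivity)] at b1
    refine (mul_le_mul b1 (st_Z hm h0 h1 g).2.2.2 (hm.tZ_pos _ _).le psv).trans ?_
    have hs := sq_sqrt h0
    have hr1 : √h ≤ 1 := sqrt_le_one.2 h1
    have hr0 := sqrt_nonneg h
    have : √h ^ 4 ≤ h * √h := by
      have : √h ^ 4 = h * h := by rw [show (4:ℕ) = 2 * 2 from rfl, pow_mul, hs]; ring
      rw [this]; gcongr; nlinarith
    calc _ = K ^ 4 * √h ^ 4 * exp (R * ‖g‖ + R ^ 2) ^ 13 := by ring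
      _ ≤ _ := by gcongr
  have hi : Integrable (fun g => TT m h p (√h • g) ^ 4 * tZ m h (√h • g)) (gam E) := by
    refine hb.mono' (((TT_meas hm hp).pow 4).mul (tZ_meas hm)).aestronglyMeasurable (ae_of_all _ fun g => ?_)
    rw [norm_of_nonneg (mul_nonneg psv (hm.tZ_pos _ _).le)]; exact hp' g
  refine ⟨hi, (integral_mono hi hb hp').trans ?_⟩
  rw [integral_const_mul, ← JE]; linarith
lemma st_int1 (hm : Bd m R) (h0 : 0 ≤ h) (h1 : h ≤ 1) {p : E → ℝ} (hp : Bf R p) (hp0 : ∫ y, p y ∂m = 0) :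
    Integrable (fun g => TT m h p (√h • g) * tZ m h (√h • g)) (gam E) ∧
    ∫ g, TT m h p (√h • g) * tZ m h (√h • g) ∂(gam E) = 0 := by
  refine ⟨?_, (ev_TT hm hp h0).trans hp0⟩
  obtain ⟨C, hC, hb⟩ := nm_le hm hp h
  refine gam_growth ((TT_meas hm hp).mul (tZ_meas hm)).aestronglyMeasurable C R fun g => ?_
  rw [TT, tl_int, div_mul_cancel₀ _ (hm.tZ_pos _ _).ne']
  refine (hb _).trans ?_
  have := hm.r0
  gcongr
  rw [norm_smul, norm_of_nonneg (sqrt_nonneg _)]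
  exact mul_le_of_le_one_left (norm_nonneg _) (sqrt_le_one.2 h1)
lemma st_log (hm : Bd m R) (h0 : 0 ≤ h) (h1 : h ≤ 1) {ι : Type*} [Fintype ι] (e : OrthonormalBasis ι ℝ E) :
    ∫ g, Real.log (tZ m h (√h • g)) * tZ m h (√h • g) ∂(gam E) ≤
      h * ∑ i, (∫ y, ⟪e i, y⟫ ∂m) ^ 2 + 4 * JE E R * (h * √h) := by
  have := hm.pr
  obtain ⟨k1, k2⟩ := st_k e hm (Bf_const R 1)
  simp only [one_mul] at k1 k2
  have iZ : Integrable (fun g => tZ m h (√h • g)) (gam E) :=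
    (JE_int R 1).mono' (tZ_meas hm).aestronglyMeasurable (ae_of_all _ fun g => by
      rw [norm_of_nonneg (hm.tZ_pos _ _).le, pow_one]; exact (st_Z hm h0 h1 g).2.2.2)
  have eZ : ∫ g, tZ m h (√h • g) ∂(gam E) = 1 := by simpa [ev] using ev_one hm h0
  have hb : Integrable (fun g : E => h * (∫ y, ⟪g, y⟫ ∂m) ^ 2 + 4 * (h * √h) * exp (R * ‖g‖ + R ^ 2) ^ 13 +
      (tZ m h (√h • g) - 1)) (gam E) :=
    ((k1.const_mul h).add ((JE_int R 13).const_mul _)).add (iZ.sub (integrable_const 1))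
  have hp' : ∀ g, Real.log (tZ m h (√h • g)) * tZ m h (√h • g) ≤
      h * (∫ y, ⟪g, y⟫ ∂m) ^ 2 + 4 * (h * √h) * exp (R * ‖g‖ + R ^ 2) ^ 13 + (tZ m h (√h • g) - 1) := fun g => by
    obtain ⟨z1, z2, z3, z4⟩ := st_Z hm h0 h1 g
    have zp := hm.tZ_pos h (√h • g)
    have hl := mul_le_mul_of_nonneg_right (Real.log_le_sub_one_of_pos zp) zp.le
    set r := √h with hr
    set x := exp (R * ‖g‖ + R ^ 2) with hx
    set Z := tZ m h (r • g)
    set k := ∫ y, ⟪g, y⟫ ∂m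
    have hr0 : 0 ≤ r := sqrt_nonneg h
    have hrh : h = r ^ 2 := (sq_sqrt h0).symm
    have hR := hm.r0
    have x1 : 1 ≤ x := one_le_exp psv
    have bk : |k| ≤ x := hm.le fun y hy => by
      have : |⟪g, y⟫| ≤ R * ‖g‖ := (abs_real_inner_le_norm g y).trans (by rw [mul_comm R]; gcongr)
      have := norm_le_exp (R * ‖g‖ + R ^ 2)
      have : 0 ≤ R ^ 2 := by positivity
      linarith
    have b3 : |Z - 1 + r * k| ≤ 2 * r * x ^ 2 := by
      refine (abs_add_le _ _).trans ?_
      rw [abs_mul, abs_of_nonneg hr0]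
      have a1 : r * |k| ≤ r * x := by gcongr
      have a2 : r * x ≤ r * x ^ 2 := by gcongr; exact le_self_pow₀ x1 nnm
      linarith
    have c1 : (Z - 1 - r * k) * (Z - 1 + r * k) ≤ 4 * (r ^ 2 * r) * x ^ 13 := by
      refine (le_abs_self _).trans ?_
      rw [abs_mul]
      calc _ ≤ (2 * r ^ 2 * x ^ 3) * (2 * r * x ^ 2) := mul_le_mul z2 b3 (abs_nonneg _) psv
        _ = 4 * (r ^ 2 * r) * x ^ 5 := by ring
        _ ≤ _ := by gcongr <;> first | exact x1 | norm_num
    rw [hrh]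
    nlinarith
  by_cases hi : Integrable (fun g => Real.log (tZ m h (√h • g)) * tZ m h (√h • g)) (gam E)
  · refine (integral_mono hi hb hp').trans (le_of_eq ?_)
    have j1 : Integrable (fun g : E => h * (∫ y, ⟪g, y⟫ ∂m) ^ 2 + 4 * (h * √h) * exp (R * ‖g‖ + R ^ 2) ^ 13) (gam E) :=
      (k1.const_mul h).add ((JE_int R 13).const_mul _)
    have j2 : Integrable (fun g => tZ m h (√h • g) - 1) (gam E) := iZ.sub (integrable_const 1)
    rw [integral_add j1 j2, integral_add (k1.const_mul h) ((JE_int R 13).const_mul _), integral_const_mul, integral_const_mul, k2,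
      integral_sub iZ (integrable_const 1), eZ, JE]
    simp; ring
  · rw [integral_undef hi]
    have := JE_nn (E := E) (R := R)
    positivity
end p1

section p2
open TensorProduct
def Vr (m : Measure E) (v : E) : ℝ := ∫ x, (⟪v, x⟫ - ∫ y, ⟪v, y⟫ ∂m) ^ 2 ∂m
def Cv (m : Measure E) : E ⊗[ℝ] E := ∑ i, ∑ j, (∫ x, ⟪ob E i, x⟫ * ⟪ob E j, x⟫ ∂m -
  (∫ x, ⟪ob E i, x⟫ ∂m) * ∫ x, ⟪ob E j, x⟫ ∂m) • (ob E i ⊗ₜ[ℝ] ob E j)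
def SS (E : Type*) [NormedAddCommGroup E] [InnerProductSpace ℝ E] (r : ℝ) : Set (E ⊗[ℝ] E) := {N | ∀ v : E, ⟪v ⊗ₜ[ℝ] v, N⟫ ≤ r * ‖v‖ ^ 2}
def GG (r : ℝ) (m : Measure E) : ℝ := Metric.infDist (Cv m) (SS E r) ^ 2

lemma Vr_eq (h : Bd m R) (v : E) : Vr m v = ∫ x, ⟪v, x⟫ ^ 2 ∂m - (∫ x, ⟪v, x⟫ ∂m) ^ 2 := by
  have := h.pr
  have i1 : Integrable (fun x => ⟪v, x⟫ ^ 2) m := h.int (Bf_cont fpp)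
  have i2 : Integrable (fun x => ⟪v, x⟫) m := h.int (Bf_cont fpp)
  set c := ∫ x, ⟪v, x⟫ ∂m with hc
  have e : ∀ x, (⟪v, x⟫ - c) ^ 2 = (⟪v, x⟫ ^ 2 - 2 * c * ⟪v, x⟫) + c ^ 2 := fun x => by ring
  have i3 : Integrable (fun x => ⟪v, x⟫ ^ 2 - 2 * c * ⟪v, x⟫) m := i1.sub (i2.const_mul _)
  rw [Vr]
  simp only [← hc, e]
  rw [integral_add i3 (integrable_const _), integral_sub i1 (i2.const_mul _), integral_const_mul, ← hc]
  simp; ring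
lemma Cv_inner (h : Bd m R) (v : E) : ⟪v ⊗ₜ[ℝ] v, Cv m⟫ = Vr m v := by
  have := h.pr
  have e0 : ∀ x, ⟪v, x⟫ = ∑ i, ⟪v, ob E i⟫ * ⟪ob E i, x⟫ := fun x => ((ob E).sum_inner_mul_inner v x).symm
  have ei : ∀ i, Integrable (fun x => ⟪v, ob E i⟫ * ⟪ob E i, x⟫) m := fun i => h.int (Bf_cont fpp)
  have e1 : ∫ x, ⟪v, x⟫ ∂m = ∑ i, ⟪v, ob E i⟫ * ∫ x, ⟪ob E i, x⟫ ∂m := by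
    rw [integral_congr_ae (.of_forall e0), integral_finsetSum _ fun i _ => ei i]; simp only [integral_const_mul]
  have e2 : ∫ x, ⟪v, x⟫ ^ 2 ∂m = ∑ i, ∑ j, ⟪v, ob E i⟫ * ⟪v, ob E j⟫ * ∫ x, ⟪ob E i, x⟫ * ⟪ob E j, x⟫ ∂m := by
    have e3 : ∀ x, ⟪v, x⟫ ^ 2 = ∑ i, ∑ j, ⟪v, ob E i⟫ * ⟪ob E i, x⟫ * (⟪v, ob E j⟫ * ⟪ob E j, x⟫) := fun x => by
      rw [e0, sq, sum_mul_sum]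
    rw [integral_congr_ae (.of_forall e3)]
    rw [integral_finsetSum _ fun i _ => h.int (Bf_cont fpp)]
    refine sum_congr rfl fun i _ => ?_
    rw [integral_finsetSum _ fun i _ => h.int (Bf_cont fpp)]
    refine sum_congr rfl fun j _ => ?_
    rw [← integral_const_mul]; congr 1; ext x; ring
  rw [Vr_eq h, e1, e2, sq, sum_mul_sum, ← sum_sub_distrib, Cv, inner_sum]
  refine sum_congr rfl fun i _ => ?_
  rw [← sum_sub_distrib, inner_sum]
  refine sum_congr rfl fun j _ => ?_
  refine (real_inner_smul_right (F := E ⊗[ℝ] E) _ _ _).trans ?_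
  rw [inner_tmul]; ring
lemma SS_ne (hr : 0 ≤ r) : (SS E r).Nonempty := ⟨0, fun v => by simp; positivity⟩
lemma GG_le (h : Bd m R) (M : E ⊗[ℝ] E) (hM : ∀ v, Vr m v ≤ ⟪v ⊗ₜ[ℝ] v, M⟫ + r * ‖v‖ ^ 2) : GG r m ≤ ‖M‖ ^ 2 := by
  have : Cv m - M ∈ SS E r := fun v => by rw [inner_sub_right, Cv_inner h]; linarith [hM v]
  have := infDist_le_dist_of_mem (x := Cv m) this
  rw [dist_eq_norm, sub_sub_cancel] at this
  exact pow_le_pow_left₀ infDist_nonneg this 2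
lemma GG_ge (h : Bd m R) (hr : 0 ≤ r) {ι : Type*} [Fintype ι] {e : ι → E} (he : Orthonormal ℝ e) :
    ∑ i, max (Vr m (e i) - r) 0 ^ 2 ≤ GG r m := by
  refine (Real.sqrt_le_left infDist_nonneg).1 ((Metric.le_infDist (SS_ne hr)).2 fun N hN => ?_)
  have ho : Orthonormal ℝ fun i => e i ⊗ₜ[ℝ] e i := by
    classical
    rw [orthonormal_iff_ite] at he ⊢
    intro i j; rw [inner_tmul, he]; split_ifs <;> simp
  have := ho.sum_inner_products_le (x := Cv m - N) (s := Finset.univ)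
  rw [dist_eq_norm]
  refine sqrt_le_iff.2 ⟨norm_nonneg _, (sum_le_sum fun i _ => ?_).trans this⟩
  rw [inner_sub_right, Cv_inner h, norm_eq_abs, sq_abs]
  have h1 := hN (e i)
  rw [he.1 i] at h1
  rcases le_total (Vr m (e i) - r) 0 with h2 | h2
  · rw [max_eq_right h2, zero_pow two_ne_zero]; positivity
  · rw [max_eq_left h2]; exact pow_le_pow_left₀ h2 lnr 2
lemma GG_nn : 0 ≤ GG r m := sq_nonneg _
lemma eig (h : Bd m R) (a : E) : ∃ e : OrthonormalBasis (Fin (finrank ℝ E)) ℝ E, ∀ i j, i ≠ j →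
    ∫ x, ⟪e i, x - a⟫ * ⟪e j, x - a⟫ ∂m = 0 := by
  let T : E →ₗ[ℝ] E := 
    { toFun := fun v => ∑ i, (∫ x, ⟪v, x - a⟫ * ⟪ob E i, x - a⟫ ∂m) • ob E i
      map_add' := fun v w => by
        rw [← sum_add_distrib]
        refine sum_congr rfl fun i _ => ?_
        rw [← add_smul, ← integral_add (h.int (Bf_cont fpp)) (h.int (Bf_cont fpp))]
        simp only [inner_add_left, add_mul]
      map_smul' := fun c v => by
        rw [smul_sum]
        refine sum_congr rfl fun i _ => ?_
        rw [smul_smul, RingHom.id_apply, ← integral_const_mul]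
        simp only [real_inner_smul_left, mul_assoc] }
  have hT : ∀ v w, ⟪T v, w⟫ = ∫ x, ⟪v, x - a⟫ * ⟪w, x - a⟫ ∂m := fun v w => by
    change ⟪∑ i, (∫ x, ⟪v, x - a⟫ * ⟪ob E i, x - a⟫ ∂m) • ob E i, w⟫ = _
    rw [sum_inner]
    simp only [real_inner_smul_left, ← integral_mul_const]
    rw [← integral_finsetSum _ fun i _ => h.int (Bf_cont fpp)]
    congr 1; ext x
    rw [← (ob E).sum_inner_mul_inner w (x - a), mul_sum]
    refine sum_congr rfl fun i _ => ?_
    rw [real_inner_comm w]; ring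
  have hs : T.IsSymmetric := fun v w => by
    rw [hT, real_inner_comm, hT]; congr 1; ext x; ring
  refine ⟨hs.eigenvectorBasis rfl, fun i j hij => ?_⟩
  rw [← hT, hs.apply_eigenvectorBasis, real_inner_smul_left, (hs.eigenvectorBasis rfl).orthonormal.2 hij, mul_zero]
end p2

section p3
open TensorProduct
lemma tens {ι : Type*} [Fintype ι] (e : OrthonormalBasis ι ℝ E) (c : ι → ι → ℝ) : ∃ M : E ⊗[ℝ] E,
    (∀ w : E, ⟪w ⊗ₜ[ℝ] w, M⟫ = ∑ i, ∑ j, ⟪w, e i⟫ * ⟪w, e j⟫ * c i j) ∧ ‖M‖ ^ 2 = ∑ i, ∑ j, c i j ^ 2 := by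
  classical
  have ho : Orthonormal ℝ fun p : ι × ι => e p.1 ⊗ₜ[ℝ] e p.2 := by
    have he := orthonormal_iff_ite.1 e.orthonormal
    rw [orthonormal_iff_ite]
    rintro ⟨i, j⟩ ⟨i', j'⟩; rw [inner_tmul, he, he]; simp only [Prod.mk.injEq]
    split_ifs <;> simp_all
  refine ⟨∑ p : ι × ι, c p.1 p.2 • (e p.1 ⊗ₜ[ℝ] e p.2), fun w => ?_, ?_⟩
  · rw [inner_sum, Fintype.sum_prod_type]
    refine sum_congr rfl fun i _ => sum_congr rfl fun j _ => ?_
    refine (real_inner_smul_right (F := E ⊗[ℝ] E) _ _ _).trans ?_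
    rw [inner_tmul]; ring
  · rw [← real_inner_self_eq_norm_sq]
    have := ho.inner_sum (fun p => c p.1 p.2) (fun p => c p.1 p.2) Finset.univ
    refine this.trans ?_
    rw [Fintype.sum_prod_type]
    simp [sq]

lemma feas {ι : Type*} [Fintype ι] [DecidableEq ι] (e : OrthonormalBasis ι ℝ E) (l : ι → ℝ) (H : ι → ι → ℝ) {ρ : ℝ} (h0 : 0 ≤ ρ) (hr : ρ < r) :
    ∃ M : E ⊗[ℝ] E, (∀ w : E, ∑ i, ∑ j, ⟪w, e i⟫ * ⟪w, e j⟫ * (H i j + if i = j then l i else 0) ≤ ⟪w ⊗ₜ[ℝ] w, M⟫ + r * ‖w‖ ^ 2) ∧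
    ‖M‖ ^ 2 ≤ ∑ i, max (l i - r) 0 ^ 2 + ∑ i, 2 * max (l i - r) 0 * H i i +
      ∑ i, ∑ j, (if l i < ρ ∧ l j < ρ then 0 else H i j ^ 2) + (∑ i, ∑ j, H i j ^ 2) ^ 2 / (r - ρ) ^ 2 := by
  set X := ∑ i, ∑ j, (if l i < ρ ∧ l j < ρ then H i j ^ 2 else 0) with hX
  set Y := ∑ i, ∑ j, H i j ^ 2 with hY
  have hXY : X ≤ Y := sum_le_sum fun i _ => sum_le_sum fun j _ => by
    split_ifs; exacts [le_rfl, sq_nonneg _]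
  have hX0 : 0 ≤ X := sum_nonneg fun i _ => sum_nonneg fun j _ => by positivity
  let b : ι → ι → ℝ := fun i j => if (l i < ρ ∧ l j < ρ) ∧ X ≤ (r - ρ) ^ 2 then 0 else H i j
  obtain ⟨M, h1, h2⟩ := tens e fun i j => b i j + if i = j then max (l i - r) 0 else 0
  have hb2 : ∑ i, ∑ j, b i j ^ 2 ≤ ∑ i, ∑ j, (if l i < ρ ∧ l j < ρ then 0 else H i j ^ 2) + Y ^ 2 / (r - ρ) ^ 2 := by
    have hd : 0 < (r - ρ) ^ 2 := by have := sub_pos.2 hr; positivity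
    by_cases hc : X ≤ (r - ρ) ^ 2
    · refine le_add_of_le_of_nonneg (sum_le_sum fun i _ => sum_le_sum fun j _ => ?_) psv
      simp only [b, hc, and_true]; split_ifs <;> simp
    · have : X ≤ Y ^ 2 / (r - ρ) ^ 2 := by
        rw [le_div_iff₀ hd]; push Not at hc; nlinarith
      refine le_trans (le_of_eq ?_) (add_le_add_right this _)
      rw [hX]; simp only [b, hc, and_false, if_false, ← sum_add_distrib]
      refine sum_congr rfl fun i _ => sum_congr rfl fun j _ => ?_
      split_ifs <;> simp
  refine ⟨M, fun w => ?_, ?_⟩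
  · rw [h1, ← e.sum_sq_inner_left w]
    have key : ∑ i, ∑ j, ⟪w, e i⟫ * ⟪w, e j⟫ * (H i j - b i j) ≤ ∑ i, (if l i < ρ then r - ρ else 0) * ⟪w, e i⟫ ^ 2 := by
      by_cases hc : X ≤ (r - ρ) ^ 2
      · set u : ι → ℝ := fun i => if l i < ρ then ⟪w, e i⟫ else 0 with hu
        have e1 : ∑ i, ∑ j, ⟪w, e i⟫ * ⟪w, e j⟫ * (H i j - b i j) = ∑ p : ι × ι, (u p.1 * u p.2) * (if l p.1 < ρ ∧ l p.2 < ρ then H p.1 p.2 else 0) := by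
          rw [Fintype.sum_prod_type]
          refine sum_congr rfl fun i _ => sum_congr rfl fun j _ => ?_
          simp only [b, hc, and_true, hu]; split_ifs <;> simp_all
        have e2 : ∑ i, (if l i < ρ then r - ρ else 0) * ⟪w, e i⟫ ^ 2 = (r - ρ) * ∑ i, u i ^ 2 := by
          rw [mul_sum]; refine sum_congr rfl fun i _ => ?_
          simp only [hu]; split_ifs <;> simp
        rw [e1, e2]
        have hu0 : 0 ≤ ∑ i, u i ^ 2 := sum_nonneg fun i _ => sq_nonneg _
        have e3 := Finset.sum_mul_sq_le_sq_mul_sq Finset.univ (fun p : ι × ι => u p.1 * u p.2) (fun p => if l p.1 < ρ ∧ l p.2 < ρ then H p.1 p.2 else 0)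
        refine abs_le_of_sq_le_sq' ?_ (mul_nonneg (sub_pos.2 hr).le hu0) |>.2
        refine e3.trans ?_
        have e4 : ∑ p : ι × ι, (u p.1 * u p.2) ^ 2 = (∑ i, u i ^ 2) ^ 2 := by
          rw [sq (∑ i, u i ^ 2), sum_mul_sum, Fintype.sum_prod_type]; simp only [mul_pow]
        have e5 : ∑ p : ι × ι, (if l p.1 < ρ ∧ l p.2 < ρ then H p.1 p.2 else 0) ^ 2 = X := by
          rw [hX, Fintype.sum_prod_type]
          refine sum_congr rfl fun i _ => sum_congr rfl fun j _ => ?_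
          split_ifs <;> simp
        rw [e4, e5, mul_comm, mul_pow]
        exact mul_le_mul_of_nonneg_right hc psv
      · simp only [b, hc, and_false, if_false, sub_self, mul_zero, Finset.sum_const_zero]
        refine sum_nonneg fun i _ => mul_nonneg ?_ (sq_nonneg _)
        split_ifs; exacts [(sub_pos.2 hr).le, le_rfl]
    have k2 : ∀ i, (if l i < ρ then r - ρ else 0) * ⟪w, e i⟫ ^ 2 ≤ (r + max (l i - r) 0 - l i) * ⟪w, e i⟫ ^ 2 := fun i => by
      refine mul_le_mul_of_nonneg_right ?_ (sq_nonneg _)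
      have := le_max_left (l i - r) 0; have := le_max_right (l i - r) 0
      split_ifs <;> linarith
    have k3 := key.trans (sum_le_sum fun i _ => k2 i)
    have k4 : ∀ (c : ι → ι → ℝ) (d : ι → ℝ), ∑ i, ∑ j, ⟪w, e i⟫ * ⟪w, e j⟫ * (c i j + if i = j then d i else 0) =
        ∑ i, ∑ j, ⟪w, e i⟫ * ⟪w, e j⟫ * c i j + ∑ i, d i * ⟪w, e i⟫ ^ 2 := fun c d => by
      simp only [mul_add, sum_add_distrib, mul_ite, mul_zero, sum_ite_eq, Finset.mem_univ, if_true]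
      congr 1; exact sum_congr rfl fun i _ => by ring
    rw [k4, k4, mul_sum]
    simp only [mul_sub, sum_sub_distrib, sub_mul, add_mul, sum_add_distrib] at k3 ⊢
    linarith
  · rw [h2]
    have k1 : ∀ i j, (b i j + if i = j then max (l i - r) 0 else 0) ^ 2 = b i j ^ 2 + if i = j then (2 * max (l i - r) 0 * H i i + max (l i - r) 0 ^ 2) else 0 := fun i j => by
      split_ifs with hij
      · subst hij
        have : max (l i - r) 0 * b i i = max (l i - r) 0 * H i i := by
          simp only [b]; split_ifs with hc
          · rw [max_eq_right (by linarith [hc.1.1])]; ring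
          · rfl
        linear_combination 2 * this
      · ring
    simp only [k1, sum_add_distrib, sum_ite_eq, Finset.mem_univ, if_true]
    linarith
end p3

section p4
lemma sumT {ι : Type*} [Fintype ι] (l : ι → ℝ) (T : ι → ι → ι → ℝ) (h0 : ∀ i j k, 0 ≤ T i j k)
    (h1 : ∀ i j k, T i j k = T j i k) (h2 : ∀ i j k, T i j k = T i k j) (ρ : ℝ) :
    ∑ i, ∑ j, (if l i < ρ ∧ l j < ρ then 0 else ∑ k, T i j k) ≤
      3 * ∑ k, if ρ ≤ l k then ∑ i, ∑ j, (if l i ≤ l k ∧ l j ≤ l k then T i j k else 0) else 0 := by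
  let W : ι → ι → ι → ℝ := fun i j k => if ρ ≤ l k ∧ l i ≤ l k ∧ l j ≤ l k then T i j k else 0
  have hW0 : ∀ i j k, 0 ≤ W i j k := fun i j k => by simp only [W]; split_ifs; exacts [h0 _ _ _, le_rfl]
  have e1 : ∀ i j, (if l i < ρ ∧ l j < ρ then 0 else ∑ k, T i j k) ≤ ∑ k, (W i j k + W i k j + W j k i) := fun i j => by
    split_ifs with hc
    · exact sum_nonneg fun k _ => by linarith [hW0 i j k, hW0 i k j, hW0 j k i]
    · refine sum_le_sum fun k _ => ?_
      have a1 := hW0 i j k; have a2 := hW0 i k j; have a3 := hW0 j k i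
      have b2 : T i k j = T i j k := h2 _ _ _
      have b3 : T j k i = T i j k := by rw [h2, h1]
      rcases le_total (l i) (l j) with hij | hij <;> rcases le_total (l i) (l k) with hik | hik <;> rcases le_total (l j) (l k) with hjk | hjk
      all_goals first
        | (have : W i j k = T i j k := if_pos ⟨by grind, by grind, by grind⟩; linarith)
        | (have : W i k j = T i k j := if_pos ⟨by grind, by grind, by grind⟩; linarith)
        | (have : W j k i = T j k i := if_pos ⟨by grind, by grind, by grind⟩; linarith)
  have e2 : ∑ k, (if ρ ≤ l k then ∑ i, ∑ j, (if l i ≤ l k ∧ l j ≤ l k then T i j k else 0) else 0) = ∑ k, ∑ i, ∑ j, W i j k :=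
    sum_congr rfl fun k _ => by
      simp only [W]; split_ifs with hc <;> simp [hc]
  refine (sum_le_sum fun i _ => sum_le_sum fun j _ => e1 i j).trans (le_of_eq ?_)
  rw [e2]
  simp only [sum_add_distrib]
  have f1 : ∑ i, ∑ j, ∑ k, W i j k = ∑ k, ∑ i, ∑ j, W i j k :=
    (sum_congr rfl fun i _ => sum_comm).trans sum_comm
  have f2 : ∑ i, ∑ j, ∑ k, W i k j = ∑ k, ∑ i, ∑ j, W i j k := sum_comm
  rw [f1, f2]; ring

lemma mean_inner (h : Bd m R) (v : E) : ⟪v, ∫ x, x ∂m⟫ = ∫ x, ⟪v, x⟫ ∂m := by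
  have := h.pr
  have hi : Integrable (fun x : E => x) m := .of_bound measurable_id.aestronglyMeasurable R h.ae
  exact (integral_inner hi v).symm
lemma Vr_cen (h : Bd m R) (v : E) : Vr m v = ∫ x, ⟪v, x - ∫ y, y ∂m⟫ * ⟪v, x - ∫ y, y ∂m⟫ ∂m := by
  simp only [Vr, inner_sub_right, mean_inner h, sq]
lemma cen0 (h : Bd m R) (v : E) : ∫ x, ⟪v, x - ∫ y, y ∂m⟫ ∂m = 0 := by
  have := h.pr
  simp only [inner_sub_right]
  rw [integral_sub (h.int (Bf_cont fpp)) (integrable_const _), mean_inner h]; simp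

lemma rateG (h : Bd m R) (hs : 0 < s) (hu : ULC s m) (e : OrthonormalBasis (Fin N) ℝ E) 
    (he : ∀ i j, i ≠ j → ∫ x, ⟪e i, x - ∫ y, y ∂m⟫ * ⟪e j, x - ∫ y, y ∂m⟫ ∂m = 0) (hr : 0 < r) (hq : 0 < q) :
    ∑ i, ∑ j, (if Vr m (e i) < 2 * r ∧ Vr m (e j) < 2 * r then 0 else
      ∑ k, (∫ x, ⟪e i, x - ∫ y, y ∂m⟫ * ⟪e j, x - ∫ y, y ∂m⟫ * ⟪e k, x - ∫ y, y ∂m⟫ ∂m) ^ 2) ≤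
      48 * √(2 * q / s) * GG r m + 48 / s * GG q m := by
  set a := ∫ y, y ∂m with ha
  have hl : ∀ i, Vr m (e i) ≤ 1 / s := fun i => by
    have := h.pr
    simpa [Vr] using varlin hs h.r0 hu h.ae (e i)
  refine (sumT (fun i => Vr m (e i)) (fun i j k => (∫ x, ⟪e i, x - a⟫ * ⟪e j, x - a⟫ * ⟪e k, x - a⟫ ∂m) ^ 2)
    (fun i j k => sq_nonneg _) (fun i j k => ?_) (fun i j k => ?_) (2 * r)).trans ?_
  · congr 2; ext x; ring
  · congr 2; ext x; ring
  have key : ∀ k, (if 2 * r ≤ Vr m (e k) then ∑ i, ∑ j, (if Vr m (e i) ≤ Vr m (e k) ∧ Vr m (e j) ≤ Vr m (e k) then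
      (∫ x, ⟪e i, x - a⟫ * ⟪e j, x - a⟫ * ⟪e k, x - a⟫ ∂m) ^ 2 else 0) else 0) ≤
      16 * √(2 * q / s) * max (Vr m (e k) - r) 0 ^ 2 + 16 / s * max (Vr m (e k) - q) 0 ^ 2 := fun k => by
    set L := Vr m (e k) with hL
    split_ifs with hc
    · have hL0 : 0 < L := by linarith
      have hD := lemD (ι := {i // Vr m (e i) ≤ L}) (e := fun i => e i) (c := fun x => ⟪e k, x - a⟫) h hs hu hL0 a
        (e.orthonormal.comp _ Subtype.val_injective) (fun v => ?_) (Bf_cont fpp) (cen0 h _) (by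
          simp only [sq]; exact (Vr_cen h (e k)).symm.le)
      · have e1 : ∀ f : Fin N → ℝ, ∑ i : {i // Vr m (e i) ≤ L}, f i = ∑ i, if Vr m (e i) ≤ L then f i else 0 := fun f => by
          rw [← Finset.sum_filter, Finset.sum_subtype (p := fun i => Vr m (e i) ≤ L) _ smp f]
        rw [e1 (fun i => ∑ j : {i // Vr m (e i) ≤ L}, (∫ x, ⟪e i, x - a⟫ * ⟪e j, x - a⟫ * ⟪e k, x - a⟫ ∂m) ^ 2)] at hD
        simp only [fun i => e1 (fun j => (∫ x, ⟪e i, x - a⟫ * ⟪e j, x - a⟫ * ⟪e k, x - a⟫ ∂m) ^ 2)] at hD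
        refine le_trans (le_of_eq ?_) (hD.trans ?_)
        · refine sum_congr rfl fun i _ => ?_
          by_cases hi : Vr m (e i) ≤ L <;> simp [hi]
        · have m1 := le_max_left (L - r) 0
          have m2 := le_max_left (L - q) 0
          have m3 : 0 ≤ √(2 * q / s) * max (L - r) 0 ^ 2 := by positivity
          have m4 : 0 ≤ 1 / s * max (L - q) 0 ^ 2 := by positivity
          have e16 : 16 / s = 16 * (1 / s) := by ring
          rw [e16]
          by_cases h2 : L ≤ 2 * q
          · have : √(L / s) ≤ √(2 * q / s) := sqrt_le_sqrt (by gcongr)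
            have h3 : L ^ 2 ≤ 4 * max (L - r) 0 ^ 2 := by nlinarith
            have := mul_le_mul h3 this psv psv
            linarith
          · have : √(L / s) ≤ 1 / s := by
              rw [show 1 / s = √((1 / s) ^ 2) from (sqrt_sq psv).symm, sq, ← div_eq_mul_one_div]
              exact sqrt_le_sqrt (by gcongr; exact hl k)
            have h3 : L ^ 2 ≤ 4 * max (L - q) 0 ^ 2 := by push Not at h2; nlinarith
            have := mul_le_mul h3 this psv psv
            linarith
      · have i0 : ∀ i j : Fin N, ∀ c : ℝ, Integrable (fun x => c * (⟪e i, x - a⟫ * ⟪e j, x - a⟫)) m := fun i j c => h.int (Bf_cont fpp)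
        have e2 : ∀ x, (∑ i : {i // Vr m (e i) ≤ L}, v i * ⟪e i, x - a⟫) ^ 2 = ∑ i : {i // Vr m (e i) ≤ L}, ∑ j : {i // Vr m (e i) ≤ L}, v i * v j * (⟪e i, x - a⟫ * ⟪e j, x - a⟫) := fun x => by
          rw [sq, sum_mul_sum]
          refine sum_congr rfl fun i _ => sum_congr rfl fun j _ => by ring
        rw [integral_congr_ae (.of_forall e2), integral_finsetSum _ fun i _ => integrable_finsetSum _ fun j _ => i0 _ _ _, mul_sum]
        refine sum_le_sum fun i _ => ?_
        rw [integral_finsetSum _ fun j _ => i0 _ _ _, sum_eq_single i]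
        · rw [integral_const_mul, ha, ← Vr_cen h]; nlinarith [i.2, sq_nonneg (v i)]
        · intro j _ hj; rw [integral_const_mul, he _ _ (fun hh => hj (Subtype.ext hh.symm)), mul_zero]
        · simp
    · positivity
  have g1 := GG_ge h hr.le e.orthonormal
  have g2 := GG_ge h hq.le e.orthonormal
  calc _ ≤ 3 * ∑ k, (16 * √(2 * q / s) * max (Vr m (e k) - r) 0 ^ 2 + 16 / s * max (Vr m (e k) - q) 0 ^ 2) :=
        mul_le_mul_of_nonneg_left (sum_le_sum fun k _ => key k) nnm
    _ = 48 * √(2 * q / s) * ∑ k, max (Vr m (e k) - r) 0 ^ 2 + 48 / s * ∑ k, max (Vr m (e k) - q) 0 ^ 2 := by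
        rw [sum_add_distrib, ← mul_sum, ← mul_sum]; ring
    _ ≤ _ := add_le_add (mul_le_mul_of_nonneg_left g1 psv) (mul_le_mul_of_nonneg_left g2 psv)
end p4

section p5
lemma Vr_le (h : Bd m R) (a v : E) : Vr m v ≤ ∫ x, ⟪v, x - a⟫ ^ 2 ∂m := by
  have := h.pr
  have i1 : Integrable (fun x => ⟪v, x⟫ ^ 2) m := h.int (Bf_cont fpp)
  have i2 : Integrable (fun x => ⟪v, x⟫) m := h.int (Bf_cont fpp)
  have e : ∀ x, ⟪v, x - a⟫ ^ 2 = (⟪v, x⟫ ^ 2 - 2 * ⟪v, a⟫ * ⟪v, x⟫) + ⟪v, a⟫ ^ 2 := fun x => by rw [inner_sub_right]; ring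
  have i3 : Integrable (fun x => ⟪v, x⟫ ^ 2 - 2 * ⟪v, a⟫ * ⟪v, x⟫) m := i1.sub (i2.const_mul _)
  simp only [e]
  rw [Vr_eq h, integral_add i3 (integrable_const _), integral_sub i1 (i2.const_mul _), integral_const_mul]
  simp; nlinarith [sq_nonneg (∫ x, ⟪v, x⟫ ∂m - ⟪v, a⟫)]

def sC (E : Type*) [NormedAddCommGroup E] [InnerProductSpace ℝ E] [FiniteDimensional ℝ E]
    [MeasurableSpace E] [BorelSpace E] (R r : ℝ) : ℝ :=
  (finrank ℝ E) ^ 2 * (7 * (8 * R ^ 2) ^ 2 * JE E R + (finrank ℝ E) ^ 2 / (2 * r) ^ 2 * ((8 * R ^ 2) ^ 4 * JE E R))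

theorem stepG (h : Bd m R) (hs : 0 < s) (hu : ULC s m) (h0 : 0 ≤ δ) (h1 : δ ≤ 1) (hr : 0 < r) (hq : 0 < q) :
    ∫ g, GG (4 * r) (tl m δ (Real.sqrt δ • g)) * tZ m δ (Real.sqrt δ • g) ∂(gam E) ≤
      GG (4 * r) m + δ * (48 * √(2 * q / s) * GG r m + 48 / s * GG q m) + sC E R r * (δ * Real.sqrt δ) := by
  have := h.pr
  set a := ∫ y, y ∂m with ha
  set N := finrank ℝ E with hN
  obtain ⟨e, he⟩ : ∃ e : OrthonormalBasis (Fin N) ℝ E, _ := eig h a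
  set l : Fin N → ℝ := fun i => Vr m (e i) with hl
  set K := 8 * R ^ 2 with hK
  have hK0 : 0 ≤ K := by positivity
  let p : Fin N → Fin N → E → ℝ := fun i j x => ⟪e i, x - a⟫ * ⟪e j, x - a⟫ - if i = j then l i else 0
  have pB : ∀ i j, Bf R (p i j) := fun i j => Bf_cont (by simp only [p]; fun_prop)
  have na : ‖a‖ ≤ R := by simpa using norm_integral_le_of_norm_le_const (μ := m) h.ae
  have b0 : ∀ i x, ‖x‖ ≤ R → |⟪e i, x - a⟫| ≤ 2 * R := fun i x hx => by
    refine (abs_real_inner_le_norm _ _).trans ?_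
    rw [e.orthonormal.1 i, one_mul]; linarith [norm_sub_le x a]
  have b1 : ∀ i j x, ‖x‖ ≤ R → |⟪e i, x - a⟫ * ⟪e j, x - a⟫| ≤ 4 * R ^ 2 := fun i j x hx => by
    have := mul_le_mul (b0 i x hx) (b0 j x hx) (abs_nonneg _) (by have := h.r0; positivity)
    rw [abs_mul]; linarith
  have b2 : ∀ i, |l i| ≤ 4 * R ^ 2 := fun i => by simp only [hl]; rw [Vr_cen h]; exact h.le fun x hx => b1 i i x hx
  have pK : ∀ i j x, ‖x‖ ≤ R → |p i j x| ≤ K := fun i j x hx => by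
    have := b1 i j x hx
    simp only [p]; split_ifs
    · exact (abs_sub _ _).trans (by linarith [b2 i])
    · rw [sub_zero]; nlinarith [sq_nonneg R]
  have ie : ∀ i j, Integrable (fun x => ⟪e i, x - a⟫ * ⟪e j, x - a⟫) m := fun i j => h.int (Bf_cont fpp)
  have p0 : ∀ i j, ∫ x, p i j x ∂m = 0 := fun i j => by
    simp only [p]; rw [integral_sub (ie i j) (integrable_const _)]
    split_ifs with hij
    · subst hij; simp only [hl]; rw [Vr_cen h, ← ha]; simp
    · rw [he i j hij]; simp
  have kap : ∀ i j k, ∫ y, p i j y * ⟪e k, y⟫ ∂m = ∫ x, ⟪e i, x - a⟫ * ⟪e j, x - a⟫ * ⟪e k, x - a⟫ ∂m := fun i j k => by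
    have c : ∀ y, p i j y * ⟪e k, y⟫ = (⟪e i, y - a⟫ * ⟪e j, y - a⟫ * ⟪e k, y - a⟫ - (if i = j then l i else 0) * ⟪e k, y - a⟫) + ⟪e k, a⟫ * p i j y := fun y => by
      have : ⟪e k, y⟫ = ⟪e k, y - a⟫ + ⟪e k, a⟫ := by rw [← inner_add_right, sub_add_cancel]
      simp only [p]; rw [this]; ring
    have i1 : Integrable (fun y => ⟪e i, y - a⟫ * ⟪e j, y - a⟫ * ⟪e k, y - a⟫ - (if i = j then l i else 0) * ⟪e k, y - a⟫) m := h.int (Bf_cont fpp)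
    rw [integral_congr_ae (.of_forall c), integral_add i1 ((h.int (pB i j)).const_mul _), integral_const_mul, p0, mul_zero, add_zero,
      integral_sub (h.int (Bf_cont fpp)) (h.int (Bf_cont fpp)), integral_const_mul, ha, cen0 h, mul_zero, sub_zero]
  let Z : E → ℝ := fun g => tZ m δ (Real.sqrt δ • g)
  let H : Fin N → Fin N → E → ℝ := fun i j g => TT m δ (p i j) (Real.sqrt δ • g)
  have hZ : ∀ g, 0 < Z g := fun g => h.tZ_pos _ _
  let d : Fin N → Fin N → ℝ := fun i j => if l i < 2 * r ∧ l j < 2 * r then 0 else 1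
  have d0 : ∀ i j, 0 ≤ d i j ∧ d i j ≤ 1 := fun i j => by simp only [d]; split_ifs <;> norm_num
  set D : ℝ := N ^ 2 / (2 * r) ^ 2 with hD
  have hD0 : 0 ≤ D := by positivity
  have pt : ∀ g, GG (4 * r) (tl m δ (Real.sqrt δ • g)) * Z g ≤ GG (4 * r) m * Z g + ∑ i, 2 * max (l i - 4 * r) 0 * (H i i g * Z g) +
      ∑ i, ∑ j, d i j * (H i j g ^ 2 * Z g) + D * ∑ i, ∑ j, H i j g ^ 4 * Z g := fun g => by
    have hb := h.tl δ (Real.sqrt δ • g)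
    have hbp := hb.pr
    obtain ⟨M, hM1, hM2⟩ := feas e l (fun i j => H i j g) (ρ := 2 * r) (r := 4 * r) psv lnr
    have c1 : ∀ i j, H i j g + (if i = j then l i else 0) = ∫ x, ⟪e i, x - a⟫ * ⟪e j, x - a⟫ ∂(tl m δ (Real.sqrt δ • g)) := fun i j => by
      simp only [H, TT, p]
      rw [integral_sub (hb.int (Bf_cont fpp)) (integrable_const _)]; simp
    have c2 := GG_le hb M fun w => by
      refine (Vr_le hb a w).trans (le_trans (le_of_eq ?_) (hM1 w))
      simp only [c1, ← integral_const_mul]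
      have c3 : ∀ x, ⟪w, x - a⟫ ^ 2 = ∑ i, ∑ j, ⟪w, e i⟫ * ⟪w, e j⟫ * (⟪e i, x - a⟫ * ⟪e j, x - a⟫) := fun x => by
        rw [← e.sum_inner_mul_inner w (x - a), sq, sum_mul_sum]
        exact sum_congr rfl fun i _ => sum_congr rfl fun j _ => by ring
      rw [integral_congr_ae (.of_forall c3), integral_finsetSum _ fun i _ => hb.int (Bf_cont fpp)]
      exact sum_congr rfl fun i _ => integral_finsetSum _ fun j _ => hb.int (Bf_cont fpp)
    have c4 := GG_ge h (r := 4 * r) psv e.orthonormal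
    have c5 : (∑ i, ∑ j, H i j g ^ 2) ^ 2 / (4 * r - 2 * r) ^ 2 ≤ D * ∑ i, ∑ j, H i j g ^ 4 := by
      have := sq_sum_le_card_mul_sum_sq (s := Finset.univ) (f := fun p : Fin N × Fin N => H p.1 p.2 g ^ 2)
      simp only [Fintype.sum_prod_type, card_univ, Fintype.card_prod, Fintype.card_fin, ← pow_mul] at this
      rw [hD, show 4 * r - 2 * r = 2 * r by ring, div_mul_eq_mul_div]
      refine div_le_div_of_nonneg_right (this.trans (le_of_eq ?_)) psv
      push_cast; ring
    have c6 : ∑ i, ∑ j, (if l i < 2 * r ∧ l j < 2 * r then 0 else H i j g ^ 2) = ∑ i, ∑ j, d i j * H i j g ^ 2 :=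
      sum_congr rfl fun i _ => sum_congr rfl fun j _ => by simp only [d]; split_ifs <;> simp
    rw [c6] at hM2
    have c7 := mul_le_mul_of_nonneg_right (c2.trans (hM2.trans (add_le_add (add_le_add_left (add_le_add_left c4 _) _) c5))) (hZ g).le
    refine c7.trans (le_of_eq ?_)
    simp only [add_mul, sum_mul, mul_sum, mul_assoc]
  have J1 := fun i j => st_int1 h h0 h1 (pB i j) (p0 i j)
  have J2 := fun i j => st_int2 e h h0 h1 (pB i j) hK0 (pK i j) (p0 i j)
  have J4 := fun i j => st_int4 h h0 h1 (pB i j) hK0 (pK i j) (p0 i j)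
  have iZ : Integrable Z (gam E) := by
    exact (JE_int R 1).mono' (tZ_meas h).aestronglyMeasurable (ae_of_all _ fun g => by
      rw [norm_of_nonneg (hZ g).le, pow_one]; exact (st_Z h h0 h1 g).2.2.2)
  have eZ : ∫ g, Z g ∂(gam E) = 1 := by simpa [ev] using ev_one h h0
  have I1 : Integrable (fun g => ∑ i, 2 * max (l i - 4 * r) 0 * (H i i g * Z g)) (gam E) := integrable_finsetSum _ fun i _ => (J1 i i).1.const_mul _
  have I2' : ∀ i, Integrable (fun g => ∑ j, d i j * (H i j g ^ 2 * Z g)) (gam E) := fun i => integrable_finsetSum _ fun j _ => (J2 i j).1.const_mul _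
  have I2 : Integrable (fun g => ∑ i, ∑ j, d i j * (H i j g ^ 2 * Z g)) (gam E) := integrable_finsetSum _ fun i _ => I2' i
  have I4' : ∀ i, Integrable (fun g => ∑ j, H i j g ^ 4 * Z g) (gam E) := fun i => integrable_finsetSum _ fun j _ => (J4 i j).1
  have I4 : Integrable (fun g => D * ∑ i, ∑ j, H i j g ^ 4 * Z g) (gam E) := (integrable_finsetSum _ fun i _ => I4' i).const_mul D
  have I0 : Integrable (fun g => GG (4 * r) m * Z g) (gam E) := iZ.const_mul _
  have I01 : Integrable (fun g => GG (4 * r) m * Z g + ∑ i, 2 * max (l i - 4 * r) 0 * (H i i g * Z g)) (gam E) := I0.add I1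
  have I02 : Integrable (fun g => GG (4 * r) m * Z g + ∑ i, 2 * max (l i - 4 * r) 0 * (H i i g * Z g) + ∑ i, ∑ j, d i j * (H i j g ^ 2 * Z g)) (gam E) := I01.add I2
  refine (integral_mono_of_nonneg (.of_forall fun g => mul_nonneg GG_nn (hZ g).le) (I02.add I4) (.of_forall pt)).trans ?_
  have S1 : ∫ g, ∑ i, 2 * max (l i - 4 * r) 0 * (H i i g * Z g) ∂(gam E) = 0 := by
    rw [integral_finsetSum _ fun i _ => (J1 i i).1.const_mul _]
    refine Finset.sum_eq_zero fun i _ => ?_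
    rw [integral_const_mul, (J1 i i).2, mul_zero]
  set B := 7 * K ^ 2 * JE E R * (δ * Real.sqrt δ) with hB
  have hJ : 0 ≤ JE E R := JE_nn
  have S2 : ∫ g, ∑ i, ∑ j, d i j * (H i j g ^ 2 * Z g) ∂(gam E) ≤ δ * (48 * √(2 * q / s) * GG r m + 48 / s * GG q m) + N ^ 2 * B := by
    rw [integral_finsetSum _ fun i _ => I2' i]
    have : ∀ i j, ∫ g, d i j * (H i j g ^ 2 * Z g) ∂(gam E) ≤ δ * (d i j * ∑ k, (∫ y, p i j y * ⟪e k, y⟫ ∂m) ^ 2) + B := fun i j => by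
      rw [integral_const_mul]
      have h1 := mul_le_mul_of_nonneg_left (J2 i j).2 (d0 i j).1
      have h2 : d i j * B ≤ B := mul_le_of_le_one_left psv (d0 i j).2
      nlinarith
    calc _ ≤ ∑ i, ∑ j, (δ * (d i j * ∑ k, (∫ y, p i j y * ⟪e k, y⟫ ∂m) ^ 2) + B) := sum_le_sum fun i _ => by
            rw [integral_finsetSum _ fun j _ => (J2 i j).1.const_mul _]; exact sum_le_sum fun j _ => this i j
      _ = δ * ∑ i, ∑ j, d i j * ∑ k, (∫ y, p i j y * ⟪e k, y⟫ ∂m) ^ 2 + N ^ 2 * B := by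
            simp only [sum_add_distrib, ← mul_sum, sum_const, card_univ, Fintype.card_fin, nsmul_eq_mul]; ring
      _ ≤ _ := by
            refine add_le_add_left (mul_le_mul_of_nonneg_left (le_trans (le_of_eq ?_) (rateG h hs hu e he hr hq)) h0) _
            refine sum_congr rfl fun i _ => sum_congr rfl fun j _ => ?_
            simp only [kap, d, ← ha]; split_ifs <;> simp
  have S4 : ∫ g, D * ∑ i, ∑ j, H i j g ^ 4 * Z g ∂(gam E) ≤ D * (N ^ 2 * (K ^ 4 * JE E R * (δ * Real.sqrt δ))) := by
    rw [integral_const_mul, integral_finsetSum _ fun i _ => I4' i]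
    refine mul_le_mul_of_nonneg_left ?_ hD0
    calc _ ≤ ∑ i : Fin N, ∑ j : Fin N, K ^ 4 * JE E R * (δ * Real.sqrt δ) := sum_le_sum fun i _ => by
            rw [integral_finsetSum _ fun j _ => (J4 i j).1]; exact sum_le_sum fun j _ => (J4 i j).2
      _ = _ := by simp; ring
  have := integral_add I02 I4
  simp only [Pi.add_apply] at this ⊢
  rw [this, integral_add I01 I2, integral_add I0 I1, S1, integral_const_mul, eZ, sC, ← hK, ← hN]
  rw [hB] at S2
  linarith
end p5

section p6
def Kc (a b : ℝ) : ℕ → ℝ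
  | 0 => b
  | j + 1 => 2 * a * Kc a b j + 96
lemma Kc_pos (ha : 0 < a) (hb : 0 < b) : ∀ j, 0 < Kc a b j
  | 0 => hb
  | j + 1 => by have := Kc_pos ha hb j; simp only [Kc]; positivity
lemma dB (he : 0 < ε) (c : ℝ) (j : ℕ) (ht : 0 ≤ t) :
    HasDerivAt (fun t => c * √(t + ε) ^ (j + 1)) (c * ((j + 1) * √(t + ε) ^ j * (1 / (2 * √(t + ε))))) t := by
  have h1 : HasDerivAt (fun t => √(t + ε)) (1 / (2 * √(t + ε))) t :=
    ((hasDerivAt_id t).add_const ε).sqrt (by simp; linarith)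
  simpa using (h1.pow (j + 1)).const_mul c
theorem ode (q : ℝ) (hq : 0 < q) : ∃ s0 : ℝ, 0 < s0 ∧ s0 ≤ 1 / 4 ∧ ∀ (n ε : ℝ) (u : ℕ → ℝ → ℝ) (C : ℕ → ℝ), 0 < n → 0 < ε → ε ≤ s0 →
    (∀ j, ContinuousOn (u j) (Icc 0 1)) → (∀ j, u j 0 = 0) → (∀ t ∈ Icc (0:ℝ) 1, u 0 t ≤ n * (4 * q ^ 2) + 4 * u 193 t) → 
    (∀ j t δ, 0 ≤ t → 0 ≤ δ → t + δ ≤ 1 → u (j + 1) (t + δ) ≤ u (j + 1) t +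
      δ * (48 * √(2 * q / (t + ε)) * u j t + 48 / (t + ε) * u 193 t) + C j * (δ * Real.sqrt δ)) →
    ∀ t ∈ Icc 0 s0, u 193 t ≤ n := by
  set a := 48 * √(2 * q) with ha
  have ha0 : 0 < a := by positivity
  set b := 4 * q ^ 2 + 4 with hb
  have hb0 : 0 < b := by positivity
  have hK := Kc_pos ha0 hb0
  set y := 1 / (2 * (a * Kc a b 192 + 1)) with hy
  have hy0 : 0 < y := by have := hK 192; positivity
  have hy1 : y ≤ 1 / 2 := by
    rw [hy]; refine one_div_le_one_div_of_le nnm ?_; have := mul_pos ha0 (hK 192); linarith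
  have hya : a * Kc a b 192 * y ≤ 1 / 2 := by
    rw [hy, mul_one_div, div_le_iff₀ (by have := hK 192; positivity)]; linarith
  refine ⟨y ^ 2 / 2, by positivity, by nlinarith, fun n ε u C hn he hes hc h0 hu0 hst => ?_⟩
  set T := y ^ 2 / 2 with hT
  have hT1 : T ≤ 1 := by nlinarith
  have hx : ∀ t ∈ Icc 0 T, 0 < √(t + ε) ∧ √(t + ε) ≤ y ∧ t + ε = √(t + ε) ^ 2 := fun t ht =>
    ⟨sqrt_pos.2 (by linarith [ht.1]), sqrt_le_iff.2 ⟨hy0.le, by linarith [ht.2]⟩, (sq_sqrt (by linarith [ht.1])).symm⟩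
  have hsq : ∀ t, √(2 * q / (t + ε)) = √(2 * q) / √(t + ε) := fun t => Real.sqrt_div psv _
  have imp : ∀ θ : ℝ, 1 ≤ θ → (∀ t ∈ Icc 0 T, u 193 t ≤ θ * n * √(t + ε) ^ 192) →
      ∀ t ∈ Icc 0 T, u 193 t ≤ 3 / 4 * θ * n * √(t + ε) ^ 192 := fun θ hθ hJ => by
    have ind : ∀ j, j ≤ 192 → ∀ t ∈ Icc 0 T, u j t ≤ θ * n * Kc a b j * √(t + ε) ^ j := fun j => by
      induction j with
      | zero =>
        intro _ t ht
        obtain ⟨x0, x1, -⟩ := hx t ht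
        have h1 : √(t + ε) ^ 192 ≤ 1 := pow_le_one₀ x0.le lnr
        have h2 := hJ t ht
        have h3 := hu0 t ⟨ht.1, ht.2.trans hT1⟩
        have h4 : θ * n * √(t + ε) ^ 192 ≤ θ * n := mul_le_of_le_one_right psv h1
        have h5 : n * (4 * q ^ 2) ≤ θ * (n * (4 * q ^ 2)) := le_mul_of_one_le_left psv hθ
        simp only [Kc, pow_zero, hb]; linarith
      | succ j ih =>
        intro hj
        refine cmpr hT1 (hc (j + 1)) (hst j) (fun t ht => dB he _ j ht.1) (fun t ht => ?_) (by rw [h0]; have := hK (j + 1); positivity)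
        have ht' := Ico_subset_Icc_self ht
        obtain ⟨x0, x1, x2⟩ := hx t ht'
        have h1 := ih (by omega) t ht'
        have h2 := hJ t ht'
        rw [hsq, x2, sqrt_sq x0.le]
        set x := √(t + ε) with hxx
        have h3 : x ^ 192 ≤ x * x ^ j := by rw [← pow_succ']; exact pow_le_pow_of_le_one x0.le lnr hj
        have hkj := hK j
        have h4 : 48 / x ^ 2 * u 193 t ≤ 48 / x ^ 2 * (θ * n * (x * x ^ j)) :=
          mul_le_mul_of_nonneg_left (h2.trans (by gcongr)) psv
        have h5 : 48 * (√(2 * q) / x) * u j t ≤ 48 * (√(2 * q) / x) * (θ * n * Kc a b j * x ^ j) := by gcongr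
        have h6 : 48 * (√(2 * q) / x) * (θ * n * Kc a b j * x ^ j) + 48 / x ^ 2 * (θ * n * (x * x ^ j)) =
            θ * n * Kc a b (j + 1) * (1 * x ^ j * (1 / (2 * x))) := by
          simp only [Kc, ha]; field_simp; ring
        have h7 : θ * n * Kc a b (j + 1) * (1 * x ^ j * (1 / (2 * x))) ≤ θ * n * Kc a b (j + 1) * ((j + 1) * x ^ j * (1 / (2 * x))) := by
          have := hK (j + 1); gcongr; linarith [Nat.cast_nonneg (α := ℝ) j]
        linarith
    refine cmpr hT1 (hc 193) (hst 192) (fun t ht => dB he _ 191 ht.1) (fun t ht => ?_) (by rw [h0]; positivity)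
    have ht' := Ico_subset_Icc_self ht
    obtain ⟨x0, x1, x2⟩ := hx t ht'
    have h1 := ind 192 le_rfl t ht'
    have h2 := hJ t ht'
    rw [hsq, x2, sqrt_sq x0.le]
    set x := √(t + ε) with hxx
    have hk := hK 192
    have h4 : 48 / x ^ 2 * u 193 t ≤ 48 / x ^ 2 * (θ * n * x ^ 192) := mul_le_mul_of_nonneg_left h2 psv
    have h5 : 48 * (√(2 * q) / x) * u 192 t ≤ 48 * (√(2 * q) / x) * (θ * n * Kc a b 192 * x ^ 192) := by gcongr
    have h6 : 48 * (√(2 * q) / x) * (θ * n * Kc a b 192 * x ^ 192) = (a * Kc a b 192 * x) * (θ * n * x ^ 192 / x ^ 2) := by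
      rw [ha]; field_simp
    have h7 : a * Kc a b 192 * x ≤ 24 := by
      have : a * Kc a b 192 * x ≤ a * Kc a b 192 * y := by gcongr
      linarith
    have h8 := mul_le_mul_of_nonneg_right h7 (by positivity : 0 ≤ θ * n * x ^ 192 / x ^ 2)
    have h9 : 3 / 4 * θ * n * (((191 : ℕ) + 1) * x ^ 191 * (1 / (2 * x))) = 72 * (θ * n * x ^ 192 / x ^ 2) := by
      push_cast; field_simp; ring
    have h10 : 48 / x ^ 2 * (θ * n * x ^ 192) = 48 * (θ * n * x ^ 192 / x ^ 2) := by ring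
    linarith
  have hcf : ContinuousOn (fun t => u 193 t / (n * √(t + ε) ^ 192)) (Icc 0 T) :=
    ((hc 193).mono (Icc_subset_Icc_right hT1)).div fpp fun t ht => by have := (hx t ht).1; positivity
  obtain ⟨t0, ht0, hmax⟩ := isCompact_Icc.exists_isMaxOn (nonempty_Icc.2 (by positivity : (0:ℝ) ≤ T)) hcf
  set θ := u 193 t0 / (n * √(t0 + ε) ^ 192) with hθ
  have hle : ∀ θ' : ℝ, θ ≤ θ' → ∀ t ∈ Icc 0 T, u 193 t ≤ θ' * n * √(t + ε) ^ 192 := fun θ' hh t ht => by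
    have := (hmax ht).trans hh
    simp only at this
    rw [div_le_iff₀ (by have := (hx t ht).1; positivity)] at this; linarith
  have hθ1 : θ ≤ 1 := by
    by_contra hc'
    push Not at hc'
    have h1 := imp θ hc'.le (hle θ le_rfl) t0 ht0
    have : θ ≤ 3 / 4 * θ := by
      conv_lhs => rw [hθ]
      rw [div_le_iff₀ (by have := (hx t0 ht0).1; positivity)]; linarith
    linarith
  intro t ht
  obtain ⟨x0, x1, -⟩ := hx t ht
  have h1 : √(t + ε) ^ 192 ≤ 1 := pow_le_one₀ x0.le lnr
  have := hle 1 hθ1 t ht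
  nlinarith
end p6

section p7
open TensorProduct
lemma GG_Gro (h : Bd m R) (r : ℝ) (hr : 0 ≤ r) : Gro (fun t θ => GG r (tl m t θ)) := by
  have hc : Continuous (fun q : ℝ × E => Cv (tl m q.1 q.2)) := by
    unfold Cv
    refine continuous_finset_sum _ fun i _ => continuous_finset_sum _ fun j _ => ?_
    have hs := (TT_cont h (p := fun x => ⟪ob E i, x⟫ * ⟪ob E j, x⟫) (Bf_cont fpp)).sub
      ((TT_cont h (p := fun x => ⟪ob E i, x⟫) (Bf_cont fpp)).mul (TT_cont h (p := fun x => ⟪ob E j, x⟫) (Bf_cont fpp)))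
    exact hs.smul (continuous_const (y := ob E i ⊗ₜ[ℝ] ob E j))
  refine ⟨((Metric.continuous_infDist_pt _).comp hc).pow 2, (∑ i : Fin (finrank ℝ E), ∑ j : Fin (finrank ℝ E), 2 * R ^ 2) ^ 2, 0, by positivity, le_rfl, fun t _ θ => ?_⟩
  rw [abs_of_nonneg GG_nn, zero_mul, exp_zero, mul_one]
  refine pow_le_pow_left₀ infDist_nonneg ((infDist_le_dist_of_mem (y := 0) (fun v => by simp; positivity)).trans ?_) 2
  have hb := h.tl t θ
  have b0 : ∀ i x, ‖x‖ ≤ R → |⟪ob E i, x⟫| ≤ R := fun i x hx => by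
    simpa [(ob E).orthonormal.1 i] using (abs_real_inner_le_norm (ob E i) x).trans (by simpa [(ob E).orthonormal.1 i] using hx)
  have hR := h.r0
  rw [dist_zero_right, Cv]
  refine (norm_sum_le _ _).trans (sum_le_sum fun i _ => (norm_sum_le _ _).trans (sum_le_sum fun j _ => ?_))
  refine (norm_smul (_ : ℝ) (_ : E ⊗[ℝ] E)).le.trans ?_
  rw [norm_tmul, (ob E).orthonormal.1 i, (ob E).orthonormal.1 j, mul_one, mul_one, norm_eq_abs]
  have c1 := hb.le (p := fun x => ⟪ob E i, x⟫ * ⟪ob E j, x⟫) (C := R * R) fun x hx => by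
    rw [abs_mul]; exact mul_le_mul (b0 i x hx) (b0 j x hx) (abs_nonneg _) hR
  have c2 := mul_le_mul (hb.le (b0 i)) (hb.le (b0 j)) (abs_nonneg _) hR
  refine (abs_sub _ _).trans ?_
  rw [abs_mul (∫ x, ⟪ob E i, x⟫ ∂_)]; linarith

lemma ev_lin (h : Bd m R) {Φ Ψ : ℝ → E → ℝ} (hΦ : Gro Φ) (hΨ : Gro Ψ) (a b : ℝ) (ht : t ∈ Icc (0:ℝ) 1) :
    ev m (fun t θ => a * Φ t θ + b * Ψ t θ) t = a * ev m Φ t + b * ev m Ψ t := by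
  have i1 := (hΦ.tZ h).int ht
  have i2 := (hΨ.tZ h).int ht
  simp only [ev]
  rw [← integral_const_mul, ← integral_const_mul, ← integral_add (i1.const_mul a) (i2.const_mul b)]
  congr 1; ext g; ring
lemma Gro.lin {Φ Ψ : ℝ → E → ℝ} (hΦ : Gro Φ) (hΨ : Gro Ψ) (a b : ℝ) : Gro (fun t θ => a * Φ t θ + b * Ψ t θ) := by
  obtain ⟨c1, C, x, hC, hx, h1⟩ := hΦ
  obtain ⟨c2, D, y, hD, hy, h2⟩ := hΨ
  refine ⟨(continuous_const.mul c1).add (continuous_const.mul c2), |a| * C + |b| * D, x + y, by positivity, by positivity, fun t ht θ => ?_⟩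
  refine (abs_add_le _ _).trans ?_
  rw [abs_mul, abs_mul, add_mul]
  have e1 : exp (x * ‖θ‖) ≤ exp ((x + y) * ‖θ‖) := exp_le_exp.2 (by gcongr; linarith)
  have e2 : exp (y * ‖θ‖) ≤ exp ((x + y) * ‖θ‖) := exp_le_exp.2 (by gcongr; linarith)
  refine add_le_add ?_ ?_ <;> rw [mul_assoc] <;> refine mul_le_mul_of_nonneg_left ?_ (abs_nonneg _)
  · exact (h1 t ht θ).trans (by gcongr)
  · exact (h2 t ht θ).trans (by gcongr)
lemma ev_mono (h : Bd m R) {Φ Ψ : ℝ → E → ℝ} (hΦ : Gro Φ) (hΨ : Gro Ψ) (ht : t ∈ Icc (0:ℝ) 1) (H : ∀ θ, Φ t θ ≤ Ψ t θ) : ev m Φ t ≤ ev m Ψ t :=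
  integral_mono ((hΦ.tZ h).int ht) ((hΨ.tZ h).int ht) fun _ => mul_le_mul_of_nonneg_right (H _) (h.tZ_pos _ _).le
lemma Gro_one : Gro (fun _ (_ : E) => (1:ℝ)) := ⟨continuous_const, 1, 0, by simp, le_rfl, by simp⟩

lemma sumsq (h : Bd m R) (hq : 0 < q) (e : OrthonormalBasis (Fin N) ℝ E) : ∑ i, Vr m (e i) ^ 2 ≤ N * (4 * q ^ 2) + 4 * GG q m := by
  have g := GG_ge h hq.le e.orthonormal
  have : ∀ i, Vr m (e i) ^ 2 ≤ 4 * q ^ 2 + 4 * max (Vr m (e i) - q) 0 ^ 2 := fun i => by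
    have h0 : 0 ≤ Vr m (e i) := integral_nonneg fun x => sq_nonneg _
    have m1 := le_max_left (Vr m (e i) - q) 0
    by_cases h2 : Vr m (e i) ≤ 2 * q
    · nlinarith [sq_nonneg (max (Vr m (e i) - q) 0)]
    · push Not at h2; nlinarith
  refine (sum_le_sum fun i _ => this i).trans ?_
  rw [sum_add_distrib, sum_const, card_univ, Fintype.card_fin, nsmul_eq_mul, ← mul_sum]; linarith
lemma GG0_le (h : Bd m R) (hq : 0 < q) (hr : 0 ≤ r) : GG r m ≤ finrank ℝ E * (4 * q ^ 2) + 4 * GG q m := by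
  obtain ⟨e, he⟩ := eig h (∫ y, y ∂m)
  refine le_trans ?_ (sumsq h hq e)
  obtain ⟨M, h1, h2⟩ := tens e fun i j => if i = j then Vr m (e i) else 0
  refine (GG_le h M fun w => ?_).trans (h2.le.trans (le_of_eq ?_))
  · rw [h1]
    have c3 : ∀ x, ⟪w, x - ∫ y, y ∂m⟫ * ⟪w, x - ∫ y, y ∂m⟫ = ∑ i, ∑ j, ⟪w, e i⟫ * ⟪w, e j⟫ * (⟪e i, x - ∫ y, y ∂m⟫ * ⟪e j, x - ∫ y, y ∂m⟫) := fun x => by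
      rw [← e.sum_inner_mul_inner w (x - ∫ y, y ∂m), sum_mul_sum]
      exact sum_congr rfl fun i _ => sum_congr rfl fun j _ => by ring
    rw [Vr_cen h, integral_congr_ae (.of_forall c3), integral_finsetSum _ fun i _ => h.int (Bf_cont fpp)]
    refine le_add_of_le_of_nonneg (le_of_eq ?_) psv
    refine sum_congr rfl fun i _ => ?_
    rw [integral_finsetSum _ fun j _ => h.int (Bf_cont fpp)]
    refine sum_congr rfl fun j _ => ?_
    rw [integral_const_mul]; congr 1
    split_ifs with hij
    · subst hij; rw [Vr_cen h]
    · exact he i j hij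
  · refine sum_congr rfl fun i _ => ?_
    simp

def qq : ℝ := 4 ^ 194
theorem covb : ∃ s0 : ℝ, 0 < s0 ∧ s0 ≤ 1 / 4 ∧ ∀ {E : Type} [NormedAddCommGroup E] [InnerProductSpace ℝ E] [FiniteDimensional ℝ E]
    [MeasurableSpace E] [BorelSpace E] {m : Measure E} {R ε : ℝ}, Bd m R → 0 < ε → ε ≤ s0 → ULC ε m → (∀ v, Vr m v ≤ 2 * ‖v‖ ^ 2) → 
    0 < finrank ℝ E → ∀ t ∈ Icc 0 s0, ev m (fun t θ => GG qq (tl m t θ)) t ≤ finrank ℝ E := by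
  obtain ⟨r, hr⟩ : ∃ r : ℕ → ℝ, ∀ j, r j = 4 ^ (j + 1) := ⟨_, fun _ => rfl⟩
  have hr0 : ∀ j, 0 < r j := fun j => hr j ▸ by positivity
  have hrs : ∀ j, r (j + 1) = 4 * r j := fun j => by rw [hr, hr, pow_succ']
  rw [show qq = r 193 from (hr 193).symm]
  obtain ⟨s0, h1, h2, H⟩ := ode (r 193) (hr0 _)
  refine ⟨s0, h1, h2, fun {E} _ _ _ _ _ {m R ε} h he hes hu hv hn => ?_⟩
  have hG : ∀ j : ℕ, Gro (fun t θ => GG (r j) (tl m t θ)) := fun j => GG_Gro h _ (hr0 _).le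
  refine H (finrank ℝ E) ε (fun j => ev m (fun t θ => GG (r j) (tl m t θ))) (fun j => sC E R (r j)) (by exact_mod_cast hn) he hes
    (fun j => ev_cont h (hG j)) (fun j => ?_) (fun t ht => ?_) (fun j t δ ht hδ htδ => ?_)
  · have : tl m 0 0 = m := by have := h.pr; simp [tl]
    have g0 : GG (r j) m = 0 := le_antisymm ((GG_le h 0 fun v => (hv v).trans (by
      rw [inner_zero_right, zero_add]
      have : (4:ℝ) ^ 1 ≤ r j := hr j ▸ pow_le_pow_right₀ nnm (by omega)
      gcongr; linarith)).trans smp) GG_nn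
    simp [ev, this, g0]
  · have e1 := ev_lin h Gro_one (hG 193) (finrank ℝ E * (4 * r 193 ^ 2)) 4 ht
    refine le_trans (ev_mono h (hG 0) (Gro_one.lin (hG 193) (finrank ℝ E * (4 * r 193 ^ 2)) 4) ht fun θ => ?_) (e1.trans (by rw [ev_one h ht.1, mul_one])).le
    rw [mul_one]
    exact GG0_le (h.tl _ _) (q := r 193) (hr0 _) (hr0 _).le
  · have e1 := ev_lin h (hG j) (hG 193) (48 * √(2 * r 193 / (t + ε))) (48 / (t + ε)) ⟨ht, by linarith⟩
    simp only [← e1]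
    refine ev_step h (hG (j + 1)) ((hG j).lin (hG 193) _ _) ht hδ htδ fun θ => ?_
    have := stepG (h.tl t θ) (s := t + ε) lnr (by rw [add_comm]; exact h.ulc hu t θ) hδ lnr (r := r j) (q := r 193) (hr0 _) (hr0 _)
    simp only [tl_tl h, ← hrs] at this
    exact this
end p7

section p8
def AA (m : Measure E) : ℝ := ‖∫ x, x ∂m‖ ^ 2
lemma AA_eq {ι : Type*} [Fintype ι] (h : Bd m R) (e : OrthonormalBasis ι ℝ E) : AA m = ∑ i, (∫ x, ⟪e i, x⟫ ∂m) ^ 2 := by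
  rw [AA, ← e.sum_sq_norm_inner_right]
  simp only [mean_inner h, norm_eq_abs, sq_abs]
lemma AA_Gro (h : Bd m R) : Gro (fun t θ => AA (tl m t θ)) := by
  refine ⟨?_, R ^ 2, 0, by positivity, le_rfl, fun t _ θ => ?_⟩
  · simp only [fun q : ℝ × E => AA_eq (h.tl q.1 q.2) (ob E)]
    exact continuous_finset_sum _ fun i _ => (TT_cont h (p := fun x => ⟪ob E i, x⟫) (Bf_cont fpp)).pow 2
  · have := (h.tl t θ).pr
    simp only [AA]; rw [zero_mul, exp_zero, mul_one, abs_of_nonneg psv]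
    gcongr
    simpa using norm_integral_le_of_norm_le_const (h.tl t θ).ae
lemma stepA (h : Bd m R) (h0 : 0 ≤ δ) (h1 : δ ≤ 1) (hq : 0 < q) :
    ∫ g, AA (tl m δ (Real.sqrt δ • g)) * tZ m δ (Real.sqrt δ • g) ∂(gam E) ≤
      AA m + δ * (finrank ℝ E * (4 * q ^ 2) + 4 * GG q m) + (finrank ℝ E * (7 * (2 * R) ^ 2 * JE E R)) * (δ * Real.sqrt δ) := by
  have := h.pr
  set a := ∫ y, y ∂m with ha
  obtain ⟨e, he⟩ := eig h a
  have hbf : ∀ i, Bf R (fun x => ⟪e i, x - a⟫) := fun i => Bf_cont fpp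
  have haR : ‖a‖ ≤ R := by simpa using norm_integral_le_of_norm_le_const h.ae
  have hK : ∀ i y, ‖y‖ ≤ R → |⟪e i, y - a⟫| ≤ 2 * R := fun i y hy => by
    have := abs_real_inner_le_norm (e i) (y - a)
    rw [e.orthonormal.1 i, one_mul] at this
    linarith [norm_sub_le y a]
  have hc0 := fun i => cen0 h (e i)
  have I1 := fun i => st_int1 h h0 h1 (hbf i) (hc0 i)
  have I2 := fun i => st_int2 e h h0 h1 (hbf i) (by linarith [h.r0]) (hK i) (hc0 i)
  have I0 : Integrable (fun g => tZ m δ (Real.sqrt δ • g)) (gam E) := by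
    simpa using (Gro_one.tZ h).int (t := δ) ⟨h0, h1⟩
  have e0 : ∫ g, tZ m δ (Real.sqrt δ • g) ∂(gam E) = 1 := by simpa [ev] using ev_one h h0
  have key : ∀ g, AA (tl m δ (Real.sqrt δ • g)) * tZ m δ (Real.sqrt δ • g) = ∑ i, (⟪e i, a⟫ ^ 2 * tZ m δ (Real.sqrt δ • g) +
      2 * ⟪e i, a⟫ * (TT m δ (fun x => ⟪e i, x - a⟫) (Real.sqrt δ • g) * tZ m δ (Real.sqrt δ • g)) +
      TT m δ (fun x => ⟪e i, x - a⟫) (Real.sqrt δ • g) ^ 2 * tZ m δ (Real.sqrt δ • g)) := fun g => by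
    have hb := h.tl δ (Real.sqrt δ • g)
    have := hb.pr
    rw [AA_eq hb e, sum_mul]
    refine sum_congr rfl fun i _ => ?_
    have : TT m δ (fun x => ⟪e i, x - a⟫) (Real.sqrt δ • g) = ∫ x, ⟪e i, x⟫ ∂(tl m δ (Real.sqrt δ • g)) - ⟪e i, a⟫ := by
      simp only [TT, inner_sub_right]
      rw [integral_sub (hb.int (Bf_cont fpp)) (integrable_const _)]; simp
    rw [this]; ring
  have Ia : ∀ i, Integrable (fun g => ⟪e i, a⟫ ^ 2 * tZ m δ (Real.sqrt δ • g) +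
      2 * ⟪e i, a⟫ * (TT m δ (fun x => ⟪e i, x - a⟫) (Real.sqrt δ • g) * tZ m δ (Real.sqrt δ • g))) (gam E) :=
    fun i => (I0.const_mul _).add ((I1 i).1.const_mul _)
  rw [integral_congr_ae (.of_forall key), integral_finsetSum _ fun i _ => (by exact (Ia i).add (I2 i).1)]
  have b : ∀ i ∈ Finset.univ, ∫ g, (⟪e i, a⟫ ^ 2 * tZ m δ (Real.sqrt δ • g) +
      2 * ⟪e i, a⟫ * (TT m δ (fun x => ⟪e i, x - a⟫) (Real.sqrt δ • g) * tZ m δ (Real.sqrt δ • g)) +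
      TT m δ (fun x => ⟪e i, x - a⟫) (Real.sqrt δ • g) ^ 2 * tZ m δ (Real.sqrt δ • g)) ∂(gam E) ≤ 
      (∫ x, ⟪e i, x⟫ ∂m) ^ 2 + δ * Vr m (e i) ^ 2 + 7 * (2 * R) ^ 2 * JE E R * (δ * Real.sqrt δ) := fun i _ => by
    rw [integral_add (Ia i) (I2 i).1,
      integral_add (I0.const_mul _) ((I1 i).1.const_mul _), integral_const_mul, integral_const_mul, e0, (I1 i).2, ← mean_inner h (e i), ← ha]
    have s1 : ∑ j, (∫ y, ⟪e i, y - a⟫ * ⟪e j, y⟫ ∂m) ^ 2 = Vr m (e i) ^ 2 := by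
      have : ∀ j, ∫ y, ⟪e i, y - a⟫ * ⟪e j, y⟫ ∂m = ∫ y, ⟪e i, y - a⟫ * ⟪e j, y - a⟫ ∂m := fun j => by
        have : ∀ y, ⟪e i, y - a⟫ * ⟪e j, y⟫ = ⟪e i, y - a⟫ * ⟪e j, y - a⟫ + ⟪e i, y - a⟫ * ⟪e j, a⟫ := fun y => by
          rw [inner_sub_right (e j)]; ring
        rw [integral_congr_ae (.of_forall this), integral_add (h.int (Bf_cont fpp)) (h.int (Bf_cont fpp)),
          integral_mul_const, hc0 i, zero_mul, add_zero]
      rw [sum_eq_single i (fun j _ hj => by rw [this, he i j hj.symm]; simp) smp, this, Vr_cen h]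
    have := (I2 i).2
    rw [s1] at this
    linarith
  refine (sum_le_sum b).trans ?_
  rw [sum_add_distrib, sum_add_distrib, ← AA_eq h, ← mul_sum, sum_const, card_univ, Fintype.card_fin, nsmul_eq_mul]
  have := mul_le_mul_of_nonneg_left (sumsq h hq e) h0
  linarith

lemma Lg_Gro (h : Bd m R) : Gro (fun t θ => Real.log (tZ m t θ)) := by
  have := h.pr
  refine ⟨(tZ_cont h).log fun q => (h.tZ_pos _ _).ne', exp (R ^ 2), R, by positivity, h.r0, fun t ht θ => ?_⟩
  have u := log_le_log (h.tZ_pos t θ) (tZ_le h ht.1 θ)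
  have l : exp (-(R * ‖θ‖) - R ^ 2) ≤ tZ m t θ := by
    have := integral_mono_ae (integrable_const _) (h.tw t θ) (h.ae.mono fun y hy => show exp (-(R * ‖θ‖) - R ^ 2) ≤ tw t θ y from
      exp_le_exp.2 (by
        have h1 := abs_le.1 (abs_real_inner_le_norm θ y)
        have h2 : ‖y‖ ^ 2 ≤ R ^ 2 := by gcongr
        have h3 : ‖θ‖ * ‖y‖ ≤ ‖θ‖ * R := by gcongr
        nlinarith [ht.1, ht.2, sq_nonneg ‖y‖, h1.1]))
    simpa [tZ] using this
  have l2 := log_le_log (exp_pos _) l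
  rw [log_exp] at u l2
  rw [← exp_add]
  refine le_trans ?_ (add_one_le_exp _)
  rw [abs_le]; constructor <;> nlinarith

lemma stepL (h : Bd m R) (h0 : 0 ≤ δ) (h1 : δ ≤ 1) (c : ℝ) :
    ∫ g, (c + Real.log (tZ m δ (Real.sqrt δ • g))) * tZ m δ (Real.sqrt δ • g) ∂(gam E) ≤ c + δ * AA m + 4 * JE E R * (δ * Real.sqrt δ) := by
  have e1 := ev_lin h Gro_one (Lg_Gro h) c 1 ⟨h0, h1⟩
  have := st_log h h0 h1 (ob E)
  rw [ev_one h h0, ev, ev] at e1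
  simp only [one_mul, mul_one] at e1
  rw [e1, AA_eq h (ob E)]
  linarith

lemma phib {s0 : ℝ} (hs : s0 ≤ 1 / 4) (h : Bd m R) (h0 : ∫ x, x ∂m = 0)
    (hg : ∀ t ∈ Icc 0 s0, ev m (fun t θ => GG qq (tl m t θ)) t ≤ finrank ℝ E) (ht : t ∈ Icc 0 s0) :
    ev m (fun t θ => Real.log (tZ m t θ)) t ≤ (4 * qq ^ 2 + 4) * finrank ℝ E * t ^ 2 / 2 := by
  have hq : 0 < qq := by norm_num [qq]
  set K := (4 * qq ^ 2 + 4) * finrank ℝ E with hK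
  have hm : tl m 0 0 = m := by have := h.pr; simp [tl]
  have hGq := GG_Gro h qq hq.le
  have a1 := cmpr (u := ev m (fun t θ => AA (tl m t θ))) (T := s0) (B := fun t => K * t) (B' := fun _ => K) lnr (ev_cont h (AA_Gro h))
    (fun t δ ht hδ htδ => ev_step h (AA_Gro h) (Gro_one.lin hGq (finrank ℝ E * (4 * qq ^ 2)) 4) ht hδ htδ fun θ => by
      have := stepA (h.tl t θ) hδ lnr hq
      simp only [tl_tl h, mul_one] at this ⊢
      exact this) (fun t _ => by simpa using (hasDerivAt_id t).const_mul K) (fun t ht => by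
      rw [ev_lin h Gro_one hGq _ _ ⟨ht.1, by linarith [ht.2]⟩, ev_one h ht.1]
      linarith [hg t ⟨ht.1, ht.2.le⟩]) (by simp [ev, AA, hm, h0])
  refine cmpr (T := s0) (B := fun t => K * t ^ 2 / 2) (B' := fun t => K * t) lnr (ev_cont h (Lg_Gro h)) 
    (fun t δ ht hδ htδ => ev_step h (Lg_Gro h) (AA_Gro h) ht hδ htδ fun θ => by
      have := stepL (h.tl t θ) hδ lnr (Real.log (tZ m t θ))
      have e : ∀ g, Real.log (tZ m (t + δ) (θ + g)) = Real.log (tZ m t θ) + Real.log (tZ (tl m t θ) δ g) := fun g => by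
        rw [← tZ_tl h, log_mul (h.tZ_pos _ _).ne' ((h.tl _ _).tZ_pos _ _).ne']
      simp only [e]; exact this) (fun t _ => ?_) (fun t ht => a1 t ⟨ht.1, ht.2.le⟩) (by have := h.pr; simp [ev, tZ, tw]) t ht
  have := ((hasDerivAt_pow 2 t).const_mul K).div_const 2
  refine this.congr_deriv ?_; simp; ring
end p8

section p9
theorem SB1 : ∃ s0 δ : ℝ, 0 < s0 ∧ 0 < δ ∧ ∀ {E : Type} [NormedAddCommGroup E] [InnerProductSpace ℝ E] [FiniteDimensional ℝ E]
    [MeasurableSpace E] [BorelSpace E] {m : Measure E} {R ε b : ℝ}, Bd m R → 0 < ε → ε ≤ s0 → ULC ε m → (∀ v, Vr m v ≤ 2 * ‖v‖ ^ 2) → 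
    0 < finrank ℝ E → m.map Neg.neg = m → finrank ℝ E / 2 ≤ ∫ x, ‖x‖ ^ 2 ∂m → b ^ 2 ≤ finrank ℝ E / 1000 →
    m.real (closedBall 0 b) ≤ exp (-δ * finrank ℝ E) := by
  obtain ⟨s0, h1, h2, H⟩ := covb
  set K := 4 * qq ^ 2 + 4 with hK
  have hK0 : 0 < K := by positivity
  set t := min s0 (1 / (20 * K)) with ht
  have t0 : 0 < t := by positivity
  have tK : K * t ≤ 1 / 20 := by
    have : t ≤ 1 / (20 * K) := min_le_right _ _
    rw [le_div_iff₀ psv] at this; linarith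
  refine ⟨s0, t / 32, h1, by positivity, fun {E} _ _ _ _ _ {m R ε b} h he hes hu hv hn hev hX hb => ?_⟩
  have := h.pr
  have hE : ∀ f : E → ℝ, ∫ x, f (-x) ∂m = ∫ x, f x ∂m := fun f => by
    exact (((MeasurableEquiv.neg E).measurableEmbedding.integral_map f).symm.trans (by rw [← hev]; rfl) : _ = ∫ x, f x ∂m)
  have hZ : ∀ f : E → ℝ, (∀ x, f (-x) = - f x) → ∫ x, f x ∂m = 0 := fun f hf => by
    have := hE f; simp only [hf, integral_neg] at this; linarith
  have h0 : ∫ x, x ∂m = 0 := ext_inner_left ℝ fun v => by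
    rw [mean_inner h, hZ _ (fun x => by simp)]; simp
  have htm : t ∈ Icc 0 s0 := ⟨t0.le, min_le_left _ _⟩
  have ht1 : t ∈ Icc (0:ℝ) 1 := ⟨t0.le, by linarith [htm.2]⟩
  have hφ := phib h2 h h0 (H h he hes hu hv hn) htm
  set S := closedBall (0:E) b with hS
  have mS : MeasurableSet S := isClosed_closedBall.measurableSet
  set p := m.real S with hp
  rcases (measureReal_nonneg : 0 ≤ m.real S).eq_or_lt with hp0 | hp0
  · rw [hp, ← hp0]; positivity
  have hpt : ∀ θ, Real.log p * 1 + (t / 8) * TT m t (fun y => ‖y‖ ^ 2) θ ≤ 3 / 4 * t * b ^ 2 * 1 + 1 * Real.log (tZ m t θ) := fun θ => by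
    have hb := h.tl t θ
    have := hb.pr
    have q1 : p * exp (-(t * b ^ 2 / 2)) ≤ ∫ y in S, tw t θ y ∂m := by
      have i1 : Integrable (fun y => (1 + ⟪θ, y⟫) * exp (-(t * b ^ 2 / 2))) m := h.int (Bf_cont fpp)
      refine le_trans (le_of_eq ?_) (setIntegral_mono_on i1.integrableOn (h.tw t θ).integrableOn mS fun y hy => ?_)
      · have i2 : Integrable (fun y => ⟪θ, y⟫) m := h.int (Bf_cont fpp)
        have : ∫ y in S, ⟪θ, y⟫ ∂m = 0 := by
          rw [← integral_indicator mS]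
          refine hZ _ fun x => ?_
          have : -x ∈ S ↔ x ∈ S := by simp [hS]
          by_cases hx : x ∈ S <;> simp [indicator, this, hx]
        rw [integral_mul_const, integral_add (integrable_const _) i2.integrableOn, this]; simp [hp]
      · have hy : ‖y‖ ≤ b := by simpa [hS] using hy
        have : ‖y‖ ^ 2 ≤ b ^ 2 := by gcongr
        rw [tw, sub_eq_add_neg, exp_add]
        have e1 := add_one_le_exp ⟪θ, y⟫
        have e2 : exp (-(t * b ^ 2 / 2)) ≤ exp (-(t * ‖y‖ ^ 2 / 2)) := exp_le_exp.2 (by nlinarith)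
        have e3 := exp_pos (-(t * b ^ 2 / 2))
        calc _ ≤ exp ⟪θ, y⟫ * exp (-(t * b ^ 2 / 2)) := by gcongr; linarith
          _ ≤ _ := by gcongr
    have q2 : (tl m t θ).real S = (∫ y in S, tw t θ y ∂m) / tZ m t θ := by
      rw [← integral_indicator_one mS, tl_int, ← integral_indicator mS]
      congr 2; ext y; by_cases hy : y ∈ S <;> simp [hy]
    set ψ : E → ℝ := fun y => 1 / 2 * ‖y‖ ^ 2 - b ^ 2 with hψ
    have iψ : Integrable (fun y => t * ψ y / 4) (tl m t θ) := hb.int (Bf_cont fpp)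
    have ie : Integrable (fun y => exp (t * ψ y / 4)) (tl m t θ) := hb.int (Bf_cont fpp)
    have q3 := maurey t0.le ((h.ulc hu t θ).mono lnr) mS (ψ := ψ) fpp fun x hx y => by
      have hx : ‖x‖ ≤ b := by simpa [hS] using hx
      have h1 : ‖y‖ ≤ ‖x‖ + ‖x - y‖ := by simpa using norm_sub_le x (x - y)
      simp only [hψ]
      nlinarith [norm_nonneg y, norm_nonneg x, norm_nonneg (x - y), sq_nonneg (‖x‖ - ‖x - y‖), pow_le_pow_left₀ (norm_nonneg x) hx 2]
    rw [← ofReal_integral_eq_lintegral_ofReal ie (.of_forall fun _ => by positivity), ← ofReal_measureReal, ← ofReal_mul psv, ofReal_le_one] at q3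
    have q4 : exp (∫ y, t * ψ y / 4 ∂(tl m t θ)) ≤ ∫ y, exp (t * ψ y / 4) ∂(tl m t θ) :=
      convexOn_exp.map_integral_le continuous_exp.continuousOn isClosed_univ smp iψ ie
    have q5 : ∫ y, t * ψ y / 4 ∂(tl m t θ) = t / 8 * TT m t (fun y => ‖y‖ ^ 2) θ - t * b ^ 2 / 4 := by
      have : ∀ y, t * ψ y / 4 = t / 8 * ‖y‖ ^ 2 - t * b ^ 2 / 4 := fun y => by simp only [hψ]; ring
      have i3 : Integrable (fun y : E => t / 8 * ‖y‖ ^ 2) (tl m t θ) := hb.int (Bf_cont fpp)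
      rw [integral_congr_ae (.of_forall this), integral_sub i3 (integrable_const _), integral_const_mul]; simp [TT]
    have q6 := (mul_le_mul (div_le_div_of_nonneg_right q1 (h.tZ_pos t θ).le) q4 psv (by rw [← q2]; positivity)).trans (q2 ▸ q3)
    have hz := h.tZ_pos t θ
    have q7 := log_le_log psv q6
    rw [log_mul psv psv, Real.log_div psv psv, log_mul hp0.ne' psv, log_exp, log_exp, Real.log_one, q5] at q7
    linarith
  have hT : Gro (fun t θ => TT m t (fun y => ‖y‖ ^ 2) θ) := ⟨TT_cont h (Bf_cont fpp), R ^ 2, 0, by positivity, le_rfl, fun t _ θ => by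
    simp only [zero_mul, exp_zero, mul_one]
    exact (h.tl t θ).le fun y hy => by rw [abs_of_nonneg psv]; gcongr⟩
  have f1 := ev_mono h (Gro_one.lin hT _ _) (Gro_one.lin (Lg_Gro h) _ _) ht1 hpt
  rw [ev_lin h Gro_one hT _ _ ht1, ev_lin h Gro_one (Lg_Gro h) _ _ ht1, ev_one h t0.le, ev_TT h (Bf_cont fpp) t0.le] at f1
  rw [← log_le_iff_le_exp hp0]
  have k1 : K * finrank ℝ E * t ^ 2 / 2 ≤ finrank ℝ E * t / 40 := by
    have : (0:ℝ) ≤ finrank ℝ E * t := by positivity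
    nlinarith
  nlinarith
end p9

section q0
lemma even_wd (h : μ.map Neg.neg = μ) {G : E → ℝ≥0∞} (hG : ∀ x, G (-x) = G x) (hm : Measurable G) :
    (μ.withDensity G).map Neg.neg = μ.withDensity G := by
  ext A hA
  rw [map_apply measurable_neg hA, withDensity_apply _ (measurable_neg hA), withDensity_apply _ hA, ← lintegral_indicator (measurable_neg hA),
    ← lintegral_indicator hA]
  conv_rhs => rw [← h, lintegral_map (hm.indicator hA) measurable_neg]
  refine lintegral_congr fun x => ?_
  by_cases hx : -x ∈ A <;> simp [indicator, hx, hG]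

theorem SB : ∃ δ : ℝ, 0 < δ ∧ ∀ {E : Type} [NormedAddCommGroup E] [InnerProductSpace ℝ E] [FiniteDimensional ℝ E]
    [MeasurableSpace E] [BorelSpace E] {μ : Measure E} {b : ℝ}, IsProbabilityMeasure μ → ULC 0 μ → 0 < finrank ℝ E → μ.map Neg.neg = μ →
    (∀ v, Integrable (fun x => ⟪v, x⟫ ^ 2) μ ∧ ∫ x, ⟪v, x⟫ ^ 2 ∂μ = ‖v‖ ^ 2) → b ^ 2 ≤ finrank ℝ E / 1000 →
    μ.real (closedBall 0 b) ≤ exp (-δ * finrank ℝ E) := by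
  obtain ⟨s0, δ, hs0, hδ, H⟩ := SB1
  refine ⟨δ, hδ, fun {E} _ _ _ _ _ {μ b} _ hu hn hev hI hb => ?_⟩
  set B : ℕ → Set E := fun j => closedBall 0 (j:ℝ) with hB
  have mB : ∀ j, MeasurableSet (B j) := fun j => isClosed_closedBall.measurableSet
  set a : ℕ → (E → ℝ) → ℝ := fun j f => ∫ x in B j, f x * tw (1 / ((j:ℝ) + 1)) 0 x ∂μ with ha
  have hw : ∀ (j : ℕ) (x : E), 0 ≤ tw (1 / ((j:ℝ) + 1)) 0 x ∧ tw (1 / ((j:ℝ) + 1)) 0 x ≤ 1 := fun j x => by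
    refine ⟨(tw_pos _ _ _).le, exp_le_one_iff.2 ?_⟩
    rw [inner_zero_left, zero_sub, neg_nonpos]; positivity
  have hlim : ∀ f : E → ℝ, Integrable f μ → Tendsto (fun j => a j f) atTop (nhds (∫ x, f x ∂μ)) := fun f hf => by
    simp only [ha, ← fun j (g : E → ℝ) => integral_indicator (μ := μ) (f := g) (mB j)]
    refine tendsto_integral_of_dominated_convergence (fun x => |f x|) (fun j => ?_) hf.abs (fun j => .of_forall fun x => ?_) (.of_forall fun x => ?_)
    · exact (hf.1.mul (tw_cont1 _ _).aestronglyMeasurable).indicator (mB j)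
    · rw [indicator]; split_ifs
      · rw [norm_eq_abs, abs_mul, abs_of_nonneg (hw j x).1]; exact mul_le_of_le_one_right (abs_nonneg _) (hw j x).2
      · simp
    · obtain ⟨N, hN⟩ := exists_nat_ge ‖x‖
      have h1 : Tendsto (fun j : ℕ => f x * tw (1 / ((j:ℝ) + 1)) 0 x) atTop (nhds (f x * tw 0 0 x)) := by
        refine .const_mul _ ?_
        unfold tw
        exact (continuous_exp.tendsto _).comp (.const_sub _ ((tendsto_one_div_add_atTop_nhds_zero_nat.mul_const _).div_const _))
      rw [show f x * tw 0 0 x = f x by simp [tw]] at h1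
      refine h1.congr' ?_
      filter_upwards [Filter.eventually_ge_atTop N] with j hj
      have : x ∈ B j := mem_closedBall_zero_iff.2 (hN.trans (by exact_mod_cast hj))
      exact (indicator_of_mem this (fun x => f x * tw (1 / ((j:ℝ) + 1)) 0 x)).symm
  have hmono : ∀ j (f : E → ℝ), Integrable f μ → (∀ x, 0 ≤ f x) → a j f ≤ ∫ x, f x ∂μ := fun j f hf h0 => by
    refine (setIntegral_mono_on ?_ hf.integrableOn (mB j) fun x _ => mul_le_of_le_one_right (h0 x) (hw j x).2).trans (setIntegral_le_integral hf (.of_forall h0))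
    exact (hf.mono (hf.1.mul (tw_cont1 _ _).aestronglyMeasurable) (.of_forall fun x => by
      rw [Pi.mul_apply, norm_mul, norm_of_nonneg (hw j x).1]; exact mul_le_of_le_one_right (norm_nonneg _) (hw j x).2)).integrableOn
  set S := closedBall (0:E) b with hS
  have mS : MeasurableSet S := isClosed_closedBall.measurableSet
  have iS : Integrable (S.indicator (1 : E → ℝ)) μ := (integrable_const 1).indicator mS
  have iN : Integrable (fun x : E => ‖x‖ ^ 2) μ ∧ ∫ x, ‖x‖ ^ 2 ∂μ = finrank ℝ E := by
    have e : ∀ x : E, ‖x‖ ^ 2 = ∑ i, ⟪ob E i, x⟫ ^ 2 := fun x => by simp [← (ob E).sum_sq_norm_inner_right x]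
    simp only [e]
    refine ⟨integrable_finsetSum _ fun i _ => (hI _).1, ?_⟩
    rw [integral_finsetSum _ fun i _ => (hI _).1]
    simp [(hI _).2, (ob E).orthonormal.1]
  have l1 := hlim (fun _ => 1) (integrable_const 1)
  simp only [integral_const, probReal_univ, one_smul] at l1
  have hn' : (0:ℝ) < finrank ℝ E := by exact_mod_cast hn
  have lS := hlim _ iS
  rw [integral_indicator_one mS] at lS
  refine le_of_tendsto lS ?_
  filter_upwards [l1.eventually (lt_mem_nhds (show (1:ℝ) / 2 < 1 by norm_num)),
    (hlim _ iN.1).eventually (lt_mem_nhds (iN.2 ▸ half_lt_self hn')),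
    (tendsto_one_div_add_atTop_nhds_zero_nat (𝕜 := ℝ)).eventually (ge_mem_nhds hs0)] with j h1 h2 h3
  have hz1 := hmono j _ (integrable_const 1) fun _ => zero_le_one
  simp only [integral_const, probReal_univ, one_smul] at hz1
  have hBp : μ (B j) ≠ 0 := fun h => by
    simp only [ha, Measure.restrict_eq_zero.2 h, integral_zero_measure] at h1; linarith
  set m0 := (μ (B j))⁻¹ • μ.restrict (B j) with hm0
  have hb0 : Bd m0 j := ⟨ProbabilityTheory.cond_isProbabilityMeasure hBp, by positivity, by
    refine Measure.ae_smul_measure ?_ _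
    filter_upwards [ae_restrict_mem (mB j)] with x hx
    simpa [hB] using hx⟩
  set m := tl m0 (1 / ((j:ℝ) + 1)) 0 with hm
  have hbm : Bd m j := hb0.tl _ _
  have hc : ((μ (B j))⁻¹).toReal ≠ 0 := ENNReal.toReal_ne_zero.2 ⟨by simp [measure_ne_top], by simp [hBp]⟩
  have hint : ∀ f : E → ℝ, ∫ x, f x ∂m = a j f / a j (fun _ => 1) := fun f => by
    rw [hm, tl_int, tZ, hm0, integral_smul_measure, integral_smul_measure, smul_eq_mul, smul_eq_mul, mul_div_mul_left _ _ hc]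
    simp [ha]
  have hm0e : m0.map Neg.neg = m0 := by
    rw [hm0, Measure.map_smul, ← withDensity_indicator_one (mB j), even_wd hev _ (measurable_one.indicator (mB j))]
    intro x; simp [indicator, hB]
  have key := H (m := m) (b := b) hbm psv (by rw [zero_add]; exact h3) (ε := 0 + 1 / ((j:ℝ) + 1)) (by rw [hm]; exact hb0.ulc ((hu.restrict (mB j) (convex_closedBall _ _)).smul _) (1 / ((j:ℝ) + 1)) 0) (fun v => ?_) hn ?_ ?_ hb
  · rw [← hS, ← integral_indicator_one mS, hint] at key
    refine le_trans ?_ key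
    rw [le_div_iff₀ lnr]
    refine mul_le_of_le_one_right (integral_nonneg fun x => mul_nonneg (indicator_nonneg smp _) (hw j x).1) hz1
  · refine (Vr_le hbm 0 v).trans ?_
    simp only [sub_zero]
    rw [hint, div_le_iff₀ lnr]
    have := hmono j _ (hI v).1 fun _ => sq_nonneg _
    rw [(hI v).2] at this
    nlinarith [sq_nonneg ‖v‖]
  · exact even_wd hm0e (fun x => by simp) fpp
  · rw [hint, le_div_iff₀ lnr]
    nlinarith
end q0

section q1
lemma borell_tail (hν : ULC 0 ν) [IsProbabilityMeasure ν] {N : E → ℝ} (hN : Measurable N)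
    (hsub : ∀ x y, N y ≤ 2 * N ((1 / 2 : ℝ) • (x + y)) + N x) {u : ℝ} (hq : 2 ≤ q)
    (h : ν.real {x | u < N x} ≤ 3 / 4 * exp (-q)) (j : ℕ) :
    ν.real {x | (2 ^ (j + 1) - 1) * u < N x} ≤ 3 / 4 * exp (-q * 2 ^ j) := by
  induction j with
  | zero => norm_num; exact h
  | succ j ih =>
    have h1 := borell_step hν hN hsub u (2 ^ (j + 1) - 1)
    have h2 := toReal_mono (by finiteness) h1
    rw [toReal_mul, ENNReal.toReal_pow] at h2
    have h3 : ν.real {x | N x ≤ u} = 1 - ν.real {x | u < N x} := by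
      rw [← probReal_compl_eq_one_sub (measurableSet_lt measurable_const hN)]; congr 1; ext; simp
    have h4 : exp (-q) ≤ 1 / 3 := (exp_le_exp.2 (by linarith : -q ≤ -2)).trans (by
      rw [exp_neg, one_div]; refine inv_anti₀ nnm ?_; linarith [add_one_le_exp 2])
    have e : (2:ℝ) ^ (j + 1 + 1) - 1 = 2 * (2 ^ (j + 1) - 1) + 1 := by ring
    have e2 : exp (-q * 2 ^ (j + 1)) = exp (-q * 2 ^ j) ^ 2 := by rw [← exp_nat_mul]; congr 1; push_cast; ring
    rw [e, e2]
    have h5 : ν.real {x | (2 ^ (j + 1) - 1) * u < N x} ^ 2 ≤ (3 / 4 * exp (-q * 2 ^ j)) ^ 2 := by gcongr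
    have h6 : (0:ℝ) ≤ ν.real {x | (2 * (2 ^ (j + 1) - 1) + 1) * u < N x} := measureReal_nonneg
    simp only [← measureReal_def, h3] at h2
    nlinarith

lemma borell_mom (hν : ULC 0 ν) [IsProbabilityMeasure ν] {N : E → ℝ} (hN : Measurable N) (hN0 : ∀ x, 0 ≤ N x)
    (hsub : ∀ x y, N y ≤ 2 * N ((1 / 2 : ℝ) • (x + y)) + N x) {u : ℝ} (hu : 0 < u) (hq : 2 ≤ q) {p : ℕ} (hp : q ≤ p)
    (h : ν.real {x | u < N x} ≤ 3 / 4 * exp (-q)) :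
    ∫⁻ x, ofReal (N x ^ p) ∂ν ≤ ofReal ((16 * (u * p / q)) ^ p) := by
  set S : ℕ → Set E := fun j => {x | (2 ^ (j + 1) - 1) * u < N x}
  have mS : ∀ j, MeasurableSet (S j) := fun j => measurableSet_lt measurable_const hN
  set w := 2 * (p:ℝ) / q
  have hw : 2 ≤ w := by rw [le_div_iff₀ lnr]; linarith
  have hp1 : 1 ≤ p := by by_contra hc; simp at hc; rw [hc] at hp; norm_num at hp; linarith
  have h1 : ∀ x, ofReal (N x ^ p) ≤ ofReal (u ^ p) + ∑' j, (S j).indicator (fun _ => ofReal ((4 * 2 ^ j * u) ^ p)) x := fun x => by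
    rcases le_or_gt (N x) u with hx | hx
    · exact le_add_right (ofReal_le_ofReal (by have := hN0 x; gcongr))
    have hex : ∃ j : ℕ, N x ≤ (2 ^ (j + 2) - 1) * u := by
      obtain ⟨j, hj⟩ := pow_unbounded_of_one_lt (N x / u) (one_lt_two (α := ℝ))
      refine ⟨j, ((div_lt_iff₀ hu).1 hj).le.trans ?_⟩
      gcongr
      have : (1:ℝ) ≤ 2 ^ j := one_le_pow₀ nnm
      rw [pow_add]; linarith
    classical
    have hj := Nat.find_spec hex
    refine le_add_left (le_trans ?_ (ENNReal.le_tsum (Nat.find hex)))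
    have : x ∈ S (Nat.find hex) := by
      rcases Nat.eq_zero_or_pos (Nat.find hex) with h0 | h0
      · rw [h0]; simp only [S, mem_ofPred_eq]; norm_num; exact hx
      · have := Nat.find_min hex (Nat.sub_one_lt_of_lt h0)
        rw [show Nat.find hex - 1 + 2 = Nat.find hex + 1 by omega] at this
        exact not_le.1 this
    rw [indicator_of_mem this]
    have := hN0 x
    have h2 : N x ≤ 4 * 2 ^ Nat.find hex * u := hj.trans (by gcongr; rw [pow_add]; linarith)
    gcongr
  have h2 : ∀ j, ofReal ((4 * 2 ^ j * u) ^ p) * ν (S j) ≤ ofReal ((4 * u * w) ^ p * (1/2)^(j+1)) := fun j => by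
    rw [← ofReal_measureReal, ← ofReal_mul psv]
    refine ofReal_le_ofReal ((mul_le_mul_of_nonneg_left (borell_tail hν hN hsub hq h j) psv).trans ?_)
    set y : ℝ := 2 ^ j
    have hy : 0 < y := by positivity
    have a1 := pow_div_factorial_le_exp (q * y / 2) psv p
    rw [div_le_iff₀ psv] at a1
    have a2 : ((p.factorial : ℕ) : ℝ) ≤ p ^ p := by exact_mod_cast p.factorial_le_pow
    have a3 : y ^ p ≤ w ^ p * exp (q * y / 2) := by
      have : y ^ p = (2 / q) ^ p * (q * y / 2) ^ p := by rw [← mul_pow]; congr 1; field_simp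
      rw [this, show w = 2 / q * p by simp only [w]; ring, mul_pow, mul_assoc]
      gcongr
      exact a1.trans (by rw [mul_comm]; gcongr)
    have a4 : exp (-(q * y / 2)) ≤ (1/2)^(j+1) := by
      have b1 : (j:ℝ) + 1 ≤ y := by have := one_add_mul_le_pow (a := (1:ℝ)) nnm j; norm_num at this; linarith
      have b2 : exp (-1) ≤ 1 / 2 := by rw [exp_neg, one_div]; exact inv_anti₀ nnm (by linarith [add_one_le_exp 1])
      refine (exp_le_exp.2 (by push_cast; nlinarith : _ ≤ ((j+1:ℕ):ℝ) * (-1))).trans ?_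
      rw [exp_nat_mul]; gcongr
    have a5 : exp (-q * y) = exp (-(q*y/2)) * exp (-(q*y/2)) := by rw [← exp_add]; congr 1; ring
    calc _ = 3 / 4 * ((4 * u) ^ p * (y ^ p * exp (-q * y))) := by simp only [mul_pow]; ring
      _ ≤ 1 * ((4 * u) ^ p * (w ^ p * exp (q * y / 2) * exp (-q * y))) := by gcongr; norm_num
      _ = (4 * u * w) ^ p * exp (-(q*y/2)) := by rw [a5, exp_neg]; simp only [mul_pow]; field_simp
      _ ≤ _ := by gcongr
  calc _ ≤ ofReal (u ^ p) + ∑' j, ofReal ((4 * 2 ^ j * u) ^ p) * ν (S j) := by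
        refine (lintegral_mono h1).trans ?_
        rw [lintegral_add_left fpp, lintegral_tsum fun j => (measurable_const.indicator (mS j)).aemeasurable]
        simp [lintegral_indicator_const (mS _)]
    _ ≤ ofReal (u ^ p) + ∑' j : ℕ, ofReal ((4 * u * w) ^ p * (1/2)^(j+1)) := by gcongr with j; exact h2 j
    _ = ofReal (u ^ p) + ofReal ((4 * u * w) ^ p) := by
        rw [← ENNReal.ofReal_tsum_of_nonneg (fun j => by positivity) (.mul_left _ ((summable_nat_add_iff 1).2 summable_geometric_two)), tsum_mul_left]
        simp only [pow_succ, tsum_mul_right, tsum_geometric_two]; norm_num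
    _ ≤ _ := by
      rw [← ofReal_add psv psv]
      refine ofReal_le_ofReal ?_
      have e : (16 * (u * p / q)) ^ p = 2 ^ p * (4 * u * w) ^ p := by rw [← mul_pow]; congr 1; simp only [w]; ring
      have h5 : (2:ℝ) ≤ 2 ^ p := by simpa using pow_le_pow_right₀ (one_le_two (α := ℝ)) hp1
      have h6 : u ^ p ≤ (4 * u * w) ^ p := by gcongr; nlinarith
      rw [e]; linarith [mul_le_mul_of_nonneg_right h5 (by positivity : 0 ≤ (4 * u * w) ^ p)]
end q1

section q2
variable {V : Type*} [NormedAddCommGroup V] [InnerProductSpace ℝ V] [FiniteDimensional ℝ V]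
  [MeasurableSpace V] [BorelSpace V]
lemma conv_mid {L : Set V} (hc : IsClosed L) (hm : ∀ x ∈ L, ∀ y ∈ L, (1 / 2 : ℝ) • (x + y) ∈ L) : Convex ℝ L := by
  rw [convex_iff_segment_subset]
  intro x hx y hy z hz
  rw [segment_eq_image'] at hz
  obtain ⟨c, ⟨h0, h1⟩, rfl⟩ := hz
  by_contra hcon
  set T : Set ℝ := (fun t : ℝ => x + t • (y - x)) ⁻¹' L
  have hT : IsClosed T := hc.preimage fpp
  have k1 : IsCompact (T ∩ Icc 0 c) := isCompact_Icc.inter_left hT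
  have k2 : IsCompact (T ∩ Icc c 1) := isCompact_Icc.inter_left hT
  obtain ⟨α, ⟨a1, a2⟩, a3⟩ := k1.exists_isGreatest ⟨0, by simpa [T] using hx, by simp [h0]⟩
  obtain ⟨β, ⟨b1, b2⟩, b3⟩ := k2.exists_isLeast ⟨1, by simpa [T] using hy, by simp [h1]⟩
  have hmid : (α + β) / 2 ∈ T := by
    have := hm _ a1 _ b1
    simp only [T, mem_preimage]
    convert this using 1; module
  have ha : α ≠ c := fun h => hcon (h ▸ a1)
  have hb : β ≠ c := fun h => hcon (h ▸ b1)
  have ha' := lt_of_le_of_ne a2.2 ha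
  have hb' := lt_of_le_of_ne b2.1 hb.symm
  rcases le_total ((α + β) / 2) c with h | h
  · have := a3 ⟨hmid, by linarith [a2.1], h⟩; linarith
  · have := b3 ⟨hmid, h, by linarith [b2.2]⟩; linarith

lemma static {ν : Measure V} [IsProbabilityMeasure ν] (hν : ULC 0 ν) (hev : ν.map Neg.neg = ν) (hs : 0 < s)
    (hb : 1 / 2 ≤ ν.real (closedBall 0 s)) (hk : 0 < finrank ℝ V) :
    ∃ t : V, ‖t‖ = 1 ∧ ν.real {y | 216 * s < |⟪t, y⟫|} ≤ 3 / 4 * exp (-finrank ℝ V) := by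
  set k := finrank ℝ V
  have : Nontrivial V := Module.finrank_pos_iff.1 hk
  set K : V → ℝ := fun x => max 0 (2 - ‖x‖ / s) with hK
  have Kc : Continuous K := by fun_prop
  have K0 : ∀ x, 0 ≤ K x := fun x => le_max_left _ _
  have K2 : ∀ x, K x ≤ 2 := fun x => max_le nnm (by linarith [show 0 ≤ ‖x‖ / s by positivity])
  have Ks : ∀ x, K x ≠ 0 → ‖x‖ ≤ 2 * s := fun x h => by
    by_contra hc; refine h (max_eq_left ?_); rw [sub_nonpos, le_div_iff₀ hs]; linarith
  have Km : ∀ u v, K u * K v ≤ K ((1 / 2 : ℝ) • (u + v)) ^ 2 := fun u v => by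
    by_cases hu : K u = 0
    · rw [hu, zero_mul]; positivity
    by_cases hv : K v = 0
    · rw [hv, mul_zero]; positivity
    have e : ∀ x, K x ≠ 0 → K x = 2 - ‖x‖ / s := fun x h => (max_choice _ _).resolve_left h
    have h1 : ‖(1 / 2 : ℝ) • (u + v)‖ / s ≤ (‖u‖ / s + ‖v‖ / s) / 2 := by
      rw [← add_div, div_div, mul_comm s, ← div_div]; gcongr; rw [norm_smul]; norm_num; linarith [norm_add_le u v]
    have h2 := e _ hu; have h3 := e _ hv
    have h4 : (K u + K v) / 2 ≤ K ((1 / 2 : ℝ) • (u + v)) := le_trans lnr (le_max_right _ _)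
    nlinarith [K0 u, K0 v, sq_nonneg (K u - K v)]
  have iK : ∀ x, Integrable (fun y => K (x - y)) ν := fun x => .of_bound fpp 2 (.of_forall fun y => by
    rw [norm_of_nonneg (K0 _)]; exact K2 _)
  set a : V → ℝ := fun x => ∫ y, K (x - y) ∂ν with ha
  have ac : Continuous a := continuous_of_dominated (bound := fun _ => 2) (fun x => (iK x).1) (fun x => .of_forall fun y => by
    rw [norm_of_nonneg (K0 _)]; exact K2 _) (integrable_const _) (.of_forall fun y => by fun_prop)
  have a0 : ∀ x, 0 ≤ a x := fun x => integral_nonneg fun y => K0 _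
  have aL : ∀ x, ofReal (a x) = ∫⁻ y, ofReal (K (x - y)) ∂ν := fun x =>
    ofReal_integral_eq_lintegral_ofReal (iK x) (.of_forall fun y => K0 _)
  have am : ∀ x y, a x * a y ≤ a ((1 / 2 : ℝ) • (x + y)) ^ 2 := fun x y => by
    rw [← ofReal_le_ofReal_iff psv, ofReal_mul (a0 _), ofReal_pow (a0 _), aL, aL, aL]
    refine hν _ _ _ fpp fpp fpp fun u v => ?_
    simp only [zero_mul, zero_div, exp_zero, ofReal_one, mul_one]
    rw [← ofReal_mul (K0 _), ← ofReal_pow (K0 _)]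
    refine ofReal_le_ofReal ((Km _ _).trans (le_of_eq ?_))
    congr 2; module
  have ae : ∀ x, a (-x) = a x := fun x => by
    simp only [ha]
    conv_lhs => rw [← hev]
    rw [integral_map fpp fpp]
    refine integral_congr_ae (.of_forall fun y => ?_)
    simp only [hK]; rw [← norm_neg]; congr 4; abel
  have amax : ∀ x, a x ≤ a 0 := fun x => by
    have := am x (-x); rw [ae, add_neg_cancel, smul_zero] at this
    nlinarith [a0 x, a0 0]
  have ah : 1 / 2 ≤ a 0 := by
    refine hb.trans ?_
    rw [← integral_indicator_one isClosed_closedBall.measurableSet]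
    refine integral_mono ((integrable_const 1).indicator isClosed_closedBall.measurableSet) (iK 0) fun y => ?_
    refine indicator_le' (fun y hy => ?_) (fun y _ => K0 _) y
    have : ‖0 - y‖ / s ≤ 1 := by rw [div_le_one hs]; simpa using hy
    exact le_trans (by rw [Pi.one_apply]; linarith) (le_max_right _ _)
  set I := ∫⁻ x, ofReal (K x) with hI
  have aI : ∀ S : Set V, (∫⁻ x in S, ofReal (a x)) = ∫⁻ y, (∫⁻ x in S, ofReal (K (x - y))) ∂ν := fun S => by
    simp only [aL]; exact lintegral_lintegral_swap fpp
  have Iu : I ≤ 2 * volume (closedBall (0:V) (2 * s)) := by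
    rw [← lintegral_indicator_const isClosed_closedBall.measurableSet]
    refine lintegral_mono fun x => ?_
    by_cases hx : K x = 0
    · simp [hx]
    · rw [indicator_of_mem (by simpa using Ks x hx)]; exact ENNReal.ofReal_le_of_le_toReal (by simpa using K2 x)
  set B := volume (Metric.ball (0:V) 1) with hB
  have hB0 : B ≠ 0 := (measure_ball_pos _ _ one_pos).ne'
  have hBt : B ≠ ⊤ := measure_ball_lt_top.ne
  have It : I ≠ ⊤ := (Iu.trans_lt (ENNReal.mul_lt_top smp measure_closedBall_lt_top)).ne
  have I0 : I ≠ 0 := by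
    refine (lt_of_lt_of_le ?_ (setLIntegral_le_lintegral (Metric.ball 0 s) _)).ne'
    refine lt_of_lt_of_le (measure_ball_pos volume (0:V) hs) ?_
    rw [← setLIntegral_one]
    refine setLIntegral_mono fpp fun x hx => ?_
    rw [ENNReal.one_le_ofReal]
    have : ‖x‖ / s ≤ 1 := by rw [div_le_one hs]; simpa using (mem_ball_zero_iff.1 hx).le
    exact le_trans lnr (le_max_right _ _)
  have shift : ∀ y, ∫⁻ x, ofReal (K (x - y)) = I := fun y => lintegral_sub_right_eq_self (fun x => ofReal (K x)) y
  set L := {x | exp (-k) * a 0 ≤ a x} with hL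
  have Lc : IsClosed L := isClosed_le continuous_const ac
  have Lv : Convex ℝ L := conv_mid Lc fun x hx y hy => by
    have h1 : exp (-k) * a 0 ≤ a x := hx
    have h2 : exp (-k) * a 0 ≤ a y := hy
    have h3 : 0 ≤ exp (-k) * a 0 := by have := a0 0; positivity
    exact abs_le_of_sq_le_sq' (by nlinarith [am x y]) (a0 _) |>.2
  have L0 : (0:V) ∈ L := mul_le_of_le_one_left (a0 0) (exp_le_one_iff.2 smp)
  set r := 24 * s
  have hex : ∃ x, ‖x‖ ≤ r ∧ x ∉ L := by
    by_contra! hc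
    have h1 : ofReal (exp (-k) * a 0) * volume (closedBall (0:V) r) ≤ I := by
      rw [← setLIntegral_const]
      refine (setLIntegral_mono fpp fun x hx => ofReal_le_ofReal (hc x (by simpa using hx))).trans ?_
      rw [aI]
      exact (lintegral_mono fun y => (setLIntegral_le_lintegral _ _).trans (shift y).le).trans smp
    have h2 := h1.trans Iu
    rw [addHaar_closedBall _ _ psv, addHaar_closedBall _ _ psv, ← mul_assoc, ← mul_assoc,
      ENNReal.mul_le_mul_iff_left hB0 hBt, ← ofReal_mul (by have := a0 0; positivity), show (2:ℝ≥0∞) = ofReal 2 by simp,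
      ← ofReal_mul nnm, ofReal_le_ofReal_iff psv, mul_pow, mul_pow] at h2
    have h3 : exp (-k) * (1 / 2) * (24 ^ k * s ^ k) ≤ 2 * (2 ^ k * s ^ k) := le_trans (by gcongr) h2
    have h4 : (2:ℝ) ^ k * exp k < 6 ^ k := by
      rw [← mul_one (k:ℝ), exp_nat_mul, ← mul_pow]; exact pow_lt_pow_left₀ (by linarith [exp_one_lt_d9]) psv hk.ne'
    have h5 : (4:ℝ) ≤ 4 ^ k := by simpa using pow_le_pow_right₀ (by norm_num : (1:ℝ) ≤ 4) hk
    have h6 : (24:ℝ) ^ k = 4 ^ k * 6 ^ k := by rw [← mul_pow]; norm_num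
    rw [h6, exp_neg, ← mul_assoc, ← mul_assoc, ← mul_assoc, mul_le_mul_iff_left₀ psv, mul_assoc, inv_mul_eq_div, div_mul_eq_mul_div, div_le_iff₀ (exp_pos _)] at h3
    nlinarith [show (0:ℝ) < 6 ^ k by positivity]
  obtain ⟨x0, hx0, hx1⟩ := hex
  obtain ⟨f, u, hf1, hf2⟩ := geometric_hahn_banach_closed_point Lv Lc hx1
  set w := (InnerProductSpace.toDual ℝ V).symm f
  have hw : ∀ x, f x = ⟪w, x⟫ := fun x => by simp [w]
  have hu : 0 < u := by simpa using hf1 0 L0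
  have hwn : 0 < ‖w‖ := norm_pos_iff.2 fun h => by rw [hw, h, inner_zero_left] at hf2; linarith
  set t := ‖w‖⁻¹ • w
  have ht : ‖t‖ = 1 := by simp [t, norm_smul, hwn.ne']
  have hsep : ∀ x, r ≤ ⟪t, x⟫ → a x ≤ exp (-k) * a 0 := fun x hx => by
    by_contra! hc
    have h1 := hf1 x hc.le
    have h2 := hf2.trans_le ((hw x0).trans_le (real_inner_le_norm w x0))
    simp only [t, inner_smul_left, conj_trivial] at hx
    rw [le_inv_mul_iff₀ hwn] at hx
    rw [hw] at h1
    nlinarith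
  set H := {x | 8 * r ≤ ⟪t, x⟫} with hH
  have mH : MeasurableSet H := measurableSet_le measurable_const fpp
  have h4 : ∀ x ∈ H, a x ≤ exp (-(4 * k)) * a ((1/2:ℝ) • x) := fun x hx => by
    have e1 := am x 0; have e2 := am ((1/2:ℝ) • x) 0; have e3 := am ((1/2:ℝ) • (1/2:ℝ) • x) 0
    simp only [add_zero] at e1 e2 e3
    have e4 := hsep ((1/2:ℝ) • (1/2:ℝ) • (1/2:ℝ) • x) (by simp only [inner_smul_right]; linarith [show 8 * r ≤ ⟪t, x⟫ from hx])
    have st : ∀ {z z' b : ℝ}, z * a 0 ≤ z' ^ 2 → 0 ≤ z' → z' ≤ b * a 0 → z ≤ b ^ 2 * a 0 := fun {z z' b} h1 h2 h3 => by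
      have : z' ^ 2 ≤ (b * a 0) ^ 2 := by gcongr
      exact le_of_mul_le_mul_right (h1.trans (this.trans (le_of_eq (by ring)))) (by linarith : 0 < a 0)
    have e5 := st e2 (a0 _) (st e3 (a0 _) e4)
    rw [← pow_mul, ← exp_nat_mul, show ((2 * 2 : ℕ) : ℝ) * (-(k:ℝ)) = -(4 * k) by push_cast; ring] at e5
    refine le_of_mul_le_mul_right (e1.trans ?_) (by linarith : 0 < a 0)
    nlinarith [a0 ((1/2:ℝ) • x)]
  have m9 : MeasurableSet {y | 9 * r ≤ ⟪t, y⟫} := measurableSet_le measurable_const fpp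
  have h5 : ν {y | 9 * r ≤ ⟪t, y⟫} ≤ ofReal (exp (-(4 * k)) * 2 ^ k) := by
    rw [← ENNReal.mul_le_mul_iff_left I0 It]
    calc _ = ∫⁻ y in {y | 9 * r ≤ ⟪t, y⟫}, I ∂ν := by rw [setLIntegral_const, mul_comm]
      _ ≤ ∫⁻ y in {y | 9 * r ≤ ⟪t, y⟫}, (∫⁻ x in H, ofReal (K (x - y))) ∂ν := by
        refine setLIntegral_mono' m9 fun y hy => ?_
        rw [← shift y, ← lintegral_indicator mH]
        refine lintegral_mono fun x => ?_
        by_cases hx : K (x - y) = 0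
        · simp [hx]
        · rw [indicator_of_mem]
          have h1 := (abs_le.1 (abs_real_inner_le_norm t (x - y))).1
          have h2 := Ks _ hx
          have h3 : 9 * r ≤ ⟪t, y⟫ := hy
          rw [inner_sub_right, ht] at h1
          exact (by linarith : 8 * r ≤ ⟪t, x⟫)
      _ ≤ ∫⁻ x in H, ofReal (a x) := by rw [aI]; exact setLIntegral_le_lintegral _ _
      _ ≤ ∫⁻ x, ofReal (exp (-(4 * k))) * ofReal (a ((1/2:ℝ) • x)) := by
        refine (setLIntegral_mono' mH fun x hx => ?_).trans (setLIntegral_le_lintegral _ _)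
        rw [← ofReal_mul (exp_pos _).le]; exact ofReal_le_ofReal (h4 x hx)
      _ = _ := by
        have e1 := lintegral_map (μ := (volume : Measure V)) (f := fun x => ofReal (a x)) fpp (measurable_const_smul (1/2:ℝ))
        have e2 := aI univ
        simp only [restrict_univ, shift, lintegral_const, measure_univ, mul_one] at e2
        rw [Measure.map_addHaar_smul _ nnm, lintegral_smul_measure, e2] at e1
        rw [lintegral_const_mul _ fpp, ← e1, ofReal_mul (exp_pos _).le, smul_eq_mul, mul_assoc]
        congr 3; rw [abs_of_pos psv]; simp [k]
  refine ⟨t, ht, ?_⟩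
  have h6 : {y | 216 * s < |⟪t, y⟫|} ⊆ {y | 9 * r ≤ ⟪t, y⟫} ∪ Neg.neg ⁻¹' {y | 9 * r ≤ ⟪t, y⟫} := fun y hy => by
    simp only [mem_union, mem_preimage, mem_ofPred_eq, inner_neg_right] at hy ⊢
    rcases lt_abs.1 hy with h | h
    exacts [.inl lnr, .inr lnr]
  have h7 : ν.real {y | 9 * r ≤ ⟪t, y⟫} ≤ exp (-(4 * k)) * 2 ^ k := ENNReal.toReal_le_of_le_ofReal psv h5
  have h8 : ν.real (Neg.neg ⁻¹' {y | 9 * r ≤ ⟪t, y⟫}) = ν.real {y | 9 * r ≤ ⟪t, y⟫} := by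
    rw [measureReal_def, ← map_apply measurable_neg m9, hev, measureReal_def]
  have h9 : exp (-(4 * k)) * 2 ^ k = exp (-k) * (2 * exp (-3)) ^ k := by
    rw [mul_pow, ← exp_nat_mul, mul_left_comm, ← exp_add, mul_comm]; congr 2; ring
  have h10 : 2 * exp (-3) ≤ 3 / 8 := by
    rw [exp_neg, ← div_eq_mul_inv, div_le_iff₀ (exp_pos _), show (3:ℝ) = (3:ℕ) * 1 by norm_num, exp_nat_mul]
    have : (2.7:ℝ) ^ 3 ≤ exp 1 ^ 3 := by gcongr; linarith [Real.exp_one_gt_d9]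
    norm_num at this ⊢; linarith
  have h11 := (pow_le_of_le_one psv (h10.trans nnm) hk.ne').trans h10
  have := (measureReal_mono (μ := ν) h6 (measure_ne_top ν _)).trans (measureReal_union_le _ _)
  rw [h8] at this
  nlinarith [exp_pos (-k:ℝ)]
end q2

section q3
variable {V Ω : Type*} [NormedAddCommGroup V] [InnerProductSpace ℝ V] [FiniteDimensional ℝ V]
  [MeasurableSpace V] [BorelSpace V] [NormedAddCommGroup Ω] [InnerProductSpace ℝ Ω] [FiniteDimensional ℝ Ω]
  [MeasurableSpace Ω] [BorelSpace Ω]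
lemma markov4 {γ : Measure Ω} {f : Ω → ℝ≥0∞} (hf : Measurable f) {b : ℝ≥0∞} (b0 : b ≠ 0) (bt : b ≠ ⊤) (h : ∫⁻ x, f x ∂γ ≤ b) :
    γ {x | 4 * b ≤ f x} ≤ 1 / 4 := by
  have := (mul_meas_ge_le_lintegral hf (4 * b)).trans h
  rw [mul_comm 4 b, mul_assoc] at this
  nth_rewrite 3 [← mul_one b] at this
  rw [ENNReal.mul_le_mul_iff_right b0 bt, mul_comm] at this
  rw [mul_comm 4 b]
  exact (ENNReal.le_div_iff_mul_le smp smp).2 this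

lemma pick {γ : Measure Ω} [IsProbabilityMeasure γ] {Φ : V → Ω → ℝ} (hc : Continuous (Function.uncurry Φ)) (h0 : ∀ t x, 0 ≤ Φ t x)
    (hadd : ∀ t w x, Φ (t + w) x ≤ Φ t x + Φ w x) (hsm : ∀ (c : ℝ) t x, Φ (c • t) x = |c| * Φ t x) {M : ℝ} (hM : 0 < M)
    (hk : 2 ≤ k) (hkV : finrank ℝ V = k)
    (h1 : ∀ t, ∫⁻ x, ofReal (Φ t x ^ (2 * k)) ∂γ ≤ ofReal ((M * ‖t‖) ^ (2 * k)))
    (h2 : ∀ t, 1 / 2 ≤ ‖t‖ → ‖t‖ ≤ 2 → γ {x | Φ t x ≤ M / 2048} ≤ ofReal ((1 / 512) ^ (2 * k)))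
    {W : Ω → ℝ≥0∞} (hW : Measurable W) {b : ℝ≥0∞} (b0 : b ≠ 0) (bt : b ≠ ⊤) (hb : ∫⁻ x, W x ∂γ ≤ b) :
    ∃ x, (∀ t, ‖t‖ = 1 → M / 4096 < Φ t x) ∧ W x ≤ 4 * b := by
  have hct : ∀ x, Continuous fun t => Φ t x := fun x => hc.comp (.prodMk_left x)
  set C := closedBall (0:V) 2
  have mC : MeasurableSet C := isClosed_closedBall.measurableSet
  set B := volume (Metric.ball (0:V) 1) with hB
  have hB0 : B ≠ 0 := (measure_ball_pos _ _ one_pos).ne'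
  have hBt : B ≠ ⊤ := measure_ball_lt_top.ne
  have vol : ∀ (t : V) {r : ℝ}, 0 ≤ r → volume (closedBall t r) = ofReal (r ^ k) * B := fun t r hr => by
    rw [addHaar_closedBall _ _ hr, hkV]
  set S : Set (V × Ω) := {z | 1 / 2 ≤ ‖z.1‖} ∩ {z | Function.uncurry Φ z ≤ M / 2048}
  have mS : MeasurableSet S := (measurableSet_le measurable_const measurable_fst.norm).inter (measurableSet_le hc.measurable measurable_const)
  set f1 : Ω → ℝ≥0∞ := fun x => ∫⁻ t in C, ofReal (Φ t x ^ (2 * k))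
  set f2 : Ω → ℝ≥0∞ := fun x => ∫⁻ t in C, S.indicator 1 (t, x)
  have mm1 : Measurable fun z : V × Ω => ofReal (Φ z.1 z.2 ^ (2 * k)) := (hc.measurable.pow_const _).ennreal_ofReal
  have mm2 : Measurable (S.indicator (1 : V × Ω → ℝ≥0∞)) := measurable_one.indicator mS
  have m1 : Measurable f1 := mm1.lintegral_prod_left'
  have m2 : Measurable f2 := mm2.lintegral_prod_left'
  have i1 : ∫⁻ x, f1 x ∂γ ≤ ofReal ((2 * M) ^ (2 * k) * 2 ^ k) * B := by
    simp only [f1]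
    rw [lintegral_lintegral_swap (by exact (mm1.comp measurable_swap).aemeasurable)]
    refine (setLIntegral_mono measurable_const fun t ht => (h1 t).trans (ofReal_le_ofReal
      (q := (2 * M) ^ (2 * k)) (by rw [mul_comm 2 M]; have := mem_closedBall_zero_iff.1 ht; gcongr))).trans ?_
    rw [setLIntegral_const, vol _ nnm, ofReal_mul psv, mul_assoc]
  have i2 : ∫⁻ x, f2 x ∂γ ≤ ofReal ((1 / 512) ^ (2 * k) * 2 ^ k) * B := by
    simp only [f2]
    rw [lintegral_lintegral_swap (by exact (mm2.comp measurable_swap).aemeasurable)]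
    refine (setLIntegral_mono measurable_const fun t ht => ?_).trans (b := ∫⁻ t in C, ofReal ((1 / 512) ^ (2 * k))) ?_
    · by_cases h : 1 / 2 ≤ ‖t‖
      · refine le_trans (le_of_eq ?_) (h2 t h (mem_closedBall_zero_iff.1 ht))
        rw [← lintegral_indicator_one (measurableSet_le (show Measurable (Φ t) from (hc.comp (.prodMk_right t)).measurable) measurable_const)]
        refine lintegral_congr fun x => ?_
        simp only [indicator, S, mem_inter_iff, mem_ofPred_eq, h, true_and]; rfl
      · rw [lintegral_congr (g := fun _ => 0) fun x => indicator_of_notMem (fun h' => h h'.1) _]; simp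
    · rw [setLIntegral_const, vol _ nnm, ofReal_mul psv, mul_assoc]
  have n1 : ofReal ((2 * M) ^ (2 * k) * 2 ^ k) * B ≠ 0 := mul_ne_zero (ofReal_pos.2 psv).ne' hB0
  have n2 : ofReal ((1 / 512) ^ (2 * k) * 2 ^ k) * B ≠ 0 := mul_ne_zero (ofReal_pos.2 psv).ne' hB0
  have q1 := markov4 m1 n1 (by finiteness) i1
  have q2 := markov4 m2 n2 (by finiteness) i2
  have q3 := markov4 hW b0 bt hb
  have hex : ∃ x, x ∉ {x | 4 * (ofReal ((2 * M) ^ (2 * k) * 2 ^ k) * B) ≤ f1 x} ∪ {x | 4 * (ofReal ((1 / 512) ^ (2 * k) * 2 ^ k) * B) ≤ f2 x} ∪ {x | 4 * b ≤ W x} := by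
    by_contra! hcon
    have := measure_univ (μ := γ) ▸ (measure_mono (μ := γ) fun x (_ : x ∈ univ) => hcon x).trans ((measure_union_le _ _).trans (add_le_add ((measure_union_le _ _).trans (add_le_add q1 q2)) q3))
    have := (ENNReal.toReal_le_toReal smp (by finiteness)).2 this
    rw [toReal_add (by finiteness) (by finiteness), toReal_add (by finiteness) (by finiteness)] at this
    norm_num at this
  obtain ⟨x, hx⟩ := hex
  simp only [mem_union, mem_ofPred_eq, not_or, not_le] at hx
  obtain ⟨⟨x1, x2⟩, x3⟩ := hx
  have hD : ∀ t, ‖t‖ = 1 → Φ t x ≤ 6 * M := fun t0 ht0 => by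
    set g : V → ℝ≥0∞ := C.indicator fun t => ofReal (Φ t x ^ (2 * k))
    have mg : Measurable g := (((hct x).measurable.pow_const _).ennreal_ofReal).indicator mC
    have e1 : ofReal (Φ t0 x ^ (2 * k)) * B ≤ 2 * f1 x := by
      have b1 : f1 x = ∫⁻ t, g t := (lintegral_indicator mC _).symm
      rw [two_mul (f1 x)]
      nth_rewrite 1 [b1.trans (lintegral_add_left_eq_self g t0).symm]
      rw [b1.trans (lintegral_sub_left_eq_self g t0).symm, ← lintegral_add_left fpp, hB, ← lintegral_indicator_const Metric.isOpen_ball.measurableSet]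
      refine lintegral_mono (indicator_le fun w hw => ?_)
      have hw := mem_ball_zero_iff.1 hw
      have c1 : t0 + w ∈ C := mem_closedBall_zero_iff.2 ((norm_add_le _ _).trans lnr)
      have c2 : t0 - w ∈ C := mem_closedBall_zero_iff.2 ((norm_sub_le _ _).trans lnr)
      simp only [g, indicator_of_mem c1, indicator_of_mem c2]
      have e := hadd (t0 + w) (t0 - w) x
      rw [show t0 + w + (t0 - w) = (2:ℝ) • t0 by module, hsm, abs_two] at e
      rcases le_total (Φ t0 x) (Φ (t0 + w) x) with h | h
      · exact le_add_right (ofReal_le_ofReal (by have := h0 t0 x; gcongr))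
      · exact le_add_left (ofReal_le_ofReal (by have := h0 t0 x; gcongr; linarith))
    have e2 := e1.trans (mul_le_mul_right x1.le 2)
    rw [show (2:ℝ≥0∞) * (4 * (ofReal ((2 * M) ^ (2 * k) * 2 ^ k) * B)) = ofReal (8 * ((2 * M) ^ (2 * k) * 2 ^ k)) * B by
      rw [ofReal_mul (by norm_num : (0:ℝ) ≤ 8), ← mul_assoc, ← mul_assoc]; norm_num, ENNReal.mul_le_mul_iff_left hB0 hBt, ofReal_le_ofReal_iff psv] at e2
    refine (pow_le_pow_iff_left₀ (h0 _ _) psv (by omega : 2 * k ≠ 0)).1 (e2.trans ?_)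
    have e3 : (8:ℝ) ≤ (9/2) ^ k := le_trans nnm (pow_le_pow_right₀ (by norm_num : (1:ℝ) ≤ 9/2) hk)
    calc _ = 8 * (8 ^ k * M ^ (2 * k)) := by rw [mul_pow, pow_mul 2 2 k, mul_right_comm, ← mul_pow]; norm_num
      _ ≤ (9/2) ^ k * (8 ^ k * M ^ (2 * k)) := by gcongr
      _ = _ := by rw [mul_pow 6, pow_mul 6 2 k, ← mul_assoc, ← mul_pow]; norm_num
  have hD' : ∀ t, Φ t x ≤ 6 * M * ‖t‖ := fun t => by
    rcases eq_or_ne t 0 with rfl | ht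
    · have := hsm 0 0 x; simp at this; simp [this]
    · have := hD (‖t‖⁻¹ • t) (by simp [norm_smul, ht])
      rwa [hsm, abs_of_nonneg psv, inv_mul_le_iff₀ (norm_pos_iff.2 ht), mul_comm] at this
  refine ⟨x, fun t ht => ?_, x3.le⟩
  by_contra! hcon
  have e1 : volume (closedBall t (1 / 24576)) ≤ f2 x := by
    rw [← setLIntegral_one, ← lintegral_indicator isClosed_closedBall.measurableSet]
    simp only [f2]
    rw [← lintegral_indicator mC]
    refine lintegral_mono (indicator_le fun w hw => ?_)
    rw [mem_closedBall_iff_norm] at hw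
    have c1 := norm_le_norm_add_norm_sub' w t
    have c2 := norm_le_norm_add_norm_sub w t
    have c3 := hadd t (w - t) x
    have c4 := hD' (w - t)
    rw [add_sub_cancel] at c3
    rw [indicator_of_mem (mem_closedBall_zero_iff.2 lnr), indicator_of_mem (show (w, x) ∈ S from ⟨show _ ≤ ‖w‖ by linarith, show Φ w x ≤ _ by nlinarith⟩)]
    rfl
  have e2 := e1.trans x2.le
  rw [vol _ nnm, ← mul_assoc, show (4:ℝ≥0∞) = ofReal 4 by simp, ← ofReal_mul nnm, ENNReal.mul_le_mul_iff_left hB0 hBt,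
    ofReal_le_ofReal_iff psv, pow_mul, ← mul_pow] at e2
  have e3 : ((1:ℝ) / 32768) ^ k < (1 / 24576) ^ k := pow_lt_pow_left₀ nnm nnm (by omega)
  have e4 : (4:ℝ) ≤ 4 ^ k := by simpa using pow_le_pow_right₀ (by norm_num : (1:ℝ) ≤ 4) (by omega : 1 ≤ k)
  have e5 : ((1:ℝ) / 32768) ^ k = 4 ^ k * ((1 / 512) ^ 2 * 2) ^ k := by rw [← mul_pow]; norm_num
  nlinarith [show (0:ℝ) < ((1 / 512) ^ 2 * 2) ^ k by positivity]
end q3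

section q4
lemma inner_pow_le (v x : E) (a : ℕ) : |⟪x, v⟫ ^ a| ≤ (‖v‖ ^ a * a.factorial) * exp (1 * ‖x‖) := by
  have h := pow_div_factorial_le_exp ‖x‖ (norm_nonneg _) a
  rw [div_le_iff₀ psv] at h
  rw [abs_pow, one_mul]
  calc _ ≤ (‖x‖ * ‖v‖) ^ a := by gcongr; exact abs_real_inner_le_norm x v
    _ = ‖v‖ ^ a * ‖x‖ ^ a := by ring
    _ ≤ _ := by rw [mul_assoc, mul_comm (a.factorial : ℝ)]; gcongr

lemma gam_pow_int (v : E) (a : ℕ) : Integrable (fun x => ⟪x, v⟫ ^ a) (gam E) :=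
  gam_growth fpp _ 1 fun x => inner_pow_le v x a

lemma gam_mom (v : E) (a : ℕ) : ∫ x, ⟪x, v⟫ ^ (2 * a) ∂(gam E) = (∏ i ∈ Finset.range a, (2 * (i:ℝ) + 1)) * ‖v‖ ^ (2 * a) := by
  induction a with
  | zero => simp
  | succ a ih =>
    have hf : ∀ x, HasFDerivAt (fun x : E => ⟪x, v⟫ ^ (2 * a + 1)) (((2 * a + 1 : ℕ) * ⟪x, v⟫ ^ (2 * a)) • (innerSL ℝ v)) x := fun x => by
      have := ((innerSL ℝ v).hasFDerivAt (x := x)).pow (2 * a + 1)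
      simp only [innerSL_apply_apply, Nat.add_sub_cancel] at this
      simp only [fun x => real_inner_comm v x]
      simpa using this
    have hd : ∀ x, fderiv ℝ (fun x : E => ⟪x, v⟫ ^ (2 * a + 1)) x v = (2 * a + 1) * ‖v‖ ^ 2 * ⟪x, v⟫ ^ (2 * a) := fun x => by
      rw [(hf x).fderiv]; simp; ring
    have := gam_ibp (E := E) (F := fun x => ⟪x, v⟫ ^ (2 * a + 1)) (fun x => (hf x).differentiableAt) v
      (max (‖v‖ ^ (2 * a + 1) * (2 * a + 1).factorial) ((2 * a + 1) * ‖v‖ ^ 2 * (‖v‖ ^ (2 * a) * (2 * a).factorial))) 1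
      (fun x => (inner_pow_le v x _).trans (by gcongr; exact le_max_left _ _)) (fun x => by
        rw [hd, abs_mul, abs_of_nonneg psv]
        refine (mul_le_mul_of_nonneg_left (inner_pow_le v x _) psv).trans ?_
        rw [← mul_assoc]; gcongr; exact le_max_right _ _)
    simp only [hd, integral_const_mul, ih, ← pow_succ'] at this
    rw [show 2 * (a + 1) = 2 * a + 1 + 1 by ring, this, Finset.prod_range_succ]; ring

lemma gmo_ge (k : ℕ) : ((k:ℝ) / 3) ^ k ≤ ∏ i ∈ Finset.range k, (2 * (i:ℝ) + 1) := by
  have h1 : ((k.factorial : ℕ) : ℝ) ≤ ∏ i ∈ Finset.range k, (2 * (i:ℝ) + 1) := by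
    rw [← Finset.prod_range_add_one_eq_factorial]; push_cast
    exact Finset.prod_le_prod (fun i _ => by positivity) fun i _ => by linarith [(Nat.cast_nonneg i : (0:ℝ) ≤ i)]
  refine le_trans ?_ h1
  have h := pow_div_factorial_le_exp k psv k
  rw [div_le_iff₀ psv, ← mul_one (k:ℝ), exp_nat_mul, mul_one] at h
  rw [div_pow, div_le_iff₀ psv, mul_comm]
  exact h.trans (by gcongr; linarith [exp_one_lt_d9])

def mF (μ : Measure E) (p : ℕ) (v : E) : ℝ := (eLpNorm (fun x => ⟪v, x⟫) p μ).toReal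

structure Pao (μ : Measure E) : Prop where
  pr : IsProbabilityMeasure μ
  lc : ULC 0 μ
  ev : μ.map Neg.neg = μ
  sm : ∀ v, Integrable (fun x => ⟪v, x⟫ ^ 2) μ ∧ ∫ x, ⟪v, x⟫ ^ 2 ∂μ ≤ 2 * ‖v‖ ^ 2

variable (h : Pao μ) {p : ℕ} (hp : 2 ≤ p)
lemma hsub_inner (v : E) (x y : E) : |⟪v, y⟫| ≤ 2 * |⟪v, (1 / 2 : ℝ) • (x + y)⟫| + |⟪v, x⟫| := by
  rw [inner_smul_right, inner_add_right, abs_mul, abs_of_pos (by norm_num : (0:ℝ) < 1 / 2)]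
  have := abs_sub (⟪v, x⟫ + ⟪v, y⟫) ⟪v, x⟫
  rw [add_sub_cancel_left] at this
  linarith

include h hp
lemma Pao.mom (v : E) : ∫⁻ x, ofReal (|⟪v, x⟫| ^ p) ∂μ ≤ ofReal ((40 * p * ‖v‖) ^ p) := by
  have := h.pr
  rcases eq_or_ne v 0 with rfl | hv
  · simp [show p ≠ 0 by omega]
  have hv := norm_pos_iff.2 hv
  have := borell_mom h.lc (N := fun x => |⟪v, x⟫|) fpp (fun x => abs_nonneg _) (hsub_inner v) (u := 5 * ‖v‖) psv le_rfl (p := p) (by exact_mod_cast hp) ?_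
  · refine this.trans (le_of_eq ?_); congr 2; ring
  have m := mul_meas_ge_le_integral_of_nonneg (.of_forall fun x => sq_nonneg _) (h.sm v).1 ((5 * ‖v‖) ^ 2)
  have h1 : μ.real {x | 5 * ‖v‖ < |⟪v, x⟫|} ≤ μ.real {x | (5 * ‖v‖) ^ 2 ≤ ⟪v, x⟫ ^ 2} := measureReal_mono (fun x hx => by
    have : 5 * ‖v‖ < |⟪v, x⟫| := hx
    show (5 * ‖v‖) ^ 2 ≤ ⟪v, x⟫ ^ 2
    rw [← sq_abs ⟪v, x⟫]; gcongr) (measure_ne_top _ _)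
  have h2 : μ.real {x | (5 * ‖v‖) ^ 2 ≤ ⟪v, x⟫ ^ 2} ≤ 2 / 25 := by
    have := m.trans (h.sm v).2
    generalize μ.real _ = z at *
    refine le_of_mul_le_mul_left ?_ (by positivity : 0 < ‖v‖ ^ 2)
    nlinarith
  have h3 : (0.13 : ℝ) ≤ exp (-2) := by
    rw [show (-2:ℝ) = (2:ℕ) * (-1) by norm_num, exp_nat_mul]
    have := Real.exp_neg_one_gt_d9
    nlinarith
  linarith

lemma Pao.mem (v : E) : MemLp (fun x => ⟪v, x⟫) p μ := by
  refine ⟨by fun_prop, ?_⟩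
  rw [eLpNorm_lt_top_iff_lintegral_rpow_enorm_lt_top (by simp; omega) smp]
  refine lt_of_le_of_lt (le_of_eq ?_) ((h.mom hp v).trans_lt ENNReal.ofReal_lt_top)
  refine lintegral_congr fun x => ?_
  rw [toReal_natCast, rpow_natCast, enorm_eq_ofReal_abs, ofReal_pow (abs_nonneg _)]

lemma Pao.pow (v : E) : ofReal (mF μ p v ^ p) = ∫⁻ x, ofReal (|⟪v, x⟫| ^ p) ∂μ := by
  rw [mF, ofReal_pow toReal_nonneg, ofReal_toReal (h.mem hp v).2.ne, eLpNorm_eq_lintegral_rpow_enorm_toReal (by simp; omega) smp, toReal_natCast,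
    ← rpow_natCast, ← rpow_mul, one_div, inv_mul_cancel₀ (by simp; omega), ENNReal.rpow_one]
  refine lintegral_congr fun x => ?_
  rw [rpow_natCast, enorm_eq_ofReal_abs, ofReal_pow (abs_nonneg _)]

lemma Pao.add (v w : E) : mF μ p (v + w) ≤ mF μ p v + mF μ p w := by
  rw [mF, mF, mF, ← toReal_add (h.mem hp v).2.ne (h.mem hp w).2.ne]
  refine toReal_mono (by simp [(h.mem hp v).2.ne, (h.mem hp w).2.ne]) ?_
  simp only [inner_add_left]
  exact eLpNorm_add_le (h.mem hp v).1 (h.mem hp w).1 (by exact_mod_cast (by omega : 1 ≤ p))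

omit h hp in
lemma mF_smul (c : ℝ) (v : E) : mF μ p (c • v) = |c| * mF μ p v := by
  simp only [mF, inner_smul_left, conj_trivial, ← smul_eq_mul]
  rw [show (fun x => c • ⟪v, x⟫) = c • fun x => ⟪v, x⟫ from rfl, eLpNorm_const_smul]; simp

lemma Pao.le (v : E) : mF μ p v ≤ 40 * p * ‖v‖ := by
  refine (pow_le_pow_iff_left₀ toReal_nonneg psv (by omega : p ≠ 0)).1 ?_
  rw [← ofReal_le_ofReal_iff psv]
  exact (h.pow hp v).trans_le (h.mom hp v)

lemma Pao.lip (v w : E) : mF μ p v - mF μ p w ≤ 40 * p * ‖v - w‖ := by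
  have := h.add hp w (v - w)
  rw [add_sub_cancel] at this
  linarith [h.le hp (v - w)]

lemma Pao.cont : Continuous (mF μ p) := by
  refine (LipschitzWith.of_dist_le_mul (K := (40 * p : NNReal)) fun v w => ?_).continuous
  rw [Real.dist_eq, dist_eq_norm, abs_le]; push_cast
  have h1 := h.lip hp v w; have h2 := h.lip hp w v
  rw [norm_sub_rev] at h2
  exact ⟨by linarith, h1⟩
end q4

section q5
abbrev En (n : ℕ) := EuclideanSpace ℝ (Fin n)
abbrev On (k n : ℕ) := EuclideanSpace ℝ (Fin k × Fin n)
def tau (t : En k) (x : En n) : On k n := WithLp.toLp 2 fun i => t i.1 * x i.2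
def Lm (t : En k) (Γ : On k n) : En n := WithLp.toLp 2 fun j => ∑ i, t i * Γ (i, j)
def Pm (Γ : On k n) : En n →ₗ[ℝ] En k where
  toFun x := WithLp.toLp 2 fun i => ∑ j, Γ (i, j) * x j
  map_add' x y := by ext i; simp [mul_add, sum_add_distrib]
  map_smul' c x := by ext i; simp [mul_sum, mul_left_comm]
lemma tau_norm (t : En k) (x : En n) : ‖tau t x‖ = ‖t‖ * ‖x‖ := by
  rw [← sq_eq_sq₀ psv psv, mul_pow]
  simp [EuclideanSpace.norm_sq_eq, tau, Fintype.sum_prod_type, mul_pow, sum_mul_sum]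
lemma Lm_inner (t : En k) (Γ : On k n) (x : En n) : ⟪Lm t Γ, x⟫ = ⟪Γ, tau t x⟫ := by
  simp only [PiLp.inner_apply, Lm, tau, Fintype.sum_prod_type, RCLike.inner_apply, conj_trivial, mul_sum]
  rw [sum_comm]; simp only [mul_comm, mul_left_comm, mul_assoc]
lemma Pm_inner (t : En k) (Γ : On k n) (x : En n) : ⟪t, Pm Γ x⟫ = ⟪Lm t Γ, x⟫ := by
  simp only [PiLp.inner_apply, Lm, Pm, RCLike.inner_apply, conj_trivial, mul_sum, LinearMap.coe_mk, AddHom.coe_mk, sum_mul]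
  rw [sum_comm]; simp only [mul_comm, mul_left_comm, mul_assoc]
lemma Lm_norm (t : En k) (Γ : On k n) : ‖Lm t Γ‖ ≤ ‖t‖ * ‖Γ‖ := by
  have h := real_inner_le_norm Γ (tau t (Lm t Γ))
  rw [← Lm_inner, real_inner_self_eq_norm_sq, tau_norm] at h
  rcases (norm_nonneg (Lm t Γ)).eq_or_lt with h0 | h0
  · rw [← h0]; positivity
  · exact le_of_mul_le_mul_right lnr h0
lemma Lm_cont : Continuous (Function.uncurry (Lm : En k → On k n → En n)) := by
  unfold Lm Function.uncurry; fun_prop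
lemma tau_cont (t : En k) : Continuous (tau t : En n → On k n) := by unfold tau; fun_prop
lemma Pm_cont : Continuous fun z : On k n × En n => (Pm z.1 z.2 : En k) := by simp only [Pm, LinearMap.coe_mk, AddHom.coe_mk]; fun_prop
lemma Lm_add (t w : En k) (Γ : On k n) : Lm (t + w) Γ = Lm t Γ + Lm w Γ := by ext j; simp [Lm, add_mul, sum_add_distrib]
lemma Lm_smul (c : ℝ) (t : En k) (Γ : On k n) : Lm (c • t) Γ = c • Lm t Γ := by ext j; simp [Lm, mul_assoc, mul_sum]
lemma Lm_sub (t : En k) (Γ Δ : On k n) : Lm t (Γ - Δ) = Lm t Γ - Lm t Δ := by ext j; simp [Lm, mul_sub]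

lemma gam_momL {E : Type*} [NormedAddCommGroup E] [InnerProductSpace ℝ E] [FiniteDimensional ℝ E] [MeasurableSpace E] [BorelSpace E] (v : E) (a : ℕ) :
    ∫⁻ x, ofReal (|⟪x, v⟫| ^ (2 * a)) ∂(gam E) = ofReal ((∏ i ∈ Finset.range a, (2 * (i:ℝ) + 1)) * ‖v‖ ^ (2 * a)) := by
  rw [← gam_mom, ofReal_integral_eq_lintegral_ofReal (gam_pow_int v _) (.of_forall fun x => by simp only [pow_mul]; positivity)]
  simp only [pow_mul, sq_abs]

variable {μ : Measure (En n)} (h : Pao μ)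
include h
lemma Pao.fub (hk : 1 ≤ k) (t : En k) : ∫⁻ Γ, ofReal (mF μ (2 * k) (Lm t Γ) ^ (2 * k)) ∂(gam (On k n)) =
    ofReal ((∏ i ∈ Finset.range k, (2 * (i:ℝ) + 1)) * ‖t‖ ^ (2 * k)) * ∫⁻ x, ofReal (‖x‖ ^ (2 * k)) ∂μ := by
  have := h.pr
  have := gam_prob (E := On k n)
  simp only [h.pow (by omega : 2 ≤ 2 * k), Lm_inner]
  rw [lintegral_lintegral_swap (by have := tau_cont (n := n) t; exact Measurable.aemeasurable fpp), ← lintegral_const_mul _ fpp]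
  refine lintegral_congr fun x => ?_
  rw [gam_momL, tau_norm, mul_pow, ← mul_assoc, ofReal_mul (mul_nonneg (Finset.prod_nonneg fun i _ => by positivity) psv)]

lemma Pao.h2 (hk : 2 ≤ k) {M : ℝ} (hM : 0 < M) (hMp : ofReal (M ^ (2 * k)) = ofReal (∏ i ∈ Finset.range k, (2 * (i:ℝ) + 1)) * ∫⁻ x, ofReal (‖x‖ ^ (2 * k)) ∂μ)
    (hb : 2 ^ 22 * 204800 * (k:ℝ) ^ 3 ≤ M ^ 2) (t : En k) (t1 : 1 / 2 ≤ ‖t‖) (t2 : ‖t‖ ≤ 2) :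
    (gam (On k n)) {Γ | mF μ (2 * k) (Lm t Γ) ≤ M / 2048} ≤ ofReal ((1 / 512) ^ (2 * k)) := by
  have := h.pr
  have := gam_prob (E := On k n)
  have hp : 2 ≤ 2 * k := by omega
  have hc : Continuous fun Γ : On k n => mF μ (2 * k) (Lm t Γ) := (h.cont hp).comp (Lm_cont.comp (.prodMk_right t))
  set a := M / 2048 with ha
  have ha0 : 0 < a := by positivity
  have hk0 : (0:ℝ) < k := by positivity
  have := maurey zero_le_one gam_ULC (S := {Γ : On k n | mF μ (2 * k) (Lm t Γ) ≤ a}) (hc.measurable measurableSet_Iic)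
    (ψ := fun y => (max 0 (mF μ (2 * k) (Lm t y) - a) / (160 * k)) ^ 2) (by have := hc.measurable; fun_prop) (fun x hx y => by
      have hx : mF μ (2 * k) (Lm t x) ≤ a := hx
      gcongr
      rw [div_le_iff₀ psv]
      refine max_le psv ?_
      have e := h.lip hp (Lm t y) (Lm t x)
      rw [← Lm_sub] at e
      have e2 := Lm_norm t (y - x)
      rw [norm_sub_rev] at e2
      have e3 : ‖t‖ * ‖x - y‖ ≤ 2 * ‖x - y‖ := by gcongr
      push_cast at e
      nlinarith)
  have key : ∀ y : On k n, ofReal (((2 * a)⁻¹) ^ (2 * k)) * ofReal (mF μ (2 * k) (Lm t y) ^ (2 * k)) ≤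
      ofReal (exp (1 * (max 0 (mF μ (2 * k) (Lm t y) - a) / (160 * k)) ^ 2 / 4)) := fun y => by
    rw [← ofReal_mul psv, ← mul_pow]
    refine ofReal_le_ofReal ?_
    set m := mF μ (2 * k) (Lm t y)
    have hm : 0 ≤ m := toReal_nonneg
    set u := max 0 (m - a) / a with hu
    have hu0 : 0 ≤ u := by positivity
    have hmu : m ≤ (1 + u) * a := by
      rw [add_mul, hu, div_mul_cancel₀ _ ha0.ne']; linarith [le_max_right 0 (m - a)]
    have e1 : ((2 * k : ℕ) : ℝ) * u ^ 2 ≤ 1 * (max 0 (m - a) / (160 * k)) ^ 2 / 4 := by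
      rw [one_mul, hu, div_pow _ a, div_pow _ (160 * (k:ℝ)), div_div, mul_div, div_le_div_iff₀ psv psv]
      have : ((2 * k : ℕ) : ℝ) * ((160 * k) ^ 2 * 4) ≤ a ^ 2 := by
        rw [ha, div_pow]; push_cast; rw [le_div_iff₀ nnm]; refine le_trans (le_of_eq (by ring)) hb
      nlinarith [mul_le_mul_of_nonneg_left this (sq_nonneg (max 0 (m - a)))]
    refine le_trans ?_ (exp_le_exp.2 e1)
    rw [exp_nat_mul]
    gcongr
    refine le_trans ?_ (add_one_le_exp _)
    rw [inv_mul_le_iff₀ psv]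
    nlinarith [sq_nonneg (u - 1)]
  have key := lintegral_mono (μ := gam (On k n)) key
  rw [lintegral_const_mul _ (by have := hc.measurable; fun_prop), h.fub (by omega), mul_comm (∏ i ∈ Finset.range k, (2 * (i:ℝ) + 1)), ofReal_mul psv, mul_assoc, ← hMp, ← ofReal_mul psv,
    ← ofReal_mul psv, ← mul_pow, ← mul_pow] at key
  have key := (mul_le_mul_right key _).trans this
  have e : ofReal (512 ^ (2 * k)) ≤ ofReal (((2 * a)⁻¹ * (‖t‖ * M)) ^ (2 * k)) := by
    refine ofReal_le_ofReal ?_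
    gcongr
    rw [ha]; field_simp; linarith
  have key := (mul_le_mul_right e _).trans key
  rw [one_div, inv_pow, ENNReal.ofReal_inv_of_pos psv]
  exact ENNReal.le_inv_iff_mul_le.2 key
end q5

section q6
variable {μ : Measure (En n)} (h : Pao μ)
include h
lemma Pao.two : ∫⁻ x, ofReal (‖x‖ ^ 2) ∂μ ≤ ofReal (2 * n) := by
  have := h.pr
  have e : ∀ x : En n, ofReal (‖x‖ ^ 2) = ∑ j, ofReal (⟪EuclideanSpace.single j (1:ℝ), x⟫ ^ 2) := fun x => by
    rw [← ofReal_sum_of_nonneg fun _ _ => sq_nonneg _, EuclideanSpace.norm_sq_eq]; simp [EuclideanSpace.inner_single_left]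
  simp only [e]
  rw [lintegral_finsetSum _ fun j _ => by fun_prop]
  refine (sum_le_sum fun j _ => ?_).trans (b := ∑ j : Fin n, ofReal 2) (by simp [ofReal_mul, mul_comm])
  rw [← ofReal_integral_eq_lintegral_ofReal (h.sm _).1 (.of_forall fun _ => sq_nonneg _)]
  exact ofReal_le_ofReal ((h.sm _).2.trans smp)

lemma Pao.W : ∫⁻ Γ : On k n, ∫⁻ x, ofReal (‖Pm Γ x‖ ^ 2) ∂μ ∂(gam (On k n)) ≤ ofReal (2 * k * n) := by
  have := h.pr
  have := gam_prob (E := On k n)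
  rw [lintegral_lintegral_swap (by have := Pm_cont (k := k) (n := n); exact Measurable.aemeasurable fpp)]
  have e : ∀ x : En n, ∫⁻ Γ : On k n, ofReal (‖Pm Γ x‖ ^ 2) ∂(gam (On k n)) = k * ofReal (‖x‖ ^ 2) := fun x => by
    have e : ∀ Γ : On k n, ofReal (‖Pm Γ x‖ ^ 2) = ∑ j, ofReal (|⟪Γ, tau (EuclideanSpace.single j (1:ℝ)) x⟫| ^ (2 * 1)) := fun Γ => by
      rw [← ofReal_sum_of_nonneg fun _ _ => by positivity, EuclideanSpace.norm_sq_eq]; simp [← Lm_inner, ← Pm_inner, EuclideanSpace.inner_single_left]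
    simp only [e]
    rw [lintegral_finsetSum _ fun j _ => by fun_prop]
    simp only [gam_momL, tau_norm]; simp
  simp only [e]
  rw [lintegral_const_mul _ fpp, mul_comm 2 (k:ℝ), mul_assoc, ofReal_mul psv, ofReal_natCast]
  exact mul_le_mul_right h.two _

lemma Pao.M (hk : 2 ≤ k) (hkn : (k:ℝ) ^ 2 ≤ 4 * n) {M : ℝ} (hM : 0 < M) (hMp : ofReal (M ^ (2 * k)) = ofReal (∏ i ∈ Finset.range k, (2 * (i:ℝ) + 1)) * ∫⁻ x, ofReal (‖x‖ ^ (2 * k)) ∂μ) :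
    M ^ 2 ≤ 2 ^ 54 * (k * n) := by
  have := h.pr
  have := gam_prob (E := On k n)
  have hp : 2 ≤ 2 * k := by omega
  have hk0 : (0:ℝ) < k := by positivity
  have hn0 : (0:ℝ) < n := by nlinarith
  rcases lt_or_ge (M ^ 2) (2 ^ 22 * 204800 * (k:ℝ) ^ 3) with hb | hb
  · nlinarith
  obtain ⟨Γ, g1, g2⟩ := pick (γ := gam (On k n)) (Φ := fun t Γ => mF μ (2 * k) (Lm t Γ)) ((h.cont hp).comp Lm_cont) (fun _ _ => toReal_nonneg)
    (fun t w Γ => by rw [Lm_add]; exact h.add hp _ _) (fun c t Γ => by rw [Lm_smul, mF_smul]) hM hk smp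
    (fun t => by rw [h.fub (by omega), mul_comm (∏ i ∈ Finset.range k, (2 * (i:ℝ) + 1)), ofReal_mul psv, mul_assoc, ← hMp, ← ofReal_mul psv, ← mul_pow, mul_comm])
    (h.h2 hk hM hMp hb) (W := fun Γ => ∫⁻ x, ofReal (‖Pm Γ x‖ ^ 2) ∂μ)
    (Measurable.lintegral_prod_right' (f := fun z : On k n × En n => ofReal (‖Pm z.1 z.2‖ ^ 2)) (by have := Pm_cont (k := k) (n := n); fun_prop))
    (b := ofReal (2 * k * n)) (ofReal_pos.2 psv).ne' ofReal_ne_top h.W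
  set s := 4 * √(k * n) with hs
  have hs0 : 0 < s := by positivity
  have hs2 : s ^ 2 = 16 * (k * n) := by rw [hs, mul_pow, sq_sqrt psv]; norm_num
  have Pc : Continuous (Pm Γ) := LinearMap.continuous_of_finiteDimensional _
  set ν := μ.map (Pm Γ)
  have : IsProbabilityMeasure ν := isProbabilityMeasure_map Pc.aemeasurable
  have hν : ULC 0 ν := h.lc.map _ smp
  have hev : ν.map Neg.neg = ν := by
    rw [map_map measurable_neg Pc.measurable, show Neg.neg ∘ Pm Γ = Pm Γ ∘ Neg.neg from funext fun x => (map_neg _ x).symm, ← map_map Pc.measurable measurable_neg, h.ev]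
  have hball : 1 / 2 ≤ ν.real (closedBall 0 s) := by
    have e1 := mul_meas_ge_le_lintegral (μ := μ) (f := fun x => ofReal (‖Pm Γ x‖ ^ 2)) fpp (ofReal (s ^ 2))
    have e1 := e1.trans g2
    have e2 : μ.real {x | ofReal (s ^ 2) ≤ ofReal (‖Pm Γ x‖ ^ 2)} ≤ 1 / 2 := by
      have := toReal_mono (by finiteness) e1
      rw [toReal_mul, toReal_mul, toReal_ofReal psv, toReal_ofReal psv, hs2] at this
      change _ * μ.real _ ≤ _ at this
      rw [hs2]
      generalize μ.real _ = z at *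
      refine le_of_mul_le_mul_left ?_ (by positivity : 0 < 16 * ((k:ℝ) * n))
      refine this.trans (le_of_eq ?_); simp; ring
    have e3 : 1 - ν.real (closedBall 0 s) ≤ 1 / 2 := by
      rw [← probReal_compl_eq_one_sub isClosed_closedBall.measurableSet, map_measureReal_apply Pc.measurable isClosed_closedBall.measurableSet.compl]
      refine (measureReal_mono (fun x hx => ?_) (measure_ne_top _ _)).trans e2
      simp only [mem_preimage, mem_compl_iff, mem_closedBall_zero_iff, not_le] at hx
      exact ofReal_le_ofReal (by gcongr)
    linarith
  obtain ⟨t, t1, ht⟩ := static hν hev hs0 hball (by simp; omega)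
  rw [finrank_euclideanSpace_fin] at ht
  have e := borell_mom hν (N := fun y => |⟪t, y⟫|) fpp (fun x => abs_nonneg _) (hsub_inner t) (u := 216 * s) psv (q := k) (by exact_mod_cast hk) (p := 2 * k) (by push_cast; linarith) ht
  rw [lintegral_map fpp Pc.measurable] at e
  simp only [Pm_inner] at e
  rw [← h.pow hp, ofReal_le_ofReal_iff psv, pow_le_pow_iff_left₀ (show 0 ≤ mF μ (2 * k) (Lm t Γ) from toReal_nonneg) psv (by omega)] at e
  have g := (g1 t t1).trans_le e
  rw [show 16 * (216 * s * ((2 * k : ℕ) : ℝ) / k) = 6912 * s by push_cast; field_simp; norm_num] at g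
  have : M ≤ 28311552 * s := by linarith
  have := pow_le_pow_left₀ hM.le this 2
  rw [mul_pow, hs2] at this
  linarith [mul_pos hk0 hn0]

lemma Pao.main (hk : 2 ≤ k) (hkn : (k:ℝ) ^ 2 ≤ 4 * n) : ∫⁻ x, ofReal (‖x‖ ^ (2 * k)) ∂μ ≤ ofReal ((2 ^ 56 * n) ^ k) := by
  have := h.pr
  have := gam_prob (E := On k n)
  have hk0 : (0:ℝ) < k := by positivity
  set J := ∫⁻ x, ofReal (‖x‖ ^ (2 * k)) ∂μ with hJ
  set g := ∏ i ∈ Finset.range k, (2 * (i:ℝ) + 1) with hg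
  have g0 : 0 < g := Finset.prod_pos fun i _ => by positivity
  have Jt : J ≠ ⊤ := fun hJt => by
    have e := h.fub (by omega : 1 ≤ k) (EuclideanSpace.single ⟨0, by omega⟩ 1)
    rw [← hJ, hJt, ENNReal.mul_top (ofReal_pos.2 (by simp; exact g0)).ne'] at e
    have i : Integrable (fun Γ : On k n => (40 * (2 * k : ℕ) * ‖Γ‖) ^ (2 * k)) (gam (On k n)) :=
      gam_growth fpp ((40 * (2 * k : ℕ)) ^ (2 * k) * (2 * k).factorial) 1 fun x => by
        have h := pow_div_factorial_le_exp ‖x‖ (norm_nonneg _) (2 * k)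
        rw [div_le_iff₀ psv] at h
        rw [abs_of_nonneg psv, mul_pow, one_mul, mul_assoc, mul_comm (Nat.cast _ : ℝ) (exp _)]
        gcongr
    refine (e ▸ lt_of_le_of_lt (lintegral_mono fun Γ => ?_) (lt_of_le_of_lt (lintegral_ofReal_le_lintegral_enorm _) i.2)).false
    refine ofReal_le_ofReal (pow_le_pow_left₀ toReal_nonneg ((h.le (by omega) _).trans ?_) _)
    gcongr
    refine (Lm_norm _ _).trans smp
  rcases eq_or_ne J 0 with J0 | J0
  · simp [J0]
  have Jp := ENNReal.toReal_pos J0 Jt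
  have hM : ((g * J.toReal) ^ (1 / (2 * k : ℕ) : ℝ)) ^ (2 * k) = g * J.toReal := by
    rw [one_div]; exact Real.rpow_inv_natCast_pow psv (by omega)
  have := h.M hk hkn (M := (g * J.toReal) ^ (1 / (2 * k : ℕ) : ℝ)) psv (by rw [hM, ofReal_mul g0.le, ofReal_toReal Jt])
  rw [← ofReal_toReal Jt]
  refine ofReal_le_ofReal ?_
  have e2 := pow_le_pow_left₀ psv this k
  rw [← pow_mul, hM] at e2
  have e3 := (mul_le_mul_of_nonneg_right (gmo_ge k) Jp.le).trans e2
  rw [show (2:ℝ) ^ 54 * (k * n) = k / 3 * (3 * 2 ^ 54 * n) by ring, mul_pow (_ / _)] at e3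
  refine (le_of_mul_le_mul_left e3 psv).trans ?_
  gcongr; norm_num
end q6

section q7
structure Iso (μ : Measure (Euc n)) : Prop where
  pr : IsProbabilityMeasure μ
  lc : ULC 0 μ
  sm : ∀ v, Integrable (fun x => ⟪v, x⟫ ^ 2) μ
  va : ∀ v, ∫ x, ⟪v, x⟫ ^ 2 ∂μ = ‖v‖ ^ 2
  me : ∀ v, ∫ x, ⟪v, x⟫ ∂μ = 0

lemma iso_of {μ : Measure (Euc n)} (h : IsIsotropicLogConcave n μ) : Iso μ := by
  obtain ⟨f, f0, fl, rfl, pr, me, co⟩ := h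
  have fm : AEMeasurable f := by
    suffices H : @Measurable (NullMeasurableSpace (Euc n) volume) ℝ _ _ f from NullMeasurable.aemeasurable H
    refine measurable_of_Ici fun c => ?_
    refine Convex.nullMeasurableSet (volume : Measure (Euc n)) (s := f ⁻¹' Ici c) fun x hx y hy a b ha hb hab => ?_
    rcases le_or_gt c 0 with hc | hc
    · exact hc.trans (f0 _)
    refine le_trans ?_ (fl x y a b ha hb hab)
    calc c = c ^ a * c ^ b := by rw [← Real.rpow_add hc, hab, Real.rpow_one]
      _ ≤ _ := mul_le_mul (rpow_le_rpow hc.le hx ha) (rpow_le_rpow hc.le hy hb) psv (rpow_nonneg (f0 _) _)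
  have sm : ∀ v : Euc n, Integrable (fun x => ⟪v, x⟫ ^ 2) (volume.withDensity fun x => ofReal (f x)) := fun v => by
    rcases eq_or_ne v 0 with rfl | hv
    · simp
    by_contra hi
    have e := co v v
    rw [integral_undef (by simpa only [real_inner_comm v, sq] using hi), real_inner_self_eq_norm_sq] at e
    exact hv (by simpa using e.symm)
  refine ⟨pr, ULC_volume.lc fm.ennreal_ofReal fun x y => ?_, sm, fun v => ?_, fun v => ?_⟩
  · have := fl x y (1 / 2) (1 / 2) nnm nnm nnm
    rw [← ofReal_mul (f0 _), ← ofReal_pow (f0 _), smul_add]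
    refine ofReal_le_ofReal (le_trans (le_of_eq ?_) (pow_le_pow_left₀ (mul_nonneg (rpow_nonneg (f0 _) _) (rpow_nonneg (f0 _) _)) this 2))
    rw [← sqrt_eq_rpow, ← sqrt_eq_rpow, mul_pow, sq_sqrt (f0 _), sq_sqrt (f0 _)]
  · simpa only [real_inner_comm v, sq, real_inner_self_eq_norm_sq] using co v v
  · have i : Integrable (fun x : Euc n => x) (volume.withDensity fun x => ofReal (f x)) := by
      refine Integrable.mono' (g := fun x => 1 + ∑ i, ⟪EuclideanSpace.single i (1:ℝ), x⟫ ^ 2) ((integrable_const _).add (integrable_finsetSum _ fun i _ => sm _)) fpp (.of_forall fun x => ?_)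
      simp only [EuclideanSpace.inner_single_left, map_one, one_mul]
      have := EuclideanSpace.real_norm_sq_eq x
      nlinarith [sq_nonneg (‖x‖ - 1)]
    have := integral_inner (𝕜 := ℝ) i v
    rw [me, inner_zero_right] at this
    simpa using this

variable {μ : Measure (Euc n)} (h : Iso μ)
include h
lemma Iso.sub_sm (v : Euc n) : Integrable (fun z : Euc n × Euc n => ⟪v, z.1 - z.2⟫ ^ 2) (μ.prod μ) ∧ ∫ z, ⟪v, z.1 - z.2⟫ ^ 2 ∂(μ.prod μ) = 2 * ‖v‖ ^ 2 := by
  have := h.pr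
  have i1 := (h.sm v).comp_fst μ
  have i2 := (h.sm v).comp_snd μ
  have m1 : Integrable (fun x => ⟪v, x⟫) μ := (memLp_two_iff_integrable_sq fpp).2 (h.sm v) |>.integrable nnm
  have i3 := m1.mul_prod m1
  have e : (fun z : Euc n × Euc n => ⟪v, z.1 - z.2⟫ ^ 2) = fun z => (⟪v, z.1⟫ ^ 2 + ⟪v, z.2⟫ ^ 2) - 2 * (⟪v, z.1⟫ * ⟪v, z.2⟫) := by
    funext z; rw [inner_sub_right]; ring
  have i4 : Integrable (fun z : Euc n × Euc n => ⟪v, z.1⟫ ^ 2 + ⟪v, z.2⟫ ^ 2) (μ.prod μ) := i1.add i2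
  rw [e]
  refine ⟨i4.sub (i3.const_mul 2), ?_⟩
  rw [integral_sub i4 (i3.const_mul 2), integral_add i1 i2, integral_const_mul, integral_prod_mul (fun x => ⟪v, x⟫) (fun x => ⟪v, x⟫), h.me,
    integral_fun_fst (fun x => ⟪v, x⟫ ^ 2), integral_fun_snd (fun x => ⟪v, x⟫ ^ 2), h.va]
  simp; ring

lemma Iso.img {F : Type*} [NormedAddCommGroup F] [InnerProductSpace ℝ F] [FiniteDimensional ℝ F] [MeasurableSpace F] [BorelSpace F] (P : Euc n →ₗ[ℝ] F) :
    IsProbabilityMeasure ((μ.prod μ).map fun z => P (z.1 - z.2)) ∧ ULC 0 ((μ.prod μ).map fun z => P (z.1 - z.2)) ∧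
      ((μ.prod μ).map fun z => P (z.1 - z.2)).map Neg.neg = ((μ.prod μ).map fun z => P (z.1 - z.2)) := by
  have := h.pr
  have Pc : Continuous P := LinearMap.continuous_of_finiteDimensional _
  have Pm : Measurable fun z : Euc n × Euc n => P (z.1 - z.2) := Continuous.measurable fpp
  refine ⟨isProbabilityMeasure_map Pm.aemeasurable, ?_, ?_⟩
  · exact ULC.map_prod (t := 0) h.lc h.lc (P ∘ₗ (LinearMap.fst ℝ (Euc n) (Euc n) - LinearMap.snd ℝ (Euc n) (Euc n))) Pm smp
  rw [map_map measurable_neg Pm]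
  nth_rw 2 [← Measure.prod_swap]
  rw [map_map Pm measurable_swap]
  congr 1; funext z; simp [← map_neg]

lemma Iso.pao : Pao ((μ.prod μ).map fun z => z.1 - z.2) := by
  obtain ⟨a, b, c⟩ := h.img LinearMap.id
  refine ⟨a, b, c, fun v => ?_⟩
  have := h.sub_sm v
  rw [integrable_map_measure fpp fpp, integral_map fpp fpp]
  exact ⟨this.1, this.2.le⟩

lemma Iso.tail (hn : 2 ≤ n) : μ.real {x | 2 ^ 32 * √n ≤ ‖x‖} ≤ exp (-3 * √n) := by
  have := h.pr
  have n0 : (0:ℝ) < n := by positivity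
  have n2 : (2:ℝ) ≤ n := by exact_mod_cast hn
  have s0 : 0 < √(n:ℝ) := by positivity
  have sq := sq_sqrt n0.le
  have s1 : 1 < √(n:ℝ) := Real.lt_sqrt_of_sq_lt lnr
  set k := ⌈√(n:ℝ)⌉₊ with hk
  have k1 : √(n:ℝ) ≤ k := Nat.le_ceil _
  have k2 : (k:ℝ) < √n + 1 := Nat.ceil_lt_add_one s0.le
  have hk2 : 2 ≤ k := Nat.lt_ceil.2 (by simpa using s1)
  have J := h.pao.main hk2 (by nlinarith)
  have Ji := (mul_meas_ge_le_lintegral (f := fun x : Euc n => ofReal (‖x‖ ^ (2 * k))) fpp (ofReal ((2 ^ 31 * √n) ^ (2 * k)))).trans J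
  have hex : exp 4 ≤ 64 := by
    rw [show (4:ℝ) = (4:ℕ) * 1 by norm_num, exp_nat_mul]
    exact (pow_le_pow_left₀ psv exp_one_lt_d9.le 4).trans nnm
  have J2 : ((μ.prod μ).map fun z => z.1 - z.2).real {x | 2 ^ 31 * √n ≤ ‖x‖} ≤ exp (-4 * √n) := by
    have e : {x : Euc n | 2 ^ 31 * √n ≤ ‖x‖} ⊆ {x | ofReal ((2 ^ 31 * √n) ^ (2 * k)) ≤ ofReal (‖x‖ ^ (2 * k))} := fun x hx =>
      ofReal_le_ofReal (pow_le_pow_left₀ psv hx _)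
    have e1 := toReal_mono ofReal_ne_top ((mul_le_mul_right (measure_mono e) _).trans Ji)
    rw [toReal_mul, toReal_ofReal psv, toReal_ofReal psv, pow_mul, mul_pow, sq,
      show ((2:ℝ) ^ 31) ^ 2 * n = 2 ^ 56 * n * 64 by ring, mul_pow _ 64, mul_assoc] at e1
    have e2 : (64:ℝ) ^ k * ((μ.prod μ).map fun z => z.1 - z.2).real {x | 2 ^ 31 * √n ≤ ‖x‖} ≤ 1 := le_of_mul_le_mul_left (by rw [mul_one]; exact e1) (by positivity : (0:ℝ) < (2 ^ 56 * n) ^ k)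
    rw [neg_mul, exp_neg, ← one_div, le_div_iff₀ (exp_pos _), mul_comm]
    refine le_trans ?_ e2
    gcongr
    calc _ ≤ exp (k * 4) := exp_le_exp.2 lnr
      _ = exp 4 ^ k := exp_nat_mul _ _
      _ ≤ _ := by gcongr
  have hB : 1 / 2 ≤ μ.real {y | ‖y‖ < 2 * √n} := by
    have e : ∀ x : Euc n, ‖x‖ ^ 2 = ∑ i, ⟪EuclideanSpace.single i (1:ℝ), x⟫ ^ 2 := fun x => by simp [EuclideanSpace.real_norm_sq_eq, EuclideanSpace.inner_single_left]
    have i : Integrable (fun x : Euc n => ‖x‖ ^ 2) μ := by simp only [e]; exact integrable_finsetSum _ fun i _ => h.sm _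
    have c := mul_meas_ge_le_integral_of_nonneg (.of_forall fun x => sq_nonneg _) i ((2 * √n) ^ 2)
    simp only [e] at c
    rw [integral_finsetSum _ fun i _ => h.sm _] at c
    simp only [h.va, ← e] at c
    have c2 : {y : Euc n | ‖y‖ < 2 * √n}ᶜ ⊆ {x | (2 * √n) ^ 2 ≤ ‖x‖ ^ 2} := fun x hx => by
      have : 2 * √n ≤ ‖x‖ := not_lt.1 hx
      show (2 * √n) ^ 2 ≤ ‖x‖ ^ 2
      gcongr
    have c3 := probReal_compl_eq_one_sub (μ := μ) (measurableSet_lt (f := fun y : Euc n => ‖y‖) (g := fun _ => 2 * √n) fpp fpp)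
    have c4 := c3 ▸ measureReal_mono c2 (measure_ne_top μ _)
    generalize μ.real _ = z at *
    generalize μ.real _ = w at *
    simp [mul_pow] at c
    nlinarith
  have hP : μ.real {x | 2 ^ 32 * √n ≤ ‖x‖} * μ.real {y | ‖y‖ < 2 * √n} ≤ exp (-4 * √n) := by
    rw [← measureReal_prod_prod]
    refine le_trans ?_ J2
    rw [map_measureReal_apply fpp (measurableSet_le measurable_const measurable_norm)]
    refine measureReal_mono (fun z hz => ?_) (measure_ne_top _ _)
    have h1 : 2 ^ 32 * √n ≤ ‖z.1‖ := hz.1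
    have h2 : ‖z.2‖ < 2 * √n := hz.2
    show 2 ^ 31 * √n ≤ ‖z.1 - z.2‖
    linarith [norm_sub_norm_le z.1 z.2]
  have e3 : exp (-4 * √n) * 2 ≤ exp (-3 * √n) := by
    rw [show -3 * √(n:ℝ) = -4 * √n + √n by ring, exp_add]
    gcongr
    linarith [add_one_le_exp √(n:ℝ)]
  nlinarith [measureReal_nonneg (μ := μ) (s := {x | 2 ^ 32 * √n ≤ ‖x‖})]

lemma Iso.sb (H : ∀ {E : Type} [NormedAddCommGroup E] [InnerProductSpace ℝ E] [FiniteDimensional ℝ E]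
    [MeasurableSpace E] [BorelSpace E] {μ : Measure E} {b : ℝ}, IsProbabilityMeasure μ → ULC 0 μ → 0 < finrank ℝ E → μ.map Neg.neg = μ →
    (∀ v, Integrable (fun x => ⟪v, x⟫ ^ 2) μ ∧ ∫ x, ⟪v, x⟫ ^ 2 ∂μ = ‖v‖ ^ 2) → b ^ 2 ≤ finrank ℝ E / 1000 →
    μ.real (closedBall 0 b) ≤ exp (-δ * finrank ℝ E)) (hk : 0 < k) {f : Fin k → Euc n} (hf : Orthonormal ℝ f) (hb0 : 0 ≤ b) (hb : b ^ 2 ≤ k / 500) :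
    (μ.prod μ).real {z | ∑ i, ⟪f i, z.1 - z.2⟫ ^ 2 ≤ b ^ 2} ≤ exp (-δ * k) := by
  have := h.pr
  set P : Euc n →ₗ[ℝ] Euc k := { toFun := fun x => WithLp.toLp 2 fun i => (√2)⁻¹ * ⟪f i, x⟫
                                 map_add' := fun x y => by ext i; simp [inner_add_right, mul_add]
                                 map_smul' := fun c x => by ext i; simp [inner_smul_right, mul_left_comm] } with hP
  have Pc : Continuous P := LinearMap.continuous_of_finiteDimensional _
  have Pm : Measurable fun z : Euc n × Euc n => P (z.1 - z.2) := Continuous.measurable fpp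
  obtain ⟨a1, a2, a3⟩ := h.img P
  have s2 := sq_sqrt (zero_le_two : (0:ℝ) ≤ 2)
  have e : ∀ v x, ⟪v, P x⟫ = ⟪(√2)⁻¹ • ∑ i, v i • f i, x⟫ := fun v x => by
    simp [hP, PiLp.inner_apply, inner_smul_left, sum_inner, mul_sum, mul_comm, mul_left_comm]
  have := H (b := b / √2) a1 a2 (by simpa) a3 (fun v => by
    have := h.sub_sm ((√2)⁻¹ • ∑ i, v i • f i)
    rw [integrable_map_measure fpp Pm.aemeasurable, integral_map Pm.aemeasurable fpp]
    simp only [Function.comp_def, e]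
    refine ⟨this.1, this.2.trans ?_⟩
    rw [norm_smul, mul_pow, ← real_inner_self_eq_norm_sq (∑ i, _), hf.inner_sum, EuclideanSpace.real_norm_sq_eq]
    simp [inv_pow, s2, ← sq]) (by rw [div_pow, s2]; simp; linarith)
  rw [map_measureReal_apply Pm isClosed_closedBall.measurableSet, finrank_euclideanSpace_fin] at this
  refine (measureReal_mono (fun z hz => ?_) (measure_ne_top _ _)).trans this
  have hz : ∑ i, ⟪f i, z.1 - z.2⟫ ^ 2 ≤ b ^ 2 := hz
  rw [mem_preimage, mem_closedBall_zero_iff, ← sq_le_sq₀ (norm_nonneg _) psv, EuclideanSpace.real_norm_sq_eq, div_pow, s2]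
  simp [hP, mul_pow, s2, ← mul_sum]
  linarith
end q7

section r0
lemma greedy {H ι κ : Type*} [NormedAddCommGroup H] [InnerProductSpace ℝ H] [Nonempty κ] [DecidableEq ι] (a : ι → κ → H) (b : ι → ℝ)
    (h1 : ∀ t u, ∃ v, ⟪u, a t v⟫ ≤ 0) (h2 : ∀ t v, ‖a t v‖ ^ 2 ≤ b t) (S : Finset ι) :
    ∃ ch : ι → κ, ‖∑ t ∈ S, a t (ch t)‖ ^ 2 ≤ ∑ t ∈ S, b t := by
  induction S using induction_on with
  | empty => exact ⟨fun _ => Classical.arbitrary κ, by simp⟩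
  | insert i S hi ih =>
    obtain ⟨ch, hc⟩ := ih
    obtain ⟨v, hv⟩ := h1 i (∑ t ∈ S, a t (ch t))
    refine ⟨Function.update ch i v, ?_⟩
    rw [sum_insert hi, sum_insert hi, Function.update_self, sum_congr rfl fun t ht => by rw [Function.update_of_ne (ne_of_mem_of_not_mem ht hi)], norm_add_sq_real, real_inner_comm]
    linarith [h2 i v]

lemma hull_le {H κ : Type*} [NormedAddCommGroup H] [InnerProductSpace ℝ H] {V : κ → H} {z : H} (hz : z ∈ convexHull ℝ (range V)) (u : H) : ∃ v, ⟪u, V v - z⟫ ≤ 0 := by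
  by_contra! hc
  have : convexHull ℝ (range V) ⊆ {w | ⟪u, z⟫ < ⟪u, w⟫} := convexHull_min (by
    rintro _ ⟨v, rfl⟩
    have := hc v
    rw [inner_sub_right] at this
    show ⟪u, z⟫ < ⟪u, V v⟫
    linarith) (convex_halfSpace_gt (innerSL ℝ u).isLinear _)
  have h : ⟪u, z⟫ < ⟪u, z⟫ := this hz
  exact lt_irrefl _ h

lemma svs (T : Euc n →ₗ[ℝ] Euc n) (hc : 0 ≤ c) : ∃ U W : Submodule ℝ (Euc n), finrank ℝ U + finrank ℝ W = n ∧ (∀ v ∈ U, c * ‖v‖ ^ 2 ≤ ‖T v‖ ^ 2) ∧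
    (∀ v ∈ W, v ≠ 0 → ‖T v‖ ^ 2 < c * ‖v‖ ^ 2) ∧ ∃ (k : ℕ) (f : Fin k → Euc n), finrank ℝ U = k ∧ Orthonormal ℝ f ∧ ∀ v, c * ∑ i, ⟪f i, v⟫ ^ 2 ≤ ‖T v‖ ^ 2 := by
  have hS : (T.adjoint ∘ₗ T).IsSymmetric := fun x y => by simp [LinearMap.adjoint_inner_left, LinearMap.adjoint_inner_right]
  set b := hS.eigenvectorBasis (finrank_euclideanSpace_fin (n := n))
  set l := hS.eigenvalues (finrank_euclideanSpace_fin (n := n))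
  have hT : ∀ v, ‖T v‖ ^ 2 = ∑ i, l i * ⟪b i, v⟫ ^ 2 := fun v => by
    rw [← real_inner_self_eq_norm_sq, ← LinearMap.adjoint_inner_left, ← b.sum_inner_mul_inner]
    refine sum_congr rfl fun i _ => ?_
    have : ⟪T.adjoint (T v), b i⟫ = l i * ⟪b i, v⟫ := by
      have := hS v (b i)
      rw [hS.apply_eigenvectorBasis] at this
      simp only [LinearMap.comp_apply] at this
      rw [this, inner_smul_right, real_inner_comm]; rfl
    rw [this]; ring
  have hv : ∀ v, ‖v‖ ^ 2 = ∑ i, ⟪b i, v⟫ ^ 2 := fun v => by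
    rw [← b.sum_sq_norm_inner_right v]; simp
  have l0 : ∀ i, 0 ≤ l i := fun i => by
    have := hT (b i)
    simp [b.inner_eq_ite] at this
    rw [← this]; positivity
  set I : Finset (Fin n) := Finset.univ.filter fun i => c ≤ l i with hI
  set U := Submodule.span ℝ (range fun i : I => b i) with hU
  have li : LinearIndependent ℝ fun i : I => b i := (b.orthonormal.comp _ Subtype.val_injective).linearIndependent
  refine ⟨U, Uᗮ, by rw [Submodule.finrank_add_finrank_orthogonal]; simp, fun v hvU => ?_, fun v hvW h0 => ?_, I.card, fun i => b (I.equivFin.symm i), ?_, b.orthonormal.comp _ (Subtype.val_injective.comp (Equiv.injective _)), fun v => ?_⟩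
  · have : ∀ i, i ∉ I → ⟪b i, v⟫ = 0 := fun i hi => by
      refine Submodule.span_induction (p := fun v _ => ⟪b i, v⟫ = 0) ?_ smp (fun x y _ _ hx hy => by simp [inner_add_right, hx, hy]) (fun a x _ hx => by simp [inner_smul_right, hx]) hvU
      rintro _ ⟨j, rfl⟩
      rw [b.inner_eq_ite, if_neg (fun h : i = ↑j => hi (by rw [h]; exact j.2))]
    rw [hT, hv, mul_sum]
    refine sum_le_sum fun i _ => ?_
    by_cases hi : i ∈ I
    · have := (mem_filter.1 hi).2; gcongr
    · simp [this i hi]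
  · have h1 : ∀ i ∈ I, ⟪b i, v⟫ = 0 := fun i hi => hvW _ (Submodule.subset_span ⟨⟨i, hi⟩, rfl⟩)
    have h3 : ∀ i, l i * ⟪b i, v⟫ ^ 2 ≤ c * ⟪b i, v⟫ ^ 2 := fun i => by
      by_cases hi : i ∈ I
      · simp [h1 i hi]
      · have : l i < c := by simpa [hI] using hi
        gcongr
    obtain ⟨i, hi⟩ : ∃ i, ⟪b i, v⟫ ≠ 0 := by
      by_contra! hc
      have := hv v
      simp [hc] at this; exact h0 this
    rw [hT, hv, mul_sum]
    refine Finset.sum_lt_sum (fun i _ => h3 i) ⟨i, Finset.mem_univ _, ?_⟩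
    have : l i < c := by
      have : i ∉ I := fun h => hi (h1 i h)
      simpa [hI] using this
    have : 0 < ⟪b i, v⟫ ^ 2 := by positivity
    gcongr
  · rw [hU, finrank_span_eq_card li]; simp
  · rw [hT, Equiv.sum_comp I.equivFin.symm fun i : I => ⟪b i, v⟫ ^ 2, Finset.sum_coe_sort I fun i => ⟪b i, v⟫ ^ 2, mul_sum]
    refine (sum_le_sum fun i hi => ?_).trans (sum_le_sum_of_subset_of_nonneg (Finset.subset_univ I) fun i _ _ => mul_nonneg (l0 i) (sq_nonneg _))
    have := (mem_filter.1 hi).2; gcongr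

lemma dim_inf (U W : Submodule ℝ (Euc n)) : finrank ℝ U + finrank ℝ W ≤ n + finrank ℝ ↥(U ⊓ W) := by
  rw [← Submodule.finrank_sup_add_finrank_inf_eq]
  have := Submodule.finrank_le (U ⊔ W)
  rw [finrank_euclideanSpace_fin] at this
  omega

lemma sv_pert {T S : Euc n →ₗ[ℝ] Euc n} {F : Submodule ℝ (Euc n)} (hF : n ≤ 2 * finrank ℝ F) (hT : ∀ v ∈ F, ‖v‖ ≤ ‖T v‖)
    (hS : ∑ i, ‖(T - S) (EuclideanSpace.single i 1)‖ ^ 2 ≤ (n:ℝ) / 16) :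
    ∃ (k : ℕ) (f : Fin k → Euc n), n ≤ 4 * k ∧ Orthonormal ℝ f ∧ ∀ v, ∑ i, ⟪f i, v⟫ ^ 2 ≤ 4 * ‖S v‖ ^ 2 := by
  obtain ⟨U, W, d1, _, hW, k, f, hk, hf, hfv⟩ := svs (T - S) (c := 1 / 4) nnm
  obtain ⟨U', W', d2, _, hW', k', f', hk', hf', hfv'⟩ := svs S (c := 1 / 4) nnm
  have e1 : 4 * k ≤ n := by
    have := (sum_le_sum fun i (_ : i ∈ Finset.univ) => hfv (EuclideanSpace.single i 1)).trans hS
    rw [← mul_sum, sum_comm] at this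
    have e : ∀ j, ∑ i, ⟪f j, EuclideanSpace.single i (1:ℝ)⟫ ^ 2 = 1 := fun j => by
      have := hf.1 j
      rw [← sq_eq_sq₀ (norm_nonneg _) zero_le_one, EuclideanSpace.real_norm_sq_eq] at this
      simpa [EuclideanSpace.inner_single_right] using this
    simp only [e] at this
    simp at this
    exact_mod_cast (by linarith : (4:ℝ) * k ≤ n)
  refine ⟨k', f', ?_, hf', fun v => by linarith [hfv' v]⟩
  by_contra! hc
  have e2 := dim_inf F W
  have e3 := dim_inf (F ⊓ W) W'
  have : 0 < finrank ℝ ↥(F ⊓ W ⊓ W') := by omega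
  obtain ⟨⟨v, ⟨v1, v2⟩, v3⟩, v0⟩ := Module.finrank_pos_iff_exists_ne_zero.1 this
  have v0 : v ≠ 0 := fun h => v0 (Subtype.ext h)
  have a1 := hT v v1
  have a2 := hW v v2 v0
  have a3 := hW' v v3 v0
  have a4 : ‖(T - S) v‖ < ‖v‖ / 2 := lt_of_pow_lt_pow_left₀ 2 psv lnr
  have a5 : ‖S v‖ < ‖v‖ / 2 := lt_of_pow_lt_pow_left₀ 2 psv lnr
  have a6 := norm_add_le ((T - S) v) (S v)
  simp at a6 a4
  linarith
end r0

section r1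
variable {m q : ℕ} {κ : Type*}
def zs (V : κ → Euc n) (r : ℝ) (s : Sym κ q) : Euc n := (r / q) • (s.1.map V).sum

lemma maur {ι τ : Type*} [Fintype ι] [Fintype τ] {V : κ → Euc n} (hV : ∀ v, ‖V v‖ ≤ C) {z : ι → Euc n} (hz : ∀ i, z i ∈ convexHull ℝ (range V)) (w : τ → ι → ℝ) (hq : 0 < q) (r : ℝ) :
    ∃ s : ι → Sym κ q, ∑ t, ‖∑ i, w t i • (zs V r (s i) - r • z i)‖ ^ 2 ≤ 4 * C ^ 2 * r ^ 2 / q * ∑ t, ∑ i, w t i ^ 2 := by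
  classical
  rcases isEmpty_or_nonempty ι with h | ⟨⟨i0⟩⟩
  · exact ⟨fun i => h.elim i, by simp⟩
  have : Nonempty κ := range_nonempty_iff_nonempty.1 (convexHull_nonempty_iff.1 ⟨_, hz i0⟩)
  have hq' : (0:ℝ) < q := by exact_mod_cast hq
  have zC : ∀ i, ‖z i‖ ≤ C := fun i => by
    have := convexHull_min (t := closedBall 0 C) (by rintro _ ⟨v, rfl⟩; simpa using hV v) (convex_closedBall _ _) (hz i)
    simpa using this
  obtain ⟨ch, hc⟩ := greedy (H := PiLp 2 fun _ : τ => Euc n) (ι := ι × Fin q) (κ := κ) (fun p v => WithLp.toLp 2 fun t => (w t p.1 * (r / q)) • (V v - z p.1))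
    (fun p => 4 * C ^ 2 * (r / q) ^ 2 * ∑ t, w t p.1 ^ 2) (fun p u => by
      obtain ⟨v, hv⟩ := hull_le (hz p.1) (∑ t, (w t p.1 * (r / q)) • u t)
      refine ⟨v, ?_⟩
      simpa [PiLp.inner_apply, sum_inner, inner_smul_left, inner_smul_right] using hv) (fun p v => by
      rw [PiLp.norm_sq_eq_of_L2]
      simp only [norm_smul, mul_pow, norm_mul, norm_eq_abs, sq_abs]
      rw [mul_sum]
      refine sum_le_sum fun t _ => ?_
      have h1 : ‖V v - z p.1‖ ^ 2 ≤ (C + C) ^ 2 := by gcongr; exact (norm_sub_le _ _).trans (add_le_add (hV v) (zC _))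
      nlinarith [mul_le_mul_of_nonneg_left h1 (by positivity : 0 ≤ w t p.1 ^ 2 * (r / q) ^ 2)]) Finset.univ
  refine ⟨fun i => ⟨Finset.univ.val.map fun l => ch (i, l), by simp⟩, ?_⟩
  rw [PiLp.norm_sq_eq_of_L2] at hc
  convert hc using 1
  · refine sum_congr rfl fun t _ => ?_
    congr 2
    simp only [WithLp.ofLp_sum, Finset.sum_apply, Fintype.sum_prod_type, zs]
    refine sum_congr rfl fun i _ => ?_
    rw [← smul_sum, sum_sub_distrib, mul_smul, smul_sub (r / q : ℝ)]
    congr 2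
    · simp [Finset.sum, Function.comp_def]
    · rw [sum_const, card_univ, Fintype.card_fin, ← Nat.cast_smul_eq_nsmul ℝ, smul_smul, div_mul_cancel₀ _ hq'.ne']
  · rw [← mul_sum, Fintype.sum_prod_type]
    simp only [sum_const, card_univ, Fintype.card_fin, nsmul_eq_mul]
    rw [← mul_sum, sum_comm]
    field_simp

def Tl (V : κ → Euc n) (r : ℝ) (s : Fin n → Sym κ q) : Euc n →ₗ[ℝ] Euc n := Fintype.linearCombination ℝ (fun i => zs V r (s i)) ∘ₗ (WithLp.linearEquiv 2 ℝ (Fin n → ℝ)).toLinearMap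
lemma Tl_apply (V : κ → Euc n) (r : ℝ) (s : Fin n → Sym κ q) (y : Euc n) : Tl V r s y = ∑ i, y i • zs V r (s i) := rfl

lemma r1_main {V : κ → Euc n} (hn : 0 < n) (hq : 0 < q) (hC : 1 ≤ C) (he : 0 < ε) (he' : 32 * ε ^ 2 ≤ 1) (hε : 4 * C ^ 2 * r ^ 2 / q ≤ ε ^ 2) (hV : ∀ v, ‖V v‖ ≤ C)
    {y : Fin m → Euc n} (hm : 0 < m) (hy : ∀ j, ‖y j‖ ≤ C * √n) {T : Euc n →ₗ[ℝ] Euc n} (h1 : ∀ i, ∃ z ∈ convexHull ℝ (range V), T (EuclideanSpace.single i 1) = r • z)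
    (h2 : ∀ j, ∃ z ∈ convexHull ℝ (range V), T ((√n)⁻¹ • y j) = r • z) {F : Submodule ℝ (Euc n)} (hF : n ≤ 2 * finrank ℝ F) (hT : ∀ v ∈ F, ‖v‖ ≤ ‖T v‖) :
    ∃ s : Fin n → Sym κ q, (∃ (k : ℕ) (f : Fin k → Euc n), n ≤ 4 * k ∧ Orthonormal ℝ f ∧ ∀ v, ∑ i, ⟪f i, v⟫ ^ 2 ≤ 4 * ‖Tl V r s v‖ ^ 2) ∧
      ∃ J : Finset (Fin m), m ≤ 2 * J.card ∧ ∀ j ∈ J, ∃ s' : Sym κ q, ‖Tl V r s (y j) - √n • zs V r s'‖ ≤ 3 * ε * C * √n := by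
  have hn' : (0:ℝ) < n := by exact_mod_cast hn
  have hm' : (0:ℝ) < m := by exact_mod_cast hm
  choose z hz hTz using h1
  choose z' hz' hTz' using h2
  obtain ⟨s, hs⟩ := maur hV hz (fun (t : Fin m ⊕ Fin n) i => t.elim (fun j => y j i) fun i' => if i = i' then C * √m else 0) hq r
  have eT : ∀ v, (Tl V r s - T) v = ∑ i, v i • (zs V r (s i) - r • z i) := fun v => by
    have : T v = ∑ i, v i • r • z i := by
      conv_lhs => rw [← (EuclideanSpace.basisFun (Fin n) ℝ).sum_repr v]
      simp [map_sum, hTz]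
    rw [LinearMap.sub_apply, Tl_apply, this, ← sum_sub_distrib]
    simp only [smul_sub]
  simp only [Fintype.sum_sum_type, Sum.elim_inl, Sum.elim_inr, ite_smul, zero_smul, sum_ite_eq', Finset.mem_univ, if_true, ite_pow, ← eT, norm_smul, mul_pow] at hs
  simp only [ne_eq, OfNat.ofNat_ne_zero, not_false_eq_true, zero_pow, sum_ite_eq', Finset.mem_univ, if_true, sum_const, card_univ, Fintype.card_fin, nsmul_eq_mul, ← EuclideanSpace.real_norm_sq_eq, sq_sqrt hm'.le, norm_eq_abs, sq_abs, mul_pow, abs_mul, ← mul_sum] at hs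
  have e1 : ∀ i, zs V r (s i) - r • z i = (Tl V r s - T) (EuclideanSpace.single i 1) := fun i => by
    rw [eT]; simp [sum_ite_eq', Pi.single_apply]
  have y2 : ∑ j, ‖y j‖ ^ 2 ≤ m * (C ^ 2 * n) := by
    refine (sum_le_sum fun j _ => pow_le_pow_left₀ (norm_nonneg _) (hy j) 2).trans ?_
    simp [mul_pow]
  have hs2 := hs.trans (mul_le_mul hε (add_le_add_left y2 _) psv psv)
  simp only [e1] at hs2
  have p1 : 0 ≤ ∑ j, ‖(Tl V r s - T) (y j)‖ ^ 2 := by positivity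
  have p2 : 0 ≤ ∑ i, ‖(Tl V r s - T) (EuclideanSpace.single i 1)‖ ^ 2 := by positivity
  have cm : 0 < C ^ 2 * m := by positivity
  refine ⟨s, sv_pert hF hT ?_, Finset.univ.filter fun j => ‖(Tl V r s - T) (y j)‖ ≤ 2 * ε * C * √n, ?_, fun j hj => ?_⟩
  · simp only [← neg_sub (Tl V r s) T, LinearMap.neg_apply, norm_neg]
    refine le_of_mul_le_mul_left ?_ cm
    nlinarith [mul_le_mul_of_nonneg_right he' (by positivity : 0 ≤ C ^ 2 * m * n)]
  · by_contra! hc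
    set J := Finset.univ.filter fun j => ‖(Tl V r s - T) (y j)‖ ≤ 2 * ε * C * √n with hJ
    have a0 := J.card_add_card_compl
    rw [Fintype.card_fin] at a0
    have a1 : (m:ℝ) < 2 * (Jᶜ.card : ℝ) := by exact_mod_cast (by omega : m < 2 * Jᶜ.card)
    have a2 : Jᶜ.card • (2 * ε * C * √n) ^ 2 ≤ ∑ j ∈ Jᶜ, ‖(Tl V r s - T) (y j)‖ ^ 2 := Finset.card_nsmul_le_sum _ _ _ fun j hj => by
      have : 2 * ε * C * √n < ‖(Tl V r s - T) (y j)‖ := by simpa [hJ] using hj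
      exact pow_le_pow_left₀ psv this.le 2
    have a3 := a2.trans (sum_le_sum_of_subset_of_nonneg (Finset.subset_univ _) fun _ _ _ => by positivity)
    rw [nsmul_eq_mul, mul_pow, sq_sqrt hn'.le] at a3
    nlinarith [mul_lt_mul_of_pos_right a1 (by positivity : 0 < (2 * ε * C) ^ 2 * n), mul_nonneg cm.le p2]
  · have hj' : ‖(Tl V r s - T) (y j)‖ ≤ 2 * ε * C * √n := (mem_filter.1 hj).2
    obtain ⟨s', h'⟩ := maur hV (fun _ : Unit => hz' j) (fun (_ _ : Unit) => 1) hq r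
    simp at h'
    have h3 : ‖zs V r (s' ()) - r • z' j‖ ≤ ε := le_of_sq_le_sq (h'.trans hε) he.le
    refine ⟨s' (), ?_⟩
    have sn : 0 < √(n:ℝ) := by positivity
    have : Tl V r s (y j) - √n • zs V r (s' ()) = (Tl V r s - T) (y j) - √(n:ℝ) • (zs V r (s' ()) - r • z' j) := by
      rw [← hTz', map_smul, smul_sub, smul_smul, mul_inv_cancel₀ sn.ne', one_smul, LinearMap.sub_apply]; abel
    rw [this]
    refine (norm_sub_le _ _).trans ?_
    rw [norm_smul, norm_eq_abs, abs_of_pos sn]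
    nlinarith [mul_le_mul_of_nonneg_left h3 sn.le, mul_le_mul_of_nonneg_left hC (mul_pos sn he).le]
end r1

section r2
variable {m q : ℕ} {κ : Type*}
lemma r2_gen {X Y σ : Type*} [MeasurableSpace X] [MeasurableSpace Y] [Fintype σ] (P : Measure X) [IsProbabilityMeasure P] (μ : Measure Y) [IsProbabilityMeasure μ] {B : σ → Set (X × Y)} (hB : ∀ s, MeasurableSet (B s)) (p : ℝ≥0∞) (J : Finset (Fin m)) :
    (P.prod (Measure.pi fun _ : Fin m => μ)) {z | (∀ s, μ (Prod.mk z.1 ⁻¹' B s) ≤ p) ∧ ∀ j ∈ J, ∃ s, (z.1, z.2 j) ∈ B s} ≤ (Fintype.card σ * p) ^ J.card := by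
  rw [Measure.prod_apply (by
    simp only [ofPred_and, ofPred_forall, ofPred_exists]
    refine .inter (.iInter fun s => measurableSet_le ((measurable_measure_prodMk_left (hB s)).comp measurable_fst) measurable_const) (.iInter fun j => .iInter fun _ => .iUnion fun s => ?_)
    exact (by fun_prop : Measurable fun z : X × (Fin m → Y) => (z.1, z.2 j)) (hB s))]
  refine (lintegral_mono (g := fun _ => (Fintype.card σ * p) ^ J.card) fun x => ?_).trans smp
  by_cases hx : ∀ s, μ (Prod.mk x ⁻¹' B s) ≤ p
  · classical
    refine (measure_mono (t := univ.pi fun j => if j ∈ J then ⋃ s, Prod.mk x ⁻¹' B s else univ) fun y hy j _ => ?_).trans ?_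
    · by_cases hj : j ∈ J
      · simpa [hj] using hy.2 j hj
      · simp [hj]
    · rw [Measure.pi_pi, ← Finset.prod_subset (Finset.subset_univ J) (fun j _ hj => by simp [hj]), ← prod_const]
      refine Finset.prod_le_prod' fun j hj => ?_
      rw [if_pos hj]
      refine (measure_iUnion_fintype_le μ _).trans ((sum_le_sum fun s _ => hx s).trans ?_)
      simp
  · rw [show Prod.mk x ⁻¹' {z : X × (Fin m → Y) | (∀ s, μ (Prod.mk z.1 ⁻¹' B s) ≤ p) ∧ ∀ j ∈ J, ∃ s, (z.1, z.2 j) ∈ B s} = ∅ from eq_empty_of_forall_notMem fun y hy => hx hy.1]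
    simp

lemma Iso.one {μ : Measure (Euc n)} (h : Iso μ) (hn : 0 < n) (hδ : 0 < δ) (H : ∀ {k : ℕ}, 0 < k → ∀ {f : Fin k → Euc n}, Orthonormal ℝ f → ∀ {b : ℝ}, 0 ≤ b → b ^ 2 ≤ k / 500 →
    (μ.prod μ).real {z | ∑ i, ⟪f i, z.1 - z.2⟫ ^ 2 ≤ b ^ 2} ≤ exp (-δ * k)) {S : Euc n →ₗ[ℝ] Euc n}
    (hS : ∃ (k : ℕ) (f : Fin k → Euc n), n ≤ 4 * k ∧ Orthonormal ℝ f ∧ ∀ v, ∑ i, ⟪f i, v⟫ ^ 2 ≤ 4 * ‖S v‖ ^ 2) (ha0 : 0 ≤ a) (ha : a ^ 2 * 32000 ≤ 1) (w : Euc n) :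
    μ {y | ‖S y - w‖ ≤ a * √n} ≤ ofReal (exp (-δ * n / 8)) := by
  have := h.pr
  obtain ⟨k, f, hk, hf, hv⟩ := hS
  have hk' : (n:ℝ) ≤ 4 * k := by exact_mod_cast hk
  have := H (by omega) hf (b := 4 * a * √n) psv (by rw [mul_pow, sq_sqrt psv]; nlinarith)
  set A := {y | ‖S y - w‖ ≤ a * √n}
  have e : μ.real A ^ 2 ≤ exp (-δ * n / 8) ^ 2 := by
    rw [sq, ← measureReal_prod_prod, ← exp_nat_mul]
    refine ((measureReal_mono fun z hz => ?_).trans this).trans (exp_le_exp.2 (by push_cast; nlinarith))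
    have z1 : ‖S z.1 - w‖ ≤ a * √n := hz.1
    have z2 : ‖S z.2 - w‖ ≤ a * √n := hz.2
    have := (norm_sub_le (S z.1 - w) (S z.2 - w)).trans (add_le_add z1 z2)
    rw [sub_sub_sub_cancel_right, ← map_sub] at this
    show ∑ i, ⟪f i, z.1 - z.2⟫ ^ 2 ≤ (4 * a * √n) ^ 2
    nlinarith [hv (z.1 - z.2), pow_le_pow_left₀ (norm_nonneg _) this 2]
  rw [← ofReal_measureReal]
  exact ofReal_le_ofReal (le_of_sq_le_sq e psv)

lemma r2_main [Fintype κ] [DecidableEq κ] {μ : Measure (Euc n)} (h : Iso μ) (hn : 0 < n) (hδ : 0 < δ) (H : ∀ {k : ℕ}, 0 < k → ∀ {f : Fin k → Euc n}, Orthonormal ℝ f → ∀ {b : ℝ}, 0 ≤ b → b ^ 2 ≤ k / 500 →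
    (μ.prod μ).real {z | ∑ i, ⟪f i, z.1 - z.2⟫ ^ 2 ≤ b ^ 2} ≤ exp (-δ * k)) {X : Type*} [TopologicalSpace X] [SecondCountableTopology X] [MeasurableSpace X] [BorelSpace X] {P : Measure X} [IsProbabilityMeasure P] {V : X → κ → Euc n} (hV : Continuous V) (ha0 : 0 ≤ a) (ha : a ^ 2 * 32000 ≤ 1) (r : ℝ)
    (hc : (Fintype.card (Sym κ q) : ℝ) ≤ exp (δ * n / 64)) (hm : 2 * n ≤ m) (hδn : 64 ≤ δ * n) :
    (P.prod (Measure.pi fun _ : Fin m => μ)) {p | ∃ s : Fin n → Sym κ q, (∃ (k : ℕ) (f : Fin k → Euc n), n ≤ 4 * k ∧ Orthonormal ℝ f ∧ ∀ v, ∑ i, ⟪f i, v⟫ ^ 2 ≤ 4 * ‖Tl (V p.1) r s v‖ ^ 2) ∧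
      ∃ J : Finset (Fin m), m ≤ 2 * J.card ∧ ∀ j ∈ J, ∃ s' : Sym κ q, ‖Tl (V p.1) r s (p.2 j) - √n • zs (V p.1) r s'‖ ≤ a * √n} ≤ ofReal (exp (-2 * m)) := by
  have := h.pr
  set p0 := ofReal (exp (-δ * n / 8))
  have hm' : (2:ℝ) * n ≤ m := by exact_mod_cast hm
  have zc : ∀ s' : Sym κ q, Continuous fun p : X × Euc n => zs (V p.1) r s' := fun s' => by
    have := (continuous_multiset_sum (f := fun v (p : X × Euc n) => V p.1 v) s'.1 fun v _ => (continuous_apply v).comp (hV.comp continuous_fst)).const_smul (r / q : ℝ)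
    exact this
  let B : (Fin n → Sym κ q) → Sym κ q → Set (X × Euc n) := fun s s' => {p | ‖Tl (V p.1) r s p.2 - √n • zs (V p.1) r s'‖ ≤ a * √n}
  have hB : ∀ s s', MeasurableSet (B s s') := fun s s' => by
    refine (isClosed_le ?_ continuous_const).measurableSet
    simp only [Tl_apply]
    have := zc s'
    have := fun i => zc (s i)
    fun_prop
  refine (measure_mono (t := ⋃ s : Fin n → Sym κ q, ⋃ J : Finset (Fin m), ⋃ _ : m ≤ 2 * J.card, {z | (∀ s', μ (Prod.mk z.1 ⁻¹' B s s') ≤ p0) ∧ ∀ j ∈ J, ∃ s' : Sym κ q, (z.1, z.2 j) ∈ B s s'}) ?_).trans ?_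
  · rintro p ⟨s, hs, J, hJ, hj⟩
    simp only [mem_iUnion]
    have := fun s' : Sym κ q => h.one hn hδ H hs ha0 ha (√n • zs (V p.1) r s')
    exact ⟨s, J, hJ, And.intro this hj⟩
  have key : ∀ J : Finset (Fin m), m ≤ 2 * J.card → (Fintype.card (Sym κ q) * p0) ^ J.card ≤ ofReal (exp (-(7 * δ * n * m / 128))) := fun J hJ => by
    have hJ' : (m:ℝ) ≤ 2 * J.card := by exact_mod_cast hJ
    rw [← ofReal_natCast, ← ofReal_mul psv, ← ofReal_pow psv]
    refine ofReal_le_ofReal ((pow_le_pow_left₀ psv (mul_le_mul_of_nonneg_right hc psv) _).trans ?_)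
    rw [← exp_add, ← exp_nat_mul]
    refine exp_le_exp.2 ?_
    nlinarith [mul_le_mul_of_nonneg_left hJ' (by positivity : 0 ≤ δ * n)]
  refine (measure_iUnion_fintype_le _ _).trans ((sum_le_sum fun s _ => (measure_iUnion_fintype_le _ _).trans (sum_le_sum (g := fun _ => ofReal (exp (-(7 * δ * n * m / 128)))) fun J _ => ?_)).trans ?_)
  · by_cases hJ : m ≤ 2 * J.card
    · simp only [hJ, iUnion_true]
      exact (r2_gen P μ (hB s) p0 J).trans (key J hJ)
    · simp [hJ]
  · simp only [sum_const, card_univ, Fintype.card_finset, Fintype.card_fin, Fintype.card_pi, prod_const, nsmul_eq_mul]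
    rw [← ofReal_natCast, ← ofReal_natCast, ← ofReal_mul psv, ← ofReal_mul psv]
    refine ofReal_le_ofReal ?_
    push_cast
    refine (mul_le_mul (pow_le_pow_left₀ psv hc n) (mul_le_mul_of_nonneg_right (pow_le_pow_left₀ nnm (by linarith [add_one_le_exp (1:ℝ)] : (2:ℝ) ≤ exp 1) m) psv) psv psv).trans ?_
    rw [← exp_nat_mul, ← exp_nat_mul, ← exp_add, ← exp_add]
    refine exp_le_exp.2 ?_
    nlinarith [mul_le_mul_of_nonneg_left hm' (by positivity : 0 ≤ δ * n), mul_le_mul_of_nonneg_right hδn (Nat.cast_nonneg (α := ℝ) m)]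

lemma r2_card [Fintype κ] [DecidableEq κ] {g L : ℝ} (hg : 0 < g) (hg1 : 4 * g ≤ 1) (hL1 : 1 ≤ L) (hL : L = Real.log (1 + m / n)) (hn : 0 < n) (hm : 2 * n ≤ m) (hκ : Fintype.card κ = 2 * (n + m))
    (h1 : 1 ≤ g ^ 2 * n / L) (hq : q = ⌈g ^ 2 * n / L⌉₊) : (Fintype.card (Sym κ q) : ℝ) ≤ exp (16 * g * n) := by
  have hn' : (0:ℝ) < n := by exact_mod_cast hn
  have hm' : (2:ℝ) * n ≤ m := by exact_mod_cast hm
  have q1 : g ^ 2 * n / L ≤ q := hq ▸ Nat.le_ceil _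
  have q2 : (q:ℝ) ≤ 2 * (g ^ 2 * n / L) := by
    have := (Nat.ceil_lt_add_one (by positivity : 0 ≤ g ^ 2 * n / L)).le
    rw [← hq] at this; linarith
  have q0 : (0:ℝ) < q := by linarith
  have qn : q ≤ m := by
    have : g ^ 2 * n / L ≤ n := (div_le_self psv hL1).trans (by nlinarith [mul_le_mul_of_nonneg_right (by nlinarith : g ^ 2 ≤ 1) hn'.le])
    exact_mod_cast (by nlinarith : (q:ℝ) ≤ m)
  rw [Sym.card_sym_eq_choose, hκ]
  have c1 : ((2 * (n + m) + q - 1).choose q : ℝ) ≤ (4 * m) ^ q / q.factorial := by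
    refine (Nat.choose_le_pow_div q _).trans ?_
    gcongr
    exact_mod_cast (by omega : 2 * (n + m) + q - 1 ≤ 4 * m)
  have c2 := pow_div_factorial_le_exp (q:ℝ) q0.le q
  have c3 : (4 * m : ℝ) ≤ q * exp (2 + 2 * L + 2 / g) := by
    have e1 : (m:ℝ) ≤ n * exp L := by
      rw [hL, Real.exp_log psv]; field_simp; linarith
    have e2 : L ≤ exp L := by linarith [add_one_le_exp L]
    have e3 : 1 / g ≤ exp (1 / g) := by linarith [add_one_le_exp (1 / g)]
    have e4 : (4:ℝ) ≤ exp 2 := by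
      rw [show (2:ℝ) = 1 + 1 by norm_num, exp_add]; nlinarith [add_one_le_exp (1:ℝ)]
    have e5 : (n:ℝ) ≤ q * (L * (1 / g) ^ 2) := by
      rw [div_le_iff₀ lnr] at q1; field_simp; linarith
    rw [show 2 + 2 * L + 2 / g = 2 + L + L + (1 / g + 1 / g) by ring, exp_add, exp_add, exp_add, exp_add]
    calc (4 * m : ℝ) ≤ exp 2 * ((q * (exp L * exp (1 / g) ^ 2)) * exp L) := by
          gcongr
          refine e1.trans ?_
          gcongr
          refine e5.trans ?_
          gcongr
      _ = _ := by ring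
  calc ((2 * (n + m) + q - 1).choose q : ℝ) ≤ (q * exp (2 + 2 * L + 2 / g)) ^ q / q.factorial := c1.trans (by gcongr)
    _ = (q:ℝ) ^ q / q.factorial * exp (q * (2 + 2 * L + 2 / g)) := by rw [mul_pow, ← exp_nat_mul]; ring
    _ ≤ exp q * exp (q * (2 + 2 * L + 2 / g)) := by gcongr
    _ ≤ _ := by
      rw [← exp_add]
      refine exp_le_exp.2 ?_
      have : (q:ℝ) + q * (2 + 2 * L + 2 / g) ≤ 2 * (g ^ 2 * n / L) * (L * (5 + 2 / g)) := by
        rw [← mul_one_add]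
        refine mul_le_mul q2 ?_ psv psv
        nlinarith [mul_le_mul_of_nonneg_right hL1 (by positivity : 0 ≤ 2 / g)]
      refine this.trans ?_
      rw [show 2 * (g ^ 2 * n / L) * (L * (5 + 2 / g)) = (10 * g + 4) * (g * n) by field_simp; ring]
      nlinarith [mul_pos hg hn']
end r2

section r3
variable {m q : ℕ}
def Wv (x : Fin m → Euc n) (t : Bool × (Fin n ⊕ Fin m)) : Euc n := (if t.1 then (1:ℝ) else -1) • t.2.elim (fun i => EuclideanSpace.single i 1) fun j => (√n)⁻¹ • x j

lemma eb (x : Fin m → Euc n) : enrichedBody n m x = convexHull ℝ (range (Wv x)) := by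
  unfold enrichedBody absConv stdBasisSet
  congr 1
  ext v
  simp only [mem_union, mem_range, mem_neg, Prod.exists, Bool.exists_bool, Sum.exists, Wv, Sum.elim_inl, Sum.elim_inr]
  simp [neg_eq_iff_eq_neg]
  grind

lemma Wv_mem (x : Fin m → Euc n) (t) : Wv x t ∈ enrichedBody n m x := eb x ▸ subset_convexHull ℝ _ ⟨t, rfl⟩

lemma eb_nhds (hn : 0 < n) (x : Fin m → Euc n) : enrichedBody n m x ∈ nhds 0 := by
  have hn' : (0:ℝ) < n := by exact_mod_cast hn
  have hc : Convex ℝ (enrichedBody n m x) := eb x ▸ convex_convexHull ℝ _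
  refine Filter.mem_of_superset (ball_mem_nhds 0 (inv_pos.2 hn')) fun v hv => ?_
  have e : v = ∑ i, (n:ℝ)⁻¹ • ((n * v i) • EuclideanSpace.single i (1:ℝ)) := by
    ext j
    simp [Finset.sum_apply, Pi.single_apply, hn'.ne']
  rw [e]
  refine hc.sum_mem (fun _ _ => by positivity) (by simp [hn'.ne']) fun i _ => ?_
  have h1 : |v i| < (n:ℝ)⁻¹ := (by simpa using PiLp.norm_apply_le v i : |v i| ≤ ‖v‖).trans_lt (by simpa using hv)
  have h2 : |n * v i| < 1 := by
    rw [abs_mul, abs_of_pos hn']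
    simpa [hn'.ne'] using mul_lt_mul_of_pos_left h1 hn'
  rw [abs_lt] at h2
  have := hc (Wv_mem x (true, .inl i)) (Wv_mem x (false, .inl i)) (a := (1 + n * v i) / 2) (b := (1 - n * v i) / 2) lnr lnr (by ring)
  convert this using 1
  simp only [Wv, Sum.elim_inl, if_true, Bool.false_eq_true, if_false, smul_smul, ← add_smul]
  congr 1; ring

lemma bmz_one {K L : Set (Euc n)} (hK : IsCompact K) (hL : Convex ℝ L) (hL0 : L ∈ nhds 0) (T : Euc n →ₗ[ℝ] Euc n) (hl : 0 ≤ l) (hr : 0 < r) (h : l * bodyOpNorm n K L T < r) :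
    ∀ v ∈ K, ∃ z ∈ L, l • T v = r • z := fun v hv => by
  have hb : BddAbove ((fun x => gauge L (T x)) '' K) := (hK.image ((continuous_gauge hL hL0).comp (LinearMap.continuous_of_finiteDimensional T))).bddAbove
  have h1 : gauge L (T v) ≤ bodyOpNorm n K L T := le_csSup hb ⟨v, hv, rfl⟩
  refine ⟨r⁻¹ • l • T v, setOfPred_gauge_lt_one_subset_self hL (mem_of_mem_nhds hL0) (absorbent_nhds_zero hL0) ?_, by rw [smul_smul, mul_inv_cancel₀ hr.ne', one_smul]⟩
  rw [mem_ofPred_eq, gauge_smul_of_nonneg (inv_pos.2 hr).le, gauge_smul_of_nonneg hl, smul_eq_mul, smul_eq_mul, inv_mul_lt_one₀ hr]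
  exact (mul_le_mul_of_nonneg_left h1 hl).trans_lt h

lemma bmz {K L : Set (Euc n)} (hK : IsCompact K) (hL : IsCompact L) (cK : Convex ℝ K) (cL : Convex ℝ L) (hK0 : K ∈ nhds 0) (hL0 : L ∈ nhds 0) (hr : 0 < r) (h : distBM n K L < r ^ 2) :
    ∃ T : Euc n ≃ₗ[ℝ] Euc n, (∀ v ∈ K, ∃ z ∈ L, T v = r • z) ∧ ∀ v ∈ L, ∃ z ∈ K, T.symm v = r • z := by
  obtain ⟨d, ⟨T, rfl⟩, hd⟩ := exists_lt_of_csInf_lt (by exact ⟨_, LinearEquiv.refl ℝ _, rfl⟩) h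
  have p : ∀ K L T, 0 ≤ bodyOpNorm n K L T := fun K L T => Real.sSup_nonneg (by rintro _ ⟨v, _, rfl⟩; exact gauge_nonneg _)
  have hα := p K L T
  have hβ := p L K T.symm
  set α := bodyOpNorm n K L T
  set β := bodyOpNorm n L K T.symm
  have h1 : 0 < (r ^ 2 - α * β) / (α + 1) := div_pos lnr lnr
  have h2 : (r ^ 2 - α * β) / (α + 1) * (α + 1) = r ^ 2 - α * β := div_mul_cancel₀ _ lnr
  set η := (r ^ 2 - α * β) / (α + 1)
  have l0 : 0 < (β + η) / r := by positivity
  refine ⟨T.trans (LinearEquiv.smulOfNeZero ℝ _ ((β + η) / r) l0.ne'), bmz_one hK cL hL0 T l0.le hr ?_, ?_⟩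
  · show (β + η) / r * α < r
    rw [div_mul_eq_mul_div, div_lt_iff₀ hr]; nlinarith
  · have := bmz_one hL cK hK0 T.symm (inv_pos.2 l0).le hr (by rw [inv_mul_lt_iff₀ l0, div_mul_cancel₀ _ hr.ne']; linarith)
    intro v hv
    obtain ⟨z, hz, e⟩ := this v hv
    refine ⟨z, hz, ?_⟩
    rw [← e, ← map_smul]; rfl

def Bad (q : ℕ) (r : ℝ) (x y : Fin m → Euc n) : Prop := ∃ s : Fin n → Sym (Bool × (Fin n ⊕ Fin m)) q, (∃ (k : ℕ) (f : Fin k → Euc n), n ≤ 4 * k ∧ Orthonormal ℝ f ∧ ∀ v, ∑ i, ⟪f i, v⟫ ^ 2 ≤ 4 * ‖Tl (Wv x) r s v‖ ^ 2) ∧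
      ∃ J : Finset (Fin m), m ≤ 2 * J.card ∧ ∀ j ∈ J, ∃ s' : Sym _ q, ‖Tl (Wv x) r s (y j) - √n • zs (Wv x) r s'‖ ≤ 3 / 2 ^ 10 * √n

lemma bad_of (hn : 0 < n) (hm : 0 < m) (hq : 0 < q) (hr : 2 ^ 150 * r ^ 2 ≤ q) {x y : Fin m → Euc n} (hx : ∀ j, ‖x j‖ ≤ 2 ^ 32 * √n) (hy : ∀ j, ‖y j‖ ≤ 2 ^ 32 * √n) {T : Euc n →ₗ[ℝ] Euc n}
    (hT : ∀ v ∈ enrichedBody n m y, ∃ z ∈ enrichedBody n m x, T v = r • z) {F : Submodule ℝ (Euc n)} (hF : n ≤ 2 * finrank ℝ F) (hTF : ∀ v ∈ F, ‖v‖ ≤ ‖T v‖) : Bad q r x y := by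
  have hq' : (0:ℝ) < q := by exact_mod_cast hq
  have hn' : (0:ℝ) < n := by exact_mod_cast hn
  have hV : ∀ t, ‖Wv x t‖ ≤ 2 ^ 32 := by
    rintro ⟨b, i | j⟩
    · cases b <;> (simp [Wv]; norm_num)
    · have : (√(n:ℝ))⁻¹ * ‖x j‖ ≤ 2 ^ 32 := by
        rw [inv_mul_le_iff₀ psv, mul_comm]; exact hx j
      cases b <;> simpa [Wv, norm_smul, abs_of_nonneg (sqrt_nonneg _)] using this
  rw [eb x] at hT
  have := r1_main (C := 2 ^ 32) (ε := 1 / 2 ^ 42) (r := r) hn hq nnm nnm nnm (by rw [div_le_iff₀ hq']; linarith) hV hm hy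
    (fun i => hT _ (by simpa [Wv] using Wv_mem y (true, .inl i))) (fun j => hT _ (by simpa [Wv] using Wv_mem y (true, .inr j))) hF hTF
  norm_num at this
  unfold Bad
  norm_num
  exact this

lemma bad_or (hn : 0 < n) (hm : 0 < m) (hq : 0 < q) (hr0 : 0 < r) (hr : 2 ^ 150 * r ^ 2 ≤ q) {x y : Fin m → Euc n} (hx : ∀ j, ‖x j‖ ≤ 2 ^ 32 * √n) (hy : ∀ j, ‖y j‖ ≤ 2 ^ 32 * √n)
    (h : distBM n (enrichedBody n m y) (enrichedBody n m x) < r ^ 2) : Bad q r x y ∨ Bad q r y x := by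
  have hc : ∀ x : Fin m → Euc n, Convex ℝ (enrichedBody n m x) := fun x => eb x ▸ convex_convexHull ℝ _
  have hk : ∀ x : Fin m → Euc n, IsCompact (enrichedBody n m x) := fun x => eb x ▸ (finite_range _).isCompact_convexHull (𝕜 := ℝ)
  obtain ⟨T, h1, h2⟩ := bmz (hk y) (hk x) (hc y) (hc x) (eb_nhds hn y) (eb_nhds hn x) hr0 h
  obtain ⟨U, W, d, hU, hW, -⟩ := svs T.toLinearMap zero_le_one
  by_cases hd : n ≤ 2 * finrank ℝ U
  · exact .inl (bad_of hn hm hq hr hx hy h1 hd fun v hv => le_of_sq_le_sq (by simpa using hU v hv) (norm_nonneg _))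
  · refine .inr (bad_of hn hm hq hr hy hx (T := T.symm) h2 (F := W.map T.toLinearMap) (by rw [LinearEquiv.finrank_map_eq]; omega) ?_)
    rintro _ ⟨w, hw, rfl⟩
    rcases eq_or_ne w 0 with rfl | h0
    · simp
    · simpa using (le_of_sq_le_sq (by simpa using (hW w hw h0).le) (norm_nonneg _) : ‖T w‖ ≤ ‖w‖)

theorem final : ∃ c c' : ℝ, 0 < c ∧ 0 < c' ∧
      ∀ (n : ℕ), 2 ≤ n → ∀ (μ : Measure (Euc n)), IsIsotropicLogConcave n μ →
      ∀ (m : ℕ), 2 * n ≤ m → (m : ℝ) ≤ exp √n →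
      ofReal (1 - 2 * exp (-c' * √n)) ≤
        ((Measure.pi fun _ : Fin m => μ).prod (Measure.pi fun _ : Fin m => μ))
          {p : (Fin m → Euc n) × (Fin m → Euc n) |
            c * n / Real.log (1 + (m : ℝ) / n) ≤
              distBM n (enrichedBody n m p.2) (enrichedBody n m p.1)} := by
  obtain ⟨δ, hδ, H⟩ := SB
  obtain ⟨g, g0, g1, gδ⟩ : ∃ g : ℝ, 0 < g ∧ 1024 * g ≤ 1 ∧ 1024 * g ≤ δ := ⟨min 1 δ / 1024, by positivity, by linarith [min_le_left 1 δ], by linarith [min_le_right 1 δ]⟩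
  refine ⟨g ^ 2 / 2 ^ 150, g ^ 2 / 2, by positivity, by positivity, fun n hn μ hμ m hm hme => ?_⟩
  have h := iso_of hμ
  have := h.pr
  have n2 : (2:ℝ) ≤ n := by exact_mod_cast hn
  have hm' : (2:ℝ) * n ≤ m := by exact_mod_cast hm
  have sn : 0 < √(n:ℝ) := by positivity
  have sq : √(n:ℝ) * √n = n := Real.mul_self_sqrt psv
  rcases lt_or_ge (g ^ 2 * √n) 1 with hl | hl
  · rw [ENNReal.ofReal_of_nonpos]
    · exact zero_le
    · linarith [add_one_le_exp (-(g ^ 2 / 2) * √n)]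
  set L := Real.log (1 + (m:ℝ) / n) with hL
  have e2 : 2 ≤ exp √n := by
    have : 1 ≤ √(n:ℝ) := by nlinarith
    linarith [add_one_le_exp √(n:ℝ)]
  have L1 : 1 ≤ L := by
    rw [hL, Real.le_log_iff_exp_le psv]
    have : 2 ≤ (m:ℝ) / n := by rw [le_div_iff₀ psv]; exact hm'
    linarith [exp_one_lt_d9]
  have L2 : L ≤ √n := by
    rw [hL, log_le_iff_le_exp psv]
    have : (m:ℝ) / n ≤ exp √n / 2 := by gcongr
    linarith
  have q1 : 1 ≤ g ^ 2 * n / L := by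
    rw [le_div_iff₀ lnr]; nlinarith
  set q := ⌈g ^ 2 * n / L⌉₊ with hq
  have q0 : 0 < q := Nat.ceil_pos.2 lnr
  set r := √(g ^ 2 / 2 ^ 150 * n / L) with hr
  have rp : 0 < g ^ 2 / 2 ^ 150 * n / L := by positivity
  have r2 : r ^ 2 = g ^ 2 / 2 ^ 150 * n / L := sq_sqrt rp.le
  have rq : 2 ^ 150 * r ^ 2 ≤ q := by
    rw [r2]; refine le_trans (le_of_eq ?_) (Nat.le_ceil _); ring
  rw [← r2]
  set P := Measure.pi fun _ : Fin m => μ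
  have hB : (P.prod P) {p | Bad q r p.1 p.2} ≤ ofReal (exp (-2 * m)) := by
    refine r2_main (V := Wv) h (by omega) (δ := 1024 * g) psv (fun hk f hf b hb0 hb => (h.sb H hk hf hb0 hb).trans (exp_le_exp.2 (by gcongr))) ?_ nnm nnm r ?_ hm (by nlinarith [pow_le_one₀ (n := 3) g0.le (by linarith : g ≤ 1), mul_self_le_mul_self zero_le_one hl])
    · refine continuous_pi fun t => ?_
      rcases t with ⟨b, i | j⟩ <;> simp only [Wv, Sum.elim_inl, Sum.elim_inr] <;> fun_prop
    · rw [show 1024 * g * n / 64 = 16 * g * n by ring]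
      exact r2_card g0 lnr L1 hL (by omega) hm smp q1 hq
  have hB' : (P.prod P) {p | Bad q r p.2 p.1} ≤ ofReal (exp (-2 * m)) := by
    refine le_trans (le_of_eq ?_) hB
    exact (Measure.measurePreserving_swap (μ := P) (ν := P)).measure_preimage_equiv (f := MeasurableEquiv.prodComm) {p | Bad q r p.1 p.2}
  have tl : μ {x | 2 ^ 32 * √n ≤ ‖x‖} ≤ ofReal (exp (-3 * √n)) := by
    rw [← ofReal_measureReal]; exact ofReal_le_ofReal (h.tail hn)
  have tm : MeasurableSet {x : Euc n | 2 ^ 32 * √n ≤ ‖x‖} := measurableSet_le measurable_const measurable_norm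
  have t1 : ∀ j, (P.prod P) ((fun p => p.1 j) ⁻¹' {x | 2 ^ 32 * √n ≤ ‖x‖}) ≤ ofReal (exp (-3 * √n)) := fun j =>
    (((measurePreserving_eval (fun _ : Fin m => μ) j).comp (measurePreserving_fst (μ := P) (ν := P))).measure_preimage tm.nullMeasurableSet).le.trans tl
  have t2 : ∀ j, (P.prod P) ((fun p => p.2 j) ⁻¹' {x | 2 ^ 32 * √n ≤ ‖x‖}) ≤ ofReal (exp (-3 * √n)) := fun j =>
    (((measurePreserving_eval (fun _ : Fin m => μ) j).comp (measurePreserving_snd (μ := P) (ν := P))).measure_preimage tm.nullMeasurableSet).le.trans tl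
  set S := {p : (Fin m → Euc n) × (Fin m → Euc n) | r ^ 2 ≤ distBM n (enrichedBody n m p.2) (enrichedBody n m p.1)}
  have cov : univ ⊆ S ∪ ({p | Bad q r p.1 p.2} ∪ {p | Bad q r p.2 p.1} ∪ ((⋃ j, (fun p : (Fin m → Euc n) × (Fin m → Euc n) => p.1 j) ⁻¹' {x | 2 ^ 32 * √n ≤ ‖x‖}) ∪ ⋃ j, (fun p : (Fin m → Euc n) × (Fin m → Euc n) => p.2 j) ⁻¹' {x | 2 ^ 32 * √n ≤ ‖x‖})) := fun p _ => by
    by_contra hc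
    simp only [mem_union, mem_iUnion, not_or, not_exists] at hc
    obtain ⟨c1, ⟨c2, c3⟩, c4, c5⟩ := hc
    have c4 : ∀ j, ¬ 2 ^ 32 * √n ≤ ‖p.1 j‖ := c4
    have c5 : ∀ j, ¬ 2 ^ 32 * √n ≤ ‖p.2 j‖ := c5
    rcases bad_or (by omega) (by omega) q0 (sqrt_pos.2 rp) rq (fun j => (not_le.1 (c4 j)).le) (fun j => (not_le.1 (c5 j)).le) (not_le.1 c1) with h | h
    exacts [c2 h, c3 h]
  have u : ∀ A : Fin m → Set ((Fin m → Euc n) × (Fin m → Euc n)), (∀ j, (P.prod P) (A j) ≤ ofReal (exp (-3 * √n))) → (P.prod P) (⋃ j, A j) ≤ ofReal (m * exp (-3 * √n)) := fun A hA => by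
    refine (measure_iUnion_fintype_le _ _).trans ((sum_le_sum fun j _ => hA j).trans ?_)
    rw [ofReal_mul psv]; simp
  have tot := (measure_mono (μ := P.prod P) cov).trans ((measure_union_le _ _).trans (add_le_add le_rfl ((measure_union_le _ _).trans (add_le_add ((measure_union_le _ _).trans (add_le_add hB hB')) ((measure_union_le _ _).trans (add_le_add (u _ t1) (u _ t2)))))))
  rw [measure_univ, ← ofReal_add psv psv, ← ofReal_add psv psv, ← ofReal_add psv psv] at tot
  rw [ENNReal.ofReal_sub _ psv, ofReal_one, tsub_le_iff_right]
  refine tot.trans (add_le_add le_rfl (ofReal_le_ofReal ?_))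
  have a1 : m * exp (-3 * √n) ≤ exp (-2 * √n) := by
    rw [show -2 * √(n:ℝ) = √n + -3 * √n by ring, exp_add]; gcongr
  have a2 : exp (-2 * m) ≤ exp (-2 * √n) := exp_le_exp.2 (by nlinarith)
  have a3 : 2 * exp (-2 * √n) ≤ exp (-1 * √n) := by
    rw [show -1 * √(n:ℝ) = √n + -2 * √n by ring, exp_add]; gcongr
  have a4 : exp (-1 * √n) ≤ exp (-(g ^ 2 / 2) * √n) := exp_le_exp.2 (by gcongr; nlinarith)
  linarith
end r3

end

theorem statement_0 :
    ∃ c c' : ℝ, 0 < c ∧ 0 < c' ∧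
      ∀ (n : ℕ), 2 ≤ n → ∀ (μ : Measure (Euc n)), IsIsotropicLogConcave n μ →
      ∀ (m : ℕ), 2 * n ≤ m → (m : ℝ) ≤ Real.exp (Real.sqrt n) →
      ENNReal.ofReal (1 - 2 * Real.exp (-c' * Real.sqrt n) - (2 : ℝ) ^ ((1 : ℝ) - (n : ℝ) ^ 2)) ≤
        ((Measure.pi fun _ : Fin m => μ).prod (Measure.pi fun _ : Fin m => μ))
          {p : (Fin m → Euc n) × (Fin m → Euc n) |
            c * n / Real.log (1 + (m : ℝ) / n) ≤
              distBM n (enrichedBody n m p.2) (enrichedBody n m p.1)} := by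
  obtain ⟨c, c', h1, h2, h⟩ := final
  exact ⟨c, c', h1, h2, fun n hn μ hμ m hm hme => (ofReal_le_ofReal (sub_le_self _ psv)).trans (h n hn μ hμ m hm hme)⟩

end
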